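/- Let K be a field, let q ∈ K be a nonzero element whose multiplicative order is e with e ≥ 3 (e may be infinite), and let f be an integer with 0 ≤ f and 2f ≤ e. Then for every n ≥ 1 the Iwahori–Hecke algebra H_q(B_n) has finite representation type if and only if n < min{e, 2f+4}. -/

import Mathlib

/-- A finite-dimensional right `A`-module, where `A` is a `K`-algebra.
Right modules are modules over the opposite ring `Aᵐᵒᵖ`. -/
structure FDRightModule (K A : Type) [Field K] [Ring A] [Algebra K A] : Type 1 where
  carrier : Type
  [isAddCommGroup : AddCommGroup carrier]
  [isModuleK : Module K carrier]
  [isModuleA : Module Aᵐᵒᵖ carrier]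
  [isTower : IsScalarTower K Aᵐᵒᵖ carrier]
  [isFinDim : FiniteDimensional K carrier]

attribute [instance] FDRightModule.isAddCommGroup FDRightModule.isModuleK
  FDRightModule.isModuleA FDRightModule.isTower FDRightModule.isFinDim

/-- A module is indecomposable if it is nonzero and is not the (internal) direct
sum of two nonzero submodules. -/
def IsIndecomposableModule (R M : Type*) [Ring R] [AddCommGroup M] [Module R M] : Prop :=
  Nontrivial M ∧ ∀ N₁ N₂ : Submodule R M, IsCompl N₁ N₂ → N₁ = ⊥ ∨ N₂ = ⊥

/-- A `K`-algebra `A` has finite representation type if there are only finitely many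
isomorphism classes of indecomposable finite-dimensional right `A`-modules. -/
def HasFiniteRepresentationType (K A : Type) [Field K] [Ring A] [Algebra K A] : Prop :=
  Finite (Quot fun M N : {M : FDRightModule K A // IsIndecomposableModule Aᵐᵒᵖ M.carrier} =>
    Nonempty (M.1.carrier ≃ₗ[Aᵐᵒᵖ] N.1.carrier))
/-- The multiplicative order of an element, valued in `ℕ∞`, with `⊤` for infinite order. -/
noncomputable def multOrder {M : Type*} [Monoid M] (x : M) : ℕ∞ :=
  if orderOf x = 0 then ⊤ else (orderOf x : ℕ∞)
/-- The defining relations of the Iwahori--Hecke algebra of type `Bₙ` with generators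
`T_0, …, T_{n-1}`, where `T_0` satisfies `(T_0 - α)(T_0 - β) = 0` and the other
generators satisfy `(T_i + 1)(T_i - q) = 0`. -/
inductive HeckeBRel (K : Type) [Field K] (α β q : K) (n : ℕ) :
    FreeAlgebra K (Fin n) → FreeAlgebra K (Fin n) → Prop
  | quad_zero (i : Fin n) (hi : (i : ℕ) = 0) :
      HeckeBRel K α β q n
        ((FreeAlgebra.ι K i - algebraMap K (FreeAlgebra K (Fin n)) α) *
          (FreeAlgebra.ι K i - algebraMap K (FreeAlgebra K (Fin n)) β)) 0
  | quad (i : Fin n) (hi : 0 < (i : ℕ)) :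
      HeckeBRel K α β q n
        ((FreeAlgebra.ι K i + 1) * (FreeAlgebra.ι K i - algebraMap K (FreeAlgebra K (Fin n)) q)) 0
  | braid_zero (i j : Fin n) (hi : (i : ℕ) = 0) (hj : (j : ℕ) = 1) :
      HeckeBRel K α β q n
        (FreeAlgebra.ι K i * FreeAlgebra.ι K j * FreeAlgebra.ι K i * FreeAlgebra.ι K j)
        (FreeAlgebra.ι K j * FreeAlgebra.ι K i * FreeAlgebra.ι K j * FreeAlgebra.ι K i)
  | braid (i j : Fin n) (hi : 0 < (i : ℕ)) (hij : (j : ℕ) = (i : ℕ) + 1) :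
      HeckeBRel K α β q n
        (FreeAlgebra.ι K j * FreeAlgebra.ι K i * FreeAlgebra.ι K j)
        (FreeAlgebra.ι K i * FreeAlgebra.ι K j * FreeAlgebra.ι K i)
  | comm (i j : Fin n) (hij : (i : ℕ) + 1 < (j : ℕ)) :
      HeckeBRel K α β q n (FreeAlgebra.ι K i * FreeAlgebra.ι K j)
        (FreeAlgebra.ι K j * FreeAlgebra.ι K i)

/-- The Iwahori--Hecke algebra of type `Bₙ`: the quotient of the free algebra on
`T_0, …, T_{n-1}` by the two-sided ideal generated by the defining relations, where
`T_0` satisfies `(T_0 - α)(T_0 - β) = 0`. -/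
abbrev HeckeB (K : Type) [Field K] (α β q : K) (n : ℕ) : Type := RingQuot (HeckeBRel K α β q n)

section

open Finset (range mem_range sum_congr sum_eq_single sum_mul mem_range_succ_iff mem_Icc Icc Ioo Ico
  mul_sum sum_insert sum_eq_zero mem_insert mem_filter sum_smul sum_range_succ mem_Ico
  add_sum_erase card_le_one)
open Polynomial (aeval X C aeval_monomial induction_on' rootMultiplicity_mul)
open LinearMap (congr_fun comp_apply ext mem_ker mulLeft_apply mulRight_apply mulLeftRight_apply)
open Module (End)
open Module.End (mul_apply)
open Nat (lt_succ_self lt_succ_iff_lt_or_eq lt_succ_iff)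
open Function (update_of_ne update_self update)
open scoped Finset Polynomial

variable {K A R U V V' W : Type*} [Field K] [Ring A] [Algebra K A] [Ring R] [Algebra K R]
  [AddCommGroup U] [Module K U] [AddCommGroup V] [Module K V] [AddCommGroup V'] [Module K V']
  [AddCommGroup W] [Module K W] {α β γ q : K} {a b f i j k l m n p r s x : ℕ} {d d' : ℕ → ℕ}
  {c : ℕ → K} {T : ℕ → End K V}

/-- The defining relations of the Iwahori--Hecke algebra of type `Bₙ`, for the first `n` members
of a sequence of elements of a `K`-algebra. -/
structure IsHecke (α β q : K) (n : ℕ)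
    (T : ℕ → A) : Prop where
  quad_zero : 0 < n → T 0 * T 0 = (α + β) • T 0 - (α * β) • (1 : A)
  quad : ∀ i, 0 < i → i < n → T i * T i = (q - 1) • T i + q • (1 : A)
  braid_zero : 1 < n → T 0 * T 1 * T 0 * T 1 = T 1 * T 0 * T 1 * T 0
  braid : ∀ i, 0 < i → i + 1 < n → T (i + 1) * T i * T (i + 1) = T i * T (i + 1) * T i
  comm : ∀ i j, i + 1 < j → j < n → T i * T j = T j * T i

/-- A linear map commuting with the first `n` operators of two sequences. -/
def Intw (n : ℕ) (T : ℕ → End K V) (T' : ℕ → End K W) (f : V →ₗ[K] W) : Prop :=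
  ∀ i < n, ∀ x, f (T i x) = T' i (f x)

/-- Indecomposability of a space with operators `T 0, …, T (n - 1)`. -/
def Indec (n : ℕ) (T : ℕ → End K V) : Prop :=
  Nontrivial V ∧ ∀ e : End K V, e * e = e → Intw n T T e → e = 0 ∨ e = 1

section Intw

variable {T' : ℕ → End K W} {T'' : ℕ → End K U}

theorem Intw.id : Intw n T T LinearMap.id := fun _ _ _ => rfl

theorem Intw.one : Intw n T T (1 : End K V) := fun _ _ _ => rfl

theorem Intw.comp {g : W →ₗ[K] U} {f : V →ₗ[K] W} (hg : Intw n T' T'' g) (hf : Intw n T T' f) :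
    Intw n T T'' (g ∘ₗ f) := fun i hi x => by simp [hf i hi, hg i hi]

theorem Intw.mul {g f : End K V} (hg : Intw n T T g) (hf : Intw n T T f) :
    Intw n T T (g * f) := hg.comp hf

theorem Intw.add {g f : V →ₗ[K] W} (hg : Intw n T T' g) (hf : Intw n T T' f) :
    Intw n T T' (g + f) := fun i hi x => by simp [hf i hi, hg i hi]

theorem Intw.sub {g f : V →ₗ[K] W} (hg : Intw n T T' g) (hf : Intw n T T' f) :
    Intw n T T' (g - f) := fun i hi x => by simp [hf i hi, hg i hi]

theorem Intw.smul {f : V →ₗ[K] W} (c : K) (hf : Intw n T T' f) :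
    Intw n T T' (c • f) := fun i hi x => by simp [hf i hi]

theorem Intw.sum {J : Type*} {s : Finset J} {f : J → V →ₗ[K] W} (hf : ∀ j ∈ s, Intw n T T' (f j)) :
    Intw n T T' (∑ j ∈ s, f j) := fun i hi x => by
  simp only [LinearMap.sum_apply, map_sum]
  exact sum_congr rfl fun j hj => hf j hj i hi x

theorem Intw.pow {f : End K V} (hf : Intw n T T f) (m : ℕ) : Intw n T T (f ^ m) := by
  induction m with
  | zero => exact Intw.one
  | succ m ih => rw [pow_succ]; exact ih.mul hf

theorem Intw.aeval {f : End K V} (hf : Intw n T T f) (p : K[X]) :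
    Intw n T T (aeval f p) := by
  induction p using induction_on' with
  | add p r hp hr => rw [map_add]; exact hp.add hr
  | monomial m c => rw [aeval_monomial, ← Algebra.smul_def]; exact (hf.pow m).smul c

theorem Intw.mono {f : V →ₗ[K] W} (hf : Intw n T T' f) (h : m ≤ n) : Intw m T T' f :=
  fun i hi => hf i (hi.trans_le h)

theorem Intw.commute {f : End K V} (hf : Intw n T T f) (hi : i < n) :
    Commute f (T i) := ext (hf i hi)

theorem Intw.of_commute {f : End K V} (hf : ∀ i < n, Commute f (T i)) : Intw n T T f :=
  fun i hi => congr_fun (hf i hi)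

theorem IsHecke.of_injective {ι : V →ₗ[K] W} (hι : Function.Injective ι) (h : Intw n T T' ι)
    (hT : IsHecke α β q n T') : IsHecke α β q n T where
  quad_zero hn := by
    ext x; apply hι
    simpa [h _ hn] using congr_fun (hT.quad_zero hn) (ι x)
  quad i h0 hi := by
    ext x; apply hι
    simpa [h _ hi] using congr_fun (hT.quad i h0 hi) (ι x)
  braid_zero hn := by
    ext x; apply hι
    simpa [h 0 (by omega), h 1 hn] using congr_fun (hT.braid_zero hn) (ι x)
  braid i h0 hi := by
    ext x; apply hι
    simpa [h i (by omega), h _ hi] using congr_fun (hT.braid i h0 hi) (ι x)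
  comm i j hij hj := by
    ext x; apply hι
    simpa [h i (by omega), h _ hj] using congr_fun (hT.comm i j hij hj) (ι x)

theorem IsHecke.of_surjective {p : V →ₗ[K] W} (hp : Function.Surjective p) (h : Intw n T T' p)
    (hT : IsHecke α β q n T) : IsHecke α β q n T' where
  quad_zero hn := by
    ext x; obtain ⟨x, rfl⟩ := hp x
    simpa [h _ hn] using congr_arg p (congr_fun (hT.quad_zero hn) x)
  quad i h0 hi := by
    ext x; obtain ⟨x, rfl⟩ := hp x
    simpa [h _ hi] using congr_arg p (congr_fun (hT.quad i h0 hi) x)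
  braid_zero hn := by
    ext x; obtain ⟨x, rfl⟩ := hp x
    simpa [h 0 (by omega), h 1 hn] using congr_arg p (congr_fun (hT.braid_zero hn) x)
  braid i h0 hi := by
    ext x; obtain ⟨x, rfl⟩ := hp x
    simpa [h i (by omega), h _ hi] using congr_arg p (congr_fun (hT.braid i h0 hi) x)
  comm i j hij hj := by
    ext x; obtain ⟨x, rfl⟩ := hp x
    simpa [h i (by omega), h _ hj] using congr_arg p (congr_fun (hT.comm i j hij hj) x)

theorem IsHecke.mono {T : ℕ → A} (hT : IsHecke α β q n T) (h : m ≤ n) : IsHecke α β q m T where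
  quad_zero hn := hT.quad_zero (by omega)
  quad i h0 hi := hT.quad i h0 (by omega)
  braid_zero hn := hT.braid_zero (by omega)
  braid i h0 hi := hT.braid i h0 (by omega)
  comm i j hij hj := hT.comm i j hij (by omega)

theorem IsHecke.map {B : Type*} [Ring B] [Algebra K B] {T : ℕ → A}
    (hT : IsHecke α β q n T) (g : A →ₐ[K] B) : IsHecke α β q n (fun i => g (T i)) where
  quad_zero hn := by simpa using congr_arg g (hT.quad_zero hn)
  quad i h0 hi := by simpa using congr_arg g (hT.quad i h0 hi)
  braid_zero hn := by simpa using congr_arg g (hT.braid_zero hn)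
  braid i h0 hi := by simpa using congr_arg g (hT.braid i h0 hi)
  comm i j hij hj := by simpa using congr_arg g (hT.comm i j hij hj)

/-- Coprime polynomials on an indecomposable system: one factor of a vanishing product vanishes. -/
theorem Indec.aeval_eq_zero_or (hV : Indec n T) {f : End K V} (hf : Intw n T T f)
    {p r : K[X]} (hpr : IsCoprime p r) (h : aeval f (p * r) = 0) :
    aeval f p = 0 ∨ aeval f r = 0 := by
  obtain ⟨a, b, hab⟩ := hpr
  have hsum : aeval f (a * p) + aeval f (b * r) = 1 := by
    rw [← map_add, hab, map_one]
  have hidem : aeval f (a * p) * aeval f (a * p)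
      = aeval f (a * p) := by
    have : aeval f (a * p) * aeval f (b * r) = 0 := by
      rw [← map_mul, show a * p * (b * r) = a * b * (p * r) by ring, map_mul, h, mul_zero]
    calc _ = aeval f (a * p) * (1 - aeval f (b * r)) := by
          rw [← hsum]; simp
      _ = _ := by rw [mul_sub, this, mul_one, sub_zero]
  rcases hV.2 _ hidem (hf.aeval _) with h0 | h1
  · left
    rw [h0, zero_add] at hsum
    calc aeval f p = aeval f p * aeval f (b * r) := by
          rw [hsum, mul_one]
      _ = 0 := by rw [← map_mul, show p * (b * r) = b * (p * r) by ring, map_mul, h, mul_zero]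
  · right
    calc aeval f r = aeval f r * aeval f (a * p) := by
          rw [h1, mul_one]
      _ = 0 := by rw [← map_mul, show r * (a * p) = a * (p * r) by ring, map_mul, h, mul_zero]

end Intw

section KrullSchmidt

variable [FiniteDimensional K V]
 

/-- Fitting's lemma. -/
theorem Indec.isUnit_or_isNilpotent (hV : Indec n T) {f : End K V} (hf : Intw n T T f) :
    IsUnit f ∨ IsNilpotent f := by
  have hfi := Algebra.IsIntegral.isIntegral (R := K) f
  have hm : minpoly K f ≠ 0 := minpoly.ne_zero hfi
  obtain ⟨r, hr, hndvd⟩ := (Polynomial.finiteMultiplicity_X_sub_C 0 hm).exists_eq_pow_mul_and_not_dvd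
  generalize multiplicity (X - C 0) (minpoly K f) = k at hr
  rw [map_zero, sub_zero] at hr hndvd
  have hcop : IsCoprime (X ^ k) r :=
    ((Polynomial.irreducible_X.coprime_iff_not_dvd).2 hndvd).pow_left
  rcases hV.aeval_eq_zero_or hf hcop (by rw [← hr]; exact minpoly.aeval K f) with h | h
  · right
    exact ⟨k, by simpa using h⟩
  · left
    obtain ⟨a, b, hab⟩ := (Polynomial.irreducible_X.coprime_iff_not_dvd).2 hndvd
    have := congr_arg (aeval f) hab
    simp only [map_add, map_mul, h, mul_zero, add_zero, map_one, Polynomial.aeval_X] at this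
    exact IsUnit.of_mul_eq_one_right _ this

theorem Indec.isUnit_of_add (hV : Indec n T) {f g : End K V} (hf : Intw n T T f)
    (hg : Intw n T T g) (h : IsUnit (f + g)) : IsUnit f ∨ IsUnit g := by
  obtain ⟨u, hu⟩ := h
  have hinv : Intw n T T (↑u⁻¹ : End K V) := by
    refine Intw.of_commute fun i hi => ?_
    have : Commute (u : End K V) (T i) := by
      rw [hu]; exact (hf.add hg).commute hi
    exact this.units_inv_left
  have hsum : ↑u⁻¹ * f + ↑u⁻¹ * g = (1 : End K V) := by rw [← mul_add, ← hu]; simp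
  rcases hV.isUnit_or_isNilpotent (hinv.mul hf) with h | h
  · left
    exact (Units.isUnit_units_mul _ _).1 h
  · right
    have := h.isUnit_one_sub
    rw [← hsum, add_sub_cancel_left] at this
    exact (Units.isUnit_units_mul _ _).1 this

theorem Indec.exists_isUnit_of_sum (hV : Indec n T) {J : Type*} (s : Finset J)
    {f : J → End K V} (hf : ∀ j ∈ s, Intw n T T (f j)) (h : IsUnit (∑ j ∈ s, f j)) :
    ∃ j ∈ s, IsUnit (f j) := by
  classical
  induction s using Finset.induction_on with
  | empty =>
    have := hV.1
    simp at h
  | insert a s ha ih =>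
    rw [sum_insert ha] at h
    rcases hV.isUnit_of_add (hf a (Finset.mem_insert_self _ _))
      (Intw.sum fun j hj => hf j (Finset.mem_insert_of_mem hj)) h with h | h
    · exact ⟨a, Finset.mem_insert_self _ _, h⟩
    · obtain ⟨j, hj, hu⟩ := ih (fun j hj => hf j (Finset.mem_insert_of_mem hj)) h
      exact ⟨j, Finset.mem_insert_of_mem hj, hu⟩

end KrullSchmidt

/-- A finite-dimensional space with operators satisfying the relations of the Hecke algebra of
type `Bₙ`. -/
structure HSys (K : Type) [Field K] (α β q : K) (n : ℕ) : Type 1 where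
  V : Type
  [acg : AddCommGroup V]
  [mod : Module K V]
  [fd : FiniteDimensional K V]
  T : ℕ → End K V
  hT : IsHecke α β q n T

attribute [instance] HSys.acg HSys.mod HSys.fd

section HSys

variable {K : Type} [Field K] {α β q : K}

/-- `M` is a direct summand of `X`. -/
def HSys.Summand (M X : HSys K α β q n) : Prop :=
  ∃ (i : M.V →ₗ[K] X.V) (p : X.V →ₗ[K] M.V), Intw n M.T X.T i ∧ Intw n X.T M.T p ∧
    p ∘ₗ i = LinearMap.id

/-- `M` and `X` are isomorphic. -/
def HSys.Iso (M X : HSys K α β q n) : Prop :=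
  ∃ (i : M.V →ₗ[K] X.V) (p : X.V →ₗ[K] M.V), Intw n M.T X.T i ∧ Intw n X.T M.T p ∧
    p ∘ₗ i = LinearMap.id ∧ i ∘ₗ p = LinearMap.id

/-- The direct summand cut out by an idempotent. -/
theorem HSys.exists_range (X : HSys K α β q n) (e : End K X.V) (he : e * e = e)
    (hi : Intw n X.T X.T e) : ∃ (Y : HSys K α β q n) (ι : Y.V →ₗ[K] X.V) (p : X.V →ₗ[K] Y.V),
      Intw n Y.T X.T ι ∧ Intw n X.T Y.T p ∧ p ∘ₗ ι = LinearMap.id ∧ ι ∘ₗ p = e := by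
  have he' : ∀ x, e (e x) = e x := congr_fun he
  set T' : ℕ → End K (LinearMap.range e) := fun i =>
    e.rangeRestrict ∘ₗ X.T i ∘ₗ (LinearMap.range e).subtype with hT'
  have h1 : Intw n T' X.T (LinearMap.range e).subtype := by
    rintro i h ⟨_, x, rfl⟩
    change e (X.T i (e x)) = X.T i (e x)
    rw [hi i h, he']
  have h2 : Intw n X.T T' e.rangeRestrict := by
    intro i h x
    apply Subtype.ext
    change e (X.T i x) = e (X.T i (e x))
    rw [hi i h, hi i h, he']
  refine ⟨⟨LinearMap.range e, T', X.hT.of_injective Subtype.val_injective h1⟩,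
    (LinearMap.range e).subtype, e.rangeRestrict, h1, h2, ?_, rfl⟩
  ext ⟨_, x, rfl⟩
  exact he' x

theorem finrank_lt_of_retract {X Y : Type*} [AddCommGroup X] [Module K X] [FiniteDimensional K X]
    [AddCommGroup Y] [Module K Y] [FiniteDimensional K Y]
    {ι : Y →ₗ[K] X} {p : X →ₗ[K] Y} (h : p ∘ₗ ι = LinearMap.id) (h' : ι ∘ₗ p ≠ LinearMap.id) :
    Module.finrank K Y < Module.finrank K X := by
  have hi : Function.LeftInverse p ι := congr_fun h
  refine (LinearMap.finrank_le_finrank_of_injective hi.injective).lt_of_ne fun heq => h' ?_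
  have := (LinearMap.injective_iff_surjective_of_finrank_eq_finrank heq.symm).2 hi.surjective
  ext x
  exact this (hi (p x))

/-- Every system is a finite direct sum of indecomposable ones. -/
theorem HSys.exists_decomp (X : HSys K α β q n) :
    ∃ (J : Type) (_ : Fintype J) (Y : J → HSys K α β q n) (ι : ∀ j, (Y j).V →ₗ[K] X.V)
      (p : ∀ j, X.V →ₗ[K] (Y j).V),
      (∀ j, Indec n (Y j).T ∧ Intw n (Y j).T X.T (ι j) ∧ Intw n X.T (Y j).T (p j) ∧
        p j ∘ₗ ι j = LinearMap.id) ∧ ∑ j, ι j ∘ₗ p j = LinearMap.id := by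
  obtain ⟨d, hd⟩ : ∃ d, Module.finrank K X.V = d := ⟨_, rfl⟩
  induction d using Nat.strong_induction_on generalizing X with
  | _ d IH =>
  rcases subsingleton_or_nontrivial X.V with hs | hs
  · exact ⟨Empty, inferInstance, Empty.elim, fun j => j.elim, fun j => j.elim, fun j => j.elim,
      Subsingleton.elim _ _⟩
  by_cases hX : Indec n X.T
  · exact ⟨Unit, inferInstance, fun _ => X, fun _ => LinearMap.id, fun _ => LinearMap.id,
      fun _ => ⟨hX, Intw.id, Intw.id, rfl⟩, by simp⟩
  simp only [Indec, hs, true_and, not_forall, not_or] at hX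
  obtain ⟨e, he, hi, h0, h1⟩ := hX
  have he' : (1 - e) * (1 - e) = 1 - e := by
    rw [mul_sub, sub_mul, sub_mul, he]; simp
  obtain ⟨X₁, ι₁, p₁, hι₁, hp₁, h1₁, h2₁⟩ := X.exists_range e he hi
  obtain ⟨X₂, ι₂, p₂, hι₂, hp₂, h1₂, h2₂⟩ := X.exists_range (1 - e) he' (Intw.one.sub hi)
  obtain ⟨J, _, Y, ι, p, hJ, hs1⟩ :=
    IH _ (hd ▸ finrank_lt_of_retract h1₁ (by rw [h2₁]; exact h1)) X₁ rfl
  obtain ⟨J', _, Y', ι', p', hJ', hs2⟩ :=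
    IH _ (hd ▸ finrank_lt_of_retract h1₂ (by
      rw [h2₂]; exact fun h => h0 (sub_eq_self.1 h))) X₂ rfl
  refine ⟨J ⊕ J', inferInstance, Sum.elim Y Y',
    fun j => match j with
      | .inl j => ι₁ ∘ₗ ι j
      | .inr j => ι₂ ∘ₗ ι' j,
    fun j => match j with
      | .inl j => p j ∘ₗ p₁
      | .inr j => p' j ∘ₗ p₂, ?_, ?_⟩
  · rintro (j | j)
    · obtain ⟨a, b, c, d⟩ := hJ j
      refine ⟨a, hι₁.comp b, c.comp hp₁, ?_⟩
      calc _ = p j ∘ₗ (p₁ ∘ₗ ι₁) ∘ₗ ι j := rfl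
        _ = _ := by rw [h1₁]; exact d
    · obtain ⟨a, b, c, d⟩ := hJ' j
      refine ⟨a, hι₂.comp b, c.comp hp₂, ?_⟩
      calc _ = p' j ∘ₗ (p₂ ∘ₗ ι₂) ∘ₗ ι' j := rfl
        _ = _ := by rw [h1₂]; exact d
  · rw [Fintype.sum_sum_type]
    calc _ = ι₁ ∘ₗ (∑ j, ι j ∘ₗ p j) ∘ₗ p₁ + ι₂ ∘ₗ (∑ j, ι' j ∘ₗ p' j) ∘ₗ p₂ := by
          ext x
          simp only [LinearMap.add_apply, LinearMap.sum_apply, comp_apply, map_sum]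
          rfl
      _ = LinearMap.id := by
        rw [hs1, hs2, LinearMap.id_comp, LinearMap.id_comp, h2₁, h2₂]
        exact add_sub_cancel _ _

/-- If the composite `p ∘ i` is invertible then `M` is a summand. -/
theorem HSys.summand_of_isUnit {M X : HSys K α β q n} {i : M.V →ₗ[K] X.V} {p : X.V →ₗ[K] M.V}
    (hi : Intw n M.T X.T i) (hp : Intw n X.T M.T p)
    (h : IsUnit (p ∘ₗ i : End K M.V)) : M.Summand X := by
  obtain ⟨u, hu⟩ := h
  have hinv : Intw n M.T M.T (↑u⁻¹ : End K M.V) := by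
    refine Intw.of_commute fun k hk => ?_
    have : Commute (u : End K M.V) (M.T k) := by
      rw [hu]; exact (hp.comp hi).commute hk
    exact this.units_inv_left
  refine ⟨i, (↑u⁻¹ : End K M.V) ∘ₗ p, hi, hinv.comp hp, ?_⟩
  rw [LinearMap.comp_assoc, ← hu]
  exact u.inv_mul

theorem HSys.Summand.iso {M X : HSys K α β q n} (h : M.Summand X) (hX : Indec n X.T)
    (hM : Nontrivial M.V) : M.Iso X := by
  obtain ⟨i, p, hi, hp, hpi⟩ := h
  refine ⟨i, p, hi, hp, hpi, ?_⟩
  rcases hX.2 (i ∘ₗ p) (by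
    calc (i ∘ₗ p) ∘ₗ i ∘ₗ p = i ∘ₗ (p ∘ₗ i) ∘ₗ p := rfl
      _ = i ∘ₗ p := by rw [hpi]; rfl) (hi.comp hp) with h0 | h1
  · obtain ⟨x, hx⟩ := exists_ne (0 : M.V)
    have h2 := congr_fun h0 (i x)
    have h3 := congr_fun hpi
    simp only [comp_apply, LinearMap.id_apply, LinearMap.zero_apply] at h2 h3
    rw [h3] at h2
    exact absurd (by rw [← h3 x, h2, map_zero]) hx
  · exact h1

/-- Indecomposable summands of a direct sum. -/
theorem HSys.exists_summand {M : HSys K α β q n} (hM : Indec n M.T) {J : Type*} (s : Finset J)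
    (Y : J → HSys K α β q n) (i : ∀ j, M.V →ₗ[K] (Y j).V) (p : ∀ j, (Y j).V →ₗ[K] M.V)
    (hi : ∀ j ∈ s, Intw n M.T (Y j).T (i j)) (hp : ∀ j ∈ s, Intw n (Y j).T M.T (p j))
    (h : IsUnit (∑ j ∈ s, p j ∘ₗ i j : End K M.V)) : ∃ j ∈ s, M.Summand (Y j) := by
  obtain ⟨j, hj, hu⟩ := hM.exists_isUnit_of_sum s (fun j hj => (hp j hj).comp (hi j hj)) h
  exact ⟨j, hj, HSys.summand_of_isUnit (hi j hj) (hp j hj) hu⟩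

/-- Finite representation type, up to direct summands. -/
def FinRep (K : Type) [Field K] (α β q : K) (n : ℕ) : Prop :=
  ∃ (S : Type) (_ : Finite S) (X : S → HSys K α β q n),
    ∀ M : HSys K α β q n, Indec n M.T → ∃ s, M.Summand (X s)

theorem FinRep.exists_indec (h : FinRep K α β q n) :
    ∃ (S : Type) (_ : Finite S) (X : S → HSys K α β q n), (∀ s, Indec n (X s).T) ∧
    ∀ M : HSys K α β q n, Indec n M.T → ∃ s, M.Iso (X s) := by
  obtain ⟨S, _, X, hX⟩ := h
  choose J hJ Y ι p hY hs using fun s => (X s).exists_decomp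
  refine ⟨Σ s, J s, inferInstance, fun s => Y s.1 s.2, fun s => (hY s.1 s.2).1, fun M hM => ?_⟩
  obtain ⟨s, i, r, hi, hr, hri⟩ := hX M hM
  obtain ⟨j, -, hj⟩ := HSys.exists_summand hM Finset.univ (Y s) (fun j => p s j ∘ₗ i)
    (fun j => r ∘ₗ ι s j) (fun j _ => (hY s j).2.2.1.comp hi) (fun j _ => hr.comp (hY s j).2.1) (by
      have : ∑ j, (r ∘ₗ ι s j) ∘ₗ p s j ∘ₗ i = r ∘ₗ (∑ j, ι s j ∘ₗ p s j) ∘ₗ i := by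
        ext x; simp
      rw [this, hs, LinearMap.id_comp, hri]
      exact isUnit_one)
  exact ⟨⟨s, j⟩, hj.iso (hY s j).1 hM.1⟩

end HSys

section Bridge

open MulOpposite

variable {K : Type} [Field K] {α β q : K}

theorem IsHecke.op {A : Type*} [Ring A] [Algebra K A] {T : ℕ → A} (hT : IsHecke α β q n T) :
    IsHecke α β q n (fun i => op (T i)) where
  quad_zero hn := by simp [← op_mul, hT.quad_zero hn]
  quad i h0 hi := by simp [← op_mul, hT.quad i h0 hi]
  braid_zero hn := by simp only [← op_mul, ← mul_assoc, hT.braid_zero hn]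
  braid i h0 hi := by simp only [← op_mul, ← mul_assoc, hT.braid i h0 hi]
  comm i j hij hj := by simp only [← op_mul, hT.comm i j hij hj]

theorem HSys.Iso.symm {M X : HSys K α β q n} (h : M.Iso X) : X.Iso M := by
  obtain ⟨i, p, hi, hp, h1, h2⟩ := h
  exact ⟨p, i, hp, hi, h2, h1⟩

theorem HSys.Iso.trans {M X Y : HSys K α β q n} (h : M.Iso X) (h' : X.Iso Y) : M.Iso Y := by
  obtain ⟨i, p, hi, hp, h1, h2⟩ := h
  obtain ⟨i', p', hi', hp', h1', h2'⟩ := h'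
  refine ⟨i' ∘ₗ i, p ∘ₗ p', hi'.comp hi, hp.comp hp', ?_, ?_⟩
  · calc _ = p ∘ₗ (p' ∘ₗ i') ∘ₗ i := rfl
      _ = _ := by rw [h1', LinearMap.id_comp, h1]
  · calc _ = i' ∘ₗ (i ∘ₗ p) ∘ₗ p' := rfl
      _ = _ := by rw [h2, LinearMap.id_comp, h2']

/-- The standard generators of the Hecke algebra, as a sequence. -/
noncomputable def heckeGen (α β q : K) (n : ℕ) (i : ℕ) : HeckeB K α β q n :=
  if h : i < n then RingQuot.mkAlgHom K (HeckeBRel K α β q n) (FreeAlgebra.ι K ⟨i, h⟩) else 0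

theorem heckeGen_of_lt (h : i < n) : heckeGen α β q n i =
    RingQuot.mkAlgHom K (HeckeBRel K α β q n) (FreeAlgebra.ι K ⟨i, h⟩) := dif_pos h

theorem isHecke_heckeGen (α β q : K) (n : ℕ) : IsHecke α β q n (heckeGen α β q n) where
  quad_zero hn := by
    have := RingQuot.mkAlgHom_rel K (HeckeBRel.quad_zero (K := K) (α := α) (β := β) (q := q)
      (⟨0, hn⟩ : Fin n) rfl)
    simp only [map_mul, map_sub, map_zero, AlgHom.commutes, ← heckeGen_of_lt] at this
    simp only [Algebra.algebraMap_eq_smul_one, mul_sub, sub_mul, smul_mul_assoc, mul_smul_comm,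
      one_mul, mul_one, smul_smul] at this
    rw [← sub_eq_zero, ← this]
    module
  quad i h0 hi := by
    have := RingQuot.mkAlgHom_rel K (HeckeBRel.quad (K := K) (α := α) (β := β) (q := q)
      (⟨i, hi⟩ : Fin n) h0)
    simp only [map_mul, map_sub, map_add, map_one, map_zero, AlgHom.commutes,
      ← heckeGen_of_lt] at this
    simp only [Algebra.algebraMap_eq_smul_one, mul_sub, add_mul, smul_mul_assoc, mul_smul_comm,
      one_mul, mul_one, smul_smul] at this
    rw [← sub_eq_zero, ← this]
    module
  braid_zero hn := by
    have := RingQuot.mkAlgHom_rel K (HeckeBRel.braid_zero (K := K) (α := α) (β := β) (q := q)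
      (⟨0, by omega⟩ : Fin n) ⟨1, hn⟩ rfl rfl)
    simpa only [map_mul, ← heckeGen_of_lt] using this
  braid i h0 hi := by
    have := RingQuot.mkAlgHom_rel K (HeckeBRel.braid (K := K) (α := α) (β := β) (q := q)
      (⟨i, by omega⟩ : Fin n) ⟨i + 1, hi⟩ h0 rfl)
    simpa only [map_mul, ← heckeGen_of_lt] using this
  comm i j hij hj := by
    have := RingQuot.mkAlgHom_rel K (HeckeBRel.comm (K := K) (α := α) (β := β) (q := q)
      (⟨i, by omega⟩ : Fin n) ⟨j, hj⟩ hij)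
    simpa only [map_mul, ← heckeGen_of_lt] using this

/-- The universal property of the Hecke algebra. -/
theorem exists_heckeLift {A : Type*} [Ring A] [Algebra K A] {T : ℕ → A}
    (hT : IsHecke α β q n T) :
    ∃ g : HeckeB K α β q n →ₐ[K] A, ∀ i < n, g (heckeGen α β q n i) = T i := by
  refine ⟨RingQuot.liftAlgHom K ⟨FreeAlgebra.lift K fun i : Fin n => T i, ?_⟩, fun i hi => ?_⟩
  · intro x y hxy
    induction hxy with
    | quad_zero i hi =>
      have hn : 0 < n := by omega
      have := hT.quad_zero hn
      simp only [map_mul, map_sub, FreeAlgebra.lift_ι_apply, AlgHom.commutes, hi, map_zero,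
        Algebra.algebraMap_eq_smul_one, mul_sub, sub_mul, smul_mul_assoc, mul_smul_comm,
        one_mul, mul_one, map_smul, map_one, smul_smul, this]
      module
    | quad i hi =>
      have := hT.quad i hi i.2
      simp only [map_mul, map_sub, map_add, map_one, FreeAlgebra.lift_ι_apply, AlgHom.commutes,
        map_zero, Algebra.algebraMap_eq_smul_one, mul_sub, add_mul, smul_mul_assoc, mul_smul_comm,
        one_mul, mul_one, map_smul, map_one, smul_smul, this]
      module
    | braid_zero i j hi hj =>
      simp only [map_mul, FreeAlgebra.lift_ι_apply, hi, hj]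
      exact hT.braid_zero (hj ▸ j.2)
    | braid i j hi hij =>
      simp only [map_mul, FreeAlgebra.lift_ι_apply, hij]
      exact hT.braid i hi (hij ▸ j.2)
    | comm i j hij =>
      simp only [map_mul, FreeAlgebra.lift_ι_apply]
      exact hT.comm i j hij j.2
  · rw [heckeGen_of_lt hi, RingQuot.liftAlgHom_mkAlgHom_apply, FreeAlgebra.lift_ι_apply]

theorem heckeB_induction {P : HeckeB K α β q n → Prop} (hc : ∀ c : K, P (algebraMap K _ c))
    (hg : ∀ i < n, P (heckeGen α β q n i)) (ha : ∀ x y, P x → P y → P (x + y))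
    (hm : ∀ x y, P x → P y → P (x * y)) (x : HeckeB K α β q n) : P x := by
  obtain ⟨x, rfl⟩ := RingQuot.mkAlgHom_surjective K (HeckeBRel K α β q n) x
  induction x using FreeAlgebra.induction with
  | grade0 c => rw [AlgHom.commutes]; exact hc c
  | grade1 i => rw [← heckeGen_of_lt i.2]; exact hg i i.2
  | mul a b h1 h2 => rw [map_mul]; exact hm _ _ h1 h2
  | add a b h1 h2 => rw [map_add]; exact ha _ _ h1 h2

/-- The system of operators on a right module. -/
noncomputable def FDRightModule.sys (M : FDRightModule K (HeckeB K α β q n)) :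
    HSys K α β q n where
  V := M.carrier
  T i := Algebra.lsmul K K M.carrier (op (heckeGen α β q n i))
  hT := ((isHecke_heckeGen α β q n).op).map (Algebra.lsmul K K M.carrier)

theorem FDRightModule.map_smul_of_intw {M N : FDRightModule K (HeckeB K α β q n)}
    {f : M.carrier →ₗ[K] N.carrier} (hf : Intw n M.sys.T N.sys.T f)
    (a : (HeckeB K α β q n)ᵐᵒᵖ) : ∀ x, f (a • x) = a • f x := by
  induction a using MulOpposite.rec' with
  | _ a =>
  induction a using heckeB_induction with
  | hc c =>
    intro x
    rw [show op (algebraMap K (HeckeB K α β q n) c) = c • (1 : (HeckeB K α β q n)ᵐᵒᵖ) by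
      rw [Algebra.algebraMap_eq_smul_one]; rfl]
    simp
  | hg i hi => exact hf i hi
  | ha a b h1 h2 => intro x; simp [add_smul, h1, h2]
  | hm a b h1 h2 => intro x; simp [mul_smul, h1, h2]

/-- The right module attached to a system of operators. -/
theorem HSys.exists_module (X : HSys K α β q n) :
    ∃ M : FDRightModule K (HeckeB K α β q n), X.Iso M.sys := by
  obtain ⟨g, hg⟩ := exists_heckeLift X.hT.op
  let h : (HeckeB K α β q n)ᵐᵒᵖ →ₐ[K] End K X.V := AlgHom.opComm g
  let _ : Module (HeckeB K α β q n)ᵐᵒᵖ X.V := Module.compHom X.V h.toRingHom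
  have hsm : ∀ (a : (HeckeB K α β q n)ᵐᵒᵖ) (x : X.V), a • x = h a x := fun _ _ => rfl
  have : IsScalarTower K (HeckeB K α β q n)ᵐᵒᵖ X.V := ⟨fun c a x => by simp [hsm]⟩
  have hT : ∀ i < n, ∀ x : X.V, op (heckeGen α β q n i) • x = X.T i x := fun i hi x => by
    rw [hsm]
    change (g (heckeGen α β q n i)).unop x = _
    rw [hg i hi, unop_op]
  exact ⟨⟨X.V⟩, LinearMap.id, LinearMap.id, fun i hi x => (hT i hi x).symm, hT, rfl, rfl⟩

theorem FDRightModule.indec_iff (M : FDRightModule K (HeckeB K α β q n)) :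
    IsIndecomposableModule (HeckeB K α β q n)ᵐᵒᵖ M.carrier ↔ Indec n M.sys.T := by
  refine and_congr Iff.rfl ⟨fun h e he hi => ?_, fun h N₁ N₂ hN => ?_⟩
  · let E : M.carrier →ₗ[(HeckeB K α β q n)ᵐᵒᵖ] M.carrier :=
      { toFun := e
        map_add' := map_add e
        map_smul' := M.map_smul_of_intw hi }
    have hE : ∀ x, E (E x) = E x := congr_fun he
    have hc : IsCompl (LinearMap.range E) (LinearMap.ker E) := by
      rw [isCompl_iff, Submodule.disjoint_def, codisjoint_iff, Submodule.eq_top_iff']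
      refine ⟨?_, fun x => ?_⟩
      · rintro _ ⟨x, rfl⟩ hx
        rwa [mem_ker, hE] at hx
      · refine Submodule.mem_sup.2 ⟨E x, ⟨x, rfl⟩, x - E x, ?_, add_sub_cancel _ _⟩
        rw [mem_ker, map_sub, hE, sub_self]
    rcases h _ _ hc with h0 | h1
    · left
      ext x
      have : E x ∈ LinearMap.range E := ⟨x, rfl⟩
      rwa [h0, Submodule.mem_bot] at this
    · right
      refine ext fun (x : M.carrier) => ?_
      have : E x - (x : M.carrier) ∈ LinearMap.ker E := by
        rw [mem_ker, map_sub, hE, sub_self]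
      rw [h1, Submodule.mem_bot, sub_eq_zero] at this
      exact this
  · let e : End K M.carrier := (N₁.projection N₂ hN).restrictScalars K
    have he : e * e = e := by
      ext x
      exact Submodule.projection_apply_of_mem_left hN (Submodule.projection_apply_mem hN x)
    rcases h e he (fun i _ (x : M.carrier) =>
      map_smul (N₁.projection N₂ hN) (op (heckeGen α β q n i)) x) with h0 | h1
    · left
      rw [eq_bot_iff]
      intro x hx
      have := congr_fun h0 x
      change N₁.projection N₂ hN x = 0 at this
      rw [Submodule.projection_apply_of_mem_left hN hx] at this
      exact this
    · right
      rw [eq_bot_iff]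
      intro x hx
      have := congr_fun h1 x
      change N₁.projection N₂ hN x = x at this
      rw [Submodule.projection_apply_of_mem_right hN hx] at this
      exact this.symm

theorem hasFiniteRepresentationType_iff_finRep :
    HasFiniteRepresentationType K (HeckeB K α β q n) ↔ FinRep K α β q n := by
  constructor
  · intro h
    obtain ⟨m, ⟨w⟩⟩ := (show Finite _ from h).exists_equiv_fin
    refine ⟨Fin m, inferInstance, fun s => (w.symm s).out.1.sys, fun X hX => ?_⟩
    obtain ⟨M, i, p, hi, hp, hpi, hip⟩ := X.exists_module
    have hM : Indec n M.sys.T := by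
      refine ⟨?_, fun e he hie => ?_⟩
      · have := hX.1
        exact (Function.LeftInverse.injective (g := p) (congr_fun hpi)).nontrivial
      have he' : ∀ x, e (e x) = e x := congr_fun he
      have hip' : ∀ x, i (p x) = x := congr_fun hip
      rcases hX.2 (p ∘ₗ e ∘ₗ i) (by
        ext x
        simp [hip', he']) (hp.comp (hie.comp hi)) with h0 | h1
      · left
        ext x
        have := congr_arg i (congr_fun h0 (p x))
        simpa [hip'] using this
      · right
        ext x
        have := congr_arg i (congr_fun h1 (p x))
        simpa [hip'] using this
    let s : {M : FDRightModule K (HeckeB K α β q n) //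
      IsIndecomposableModule (HeckeB K α β q n)ᵐᵒᵖ M.carrier} := ⟨M, M.indec_iff.2 hM⟩
    refine ⟨w (Quot.mk _ s), ?_⟩
    simp only [Equiv.symm_apply_apply]
    have hs := Quot.eqvGen_exact (Quot.out_eq (Quot.mk (fun M N :
      {M : FDRightModule K (HeckeB K α β q n) //
        IsIndecomposableModule (HeckeB K α β q n)ᵐᵒᵖ M.carrier} =>
      Nonempty (M.1.carrier ≃ₗ[(HeckeB K α β q n)ᵐᵒᵖ] N.1.carrier)) s))
    obtain ⟨φ⟩ := ((⟨fun _ => ⟨LinearEquiv.refl _ _⟩, fun ⟨a⟩ => ⟨a.symm⟩,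
      fun ⟨a⟩ ⟨b⟩ => ⟨a.trans b⟩⟩ : Equivalence (fun M N :
      {M : FDRightModule K (HeckeB K α β q n) //
        IsIndecomposableModule (HeckeB K α β q n)ᵐᵒᵖ M.carrier} =>
      Nonempty (M.1.carrier ≃ₗ[(HeckeB K α β q n)ᵐᵒᵖ] N.1.carrier)))).eqvGen_iff.1 hs
    refine ⟨(φ.symm.toLinearMap.restrictScalars K) ∘ₗ i, p ∘ₗ (φ.toLinearMap.restrictScalars K),
      Intw.comp (fun k _ (x : M.carrier) => map_smul φ.symm (op (heckeGen α β q n k)) x) hi,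
      hp.comp (fun k _ x =>
        LinearMap.map_smul φ.toLinearMap (op (heckeGen α β q n k)) x), ?_⟩
    ext x
    have := congr_fun hpi x
    simp only [comp_apply, LinearMap.id_apply] at this ⊢
    refine Eq.trans ?_ this
    exact congr_arg p (φ.apply_symm_apply _)
  · intro h
    obtain ⟨S, _, X, hX, h⟩ := h.exists_indec
    choose g hg using fun M : {M : FDRightModule K (HeckeB K α β q n) //
      IsIndecomposableModule (HeckeB K α β q n)ᵐᵒᵖ M.carrier} => h M.1.sys (M.1.indec_iff.1 M.2)
    refine Finite.of_injective (fun s => g s.out) fun s t hst => ?_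
    rw [← Quot.out_eq s, ← Quot.out_eq t]
    apply Quot.sound
    have hs := hg s.out
    simp only at hst
    rw [hst] at hs
    obtain ⟨i, p, hi, hp, h1, h2⟩ := hs.trans (hg t.out).symm
    exact ⟨LinearEquiv.ofLinearMap
      { toFun := i
        map_add' := map_add i
        map_smul' := FDRightModule.map_smul_of_intw hi }
      { toFun := p
        map_add' := map_add p
        map_smul' := FDRightModule.map_smul_of_intw hp }
      (ext fun x => congr_fun h2 x)
      (ext fun x => congr_fun h1 x)⟩

end Bridge

/-- The relations between a Hecke generator and two consecutive Jucys--Murphy elements. -/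
structure HPair (q : K) (T a b : A) : Prop where
  quad : T * T = (q - 1) • T + q • (1 : A)
  bT : b * T = T * a + (q - 1) • b
  Tb : T * b = a * T + (q - 1) • b
  TaT : T * a * T = q • b
  comm : a * b = b * a

section HPair

variable {T a b : A}

theorem HPair.of_eq (hq : q ≠ 0) (hT : T * T = (q - 1) • T + q • (1 : A))
    (hb : b = q⁻¹ • (T * a * T)) (hab : a * b = b * a) : HPair q T a b where
  quad := hT
  bT := by
    have : b * T = q⁻¹ • (T * a * (T * T)) := by simp only [hb, smul_mul_assoc, mul_assoc]
    rw [this, hT, hb]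
    simp only [mul_add, mul_smul_comm, mul_one, smul_add, smul_smul, inv_mul_cancel₀ hq, one_smul]
    module
  Tb := by
    have : T * b = q⁻¹ • (T * T * (a * T)) := by simp only [hb, mul_smul_comm, mul_assoc]
    rw [this, hT, hb]
    simp only [add_mul, smul_mul_assoc, one_mul, smul_add, smul_smul, inv_mul_cancel₀ hq, one_smul,
      mul_assoc]
    module
  TaT := by rw [hb, smul_smul, mul_inv_cancel₀ hq, one_smul]
  comm := hab

namespace HPair

variable (h : HPair q T a b)

include h

theorem phi_a : (T * a - a * T) * a = b * (T * a - a * T) := by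
  linear_combination (norm := skip) (-1 : K) • (h.bT * a) - h.comm * T + a * h.bT
    + (q - 1) • h.comm
  simp only [mul_add, mul_sub, add_mul, sub_mul, smul_mul_assoc, mul_smul_comm, mul_assoc,
    one_mul, mul_one]
  module

theorem phi_b : (T * a - a * T) * b = a * (T * a - a * T) := by
  linear_combination (norm := skip) h.Tb * a - a * h.Tb + T * h.comm - (q - 1) • h.comm
  simp only [mul_add, mul_sub, add_mul, sub_mul, smul_mul_assoc, mul_smul_comm, mul_assoc,
    one_mul, mul_one]
  module

theorem phi_sq : (T * a - a * T) * (T * a - a * T) = (q • a - b) * (q • b - a) := by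
  linear_combination (norm := skip) h.TaT * a + a * h.TaT - a * h.quad * a + T * a * h.Tb
    - h.TaT * b + (q - 1) • (h.Tb * a) + ((q - 1) • T + (q - q ^ 2) • 1) * h.comm
  simp only [mul_add, mul_sub, add_mul, sub_mul, smul_mul_assoc, mul_smul_comm, mul_assoc,
    one_mul, mul_one]
  module

theorem phi_eq : T * a - a * T = b * T - T * b := by
  linear_combination (norm := skip) (-1 : K) • h.bT + h.Tb
  module

theorem commute_add : Commute T (a + b) := by
  change T * (a + b) = (a + b) * T
  linear_combination (norm := skip) h.Tb - h.bT
  simp only [mul_add, add_mul]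
  module

theorem commute_mul : Commute T (a * b) := by
  change T * (a * b) = a * b * T
  linear_combination (norm := skip) T * h.comm + h.Tb * a  - a * h.bT - (q - 1) • h.comm
  simp only [mul_add, mul_sub, add_mul, sub_mul, smul_mul_assoc, mul_smul_comm, mul_assoc,
    one_mul, mul_one]
  module

theorem phi_pow_b (m : ℕ) : (T * a - a * T) * b ^ m = a ^ m * (T * a - a * T) := by
  induction m with
  | zero => simp
  | succ m ih => rw [pow_succ, ← mul_assoc, ih, mul_assoc, h.phi_b, ← mul_assoc, ← pow_succ]

theorem phi_pow_a (m : ℕ) : (T * a - a * T) * a ^ m = b ^ m * (T * a - a * T) := by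
  induction m with
  | zero => simp
  | succ m ih => rw [pow_succ, ← mul_assoc, ih, mul_assoc, h.phi_a, ← mul_assoc, ← pow_succ]

theorem commute_pow_add (m : ℕ) : Commute T (a ^ m + b ^ m) := by
  induction m using Nat.strong_induction_on with
  | _ m ih =>
    match m with
    | 0 => simp
    | 1 => simpa using h.commute_add
    | m + 2 =>
      have : a ^ (m + 2) + b ^ (m + 2)
          = (a + b) * (a ^ (m + 1) + b ^ (m + 1)) - a * b * (a ^ m + b ^ m) := by
        have h1 : b * a ^ (m + 1) = a * b * a ^ m := by rw [pow_succ', ← mul_assoc, ← h.comm]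
        have h2 : a * b ^ (m + 1) = a * b * b ^ m := by rw [pow_succ', ← mul_assoc]
        simp only [add_mul, mul_add, h1, h2, ← pow_succ']
        abel
      rw [this]
      exact (h.commute_add.mul_right (ih _ (by omega))).sub_right
        (h.commute_mul.mul_right (ih _ (by omega)))

theorem commute_aeval_add (g : K[X]) :
    Commute T (aeval a g + aeval b g) := by
  induction g using induction_on' with
  | add p r hp hr =>
    rw [map_add, map_add, add_add_add_comm]
    exact hp.add_right hr
  | monomial m c =>
    rw [aeval_monomial, aeval_monomial, ← mul_add, ← Algebra.smul_def]
    exact (h.commute_pow_add m).smul_right c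

theorem phi_aeval_b (g : K[X]) : (T * a - a * T) * aeval b g
    = aeval a g * (T * a - a * T) := by
  induction g using induction_on' with
  | add p r hp hr => rw [map_add, map_add, mul_add, add_mul, hp, hr]
  | monomial m c =>
    rw [aeval_monomial, aeval_monomial, ← Algebra.smul_def,
      ← Algebra.smul_def, mul_smul_comm, smul_mul_assoc, h.phi_pow_b]

theorem phi_aeval_a (g : K[X]) : (T * a - a * T) * aeval a g
    = aeval b g * (T * a - a * T) := by
  induction g using induction_on' with
  | add p r hp hr => rw [map_add, map_add, mul_add, add_mul, hp, hr]
  | monomial m c =>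
    rw [aeval_monomial, aeval_monomial, ← Algebra.smul_def,
      ← Algebra.smul_def, mul_smul_comm, smul_mul_assoc, h.phi_pow_a]

end HPair
end HPair

/-- The Jucys--Murphy elements. -/
def jm (q : K) (T : ℕ → A) : ℕ → A
  | 0 => T 0
  | k + 1 => q⁻¹ • (T (k + 1) * jm q T k * T (k + 1))

section JM

variable {T : ℕ → A}

namespace IsHecke

variable (hT : IsHecke α β q n T)

include hT

theorem commute_jm_of_gt (h : k + 1 < j) (hj : j < n) : Commute (T j) (jm q T k) := by
  induction k with
  | zero => exact (hT.comm 0 j (by omega) hj).symm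
  | succ k ih =>
    have := (hT.comm (k + 1) j h hj).symm
    exact ((Commute.mul_right this (ih (by omega))).mul_right this).smul_right _

theorem commute_jm_of_lt (h : i < k) (hk : k < n) : Commute (T i) (jm q T k) := by
  induction k with
  | zero => omega
  | succ k ih =>
    refine Commute.smul_right ?_ _
    rcases lt_succ_iff_lt_or_eq.1 h with hlt | rfl
    · have : Commute (T i) (T (k + 1)) := hT.comm i (k + 1) (by omega) hk
      exact (this.mul_right (ih hlt (by omega))).mul_right this
    · rcases i with _ | i
      · change T 0 * (T 1 * T 0 * T 1) = T 1 * T 0 * T 1 * T 0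
        rw [← hT.braid_zero hk]
        simp only [mul_assoc]
      · simp only [jm, mul_smul_comm, smul_mul_assoc]
        refine Commute.smul_right ?_ _
        have hb := hT.braid (i + 1) (by omega) hk
        have hc : Commute (T (i + 2)) (jm q T i) := hT.commute_jm_of_gt (by omega) hk
        change T (i + 1) * (T (i + 2) * (T (i + 1) * jm q T i * T (i + 1)) * T (i + 2))
          = T (i + 2) * (T (i + 1) * jm q T i * T (i + 1)) * T (i + 2) * T (i + 1)
        calc _ = (T (i + 1) * T (i + 2) * T (i + 1)) * jm q T i * T (i + 1) * T (i + 2) := by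
              simp only [mul_assoc]
          _ = T (i + 2) * T (i + 1) * (T (i + 2) * jm q T i) * T (i + 1) * T (i + 2) := by
              rw [← hb]; simp only [mul_assoc]
          _ = T (i + 2) * T (i + 1) * jm q T i * (T (i + 2) * T (i + 1) * T (i + 2)) := by
              rw [hc.eq]; simp only [mul_assoc]
          _ = _ := by rw [hb]; simp only [mul_assoc]

theorem commute_jm (h : i ≠ k) (h' : i ≠ k + 1) (hi : i < n) (hk : k < n) :
    Commute (T i) (jm q T k) := by
  rcases lt_or_gt_of_ne h with h | h
  · exact hT.commute_jm_of_lt h hk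
  · exact hT.commute_jm_of_gt (by omega) hi

theorem jm_commute_of_lt (h : k < l) (hl : l < n) : Commute (jm q T k) (jm q T l) := by
  induction k with
  | zero => exact hT.commute_jm_of_lt h hl
  | succ k ih =>
    have := hT.commute_jm_of_lt h hl
    exact ((this.mul_left (ih (by omega))).mul_left this).smul_left _

theorem jm_commute (hk : k < n) (hl : l < n) : Commute (jm q T k) (jm q T l) := by
  rcases lt_trichotomy k l with h | rfl | h
  · exact hT.jm_commute_of_lt h hl
  · exact Commute.refl _
  · exact (hT.jm_commute_of_lt h hk).symm

theorem hPair (hq : q ≠ 0) (hk : k + 1 < n) :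
    HPair q (T (k + 1)) (jm q T k) (jm q T (k + 1)) :=
  HPair.of_eq hq (hT.quad _ (by omega) hk) rfl (hT.jm_commute (by omega) hk)

end IsHecke

end JM

section Induction

/-- The action of a generator on functions of a coset representative, before truncation. -/
def indFun (α β q : K) (T : ℕ → End K V) (j : ℕ) (g : ℕ → Bool → V) (p : ℕ) (s : Bool) : V :=
  match j with
  | 0 => if p = 0 then (if s then -(α * β) • g 0 false else g 0 true + (α + β) • g 0 false)
      else T 0 (g p s)
  | k + 1 => if p = k + 1 then (if s then q • g k true else g k false + (q - 1) • g (k + 1) false)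
      else if p = k then (if s then g (k + 1) true + (q - 1) • g k true else q • g (k + 1) false)
      else if p < k then T k (g p s) else T (k + 1) (g p s)

/-- Extension by zero of a function on `Fin (n + 1)`. -/
def extFun (n : ℕ) (g : Fin (n + 1) → Bool → V) (p : ℕ) (s : Bool) : V :=
  if h : p < n + 1 then g ⟨p, h⟩ s else 0

/-- The operators on the induced system. -/
def indT (α β q : K) (n : ℕ) (T : ℕ → End K V) (j : ℕ) :
    End K (Fin (n + 1) → Bool → V) where
  toFun g p s := indFun α β q T j (extFun n g) p s
  map_add' g h := by
    ext p s
    have : extFun n (g + h) = extFun n g + extFun n h := by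
      ext p s; simp only [extFun, Pi.add_apply]; split <;> simp
    rw [this]
    rcases j with _ | j
    · simp only [indFun, Pi.add_apply, map_add, smul_add]
      split_ifs <;> abel
    · simp only [indFun, Pi.add_apply, map_add, smul_add]
      split_ifs <;> abel
  map_smul' c g := by
    ext p s
    have : extFun n (c • g) = c • extFun n g := by
      ext p s; simp only [extFun, Pi.smul_apply]; split <;> simp
    rw [this]
    rcases j with _ | j
    · simp only [indFun, Pi.smul_apply, map_smul, RingHom.id_apply]
      split_ifs <;> module
    · simp only [indFun, Pi.smul_apply, map_smul, RingHom.id_apply]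
      split_ifs <;> module

variable {α β q : K} {T : ℕ → End K V}

theorem extFun_of_lt (g : Fin (n + 1) → Bool → V) (h : p < n + 1) (s : Bool) :
    extFun n g p s = g ⟨p, h⟩ s := dif_pos h

theorem extFun_indT (g : Fin (n + 1) → Bool → V) (j : ℕ) (hp : p < n + 1) (s : Bool) :
    extFun n (indT α β q n T j g) p s = indFun α β q T j (extFun n g) p s :=
  extFun_of_lt _ hp s

theorem indFun_zero_true (g : ℕ → Bool → V) :
    indFun α β q T 0 g 0 true = -(α * β) • g 0 false := rfl

theorem indFun_zero_false (g : ℕ → Bool → V) :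
    indFun α β q T 0 g 0 false = g 0 true + (α + β) • g 0 false := rfl

theorem indFun_zero_of_pos (g : ℕ → Bool → V) (hp : p ≠ 0) (s : Bool) :
    indFun α β q T 0 g p s = T 0 (g p s) := if_neg hp

theorem indFun_succ_true (g : ℕ → Bool → V) (k : ℕ) :
    indFun α β q T (k + 1) g (k + 1) true = q • g k true := by simp [indFun]

theorem indFun_succ_false (g : ℕ → Bool → V) (k : ℕ) :
    indFun α β q T (k + 1) g (k + 1) false = g k false + (q - 1) • g (k + 1) false := by
  simp [indFun]

theorem indFun_self_true (g : ℕ → Bool → V) (k : ℕ) :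
    indFun α β q T (k + 1) g k true = g (k + 1) true + (q - 1) • g k true := by simp [indFun]

theorem indFun_self_false (g : ℕ → Bool → V) (k : ℕ) :
    indFun α β q T (k + 1) g k false = q • g (k + 1) false := by simp [indFun]

theorem indFun_of_lt (g : ℕ → Bool → V) (h : p < k) (s : Bool) :
    indFun α β q T (k + 1) g p s = T k (g p s) := by
  simp [indFun, h, h.ne, show p ≠ k + 1 by omega]

theorem indFun_of_gt (g : ℕ → Bool → V) (h : j < p) (s : Bool) :
    indFun α β q T j g p s = T j (g p s) := by
  rcases j with _ | k
  · exact indFun_zero_of_pos g (by omega) s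
  · simp [indFun, h.ne', show p ≠ k by omega, show ¬ p < k by omega]

theorem ind_quad_zero (hT : IsHecke α β q n T) (g : Fin (n + 1) → Bool → V) (hp : p < n + 1)
    (s : Bool) :
    extFun n (indT α β q n T 0 (indT α β q n T 0 g)) p s =
      (α + β) • extFun n (indT α β q n T 0 g) p s - (α * β) • extFun n g p s := by
  rcases p with _ | p
  · cases s <;> simp only [extFun_indT _ _ hp, indFun_zero_true, indFun_zero_false] <;> module
  · simp only [extFun_indT _ _ hp, indFun_zero_of_pos _ (Nat.succ_ne_zero p)]
    exact congr_fun (hT.quad_zero (by omega)) _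

theorem ind_quad (hT : IsHecke α β q n T) (g : Fin (n + 1) → Bool → V) (hp : p < n + 1)
    (hi : i + 1 < n + 1) (s : Bool) :
    extFun n (indT α β q n T (i + 1) (indT α β q n T (i + 1) g)) p s =
      (q - 1) • extFun n (indT α β q n T (i + 1) g) p s + q • extFun n g p s := by
  have hi' : i < n + 1 := by omega
  rcases lt_trichotomy p (i + 1) with h | rfl | h
  · rcases (lt_succ_iff.1 h).lt_or_eq with h | rfl
    · simp only [extFun_indT _ _ hp, indFun_of_lt _ h]
      exact congr_fun (hT.quad i (by omega) (by omega)) _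
    · cases s <;> simp only [extFun_indT _ _ hp, extFun_indT _ _ hi, indFun_self_true,
        indFun_self_false, indFun_succ_true, indFun_succ_false] <;> module
  · cases s <;> simp only [extFun_indT _ _ hp, extFun_indT _ _ hi', indFun_self_true,
        indFun_self_false, indFun_succ_true, indFun_succ_false] <;> module
  · simp only [extFun_indT _ _ hp, indFun_of_gt _ h]
    exact congr_fun (hT.quad _ (by omega) (by omega)) _

theorem ind_braid_zero (hT : IsHecke α β q n T) (g : Fin (n + 1) → Bool → V) (hp : p < n + 1)
    (hn : 1 < n + 1) (s : Bool) :
    extFun n (indT α β q n T 0 (indT α β q n T 1 (indT α β q n T 0 (indT α β q n T 1 g)))) p s =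
    extFun n (indT α β q n T 1 (indT α β q n T 0 (indT α β q n T 1 (indT α β q n T 0 g)))) p s := by
  have h0 : 0 < n + 1 := by omega
  have e1 := fun (g : ℕ → Bool → V) (s : Bool) =>
    indFun_zero_of_pos (α := α) (β := β) (q := q) (T := T) g one_ne_zero s
  have e2 := fun g : ℕ → Bool → V => indFun_self_true (α := α) (β := β) (q := q) (T := T) g 0
  have e3 := fun g : ℕ → Bool → V => indFun_self_false (α := α) (β := β) (q := q) (T := T) g 0
  have e4 := fun g : ℕ → Bool → V => indFun_succ_true (α := α) (β := β) (q := q) (T := T) g 0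
  have e5 := fun g : ℕ → Bool → V => indFun_succ_false (α := α) (β := β) (q := q) (T := T) g 0
  simp only [zero_add] at e2 e3 e4 e5
  have hq := fun x => congr_fun (hT.quad_zero (by omega)) x
  simp only [mul_apply, LinearMap.sub_apply, LinearMap.smul_apply,
    End.one_apply] at hq
  rcases p with _ | _ | p
  · cases s <;> simp only [extFun_indT _ _ hn, extFun_indT _ _ h0, indFun_zero_true,
      indFun_zero_false, e1, e2, e3, e4, e5, map_add, map_smul, hq] <;> module
  · cases s <;> simp only [extFun_indT _ _ hn, extFun_indT _ _ h0, indFun_zero_true, zero_add,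
      indFun_zero_false, e1, e2, e3, e4, e5, map_add, map_smul, hq] <;> module
  · simp only [extFun_indT _ _ hp, indFun_of_gt _ (show 0 < p + 1 + 1 by omega),
      indFun_of_gt _ (show 1 < p + 1 + 1 by omega)]
    exact congr_fun (hT.braid_zero (by omega)) _

theorem ind_braid (hT : IsHecke α β q n T) (g : Fin (n + 1) → Bool → V) (hp : p < n + 1)
    (hi : i + 2 < n + 1) (s : Bool) :
    extFun n (indT α β q n T (i + 2) (indT α β q n T (i + 1) (indT α β q n T (i + 2) g))) p s =
    extFun n (indT α β q n T (i + 1) (indT α β q n T (i + 2) (indT α β q n T (i + 1) g))) p s := by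
  have h0 : i < n + 1 := by omega
  have h1 : i + 1 < n + 1 := by omega
  have e1 := fun (g : ℕ → Bool → V) (s : Bool) =>
    indFun_of_gt (α := α) (β := β) (q := q) (T := T) g (show i + 1 < i + 2 by omega) s
  have e2 := fun (g : ℕ → Bool → V) (s : Bool) =>
    indFun_of_lt (α := α) (β := β) (q := q) (T := T) g (show i < i + 1 by omega) s
  have f2 := fun g : ℕ → Bool → V => indFun_self_true (α := α) (β := β) (q := q) (T := T) g (i + 1)
  have f3 := fun g : ℕ → Bool → V => indFun_self_false (α := α) (β := β) (q := q) (T := T) g (i + 1)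
  have f4 := fun g : ℕ → Bool → V => indFun_succ_true (α := α) (β := β) (q := q) (T := T) g (i + 1)
  have f5 := fun g : ℕ → Bool → V => indFun_succ_false (α := α) (β := β) (q := q) (T := T) g (i + 1)
  simp only [add_assoc, Nat.reduceAdd] at e2 f2 f3 f4 f5
  have hq := fun x => congr_fun (hT.quad (i + 1) (by omega) (by omega)) x
  simp only [mul_apply, LinearMap.add_apply, LinearMap.smul_apply,
    End.one_apply] at hq
  rcases lt_trichotomy p (i + 1) with h | rfl | h
  · rcases (lt_succ_iff.1 h).lt_or_eq with h | rfl
    · simp only [extFun_indT _ _ hp, indFun_of_lt _ h, indFun_of_lt _ (show p < i + 1 by omega)]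
      exact congr_fun (hT.braid i (by omega) (by omega)) _
    · cases s <;> simp only [extFun_indT _ _ h0, extFun_indT _ _ h1, extFun_indT _ _ hi,
        indFun_self_true, indFun_self_false, indFun_succ_true, indFun_succ_false, e1, e2, f2, f3,
        f4, f5, map_add, map_smul, hq] <;> module
  · cases s <;> simp only [extFun_indT _ _ h0, extFun_indT _ _ h1, extFun_indT _ _ hi,
        indFun_self_true, indFun_self_false, indFun_succ_true, indFun_succ_false, e1, e2, f2, f3,
        f4, f5, map_add, map_smul, hq] <;> module
  · rcases (Nat.succ_le_of_lt h).lt_or_eq with h | rfl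
    · simp only [extFun_indT _ _ hp, indFun_of_gt _ (show i + 2 < p from h),
        indFun_of_gt _ (show i + 1 < p by omega)]
      exact congr_fun (hT.braid (i + 1) (by omega) (by omega)) _
    · cases s <;> simp only [Nat.succ_eq_add_one, add_assoc, Nat.reduceAdd,
        extFun_indT _ _ h0, extFun_indT _ _ h1, extFun_indT _ _ hi,
        indFun_self_true, indFun_self_false, indFun_succ_true, indFun_succ_false, e1, e2, f2, f3,
        f4, f5, map_add, map_smul, hq] <;> module

theorem ind_comm (hT : IsHecke α β q n T) (g : Fin (n + 1) → Bool → V) (hp : p < n + 1)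
    (hij : i + 1 < j + 1) (hj : j + 1 < n + 1) (s : Bool) :
    extFun n (indT α β q n T i (indT α β q n T (j + 1) g)) p s =
    extFun n (indT α β q n T (j + 1) (indT α β q n T i g)) p s := by
  have hj' : j < n + 1 := by omega
  have e1 := fun (g : ℕ → Bool → V) (s : Bool) =>
    indFun_of_gt (α := α) (β := β) (q := q) (T := T) g (show i < j + 1 by omega) s
  have e2 := fun (g : ℕ → Bool → V) (s : Bool) =>
    indFun_of_gt (α := α) (β := β) (q := q) (T := T) g (show i < j by omega) s
  rcases lt_trichotomy p j with h | rfl | h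
  · rcases lt_trichotomy p i with hi | rfl | hi
    · obtain ⟨i, rfl⟩ : ∃ k, i = k + 1 := ⟨i - 1, by omega⟩
      have hi' : i < n + 1 := by omega
      rcases (lt_succ_iff.1 hi).lt_or_eq with hi | rfl
      · simp only [extFun_indT _ _ hp, indFun_of_lt _ h, indFun_of_lt _ hi]
        exact congr_fun (hT.comm i j (by omega) (by omega)) _
      · have h1 : p + 1 < n + 1 := by omega
        cases s <;> simp only [extFun_indT _ _ hp, extFun_indT _ _ h1, indFun_of_lt _ h,
          indFun_self_true, indFun_self_false, indFun_of_lt _ (show p + 1 < j by omega),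
          map_add, map_smul]
    · rcases p with _ | p
      · cases s <;> simp only [extFun_indT _ _ hp, indFun_of_lt _ h, indFun_zero_true,
          indFun_zero_false, map_add, map_smul]
      · have h1 : p < n + 1 := by omega
        cases s <;> simp only [extFun_indT _ _ hp, extFun_indT _ _ h1, indFun_of_lt _ h,
          indFun_succ_true, indFun_succ_false, indFun_of_lt _ (show p < j by omega),
          map_add, map_smul]
    · simp only [extFun_indT _ _ hp, indFun_of_lt _ h, indFun_of_gt _ hi]
      exact congr_fun (hT.comm i j (by omega) (by omega)) _
  · cases s <;> simp only [extFun_indT _ _ hp, extFun_indT _ _ hj, indFun_self_true,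
      indFun_self_false, e1, e2, map_add, map_smul]
  · rcases (Nat.succ_le_of_lt h).lt_or_eq with h | rfl
    · simp only [extFun_indT _ _ hp, indFun_of_gt _ (show j + 1 < p from h),
        indFun_of_gt _ (show i < p by omega)]
      exact congr_fun (hT.comm i (j + 1) (by omega) (by omega)) _
    · cases s <;> simp only [Nat.succ_eq_add_one, extFun_indT _ _ hj', extFun_indT _ _ hj,
        indFun_succ_true, indFun_succ_false, e1, e2, map_add, map_smul]

theorem isHecke_indT (hT : IsHecke α β q n T) :
    IsHecke α β q (n + 1) (indT α β q n T) where
  quad_zero _ := by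
    refine ext fun g => funext fun p => funext fun s => ?_
    simpa [extFun_of_lt _ p.2] using ind_quad_zero hT g p.2 s
  quad i h0 hi := by
    obtain ⟨i, rfl⟩ : ∃ k, i = k + 1 := ⟨i - 1, by omega⟩
    refine ext fun g => funext fun p => funext fun s => ?_
    simpa [extFun_of_lt _ p.2] using ind_quad hT g p.2 hi s
  braid_zero h := by
    refine ext fun g => funext fun p => funext fun s => ?_
    simpa [extFun_of_lt _ p.2] using ind_braid_zero hT g p.2 h s
  braid i h0 hi := by
    obtain ⟨i, rfl⟩ : ∃ k, i = k + 1 := ⟨i - 1, by omega⟩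
    refine ext fun g => funext fun p => funext fun s => ?_
    simpa [extFun_of_lt _ p.2] using ind_braid hT g p.2 hi s
  comm i j hij hj := by
    obtain ⟨j, rfl⟩ : ∃ k, j = k + 1 := ⟨j - 1, by omega⟩
    refine ext fun g => funext fun p => funext fun s => ?_
    simpa [extFun_of_lt _ p.2] using ind_comm hT g p.2 hij hj s

/-- The embedding of `V` at the coset `(k, +)`. -/
def indJ (V : Type*) (K : Type*) [Field K] [AddCommGroup V] [Module K V] (n k : ℕ) :
    V →ₗ[K] (Fin (n + 1) → Bool → V) where
  toFun v p s := if p = k ∧ s = true then v else 0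
  map_add' v w := by
    refine funext fun p => funext fun s => ?_
    simp only [Pi.add_apply]; split_ifs <;> simp
  map_smul' c v := by
    refine funext fun p => funext fun s => ?_
    simp only [Pi.smul_apply]; split_ifs <;> simp

/-- The component at the coset `(k, +)`. -/
def indPi (V : Type*) (K : Type*) [Field K] [AddCommGroup V] [Module K V] (n k : ℕ) :
    (Fin (n + 1) → Bool → V) →ₗ[K] V where
  toFun g := extFun n g k true
  map_add' v w := by
    simp only [extFun]; split_ifs <;> simp
  map_smul' c v := by
    simp only [extFun]; split_ifs <;> simp

theorem extFun_indJ (hk : k ≤ n) (v : V) (s : Bool) :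
    extFun n (indJ V K n k v) p s = if p = k ∧ s = true then v else 0 := by
  simp only [extFun, indJ, LinearMap.coe_mk, AddHom.coe_mk]
  split_ifs <;> first | rfl | omega

theorem ext_extFun {g h : Fin (n + 1) → Bool → V}
    (H : ∀ p, p < n + 1 → ∀ s, extFun n g p s = extFun n h p s) : g = h := by
  refine funext fun p => funext fun s => ?_
  simpa [extFun_of_lt _ p.2] using H p p.2 s

theorem intw_indJ (hk : k ≤ n) : Intw k T (indT α β q n T) (indJ V K n k) := by
  intro i hi v
  refine ext_extFun fun p hp s => ?_
  rw [extFun_indT _ _ hp, extFun_indJ hk]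
  have hj : ∀ p s, extFun n (indJ V K n k v) p s = if p = k ∧ s = true then v else 0 :=
    fun p s => extFun_indJ hk v s
  rcases i with _ | i
  · simp only [indFun, hj]
    rcases p with _ | p
    · cases s <;> simp [hi.ne]
    · split_ifs <;> simp_all
  · simp only [indFun, hj]
    by_cases h1 : p = k
    · subst h1
      cases s <;> simp [hi.ne', show p ≠ i by omega, show ¬ p < i by omega]
    · simp [h1, show i ≠ k by omega, hi.ne]

theorem intw_indPi (hk : k ≤ n) : Intw k (indT α β q n T) T (indPi V K n k) := by
  intro i hi g
  simp only [indPi, LinearMap.coe_mk, AddHom.coe_mk]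
  rw [extFun_indT _ _ (by omega), indFun_of_gt _ hi]

theorem indT_indJ (hk : k + 1 ≤ n) (v : V) :
    indT α β q n T (k + 1) (indJ V K n (k + 1) v) = indJ V K n k v := by
  refine ext_extFun fun p hp s => ?_
  have hj : ∀ p s, extFun n (indJ V K n (k + 1) v) p s = if p = k + 1 ∧ s = true then v else 0 :=
    fun p s => extFun_indJ hk v s
  rw [extFun_indT _ _ hp, extFun_indJ (by omega)]
  simp only [indFun, hj]
  by_cases h1 : p = k + 1
  · subst h1
    cases s <;> simp
  · by_cases h2 : p = k
    · subst h2
      cases s <;> simp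
    · simp [h1, h2]

theorem indPi_indT (hk : k + 1 ≤ n) (g : Fin (n + 1) → Bool → V) :
    indPi V K n (k + 1) (indT α β q n T (k + 1) g) = q • indPi V K n k g := by
  simp only [indPi, LinearMap.coe_mk, AddHom.coe_mk]
  rw [extFun_indT _ _ (by omega), indFun_succ_true]

theorem indPi_indJ (hk : k ≤ n) (v : V) : indPi V K n k (indJ V K n k v) = v := by
  simp only [indPi, LinearMap.coe_mk, AddHom.coe_mk]
  rw [extFun_indJ hk]; simp

theorem indPi_indJ_of_ne (hk : k ≤ n) (h : l ≠ k) (v : V) :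
    indPi V K n l (indJ V K n k v) = 0 := by
  simp only [indPi, LinearMap.coe_mk, AddHom.coe_mk]
  rw [extFun_indJ hk]; simp [h]

theorem indPi_indT_indJ (hk : k ≤ n) (v : V) :
    indPi V K n k (indT α β q n T k (indJ V K n k v)) = 0 := by
  rcases k with _ | k
  · simp only [indPi, LinearMap.coe_mk, AddHom.coe_mk]
    rw [extFun_indT _ _ (by omega), indFun_zero_true, extFun_indJ (by omega)]
    simp
  · rw [indPi_indT hk, indPi_indJ_of_ne hk (by omega), smul_zero]

theorem indPi_jm_indJ (hk : k ≤ n) (v : V) :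
    indPi V K n k (jm q (indT α β q n T) k (indJ V K n k v)) = 0 := by
  induction k with
  | zero => exact indPi_indT_indJ hk v
  | succ k ih =>
    simp only [jm, LinearMap.smul_apply, mul_apply, map_smul]
    rw [indT_indJ hk, indPi_indT hk, ih (by omega), smul_zero, smul_zero]

end Induction

section Intertwine

variable {T : ℕ → End K V} {T' : ℕ → End K W} {f : V →ₗ[K] W}

theorem Intw.jm (hf : Intw n T T' f) (hk : k < n) (q : K) (x : V) :
    f (jm q T k x) = jm q T' k (f x) := by
  induction k generalizing x with
  | zero => exact hf 0 hk x
  | succ k ih =>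
    simp only [_root_.jm, LinearMap.smul_apply, mul_apply, map_smul]
    rw [hf _ hk, ih (by omega), hf _ hk]

theorem Intw.aeval_jm (hf : Intw n T T' f) (hk : k < n) (q : K) (g : K[X])
    (x : V) :
    f (Polynomial.aeval (_root_.jm q T k) g x) = Polynomial.aeval (_root_.jm q T' k) g (f x) := by
  induction g using induction_on' with
  | add p r hp hr => simp only [map_add, LinearMap.add_apply, hp, hr]
  | monomial m c =>
    rw [aeval_monomial, aeval_monomial, ← Algebra.smul_def,
      ← Algebra.smul_def]
    simp only [LinearMap.smul_apply, map_smul]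
    congr 1
    induction m generalizing x with
    | zero => simp
    | succ m ih => rw [pow_succ, pow_succ, mul_apply, mul_apply, ih, hf.jm hk]

end Intertwine

/-- The induced system. -/
abbrev HSys.ind {K : Type} [Field K] {α β q : K} {n : ℕ} (M : HSys K α β q n) :
    HSys K α β q (n + 1) := ⟨Fin (n + 1) → Bool → M.V, indT α β q n M.T, isHecke_indT M.hT⟩

theorem HSys.intw_indJ {K : Type} [Field K] {α β q : K} (M : HSys K α β q n) :
    Intw n M.T M.ind.T (indJ M.V K n n) := _root_.intw_indJ le_rfl

theorem HSys.intw_indPi {K : Type} [Field K] {α β q : K} (M : HSys K α β q n) :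
    Intw n M.ind.T M.T (indPi M.V K n n) := _root_.intw_indPi le_rfl

/-- Restriction to fewer generators. -/
abbrev HSys.res {K : Type} [Field K] {α β q : K} {n m : ℕ} (M : HSys K α β q n) (h : m ≤ n) :
    HSys K α β q m := ⟨M.V, M.T, M.hT.mono h⟩

/-- Finite representation type passes to fewer generators. -/
theorem FinRep.of_succ {K : Type} [Field K] {α β q : K} (h : FinRep K α β q (n + 1)) :
    FinRep K α β q n := by
  obtain ⟨S, _, X, hX⟩ := h
  refine ⟨S, inferInstance, fun s => (X s).res (Nat.le_succ n), fun N hN => ?_⟩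
  obtain ⟨J, _, Y, ι, p, hJ, hs⟩ := N.ind.exists_decomp
  choose s hs' using fun j => hX (Y j) (hJ j).1
  choose i r hi hr hri using hs'
  have key : ∑ j, (indPi N.V K n n ∘ₗ ι j ∘ₗ r j) ∘ₗ (i j ∘ₗ p j ∘ₗ indJ N.V K n n)
      = LinearMap.id := by
    have : ∀ j, (indPi N.V K n n ∘ₗ ι j ∘ₗ r j) ∘ₗ (i j ∘ₗ p j ∘ₗ indJ N.V K n n)
        = indPi N.V K n n ∘ₗ (ι j ∘ₗ p j) ∘ₗ indJ N.V K n n := fun j => by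
      calc _ = indPi N.V K n n ∘ₗ ι j ∘ₗ (r j ∘ₗ i j) ∘ₗ p j ∘ₗ indJ N.V K n n := rfl
        _ = _ := by rw [hri, LinearMap.id_comp]; rfl
    rw [sum_congr rfl fun j _ => this j]
    ext x
    have hx := congr_fun hs (indJ N.V K n n x)
    simp only [LinearMap.sum_apply, comp_apply, LinearMap.id_apply] at hx ⊢
    rw [← map_sum, hx]
    exact indPi_indJ le_rfl x
  obtain ⟨j, -, hj⟩ := HSys.exists_summand hN Finset.univ
    (fun j => (X (s j)).res (Nat.le_succ n))
    (fun j => (i j ∘ₗ p j ∘ₗ indJ N.V K n n : N.V →ₗ[K] (X (s j)).V))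
    (fun j => (indPi N.V K n n ∘ₗ ι j ∘ₗ r j : (X (s j)).V →ₗ[K] N.V))
    (fun j _ => (((hi j).comp (hJ j).2.2.1).mono (Nat.le_succ n)).comp N.intw_indJ)
    (fun j _ => N.intw_indPi.comp (((hJ j).2.1.comp (hr j)).mono (Nat.le_succ n)))
    (by rw [key]; exact isUnit_one)
  exact ⟨s j, hj⟩

section Universal

/-- The polynomial relation satisfied by the `k`-th Jucys--Murphy element over the previous
ones. -/
def uid (α β q : K) (T : ℕ → A) : ℕ → A → A
  | 0, x => (x - α • (1 : A)) * (x - β • (1 : A))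
  | k + 1, x => (x - q • jm q T k) * ((x - q⁻¹ • jm q T k) * uid α β q T k x)

variable {T : ℕ → A}

theorem uid_intertwine {φ a b : A} (h : φ * b = a * φ) (hφ : ∀ l < k, Commute φ (jm q T l)) :
    φ * uid α β q T k b = uid α β q T k a * φ := by
  induction k with
  | zero =>
    simp only [uid, mul_sub, sub_mul, smul_mul_assoc, mul_smul_comm, one_mul, mul_one]
    rw [← mul_assoc, h, mul_assoc, h, ← mul_assoc]
  | succ k ih =>
    have h1 : ∀ c : K, φ * (b - c • jm q T k) = (a - c • jm q T k) * φ := fun c => by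
      rw [mul_sub, sub_mul, h, mul_smul_comm, smul_mul_assoc, (hφ k (by omega)).eq]
    rw [uid, uid, ← mul_assoc, h1, mul_assoc, ← mul_assoc φ, h1, mul_assoc,
      ih fun l hl => hφ l (by omega)]
    simp only [mul_assoc]

theorem IsHecke.uid_eq_zero (hT : IsHecke α β q n T) (hq : q ≠ 0) (hk : k < n) :
    uid α β q T k (jm q T k) = 0 := by
  induction k with
  | zero =>
    simp only [uid, jm, mul_sub, sub_mul, smul_mul_assoc, mul_smul_comm, one_mul, mul_one,
      hT.quad_zero hk]
    module
  | succ k ih =>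
    have h := hT.hPair hq hk
    set a := jm q T k
    set b := jm q T (k + 1)
    have hφ : ∀ l < k, Commute (T (k + 1) * a - a * T (k + 1)) (jm q T l) := fun l hl => by
      have h1 := hT.commute_jm_of_gt (k := l) (j := k + 1) (by omega) hk
      have h2 : Commute a (jm q T l) := hT.jm_commute (by omega) (by omega)
      exact (h1.mul_left h2).sub_left (h2.mul_left h1)
    have h2 := uid_intertwine (α := α) (β := β) (by simpa using h.phi_pow_b 1) hφ
    rw [ih (by omega), zero_mul] at h2
    have h3 : (b - q • a) * (b - q⁻¹ • a) =
        -(q⁻¹ • ((T (k + 1) * a - a * T (k + 1)) * (T (k + 1) * a - a * T (k + 1)))) := by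
      rw [h.phi_sq]
      have : (q • a - b) * (q • b - a) = -(q • ((b - q • a) * (b - q⁻¹ • a))) := by
        simp only [mul_sub, sub_mul, smul_mul_assoc, mul_smul_comm, smul_sub, smul_smul,
          mul_inv_cancel₀ hq, h.comm]
        match_scalars <;> field_simp <;> ring
      rw [this, smul_neg, neg_neg, smul_smul, inv_mul_cancel₀ hq, one_smul]
    rw [uid, ← mul_assoc, h3, neg_mul, smul_mul_assoc, mul_assoc, h2, mul_zero, smul_zero, neg_zero]

/-- The possible values of the `k`-th entry of a weight. -/
def wtRoots (α β q : K) (c : ℕ → K) : ℕ → Multiset K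
  | 0 => {α, β}
  | k + 1 => (q * c k) ::ₘ (q⁻¹ * c k) ::ₘ wtRoots α β q c k

/-- The monic polynomial with given roots. -/
noncomputable def rootPoly (s : Multiset K) : K[X] :=
  (s.map fun r => X - C r).prod

theorem rootPoly_cons (r : K) (s : Multiset K) :
    rootPoly (r ::ₘ s) = (X - C r) * rootPoly s := by
  simp [rootPoly]

end Universal

section Weights

theorem aeval_X_sub_C_apply (f : End K V) (r : K) (x : V) :
    aeval f (X - C r) x = f x - r • x := by
  simp [Algebra.algebraMap_eq_smul_one]

theorem uid_apply {f : End K V} {x : V}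
    (hf : ∀ l < k, Commute f (jm q T l)) (hx : ∀ l < k, jm q T l x = c l • x) :
    uid α β q T k f x = aeval f (rootPoly (wtRoots α β q c k)) x := by
  induction k with
  | zero =>
    simp only [uid, wtRoots, Multiset.insert_eq_cons]
    rw [rootPoly_cons, map_mul, mul_apply, mul_apply]
    simp [rootPoly, Algebra.algebraMap_eq_smul_one]
  | succ k ih =>
    have hcomm : ∀ g : K[X], jm q T k (aeval f g x)
        = c k • aeval f g x := fun g => by
      have : Commute (aeval f g) (jm q T k) := by
        refine induction_on' g (fun p r hp hr => ?_) fun m r => ?_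
        · rw [map_add]; exact hp.add_left hr
        · rw [aeval_monomial, ← Algebra.smul_def]
          exact ((hf k (by omega)).pow_left m).smul_left r
      rw [← mul_apply, ← this.eq, mul_apply, hx k (by omega), map_smul]
    simp only [uid, mul_apply, wtRoots, rootPoly_cons]
    rw [ih (fun l hl => hf l (by omega)) fun l hl => hx l (by omega)]
    have h1 : (f - q⁻¹ • jm q T k) (aeval f (rootPoly (wtRoots α β q c k)) x)
        = aeval f ((X - C (q⁻¹ * c k)) *
            rootPoly (wtRoots α β q c k)) x := by
      rw [map_mul, mul_apply, aeval_X_sub_C_apply, LinearMap.sub_apply,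
        LinearMap.smul_apply, hcomm, smul_smul]
    rw [h1, map_mul _ (X - C (q * c k)), mul_apply,
      aeval_X_sub_C_apply, LinearMap.sub_apply, LinearMap.smul_apply, hcomm, smul_smul]

theorem IsHecke.aeval_rootPoly (hT : IsHecke α β q n T) (hq : q ≠ 0) (hk : k < n) {x : V}
    (hx : ∀ l < k, jm q T l x = c l • x) :
    aeval (jm q T k) (rootPoly (wtRoots α β q c k)) x = 0 := by
  rw [← uid_apply (fun l hl => hT.jm_commute hk (by omega)) hx, hT.uid_eq_zero hq hk]
  rfl

theorem exists_eigenvector_of_rootPoly {f : End K V} {s : Multiset K} {x : V} (hx : x ≠ 0)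
    (h : aeval f (rootPoly s) x = 0) :
    ∃ r ∈ s, ∃ g : K[X], aeval f g x ≠ 0 ∧
      f (aeval f g x) = r • aeval f g x := by
  induction s using Multiset.induction with
  | empty => simp [rootPoly, hx] at h
  | cons r s ih =>
    by_cases h0 : aeval f (rootPoly s) x = 0
    · obtain ⟨r', hr', g, hg⟩ := ih h0
      exact ⟨r', Multiset.mem_cons_of_mem hr', g, hg⟩
    · refine ⟨r, Multiset.mem_cons_self r s, rootPoly s, h0, ?_⟩
      rw [rootPoly_cons, map_mul, mul_apply, aeval_X_sub_C_apply] at h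
      exact sub_eq_zero.1 h

theorem wtRoots_congr {c d : ℕ → K} (h : ∀ l < k, c l = d l) :
    wtRoots α β q c k = wtRoots α β q d k := by
  induction k with
  | zero => rfl
  | succ k ih => rw [wtRoots, wtRoots, h k (by omega), ih fun l hl => h l (by omega)]

theorem Submodule.aeval_mem {W : Submodule K V} {f : End K V} (hW : ∀ x ∈ W, f x ∈ W)
    (g : K[X]) {x : V} (hx : x ∈ W) : aeval f g x ∈ W := by
  induction g using induction_on' with
  | add p r hp hr => rw [map_add]; exact W.add_mem hp hr
  | monomial m c =>
    rw [aeval_monomial, ← Algebra.smul_def]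
    refine W.smul_mem c ?_
    induction m with
    | zero => exact hx
    | succ m ih => rw [pow_succ', mul_apply]; exact hW _ ih

theorem Commute.aeval_left {f g : End K V} (h : Commute f g) (p : K[X]) :
    Commute (aeval f p) g := by
  induction p using induction_on' with
  | add p r hp hr => rw [map_add]; exact hp.add_left hr
  | monomial m c =>
    rw [aeval_monomial, ← Algebra.smul_def]
    exact (h.pow_left m).smul_left c

/-- A nonzero subspace stable under the Jucys--Murphy elements contains a simultaneous
eigenvector. -/
theorem IsHecke.exists_eigenvector (hT : IsHecke α β q n T) (hq : q ≠ 0) {W : Submodule K V}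
    (hW0 : W ≠ ⊥) (hW : ∀ l < n, ∀ x ∈ W, jm q T l x ∈ W) :
    ∃ (c : ℕ → K) (x : V), x ∈ W ∧ x ≠ 0 ∧ (∀ l < n, jm q T l x = c l • x) ∧
      ∀ l < n, c l ∈ wtRoots α β q c l := by
  suffices H : ∀ k ≤ n, ∃ (c : ℕ → K) (x : V), x ∈ W ∧ x ≠ 0 ∧ (∀ l < k, jm q T l x = c l • x) ∧
      ∀ l < k, c l ∈ wtRoots α β q c l from H n le_rfl
  intro k hk
  induction k with
  | zero =>
    obtain ⟨x, hx, h0⟩ := Submodule.exists_mem_ne_zero_of_ne_bot hW0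
    exact ⟨0, x, hx, h0, by simp, by simp⟩
  | succ k ih =>
    obtain ⟨c, x, hx, h0, he, hr⟩ := ih (by omega)
    obtain ⟨r, hrs, g, hg, hgr⟩ :=
      exists_eigenvector_of_rootPoly h0 (hT.aeval_rootPoly hq hk he)
    have hc : ∀ l < k, update c k r l = c l := fun l hl =>
      update_of_ne hl.ne _ _
    refine ⟨update c k r, aeval (jm q T k) g x,
      Submodule.aeval_mem (hW k hk) g hx, hg, fun l hl => ?_, fun l hl => ?_⟩
    · rcases lt_succ_iff_lt_or_eq.1 hl with hl | rfl
      · have := (hT.jm_commute (q := q) hk (show l < n by omega)).aeval_left g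
        rw [hc l hl, ← mul_apply, ← this.eq, mul_apply, he l hl, map_smul]
      · rw [update_self, hgr]
    · rcases lt_succ_iff_lt_or_eq.1 hl with hl | rfl
      · rw [hc l hl, wtRoots_congr fun i hi => hc i (by omega)]
        exact hr l hl
      · rw [update_self, wtRoots_congr fun i hi => hc i (by omega)]
        exact hrs

theorem wtRoots_ne_zero (hα : α ≠ 0) (hβ : β ≠ 0) (hq : q ≠ 0) (h : ∀ l < k, c l ≠ 0) :
    ∀ r ∈ wtRoots α β q c k, r ≠ 0 := by
  induction k with
  | zero => simp [wtRoots, hα, hβ]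
  | succ k ih =>
    have hk := h k (by omega)
    simp only [wtRoots, Multiset.mem_cons]
    rintro r (rfl | rfl | hr)
    · exact mul_ne_zero hq hk
    · exact mul_ne_zero (inv_ne_zero hq) hk
    · exact ih (fun l hl => h l (by omega)) r hr

theorem weight_ne_zero (hα : α ≠ 0) (hβ : β ≠ 0) (hq : q ≠ 0)
    (h : ∀ l < k, c l ∈ wtRoots α β q c l) : ∀ l < k, c l ≠ 0 := by
  intro l
  induction l using Nat.strong_induction_on with
  | _ l ih =>
    intro hl
    exact wtRoots_ne_zero hα hβ hq (fun i hi => ih i hi (by omega)) _ (h l hl)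

end Weights

/-- The polynomial with constant term `1` whose roots are the inverses of given scalars. -/
noncomputable def revPoly (s : Multiset K) : K[X] :=
  (s.map fun r => 1 - C r * X).prod

section RevPoly

open Polynomial

theorem revPoly_zero : revPoly (0 : Multiset K) = 1 := by simp [revPoly]

theorem revPoly_cons (r : K) (s : Multiset K) :
    revPoly (r ::ₘ s) = (1 - C r * X) * revPoly s := by simp [revPoly]

theorem one_sub_C_mul_X_ne_zero (r : K) : (1 - C r * X : K[X]) ≠ 0 := fun h => by
  simpa using congr_arg (eval 0) h

theorem revPoly_ne_zero (s : Multiset K) : revPoly s ≠ 0 := by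
  induction s using Multiset.induction with
  | empty => simp [revPoly]
  | cons r s ih => rw [revPoly_cons]; exact mul_ne_zero (one_sub_C_mul_X_ne_zero r) ih

theorem rootMultiplicity_revPoly [DecidableEq K] {c : K} (hc : c ≠ 0) (s : Multiset K) :
    rootMultiplicity c⁻¹ (revPoly s) = s.count c := by
  induction s using Multiset.induction with
  | empty => simpa [revPoly] using rootMultiplicity_C (1 : K) c⁻¹
  | cons r s ih =>
    rw [revPoly_cons, rootMultiplicity_mul
      (mul_ne_zero (one_sub_C_mul_X_ne_zero r) (revPoly_ne_zero s)), ih, Multiset.count_cons,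
      add_comm]
    congr 1
    split_ifs with h
    · subst h
      have : (1 - C c * X : K[X]) = C (-c) * (X - C c⁻¹) := by
        rw [mul_sub, ← C_mul]; simp [hc]; ring
      have hne : C (-c) * (X - C c⁻¹) ≠ 0 := this ▸ one_sub_C_mul_X_ne_zero c
      rw [this, rootMultiplicity_mul hne, rootMultiplicity_X_sub_C_self, rootMultiplicity_C]
    · apply rootMultiplicity_eq_zero
      simp only [IsRoot, eval_sub, eval_one, eval_mul, eval_C, eval_X]
      refine fun h' => h ?_
      field_simp at h'
      linear_combination h'

theorem reverse_X_sub_C (c : K) : (X - C c : K[X]).reverse = 1 - C c * X := by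
  rw [reverse, natDegree_X_sub_C]
  ext i
  rw [coeff_reflect]
  rcases i with _ | _ | i
  · rw [revAt_le (by omega)]; simp [coeff_C]
  · rw [revAt_le (by omega)]; simp [coeff_one]
  · rw [revAt_eq_self_of_lt (by omega)]
    simp [coeff_X, coeff_C, coeff_one]

theorem reverse_pow_of_domain (P : K[X]) (m : ℕ) : (P ^ m).reverse = P.reverse ^ m := by
  induction m with
  | zero => simpa using reverse_C (1 : K)
  | succ m ih => rw [pow_succ, reverse_mul_of_domain, ih, pow_succ]

theorem eval_reverse_ne_zero {c : K} (hc : c ≠ 0) {g : K[X]} (hg : g.eval c ≠ 0) :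
    g.reverse.eval c⁻¹ ≠ 0 := fun h => by
  have : Invertible c := invertibleOfNonzero hc
  have h2 := eval₂_reverse_mul_pow (RingHom.id K) c g
  rw [invOf_eq_inv, eval₂_id, eval₂_id, h, zero_mul] at h2
  exact hg h2.symm

theorem PowerSeries.one_sub_C_mul_X_mul_coeff_succ (r : K) (F : PowerSeries K) (m : ℕ) :
    PowerSeries.coeff (m + 1) ((1 - PowerSeries.C r * PowerSeries.X) * F)
      = PowerSeries.coeff (m + 1) F - r * PowerSeries.coeff m F := by
  rw [sub_mul, one_mul, map_sub, mul_assoc, PowerSeries.coeff_C_mul, mul_comm PowerSeries.X,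
    PowerSeries.coeff_succ_mul_X]

theorem PowerSeries.one_sub_C_mul_X_mul_coeff_zero (r : K) (F : PowerSeries K) :
    PowerSeries.coeff 0 ((1 - PowerSeries.C r * PowerSeries.X) * F) = PowerSeries.coeff 0 F := by
  rw [sub_mul, one_mul, map_sub, mul_assoc, PowerSeries.coeff_C_mul, mul_comm PowerSeries.X,
    PowerSeries.coeff_zero_mul_X, mul_zero, sub_zero]

theorem powerSeries_eq_of_recurrence {u w u' w' : K} {x x' : ℕ → K} (h0 : x 0 = x' 0)
    (h1 : x 1 - (u + w) * x 0 = x' 1 - (u' + w') * x' 0)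
    (h : ∀ m, x (m + 2) - (u + w) * x (m + 1) + u * w * x m
      = x' (m + 2) - (u' + w') * x' (m + 1) + u' * w' * x' m) :
    (1 - PowerSeries.C u * PowerSeries.X) * ((1 - PowerSeries.C w * PowerSeries.X) *
      PowerSeries.mk x) = (1 - PowerSeries.C u' * PowerSeries.X) *
      ((1 - PowerSeries.C w' * PowerSeries.X) * PowerSeries.mk x') := by
  ext m
  rcases m with _ | _ | m
  · simp only [PowerSeries.one_sub_C_mul_X_mul_coeff_zero, PowerSeries.coeff_mk, h0]
  · simp only [zero_add]
    rw [← zero_add 1]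
    simp only [PowerSeries.one_sub_C_mul_X_mul_coeff_succ,
      PowerSeries.one_sub_C_mul_X_mul_coeff_zero, PowerSeries.coeff_mk]
    linear_combination h1
  · simp only [PowerSeries.one_sub_C_mul_X_mul_coeff_succ, PowerSeries.coeff_mk]
    linear_combination h m

theorem coe_revPoly_cons (r : K) (s : Multiset K) : ((revPoly (r ::ₘ s) : K[X]) : PowerSeries K)
    = (1 - PowerSeries.C r * PowerSeries.X) * (revPoly s : PowerSeries K) := by
  rw [revPoly_cons]; simp

theorem exists_eq_coe_of_recurrence (D : K[X]) {x : ℕ → K}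
    (h : ∀ m, ∑ i ∈ range (D.natDegree + 1), D.coeff i * x (m + i) = 0) :
    ∃ G : K[X], (D.reverse : PowerSeries K) * PowerSeries.mk x = G := by
  refine ⟨PowerSeries.trunc D.natDegree ((D.reverse : PowerSeries K) * PowerSeries.mk x), ?_⟩
  ext j
  rw [Polynomial.coeff_coe, PowerSeries.coeff_trunc]
  split_ifs with hj
  · rfl
  · obtain ⟨m, rfl⟩ : ∃ m, j = D.natDegree + m := ⟨j - D.natDegree, by omega⟩
    rw [PowerSeries.coeff_mul, Finset.Nat.sum_antidiagonal_eq_sum_range_succ_mk, ← h m,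
      Finset.range_eq_Ico, ← Finset.sum_subset (s₁ := Ico 0 (D.natDegree + 1))]
    · rw [← Finset.range_eq_Ico, ← Finset.sum_range_reflect]
      refine sum_congr rfl fun i hi => ?_
      rw [mem_range] at hi
      simp only [Polynomial.coeff_coe, PowerSeries.coeff_mk, coeff_reverse]
      rw [revAt_le (by omega)]
      congr 2 <;> omega
    · exact fun i hi => by simp only [mem_Ico] at hi ⊢; omega
    · intro i hi hi'
      simp only [mem_Ico] at hi hi'
      simp only [Polynomial.coeff_coe]
      rw [coeff_reverse, revAt_eq_self_of_lt (by omega), coeff_eq_zero_of_natDegree_lt (by omega),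
        zero_mul]

end RevPoly

section Ord

open scoped PowerSeries

theorem indPi_recurrence (hT : IsHecke α β q n T) (hq : q ≠ 0) (hk : k + 1 ≤ n) {c : K}
    {v : V} (hv : jm q T k v = c • v)
    {e e' : ℕ → V}
    (he : ∀ m, e m = indPi V K n (k + 1)
      ((jm q (indT α β q n T) (k + 1) ^ m) (indJ V K n (k + 1) v)))
    (he' : ∀ m, e' m = indPi V K n k ((jm q (indT α β q n T) k ^ m) (indJ V K n k v)))
    (hc : ∀ m, jm q T k (e' m) = c • e' m) (m : ℕ) :
    e (m + 2) - ((q + q⁻¹) * c) • e (m + 1) + c ^ 2 • e m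
      = e' (m + 2) - (2 * c) • e' (m + 1) + c ^ 2 • e' m := by
  have hS := isHecke_indT hT
  have h := hS.hPair hq (show k + 1 < n + 1 by omega)
  set S := indT α β q n T
  set a := jm q S k
  set b := jm q S (k + 1)
  set j := indJ V K n (k + 1)
  set π := indPi V K n (k + 1)
  have haj : a (j v) = c • j v := by
    rw [← map_smul, ← hv]; exact ((intw_indJ hk).jm (lt_succ_self k) q v).symm
  have hπa : ∀ x, π (a x) = jm q T k (π x) := (intw_indPi hk).jm (lt_succ_self k) q
  have hTj : S (k + 1) (j v) = indJ V K n k v := indT_indJ hk v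
  have hπT : ∀ x, π (S (k + 1) x) = q • indPi V K n k x := indPi_indT hk
  have hab : ∀ m, (b ^ m) (a (j v)) = c • (b ^ m) (j v) := fun m => by rw [haj, map_smul]
  have key : (S (k + 1) * a - a * S (k + 1)) * a ^ m * (S (k + 1) * a - a * S (k + 1))
      = b ^ m * ((q • a - b) * (q • b - a)) := by
    rw [h.phi_pow_a, mul_assoc, h.phi_sq]
  have key2 := congr_arg π (congr_fun key (j v))
  have hba : b * a = a * b := h.comm.symm
  have hR : b ^ m * ((q • a - b) * (q • b - a))
      = (q ^ 2 + 1) • (b ^ (m + 1) * a) - q • (b ^ m * (a * a)) - q • b ^ (m + 2) := by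
    simp only [mul_sub, sub_mul, smul_mul_assoc, mul_smul_comm, pow_succ, mul_assoc, hba]
    module
  have hL : (S (k + 1) * a - a * S (k + 1)) * a ^ m * (S (k + 1) * a - a * S (k + 1))
      = S (k + 1) * a ^ (m + 1) * S (k + 1) * a - S (k + 1) * a ^ (m + 2) * S (k + 1)
        - a * (S (k + 1) * a ^ m * S (k + 1) * a) + a * (S (k + 1) * a ^ (m + 1) * S (k + 1)) := by
    have e1 : a * a ^ m = a ^ (m + 1) := (pow_succ' a m).symm
    have e2 : a ^ (m + 1) * a = a ^ (m + 2) := (pow_succ a (m + 1)).symm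
    have e3 : a ^ m * a = a ^ (m + 1) := (pow_succ a m).symm
    calc _ = S (k + 1) * (a * a ^ m) * S (k + 1) * a - S (k + 1) * (a * a ^ m * a) * S (k + 1)
        - a * (S (k + 1) * a ^ m * S (k + 1) * a) + a * (S (k + 1) * (a ^ m * a) * S (k + 1)) := by
          simp only [mul_sub, sub_mul, mul_assoc]; abel
      _ = _ := by rw [e1, e2, e3]
  rw [hL, hR] at key2
  simp only [LinearMap.sub_apply, LinearMap.add_apply, LinearMap.smul_apply, mul_apply,
    map_sub, map_add, map_smul, haj, hπa, hTj, hπT, ← he, ← he', hc] at key2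
  have : (q * q⁻¹ : K) = 1 := mul_inv_cancel₀ hq
  linear_combination (norm := skip) q⁻¹ • key2
  match_scalars <;> field_simp <;> ring

/-- The multiset of scalars `c l`, `l < k`, each taken twice. -/
def dblRoots (c : ℕ → K) : ℕ → Multiset K
  | 0 => 0
  | k + 1 => c k ::ₘ c k ::ₘ dblRoots c k

/-- The generating function of the traces of powers of the last Jucys--Murphy element. -/
theorem exists_indPi_genFun (hT : IsHecke α β q n T) (hq : q ≠ 0) {v : V}
    (hv0 : v ≠ 0) (hv : ∀ l < n, jm q T l v = c l • v) (k : ℕ) (hk : k ≤ n) :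
    ∃ ε : ℕ → K,
      (∀ m, indPi V K n k ((jm q (indT α β q n T) k ^ m) (indJ V K n k v)) = ε m • v) ∧
      ε 0 = 1 ∧ ε 1 = 0 ∧
      (revPoly (wtRoots α β q c k) : PowerSeries K) *
          (PowerSeries.mk fun m => ε m - if m = 0 then 1 else 0)
        = PowerSeries.C (-(α * β)) * PowerSeries.X ^ 2 * (revPoly (dblRoots c k) : K⟦X⟧) := by
  set S := indT α β q n T with hSdef
  have hS : IsHecke α β q (n + 1) S := isHecke_indT hT
  induction k with
  | zero =>
    have hpi1 : indPi V K n 0 ((jm q S 0) (indJ V K n 0 v)) = 0 :=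
      indPi_jm_indJ hk v
    have hsq : ∀ m, jm q S 0 ^ (m + 2) = (α + β) • jm q S 0 ^ (m + 1) - (α * β) • jm q S 0 ^ m := by
      intro m
      have : jm q S 0 * jm q S 0 = (α + β) • jm q S 0 - (α * β) • 1 := hS.quad_zero (by omega)
      rw [pow_add, pow_two, this, pow_succ, mul_sub, mul_smul_comm, mul_smul_comm, mul_one]
    have hrec : ∀ m, indPi V K n 0 ((jm q S 0 ^ (m + 2)) (indJ V K n 0 v))
        = (α + β) • indPi V K n 0 ((jm q S 0 ^ (m + 1)) (indJ V K n 0 v))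
          - (α * β) • indPi V K n 0 ((jm q S 0 ^ m) (indJ V K n 0 v)) := fun m => by
      rw [hsq]; simp
    have h0 : indPi V K n 0 ((jm q S 0 ^ 0) (indJ V K n 0 v)) = v := by simp [indPi_indJ hk]
    have h1 : indPi V K n 0 ((jm q S 0 ^ 1) (indJ V K n 0 v)) = 0 := by rw [pow_one, hpi1]
    have hex : ∀ m, ∃ s : K, indPi V K n 0 ((jm q S 0 ^ m) (indJ V K n 0 v)) = s • v := by
      intro m
      induction m using Nat.twoStepInduction with
      | zero => exact ⟨1, by rw [h0, one_smul]⟩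
      | one => exact ⟨0, by rw [h1, zero_smul]⟩
      | more m h2 h3 =>
        obtain ⟨s, hs⟩ := h2
        obtain ⟨t, ht⟩ := h3
        refine ⟨(α + β) * t - α * β * s, ?_⟩
        rw [hrec, hs, ht]
        module
    choose ε he using hex
    have hinj : ∀ {s t : K}, s • v = t • v → s = t := fun h => smul_left_injective K hv0 h
    have e0 : ε 0 = 1 := hinj (by rw [← he, h0, one_smul])
    have e1 : ε 1 = 0 := hinj (by rw [← he, h1, zero_smul])
    have hr : ∀ m, ε (m + 2) = (α + β) * ε (m + 1) - α * β * ε m := fun m => hinj (by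
      have := hrec m
      simp only [he] at this
      linear_combination (norm := module) this)
    refine ⟨ε, he, e0, e1, ?_⟩
    have : wtRoots α β q c 0 = α ::ₘ β ::ₘ 0 := rfl
    rw [this, dblRoots, coe_revPoly_cons, coe_revPoly_cons, revPoly_zero, Polynomial.coe_one,
      mul_one, mul_one, mul_assoc]
    ext m
    rcases m with _ | _ | m
    · simp only [PowerSeries.one_sub_C_mul_X_mul_coeff_zero, PowerSeries.coeff_mk,
        PowerSeries.coeff_C_mul]
      simp [e0]
    · simp only [PowerSeries.one_sub_C_mul_X_mul_coeff_zero, PowerSeries.coeff_mk,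
        PowerSeries.one_sub_C_mul_X_mul_coeff_succ, PowerSeries.coeff_C_mul]
      simp [e0, e1, PowerSeries.coeff_X_pow]
    · simp only [PowerSeries.coeff_mk,
        PowerSeries.one_sub_C_mul_X_mul_coeff_succ, PowerSeries.coeff_C_mul, PowerSeries.coeff_X_pow]
      rcases m with _ | m
      · simp [hr, e0, e1]
      · simp [hr]; ring
  | succ k ih =>
    obtain ⟨ε', he', h0', h1', hgf⟩ := ih (by omega)
    have hrec := indPi_recurrence hT hq hk (hv k (by omega))
      (e := fun m => indPi V K n (k + 1) ((jm q S (k + 1) ^ m) (indJ V K n (k + 1) v)))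
      (fun m => rfl) (e' := fun m => ε' m • v) (fun m => (he' m).symm)
      (fun m => by rw [map_smul, hv k (by omega), smul_comm])
    have h0 : indPi V K n (k + 1) ((jm q S (k + 1) ^ 0) (indJ V K n (k + 1) v)) = v := by
      simp [indPi_indJ hk]
    have h1 : indPi V K n (k + 1) ((jm q S (k + 1) ^ 1) (indJ V K n (k + 1) v)) = 0 := by
      rw [pow_one]; exact indPi_jm_indJ hk v
    have hex : ∀ m, ∃ s : K,
        indPi V K n (k + 1) ((jm q S (k + 1) ^ m) (indJ V K n (k + 1) v)) = s • v := by
      intro m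
      induction m using Nat.twoStepInduction with
      | zero => exact ⟨1, by rw [h0, one_smul]⟩
      | one => exact ⟨0, by rw [h1, zero_smul]⟩
      | more m h2 h3 =>
        obtain ⟨s, hs⟩ := h2
        obtain ⟨t, ht⟩ := h3
        have := hrec m
        rw [hs, ht] at this
        refine ⟨ε' (m + 2) - 2 * c k * ε' (m + 1) + c k ^ 2 * ε' m + (q + q⁻¹) * c k * t
          - c k ^ 2 * s, ?_⟩
        linear_combination (norm := module) this
    choose ε he using hex
    have hinj : ∀ {s t : K}, s • v = t • v → s = t := fun h => smul_left_injective K hv0 h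
    refine ⟨ε, he, hinj (by rw [← he, h0, one_smul]), hinj (by rw [← he, h1, zero_smul]), ?_⟩
    have e0 : ε 0 = 1 := hinj (by rw [← he, h0, one_smul])
    have e1 : ε 1 = 0 := hinj (by rw [← he, h1, zero_smul])
    have hr : ∀ m, ε (m + 2) - (q + q⁻¹) * c k * ε (m + 1) + c k ^ 2 * ε m
        = ε' (m + 2) - 2 * c k * ε' (m + 1) + c k ^ 2 * ε' m := fun m => hinj (by
      have := hrec m
      simp only [he] at this
      linear_combination (norm := module) this)
    have key := powerSeries_eq_of_recurrence (u := q * c k) (w := q⁻¹ * c k) (u' := c k)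
      (w' := c k) (x := fun m => ε m - if m = 0 then 1 else 0)
      (x' := fun m => ε' m - if m = 0 then 1 else 0) (by simp [e0, h0']) (by simp [e0, e1, h0', h1'])
      (by
        intro m
        rcases m with _ | m
        · have := hr 0
          simp only [e0, e1, h0', h1', zero_add] at this ⊢
          simp
          linear_combination this
        · have := hr (m + 1)
          simp only [Nat.add_eq_zero_iff, Nat.succ_ne_zero, and_false, if_false, sub_zero,
            one_ne_zero, OfNat.ofNat_ne_zero]
          linear_combination this + c k ^ 2 * ε (m + 1) * mul_inv_cancel₀ hq)
    rw [wtRoots, dblRoots, coe_revPoly_cons, coe_revPoly_cons, coe_revPoly_cons,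
      coe_revPoly_cons]
    linear_combination (revPoly (wtRoots α β q c k) : PowerSeries K) * key
      + (1 - PowerSeries.C (c k) * PowerSeries.X) ^ 2 * hgf

theorem count_wtRoots_le [DecidableEq K] (hT : IsHecke α β q n T) (hq : q ≠ 0) (hα : α ≠ 0)
    (hβ : β ≠ 0)
    {v : V} (hv0 : v ≠ 0) (hv : ∀ l < n, jm q T l v = c l • v) {k : ℕ} (hk : k ≤ n)
    {c₀ : K} (hc₀ : c₀ ≠ 0) {μ : ℕ} {g : K[X]} (hg : g.eval c₀ ≠ 0)
    (h : aeval (jm q (indT α β q n T) k) ((X - C c₀) ^ μ * g)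
      (indJ V K n k v) = 0) :
    (wtRoots α β q c k).count c₀ ≤ μ + (dblRoots c k).count c₀ := by
  obtain ⟨ε, he, -, -, hgf⟩ := exists_indPi_genFun hT hq hv0 hv k hk
  set D := (X - C c₀) ^ μ * g with hD
  have hrec : ∀ m, ∑ i ∈ range (D.natDegree + 1), D.coeff i * ε (m + i) = 0 := by
    intro m
    refine smul_left_injective K hv0 ?_
    simp only [zero_smul, sum_smul, mul_smul, ← he]
    have := congr_arg (fun x => indPi V K n k ((jm q (indT α β q n T) k ^ m) x)) h
    simp only [Polynomial.aeval_eq_sum_range, LinearMap.sum_apply, LinearMap.smul_apply, map_sum,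
      map_smul, map_zero, ← mul_apply, ← pow_add] at this
    exact this
  obtain ⟨G, hG⟩ := exists_eq_coe_of_recurrence D hrec
  have hsplit : (PowerSeries.mk fun m => ε m - if m = 0 then 1 else 0) = PowerSeries.mk ε - 1 := by
    ext m; simp [PowerSeries.coeff_one]
  have key : revPoly (wtRoots α β q c k) * (G - D.reverse)
      = C (-(α * β)) * X ^ 2 * revPoly (dblRoots c k) * D.reverse := by
    apply Polynomial.coe_injective K
    rw [hsplit] at hgf
    simp only [Polynomial.coe_mul, Polynomial.coe_sub, Polynomial.coe_C, Polynomial.coe_pow,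
      Polynomial.coe_X, ← hG]
    linear_combination (D.reverse : PowerSeries K) * hgf
  have hg0 : g ≠ 0 := fun h => hg (by simp [h])
  have hrev : D.reverse = revPoly (Multiset.replicate μ c₀) * g.reverse := by
    rw [hD, Polynomial.reverse_mul_of_domain, reverse_pow_of_domain, reverse_X_sub_C]
    simp [revPoly]
  have hgr : g.reverse ≠ 0 := by simpa using hg0
  have hconst : C (-(α * β)) * X ^ 2 ≠ (0 : K[X]) := by
    refine mul_ne_zero ?_ (pow_ne_zero _ Polynomial.X_ne_zero)
    simpa using ⟨hα, hβ⟩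
  rw [hrev] at key
  have hR := revPoly_ne_zero (dblRoots c k)
  have hM := revPoly_ne_zero (Multiset.replicate μ c₀)
  have hrhs := mul_ne_zero (mul_ne_zero hconst hR) (mul_ne_zero hM hgr)
  have hm := congr_arg (Polynomial.rootMultiplicity c₀⁻¹) key
  rw [rootMultiplicity_mul (by rw [key]; exact hrhs),
    rootMultiplicity_mul hrhs,
    rootMultiplicity_mul (mul_ne_zero hconst hR),
    rootMultiplicity_mul (mul_ne_zero hM hgr), rootMultiplicity_revPoly hc₀,
    rootMultiplicity_revPoly hc₀, rootMultiplicity_revPoly hc₀, Multiset.count_replicate_self,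
    Polynomial.rootMultiplicity_eq_zero (p := g.reverse) (eval_reverse_ne_zero hc₀ hg),
    Polynomial.rootMultiplicity_eq_zero (p := C (-(α * β)) * X ^ 2)
      (by simp [hα, hβ, hc₀])] at hm
  omega

end Ord

section GenWeight

variable {K : Type} [Field K] {α β q : K}

/-- Applying a polynomial in the last Jucys--Murphy element of the induced system. -/
noncomputable def HSys.indMap (M : HSys K α β q n) (g : K[X]) :
    M.V →ₗ[K] M.ind.V :=
  aeval (jm q M.ind.T n) g ∘ₗ indJ M.V K n n

theorem HSys.intw_indMap (M : HSys K α β q n) (g : K[X]) :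
    Intw n M.T M.ind.T (M.indMap g) := by
  refine Intw.comp (Intw.aeval (Intw.of_commute fun i hi => ?_) g) M.intw_indJ
  exact (M.ind.hT.commute_jm_of_lt hi (lt_succ_self n)).symm

theorem Intw.mem_maxGenEigenspace {K V W : Type*} [Field K] [AddCommGroup V] [Module K V] [AddCommGroup W]
    [Module K W] {f : V →ₗ[K] W} {a : End K V} {b : End K W}
    (h : ∀ x, f (a x) = b (f x)) {c : K} {x : V} (hx : x ∈ a.maxGenEigenspace c) :
    f x ∈ b.maxGenEigenspace c := by
  rw [End.mem_maxGenEigenspace] at hx ⊢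
  obtain ⟨d, hd⟩ := hx
  refine ⟨d, ?_⟩
  have : ∀ (d : ℕ) y, ((b - c • 1) ^ d) (f y) = f (((a - c • 1) ^ d) y) := fun d y => by
    induction d generalizing y with
    | zero => rfl
    | succ d ih =>
      rw [pow_succ, pow_succ, mul_apply, mul_apply, ← ih]
      simp [h]
  rw [this, hd, map_zero]

/-- Polynomials separating an eigenvalue of the last Jucys--Murphy element. -/
theorem HSys.exists_separating (hq : q ≠ 0) (hα : α ≠ 0) (hβ : β ≠ 0)
    (M : HSys K α β q k) {c : ℕ → K} (hc : c k ≠ 0) {u : M.V} (hu0 : u ≠ 0)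
    (hu : ∀ l < k, jm q M.T l u = c l • u) [DecidableEq K] :
    ∃ (g : K[X]) (s : ℕ), (∀ x, M.indMap ((X - C (c k)) ^ s * g) x = 0) ∧
      ∀ μ, (dblRoots c k).count (c k) + μ < (wtRoots α β q c k).count (c k) →
        M.indMap ((X - C (c k)) ^ μ * g) u ≠ 0 := by
  set L := jm q M.ind.T k
  have hP : L.charpoly ≠ 0 := L.charpoly_monic.ne_zero
  obtain ⟨g, hg, hndvd⟩ :=
    (Polynomial.finiteMultiplicity_X_sub_C (c k) hP).exists_eq_pow_mul_and_not_dvd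
  generalize multiplicity (X - C (c k)) L.charpoly = s at hg
  refine ⟨g, s, fun x => ?_, fun μ hμ h => ?_⟩
  · rw [HSys.indMap, ← hg]
    have := L.aeval_self_charpoly
    rw [comp_apply, this]; rfl
  · have := count_wtRoots_le M.hT hq hα hβ hu0 hu le_rfl hc (μ := μ) (g := g)
      (fun h0 => hndvd (Polynomial.dvd_iff_isRoot.2 h0)) h
    omega

theorem HSys.jm_indMap (M : HSys K α β q k) (g : K[X]) {r : K} (x : M.V) :
    jm q M.ind.T k (M.indMap g x) - r • M.indMap g x
      = M.indMap ((X - C r) * g) x := by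
  rw [HSys.indMap, HSys.indMap, comp_apply, comp_apply, map_mul,
    mul_apply, aeval_X_sub_C_apply]

/-- A generalized weight vector annihilated by an iterate, one step up. -/
theorem HSys.exists_top (hq : q ≠ 0) (hα : α ≠ 0) (hβ : β ≠ 0)
    (M : HSys K α β q k) {c : ℕ → K} (hc : c k ≠ 0) {u : M.V} (hu0 : u ≠ 0)
    (hu : ∀ l < k, jm q M.T l u = c l • u) [DecidableEq K] {r : ℕ}
    (hr : (dblRoots c k).count (c k) + r < (wtRoots α β q c k).count (c k)) :
    ∃ g : K[X], (∃ s, ∀ x, M.indMap ((X - C (c k)) ^ s * g) x = 0) ∧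
      M.indMap ((X - C (c k)) ^ r * g) u ≠ 0 ∧
      M.indMap ((X - C (c k)) ^ (r + 1) * g) u = 0 := by
  classical
  obtain ⟨g, s, hs, hμ⟩ := M.exists_separating hq hα hβ hc hu0 hu
  have hex : ∃ N, M.indMap ((X - C (c k)) ^ N * g) u = 0 := ⟨s, hs u⟩
  obtain ⟨N, hN0, hNm⟩ : ∃ N, M.indMap ((X - C (c k)) ^ N * g) u = 0 ∧
      ∀ m < N, M.indMap ((X - C (c k)) ^ m * g) u ≠ 0 :=
    ⟨Nat.find hex, Nat.find_spec hex, fun m => Nat.find_min hex⟩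
  obtain ⟨t, rfl⟩ : ∃ t, N = r + 1 + t := by
    refine ⟨N - (r + 1), ?_⟩
    by_contra hlt
    exact hμ N (by omega) hN0
  refine ⟨(X - C (c k)) ^ t * g, ⟨s, fun x => ?_⟩, ?_, ?_⟩
  · rw [mul_left_comm, HSys.indMap, map_mul, comp_apply, mul_apply]
    have := hs x
    rw [HSys.indMap, comp_apply] at this
    rw [this, map_zero]
  · rw [← mul_assoc, ← pow_add]
    exact hNm _ (by omega)
  · rw [← mul_assoc, ← pow_add]
    exact hN0

theorem HSys.mem_maxGenEigenspace_indMap (M : HSys K α β q k) {c : K} {g : K[X]}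
    {x : M.V} (h : M.indMap ((X - C c) ^ s * g) x = 0) :
    M.indMap g x ∈ (jm q M.ind.T k).maxGenEigenspace c := by
  rw [End.mem_maxGenEigenspace]
  refine ⟨s, ?_⟩
  rw [HSys.indMap, map_mul, comp_apply, mul_apply] at h
  rw [HSys.indMap, comp_apply]
  simpa [Algebra.algebraMap_eq_smul_one] using h

/-- Existence of a weight vector. -/
theorem HSys.exists_weight_vector (hq : q ≠ 0) (hα : α ≠ 0) (hβ : β ≠ 0) [DecidableEq K]
    {c : ℕ → K} (hc : ∀ k, c k ≠ 0) (k : ℕ)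
    (hr : ∀ l < k, (dblRoots c l).count (c l) < (wtRoots α β q c l).count (c l)) :
    ∃ (M : HSys K α β q k) (u : M.V), u ≠ 0 ∧ ∀ l < k, jm q M.T l u = c l • u := by
  induction k with
  | zero =>
    refine ⟨⟨K, 0, ⟨by omega, by omega, by omega, by omega, by omega⟩⟩, (1 : K), one_ne_zero,
      by omega⟩
  | succ k ih =>
    obtain ⟨M, u, hu0, hu⟩ := ih fun l hl => hr l (by omega)
    obtain ⟨g, -, h1, h2⟩ := M.exists_top hq hα hβ (hc k) hu0 hu (r := 0) (hr k (by omega))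
    simp only [pow_zero, one_mul, zero_add, pow_one] at h1 h2
    refine ⟨M.ind, M.indMap g u, h1, fun l hl => ?_⟩
    rcases lt_succ_iff_lt_or_eq.1 hl with hl | rfl
    · rw [← (M.intw_indMap g).jm hl, hu l hl, map_smul]
    · rw [← sub_eq_zero, M.jm_indMap, h2]

/-- Existence of a generalized weight vector on which one Jucys--Murphy element is not
semisimple. -/
theorem HSys.exists_jordan_vector (hq : q ≠ 0) (hα : α ≠ 0) (hβ : β ≠ 0) [DecidableEq K]
    {c : ℕ → K} (hc : ∀ k, c k ≠ 0) {a : ℕ} (k : ℕ) (hk : a < k)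
    (hr : ∀ l < k, (dblRoots c l).count (c l) < (wtRoots α β q c l).count (c l))
    (hra : (dblRoots c a).count (c a) + 1 < (wtRoots α β q c a).count (c a)) :
    ∃ (M : HSys K α β q k) (v u : M.V), u ≠ 0 ∧ (∀ l < k, jm q M.T l u = c l • u) ∧
      (∀ l < k, v ∈ (jm q M.T l).maxGenEigenspace (c l)) ∧ jm q M.T a v - c a • v = u := by
  induction k, hk using Nat.le_induction with
  | base =>
    obtain ⟨M, u, hu0, hu⟩ := HSys.exists_weight_vector hq hα hβ hc a fun l hl => hr l (by omega)
    obtain ⟨g, ⟨s, hs⟩, h1, h2⟩ := M.exists_top hq hα hβ (hc a) hu0 hu hra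
    refine ⟨M.ind, M.indMap g u, M.indMap ((X - C (c a)) ^ 1 * g) u, h1,
      fun l hl => ?_, fun l hl => ?_, ?_⟩
    · rcases lt_succ_iff_lt_or_eq.1 hl with hl | rfl
      · rw [← (M.intw_indMap _).jm hl, hu l hl, map_smul]
      · rw [← sub_eq_zero, M.jm_indMap, ← mul_assoc, ← pow_succ', h2]
    · rcases lt_succ_iff_lt_or_eq.1 hl with hl | rfl
      · rw [End.mem_maxGenEigenspace]
        refine ⟨1, ?_⟩
        rw [pow_one, LinearMap.sub_apply, ← (M.intw_indMap _).jm hl, hu l hl, map_smul]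
        simp
      · exact M.mem_maxGenEigenspace_indMap (hs u)
    · rw [M.jm_indMap, pow_one]
  | succ k hk ih =>
    obtain ⟨M, v, u, hu0, hu, hv, hvu⟩ := ih fun l hl => hr l (by omega)
    obtain ⟨g, ⟨s, hs⟩, h1, h2⟩ := M.exists_top hq hα hβ (hc k) hu0 hu (r := 0) (hr k (by omega))
    simp only [pow_zero, one_mul, zero_add, pow_one] at h1 h2
    refine ⟨M.ind, M.indMap g v, M.indMap g u, h1, fun l hl => ?_, fun l hl => ?_, ?_⟩
    · rcases lt_succ_iff_lt_or_eq.1 hl with hl | rfl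
      · rw [← (M.intw_indMap g).jm hl, hu l hl, map_smul]
      · rw [← sub_eq_zero, M.jm_indMap, h2]
    · rcases lt_succ_iff_lt_or_eq.1 hl with hl | rfl
      · exact Intw.mem_maxGenEigenspace ((M.intw_indMap g).jm hl q) (hv l hl)
      · exact M.mem_maxGenEigenspace_indMap (hs v)
    · rw [← (M.intw_indMap g).jm hk, ← map_smul, ← map_sub, hvu]

/-- Existence of a generalized weight vector on which two Jucys--Murphy elements are not
semisimple. -/
theorem HSys.exists_double_jordan_vector (hq : q ≠ 0) (hα : α ≠ 0) (hβ : β ≠ 0) [DecidableEq K]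
    {c : ℕ → K} (hc : ∀ k, c k ≠ 0) {a k : ℕ} (hk : a < k)
    (hr : ∀ l < k, (dblRoots c l).count (c l) < (wtRoots α β q c l).count (c l))
    (hra : (dblRoots c a).count (c a) + 1 < (wtRoots α β q c a).count (c a))
    (hrk : (dblRoots c k).count (c k) + 1 < (wtRoots α β q c k).count (c k)) :
    ∃ (M : HSys K α β q (k + 1)) (v u : M.V), jm q M.T k u - c k • u ≠ 0 ∧
      (∀ l < k, jm q M.T l u = c l • u) ∧
      (∀ l < k + 1, v ∈ (jm q M.T l).maxGenEigenspace (c l)) ∧ jm q M.T a v - c a • v = u := by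
  obtain ⟨M, v, u, hu0, hu, hv, hvu⟩ := HSys.exists_jordan_vector hq hα hβ hc k hk hr hra
  obtain ⟨g, s, hs, h1⟩ := M.exists_separating hq hα hβ (hc k) hu0 hu
  refine ⟨M.ind, M.indMap g v, M.indMap g u, ?_, fun l hl => ?_, fun l hl => ?_, ?_⟩
  · rw [M.jm_indMap]
    simpa using h1 1 hrk
  · rw [← (M.intw_indMap g).jm hl, hu l hl, map_smul]
  · rcases lt_succ_iff_lt_or_eq.1 hl with hl | rfl
    · exact Intw.mem_maxGenEigenspace ((M.intw_indMap g).jm hl q) (hv l hl)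
    · exact M.mem_maxGenEigenspace_indMap (hs v)
  · rw [← (M.intw_indMap g).jm hk, ← map_smul, ← map_sub, hvu]

end GenWeight

section SymOp

variable {α β q : K}

/-- The operator `∑ k, g (L k)` for the Jucys--Murphy elements `L k`. -/
noncomputable def symOp (q : K) (T : ℕ → A) (n : ℕ)
    (g : K[X]) : A :=
  ∑ k ∈ range n, aeval (jm q T k) g

theorem IsHecke.commute_symOp {T : ℕ → A}
    (hT : IsHecke α β q n T) (hq : q ≠ 0) (g : K[X]) (hi : i < n) :
    Commute (T i) (symOp q T n g) := by
  have haev : ∀ {x y : A}, Commute x y → Commute x (aeval y g) := fun {x y} h => by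
    induction g using induction_on' with
    | add p r hp hr => rw [map_add]; exact hp.add_right hr
    | monomial m c =>
      rw [aeval_monomial, ← Algebra.smul_def]
      exact (h.pow_right m).smul_right c
  rcases i with _ | i
  · exact Commute.sum_right _ _ _ fun k hk =>
      haev (hT.jm_commute hi (mem_range.1 hk))
  · have h1 : i ∈ range n := mem_range.2 (by omega)
    have h2 : i + 1 ∈ (range n).erase i := by simp; omega
    rw [symOp, ← add_sum_erase _ _ h1, ← add_sum_erase _ _ h2, ← add_assoc]
    refine Commute.add_right ((hT.hPair hq hi).commute_aeval_add g) ?_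
    refine Commute.sum_right _ _ _ fun k hk => haev ?_
    simp only [Finset.mem_erase, mem_range] at hk
    exact hT.commute_jm (by omega) (by omega) hi (by omega)

theorem Intw.map_symOp {T : ℕ → End K V} {T' : ℕ → End K W} {f : V →ₗ[K] W} (hf : Intw n T T' f)
    (q : K) (g : K[X]) (x : V) : f (symOp q T n g x) = symOp q T' n g (f x) := by
  simp only [symOp, LinearMap.sum_apply, map_sum]
  exact sum_congr rfl fun k hk => hf.aeval_jm (mem_range.1 hk) q g x

end SymOp

section Constructions

variable {K : Type} [Field K] {α β q : K}

open Classical in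
theorem HSys.exists_sub (X : HSys K α β q n) (W : Submodule K X.V)
    (hW : ∀ i < n, ∀ x ∈ W, X.T i x ∈ W) :
    ∃ (Y : HSys K α β q n) (ι : Y.V →ₗ[K] X.V), Function.Injective ι ∧ Intw n Y.T X.T ι ∧
      LinearMap.range ι = W := by
  set T' : ℕ → End K W := fun i =>
    if h : ∀ x ∈ W, X.T i x ∈ W then (X.T i).restrict h else 0 with hT'
  have h1 : Intw n T' X.T W.subtype := fun i hi x => by
    simp only [hT', dif_pos (hW i hi)]; rfl
  exact ⟨⟨W, T', X.hT.of_injective Subtype.val_injective h1⟩, W.subtype, Subtype.val_injective, h1,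
    W.range_subtype⟩

open Classical in
theorem HSys.exists_quot (X : HSys K α β q n) (W : Submodule K X.V)
    (hW : ∀ i < n, ∀ x ∈ W, X.T i x ∈ W) :
    ∃ (Y : HSys K α β q n) (π : X.V →ₗ[K] Y.V), Function.Surjective π ∧ Intw n X.T Y.T π ∧
      LinearMap.ker π = W := by
  set T' : ℕ → End K (X.V ⧸ W) := fun i =>
    if h : W ≤ W.comap (X.T i) then W.mapQ W (X.T i) h else 0 with hT'
  have h1 : Intw n X.T T' W.mkQ := fun i hi x => by
    simp only [hT', dif_pos (show W ≤ W.comap (X.T i) from hW i hi)]; rfl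
  exact ⟨⟨X.V ⧸ W, T', X.hT.of_surjective W.mkQ_surjective h1⟩, W.mkQ, W.mkQ_surjective, h1,
    W.ker_mkQ⟩

/-- The direct sum of `k` copies of a system. -/
abbrev HSys.pow (X : HSys K α β q n) (k : ℕ) : HSys K α β q n :=
  ⟨Fin k → X.V, fun i => (X.T i).compLeft (Fin k), {
    quad_zero := fun h => ext fun g => funext fun j => by
      simpa using congr_fun (X.hT.quad_zero h) (g j)
    quad := fun i h h' => ext fun g => funext fun j => by
      simpa using congr_fun (X.hT.quad i h h') (g j)
    braid_zero := fun h => ext fun g => funext fun j => by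
      simpa using congr_fun (X.hT.braid_zero h) (g j)
    braid := fun i h h' => ext fun g => funext fun j => by
      simpa using congr_fun (X.hT.braid i h h') (g j)
    comm := fun i j' h h' => ext fun g => funext fun j => by
      simpa using congr_fun (X.hT.comm i j' h h') (g j) }⟩

theorem HSys.intw_proj (X : HSys K α β q n) (j : Fin k) :
    Intw n (X.pow k).T X.T (LinearMap.proj j) := fun _ _ _ => rfl

end Constructions

section Criterion

variable {K : Type} [Field K] {α β q : K}

theorem FinRep.exists_finrank_le (h : FinRep K α β q n) :
    ∃ b, ∀ M : HSys K α β q n, Indec n M.T → Module.finrank K M.V ≤ b := by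
  obtain ⟨S, _, X, -, hX⟩ := h.exists_indec
  obtain ⟨b, hb⟩ := (Set.finite_range fun s => Module.finrank K (X s).V).bddAbove
  refine ⟨b, fun M hM => ?_⟩
  obtain ⟨s, i, p, -, -, h1, h2⟩ := hX M hM
  rw [(LinearEquiv.ofLinear i p h2 h1).finrank_eq]
  exact hb ⟨s, rfl⟩

/-- The shift operator on `k` copies of a space. -/
def shift (K : Type) [Field K] (V : Type) [AddCommGroup V] [Module K V] (k : ℕ) :
    End K (Fin k → V) where
  toFun g i := if h : (i : ℕ) + 1 < k then g ⟨i + 1, h⟩ else 0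
  map_add' g g' := by ext i; by_cases h : (i : ℕ) + 1 < k <;> simp [h]
  map_smul' r g := by ext i; by_cases h : (i : ℕ) + 1 < k <;> simp [h]

theorem shift_pow_apply {V : Type} [AddCommGroup V] [Module K V] (m : ℕ) (g : Fin k → V)
    (i : Fin k) : (shift K V k ^ m) g i = if h : (i : ℕ) + m < k then g ⟨i + m, h⟩ else 0 := by
  induction m generalizing i with
  | zero => simp
  | succ m ih =>
    rw [pow_succ', mul_apply]
    simp only [shift, LinearMap.coe_mk, AddHom.coe_mk]
    by_cases h : (i : ℕ) + 1 < k
    · rw [dif_pos h]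
      refine (ih _).trans ?_
      simp only [add_right_comm _ 1 m, add_assoc (i : ℕ) m 1]
    · rw [dif_neg h, dif_neg (by omega)]

theorem shift_comp {V W : Type} [AddCommGroup V] [Module K V] [AddCommGroup W] [Module K W] (f : V →ₗ[K] W) (g : Fin k → V) :
    shift K W k (f.compLeft (Fin k) g) = f.compLeft (Fin k) (shift K V k g) := by
  ext i
  simp only [shift, LinearMap.coe_mk, AddHom.coe_mk, LinearMap.compLeft_apply, Function.comp_apply]
  split_ifs <;> simp

/-- A power of the shift kills `Y` on a system of small indecomposable summands on which
`C ∘ Y = X`. -/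
theorem HSys.pow_apply_symOp_eq_zero (hb : ∀ M : HSys K α β q n, Indec n M.T → Module.finrank K M.V ≤ b) {gX gY : K[X]}
    (Q : HSys K α β q n) {C : End K Q.V} (hC : Intw n Q.T Q.T C) {N : ℕ} (hN : C ^ N = 0)
    (hXY : ∀ x, C (symOp q Q.T n gY x) = symOp q Q.T n gX x) (x : Q.V) :
    (C ^ b) (symOp q Q.T n gY x) = 0 := by
  obtain ⟨J, _, Z, ι, p, hJ, hs⟩ := Q.exists_decomp
  have hx : x = ∑ j, ι j (p j x) := by
    have := congr_fun hs x
    simpa using this.symm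
  rw [hx, map_sum, map_sum]
  refine sum_eq_zero fun j _ => ?_
  obtain ⟨hI, hι, hp, hpι⟩ := hJ j
  have hpι' : ∀ z, p j (ι j z) = z := congr_fun hpι
  set U : Submodule K Q.V := LinearMap.range (ι j ∘ₗ symOp q (Z j).T n gY)
  have hU : ∀ y ∈ U, C y ∈ U := by
    rintro _ ⟨z, rfl⟩
    refine ⟨p j (C (ι j z)), ?_⟩
    simp only [comp_apply]
    have : symOp q (Z j).T n gX z = symOp q (Z j).T n gY (p j (C (ι j z))) := by
      rw [← hp.map_symOp, ← hC.map_symOp, hXY, hp.map_symOp, hpι']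
    rw [← this, hι.map_symOp, hι.map_symOp, hXY]
  have hn : ∀ m (y : U), (((C.restrict hU) ^ m) y : Q.V) = (C ^ m) y := fun m y => by
    induction m generalizing y with
    | zero => rfl
    | succ m ih => rw [pow_succ, pow_succ, mul_apply, mul_apply, ih]; rfl
  have hmem : symOp q Q.T n gY (ι j (p j x)) ∈ U := ⟨p j x, by
    rw [comp_apply, hι.map_symOp]⟩
  have hker : (⟨_, hmem⟩ : U) ∈ LinearMap.ker ((C.restrict hU) ^ N) := by
    rw [mem_ker]
    apply Subtype.ext
    rw [hn, hN]; rfl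
  have h2 := End.ker_pow_le_ker_pow_finrank (C.restrict hU) N hker
  rw [mem_ker] at h2
  have h3 := congr_arg Subtype.val h2
  rw [hn] at h3
  have hdim : Module.finrank K U ≤ b := (LinearMap.finrank_range_le _).trans (hb _ hI)
  obtain ⟨t, rfl⟩ := Nat.exists_eq_add_of_le hdim
  rw [add_comm, pow_add, mul_apply]
  change (C ^ t) ((C ^ Module.finrank K U) (symOp q Q.T n gY (ι j (p j x)))) = 0
  rw [h3]; simp

theorem not_finRep_of_symOp_of_forall (hq : q ≠ 0) (M : HSys K α β q n)
    {gX gY gw : K[X]}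
    (hXX : ∀ v, symOp q M.T n gX (symOp q M.T n gX v) = 0)
    (hwX : ∀ v, symOp q M.T n gw (symOp q M.T n gX v) = 0)
    (hYY : ∀ v, symOp q M.T n gY (symOp q M.T n gY v) = symOp q M.T n gw (symOp q M.T n gY v))
    {v : M.V} (hne : symOp q M.T n gX (symOp q M.T n gY v) ≠ 0) : ¬ FinRep K α β q n := by
  intro hF
  obtain ⟨b, hb⟩ := hF.exists_finrank_le
  set P := M.pow (b + 1)
  set c : End K P.V := shift K M.V (b + 1)
  have hs : ∀ (g : K[X]) (x : P.V) (i : Fin (b + 1)),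
      symOp q P.T n g x i = symOp q M.T n g (x i) := fun g x i =>
    (M.intw_proj i).map_symOp q g x
  have hsI : ∀ g, Intw n P.T P.T (symOp q P.T n g) := fun g =>
    Intw.of_commute fun i hi => (P.hT.commute_symOp hq g hi).symm
  have hcI : Intw n P.T P.T c := fun i _ x => shift_comp (M.T i) x
  have hcs : ∀ g x, c (symOp q P.T n g x) = symOp q P.T n g (c x) := fun g x =>
    hcI.map_symOp q g x
  have hss : ∀ g g' x, symOp q P.T n g (symOp q P.T n g' x) = symOp q P.T n g' (symOp q P.T n g x) :=
    fun g g' x => (hsI g).map_symOp q g' x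
  have hXX' : ∀ x, symOp q P.T n gX (symOp q P.T n gX x) = 0 := fun x => funext fun i => by
    rw [hs, hs, hXX]; rfl
  have hwX' : ∀ x, symOp q P.T n gw (symOp q P.T n gX x) = 0 := fun x => funext fun i => by
    rw [hs, hs, hwX]; rfl
  have hYY' : ∀ x, symOp q P.T n gY (symOp q P.T n gY x)
      = symOp q P.T n gw (symOp q P.T n gY x) := fun x => funext fun i => by
    rw [hs, hs, hs, hs, hYY]
  set D : End K P.V := symOp q P.T n gX - c * symOp q P.T n gY
  have hDI : Intw n P.T P.T D := (hsI gX).sub (hcI.mul (hsI gY))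
  obtain ⟨Q, π, hπs, hπ, hker⟩ := P.exists_quot (LinearMap.range D) (by
    rintro i hi _ ⟨y, rfl⟩
    exact ⟨P.T i y, hDI i hi y⟩)
  have hD0 : ∀ x, π (D x) = 0 := fun x => by
    rw [← mem_ker, hker]; exact ⟨x, rfl⟩
  have hcD : ∀ x, c (D x) = D (c x) := fun x => by
    simp only [D, LinearMap.sub_apply, mul_apply, map_sub, hcs]
  set C : End K Q.V := ((LinearMap.ker π).liftQ (π ∘ₗ c) (by
    intro x hx
    rw [hker] at hx
    obtain ⟨y, rfl⟩ := hx
    rw [mem_ker, comp_apply, hcD, hD0])) ∘ₗ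
      (π.quotKerEquivOfSurjective hπs).symm.toLinearMap
  have hCπ : ∀ x, C (π x) = π (c x) := fun x => by
    have : (π.quotKerEquivOfSurjective hπs).symm (π x) = Submodule.Quotient.mk x := by
      rw [LinearEquiv.symm_apply_eq]; rfl
    simp only [C, comp_apply, LinearEquiv.coe_coe, this]
    rfl
  have hCm : ∀ m x, (C ^ m) (π x) = π ((c ^ m) x) := fun m x => by
    induction m generalizing x with
    | zero => rfl
    | succ m ih => rw [pow_succ, pow_succ, mul_apply, mul_apply, hCπ, ih]
  have hCI : Intw n Q.T Q.T C := fun i hi x => by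
    obtain ⟨x, rfl⟩ := hπs x
    rw [← hπ i hi, hCπ, hCπ, ← hπ i hi, hcI i hi]
  have hCN : C ^ (b + 1) = 0 := ext fun x => by
    obtain ⟨x, rfl⟩ := hπs x
    rw [hCm]
    have : (c ^ (b + 1)) x = 0 := funext fun i => by
      rw [shift_pow_apply, dif_neg (by omega)]; rfl
    rw [this, map_zero]; rfl
  have hCXY : ∀ x, C (symOp q Q.T n gY x) = symOp q Q.T n gX x := fun x => by
    obtain ⟨x, rfl⟩ := hπs x
    rw [← hπ.map_symOp, ← hπ.map_symOp, hCπ]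
    have := hD0 x
    simp only [D, LinearMap.sub_apply, mul_apply, map_sub] at this
    exact (sub_eq_zero.1 this).symm
  set x₀ : P.V := fun _ => v
  have h0 := Q.pow_apply_symOp_eq_zero hb hCI hCN hCXY (π x₀)
  rw [← hπ.map_symOp, hCm, ← mem_ker, hker] at h0
  obtain ⟨y, hy⟩ := h0
  have hcms : ∀ g x, (c ^ b) (symOp q P.T n g x) = symOp q P.T n g ((c ^ b) x) := fun g x =>
    (hcI.pow b).map_symOp q g x
  have hy1 : symOp q P.T n gY (D y) = symOp q P.T n gw (D y) := by
    rw [hy, ← hcms, ← hcms, hYY']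
  have hXYy : symOp q P.T n gX (symOp q P.T n gY y) = 0 := by
    simp only [D, LinearMap.sub_apply, mul_apply, map_sub, ← hcs, hYY', hwX'] at hy1
    rw [zero_sub, sub_eq_neg_self] at hy1
    rw [hss]; exact hy1
  have hy2 := congr_arg (fun z => symOp q P.T n gX z ⟨0, Nat.succ_pos b⟩) hy
  simp only [D, LinearMap.sub_apply, mul_apply, map_sub, ← hcs, hXX', hXYy, map_zero,
    sub_zero, ← hcms] at hy2
  apply hne
  rw [shift_pow_apply, dif_pos (by simp), hs, hs] at hy2
  exact hy2.symm

/-- A criterion for infinite representation type. -/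
theorem not_finRep_of_symOp (hq : q ≠ 0) (M : HSys K α β q n) {gX gY gw : K[X]} {v : M.V}
    (hXX : symOp q M.T n gX (symOp q M.T n gX v) = 0)
    (hwX : symOp q M.T n gw (symOp q M.T n gX v) = 0)
    (hYY : symOp q M.T n gY (symOp q M.T n gY v) = symOp q M.T n gw (symOp q M.T n gY v))
    (hne : symOp q M.T n gX (symOp q M.T n gY v) ≠ 0) : ¬ FinRep K α β q n := by
  have hsI : ∀ g, Intw n M.T M.T (symOp q M.T n g) := fun g =>
    Intw.of_commute fun i hi => (M.hT.commute_symOp hq g hi).symm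
  have hI : ∀ A : End K M.V, Intw n M.T M.T A → ∀ i < n, ∀ x ∈ LinearMap.ker A,
      M.T i x ∈ LinearMap.ker A := fun A hA i hi x hx => by
    rw [mem_ker] at hx ⊢
    rw [hA i hi, hx, map_zero]
  obtain ⟨N, ι, hinj, hι, hr⟩ := M.exists_sub
    (LinearMap.ker (symOp q M.T n gX * symOp q M.T n gX) ⊓
      (LinearMap.ker (symOp q M.T n gw * symOp q M.T n gX) ⊓
      LinearMap.ker (symOp q M.T n gY * symOp q M.T n gY - symOp q M.T n gw * symOp q M.T n gY)))
    (fun i hi x hx => ⟨hI _ ((hsI _).mul (hsI _)) i hi x hx.1,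
      hI _ ((hsI _).mul (hsI _)) i hi x hx.2.1,
      hI _ (((hsI _).mul (hsI _)).sub ((hsI _).mul (hsI _))) i hi x hx.2.2⟩)
  have hmem : ∀ x, ι x ∈ LinearMap.range ι := fun x => ⟨x, rfl⟩
  rw [hr] at hmem
  obtain ⟨w, hw⟩ : v ∈ LinearMap.range ι := by
    rw [hr]
    exact ⟨hXX, hwX, sub_eq_zero.2 hYY⟩
  refine not_finRep_of_symOp_of_forall hq N (gX := gX) (gY := gY) (gw := gw) (v := w)
    (fun x => hinj ?_) (fun x => hinj ?_) (fun x => hinj ?_) (fun h => hne ?_)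
  · rw [hι.map_symOp, hι.map_symOp, map_zero]; exact (hmem x).1
  · rw [hι.map_symOp, hι.map_symOp, map_zero]; exact (hmem x).2.1
  · rw [hι.map_symOp, hι.map_symOp, hι.map_symOp, hι.map_symOp]
    exact sub_eq_zero.1 (hmem x).2.2
  · rw [← hw, ← hι.map_symOp, ← hι.map_symOp, h, map_zero]

end Criterion

section GeneralizedWeights

variable {α β q : K}
  {T : ℕ → End K V} {c : ℕ → K}

theorem eq_zero_of_apply_eq_smul_apply {f g : End K V} (h : Commute f g) {a b t : K}
    (hab : a ≠ t * b) {w : V} (hf : w ∈ f.maxGenEigenspace a) (hg : w ∈ g.maxGenEigenspace b)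
    (hw : f w - t • g w = 0) : w = 0 := by
  have hg' := End.genEigenspace_le_smul g b (-t) ⊤ hg
  have h1 := End.genEigenspace_inf_le_add f (-t • g) a (-t * b) ⊤ ⊤ (h.smul_right _) ⟨hf, hg'⟩
  have h2 : w ∈ (f + -t • g).genEigenspace 0 ⊤ := by
    refine (End.genEigenspace _ _).monotone (le_top : (1 : ℕ∞) ≤ ⊤) ?_
    rw [End.genEigenspace_one, mem_ker]
    rw [← hw]
    simp [sub_eq_add_neg]
  have h3 : a + -t * b ≠ 0 := fun h => hab (by linear_combination h)
  rw [top_add] at h1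
  exact (Submodule.disjoint_def.1 (End.disjoint_genEigenspace _ h3 ⊤ ⊤)) w h1 h2

/-- The generalized weight space of a weight `c`. -/
def genWt (q : K) (T : ℕ → End K V) (n : ℕ) (c : ℕ → K) : Submodule K V :=
  ⨅ (l : ℕ) (_ : l < n), (jm q T l).maxGenEigenspace (c l)

theorem mem_genWt {v : V} : v ∈ genWt q T n c ↔ ∀ l < n, v ∈ (jm q T l).maxGenEigenspace (c l) := by
  simp [genWt]

theorem mem_genWt_of_commute {v : V} (hv : v ∈ genWt q T n c) {f : End K V}
    (hf : ∀ l < n, Commute f (jm q T l)) : f v ∈ genWt q T n c := by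
  rw [mem_genWt] at hv ⊢
  exact fun l hl => Intw.mem_maxGenEigenspace (LinearMap.congr_fun (hf l hl).eq) (hv l hl)

open Classical in
/-- The factor of the reduced relation coming from the `m`-th Jucys--Murphy element. -/
noncomputable def ridFactor (q : K) (T : ℕ → End K V) (c : ℕ → K) (ρ : K) (m : ℕ)
    (x : End K V) : End K V :=
  (if ρ = q * c m then x - q • jm q T m else 1) * (if ρ = q⁻¹ * c m then x - q⁻¹ • jm q T m else 1)

open Classical in
/-- The relation `uid` with the factors that are invertible on a generalized weight space
removed. -/
noncomputable def rid (α β q : K) (T : ℕ → End K V) (c : ℕ → K) (ρ : K) :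
    ℕ → End K V → End K V
  | 0, x => (if ρ = α then x - α • 1 else 1) * (if ρ = β then x - β • 1 else 1)
  | m + 1, x => rid α β q T c ρ m x * ridFactor q T c ρ m x

theorem rid_eq_of_forall {ρ : K} {m m' : ℕ} (h : m ≤ m')
    (hc : ∀ l, m ≤ l → l < m' → ρ ≠ q * c l ∧ ρ ≠ q⁻¹ * c l) (x : End K V) :
    rid α β q T c ρ m' x = rid α β q T c ρ m x := by
  induction m', h using Nat.le_induction with
  | base => rfl
  | succ m' h ih =>
    obtain ⟨h1, h2⟩ := hc m' h (lt_succ_self _)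
    rw [rid, ridFactor, if_neg h1, if_neg h2, mul_one, mul_one,
      ih fun l hl hl' => hc l hl (by omega)]

theorem commute_uid {f x : End K V} (hx : Commute f x) (hf : ∀ l < m, Commute f (jm q T l)) :
    Commute f (uid α β q T m x) := by
  have hone : ∀ r : K, Commute f (r • 1) := fun r => (Commute.one_right f).smul_right r
  induction m with
  | zero => exact (hx.sub_right (hone _)).mul_right (hx.sub_right (hone _))
  | succ m ih =>
    exact (hx.sub_right ((hf m (by omega)).smul_right _)).mul_right
      ((hx.sub_right ((hf m (by omega)).smul_right _)).mul_right (ih fun l hl => hf l (by omega)))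

theorem IsHecke.rid_apply_eq_zero (hT : IsHecke α β q n T) (hq : q ≠ 0) (hk : k < n) {v : V}
    (hv : v ∈ genWt q T n c) : rid α β q T c (c k) k (jm q T k) v = 0 := by
  set x := jm q T k with hx
  have hxc : ∀ l < n, Commute x (jm q T l) := fun l hl => hT.jm_commute hk hl
  have hLc : ∀ m < n, ∀ t : K, ∀ l < n, Commute (x - t • jm q T m) (jm q T l) := fun m hm t l hl =>
    (hxc l hl).sub_left ((hT.jm_commute hm hl).smul_left t)
  have hone : ∀ f : End K V, ∀ r : K, Commute f (r • 1) := fun f r =>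
    (Commute.one_right f).smul_right r
  have hgen1 : ∀ t : K, ∀ w ∈ genWt q T n c, (x - t • 1) w = 0 → c k ≠ t → w = 0 := by
    intro t w hw h hne
    refine eq_zero_of_apply_eq_smul_apply (f := x) (g := 1) (Commute.one_right _) (a := c k) (b := 1)
      (t := t) (by simpa using hne) (mem_genWt.1 hw k hk) ?_ h
    rw [End.mem_maxGenEigenspace]
    exact ⟨1, by simp⟩
  have hgen : ∀ m < n, ∀ t : K, ∀ w ∈ genWt q T n c, (x - t • jm q T m) w = 0 → c k ≠ t * c m → w = 0 :=
    fun m hm t w hw h hne => eq_zero_of_apply_eq_smul_apply (hxc m hm) hne (mem_genWt.1 hw k hk)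
      (mem_genWt.1 hw m hm) h
  have key : ∀ m ≤ k, ∀ w ∈ genWt q T n c, uid α β q T m x w = 0 → rid α β q T c (c k) m x w = 0 := by
    intro m
    induction m with
    | zero =>
      intro _ w hw h
      rw [uid, mul_apply] at h
      have hβ : (x - β • 1) w ∈ genWt q T n c := mem_genWt_of_commute hw fun l hl =>
        (hxc l hl).sub_left (hone _ _).symm
      rw [rid, mul_apply]
      split_ifs with h1 h2 h2
      · exact h
      · refine hgen1 β ((x - α • 1) w) (mem_genWt_of_commute hw fun l hl =>
          (hxc l hl).sub_left (hone _ _).symm) ?_ h2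
        rw [← h, ← mul_apply, ← mul_apply]
        congr 1
        simp only [mul_sub, sub_mul, smul_mul_assoc, mul_smul_comm, one_mul, mul_one]
        module
      · exact hgen1 α _ hβ h h1
      · exact hgen1 β _ hw (hgen1 α _ hβ h h1) h2
    | succ m ih =>
      intro hm w hw h
      rw [uid, mul_apply, mul_apply] at h
      have hu : uid α β q T m x w ∈ genWt q T n c := mem_genWt_of_commute hw fun l hl =>
        (commute_uid (hxc l hl).symm fun l' hl' => hT.jm_commute hl (by omega)).symm
      have hst : ∀ t : K, ∀ w ∈ genWt q T n c, (x - t • jm q T m) w ∈ genWt q T n c := fun t w hw =>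
        mem_genWt_of_commute hw (hLc m (by omega) t)
      have hcomm : ∀ s t : K, Commute (x - s • jm q T m) (x - t • jm q T m) := fun s t =>
        ((Commute.refl x).sub_right ((hxc m (by omega)).smul_right t)).sub_left
          (((hxc m (by omega)).symm.smul_left s).sub_right
            (((Commute.refl _).smul_right t).smul_left s))
      have hF : ridFactor q T c (c k) m x (uid α β q T m x w) = 0 := by
        rw [ridFactor, mul_apply]
        split_ifs with h1 h2 h2
        · exact h
        · refine hgen m (by omega) q⁻¹ _ (hst q _ hu) ?_ h2
          rw [← mul_apply, ← (hcomm q q⁻¹).eq]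
          exact h
        · exact hgen m (by omega) q _ (hst _ _ hu) h h1
        · exact hgen m (by omega) q⁻¹ _ hu (hgen m (by omega) q _ (hst _ _ hu) h h1) h2
      have hFc : ∀ y : End K V, Commute y x → Commute y (jm q T m) →
          Commute y (ridFactor q T c (c k) m x) := by
        intro y h1 h2
        rw [ridFactor]
        refine Commute.mul_right ?_ ?_ <;> split_ifs
        exacts [h1.sub_right (h2.smul_right _), Commute.one_right _,
          h1.sub_right (h2.smul_right _), Commute.one_right _]
      rw [rid, mul_apply]
      refine ih (by omega) _ (mem_genWt_of_commute hw fun l hl =>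
        (hFc _ (hxc l hl).symm (hT.jm_commute hl (by omega))).symm) ?_
      rw [← mul_apply, ← (commute_uid (hFc x (Commute.refl x) (hxc m (by omega))).symm
        fun l hl => (hFc _ (hxc l (by omega)).symm (hT.jm_commute (by omega) (by omega))).symm).eq,
        mul_apply, hF]
  refine key k le_rfl v hv ?_
  rw [hT.uid_eq_zero hq hk, LinearMap.zero_apply]

open Classical in
theorem exists_pick [FiniteDimensional K V] (q : K) (T : ℕ → End K V) (n : ℕ) (c : ℕ → K)
    (ρ : K) : ∃ g : K[X], ∀ v ∈ genWt q T n c,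
      symOp q T n g v = ∑ k ∈ range n, if c k = ρ then jm q T k v - ρ • v else 0 := by
  set d := Module.finrank K V
  set P : K[X] := ∏ σ ∈ ((range n).image c).erase ρ,
    (X - C σ) ^ d with hP
  obtain ⟨a, b, hab⟩ : IsCoprime P ((X - C ρ) ^ d) :=
    IsCoprime.prod_left fun σ hσ =>
      (Polynomial.isCoprime_X_sub_C_of_isUnit_sub
        (sub_ne_zero.2 (Finset.ne_of_mem_erase hσ)).isUnit).pow
  refine ⟨(X - C ρ) * (a * P), fun v hv => ?_⟩
  rw [symOp, LinearMap.sum_apply]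
  refine sum_congr rfl fun k hk => ?_
  have hkn := mem_range.1 hk
  have h1 : aeval (jm q T k) ((X - C (c k)) ^ d) v = 0 := by
    have := mem_genWt.1 hv k hkn
    rw [End.maxGenEigenspace_eq_genEigenspace_finrank, End.mem_genEigenspace_nat,
      mem_ker] at this
    simpa [Algebra.algebraMap_eq_smul_one] using this
  split_ifs with h
  · have h2 : (X - C ρ) * (a * P) = (X - C ρ) -
        ((X - C ρ) * b) * (X - C ρ) ^ d := by
      linear_combination (X - C ρ) * hab
    rw [h] at h1
    rw [h2, map_sub, map_mul, LinearMap.sub_apply, mul_apply, h1, map_zero, sub_zero,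
      aeval_X_sub_C_apply]
  · have h2 : (X - C (c k)) ^ d ∣ P :=
      Finset.dvd_prod_of_mem (fun σ => (X - C σ) ^ d)
        (Finset.mem_erase.2 ⟨h, Finset.mem_image_of_mem c hk⟩)
    obtain ⟨r, hr⟩ := h2
    rw [hr, mul_comm _ r, ← mul_assoc, ← mul_assoc, map_mul, mul_apply, h1, map_zero]

end GeneralizedWeights

section InfiniteType

variable {K : Type} [Field K] {α β q : K}

theorem symOp_add {A : Type*} [Ring A] [Algebra K A] (T : ℕ → A) (g h : K[X]) :
    symOp q T n (g + h) = symOp q T n g + symOp q T n h := by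
  simp [symOp, Finset.sum_add_distrib]

theorem symOp_smul {A : Type*} [Ring A] [Algebra K A] (T : ℕ → A) (r : K) (g : K[X]) :
    symOp q T n (r • g) = r • symOp q T n g := by
  simp [symOp, Finset.smul_sum]

/-- Infinite representation type from a generalized weight vector. -/
theorem not_finRep_of_genWt (hq : q ≠ 0) (M : HSys K α β q n) {c : ℕ → K} {v u : M.V}
    (ha : a < n) (hk : k < n) (hi : i < n) (hj : j < n) {gX gY gw : K[X]}
    {s t t' : K}
    (hv : v ∈ genWt q M.T n c) (hu : jm q M.T a v - c a • v = u)
    (hua : jm q M.T a u = c a • u) (hui : jm q M.T i u = c i • u) (huj : jm q M.T j u = c j • u)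
    (huk : jm q M.T k u - c k • u ≠ 0) (hs : s ≠ 0)
    (hX : ∀ x ∈ genWt q M.T n c, symOp q M.T n gX x = s • (jm q M.T a x - c a • x))
    (hY : ∀ x ∈ genWt q M.T n c, symOp q M.T n gY x = jm q M.T k x - c k • x)
    (hw : ∀ x ∈ genWt q M.T n c, symOp q M.T n gw x =
      t • (jm q M.T i x - c i • x) + t' • (jm q M.T j x - c j • x))
    (hti : c k = t * c i) (htj : c k = t' * c j)
    (hrel : (jm q M.T k - t' • jm q M.T j) ((jm q M.T k - t • jm q M.T i) v) = 0)
    (hiv : jm q M.T i v = c i • v ∨ jm q M.T i v - c i • v = u) : ¬ FinRep K α β q n := by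
  have hst : ∀ l < n, ∀ x ∈ genWt q M.T n c, jm q M.T l x ∈ genWt q M.T n c := fun l hl x hx =>
    mem_genWt_of_commute hx fun l' hl' => M.hT.jm_commute hl hl'
  have hst' : ∀ l < n, ∀ x ∈ genWt q M.T n c, jm q M.T l x - c l • x ∈ genWt q M.T n c :=
    fun l hl x hx => Submodule.sub_mem _ (hst l hl x hx) (Submodule.smul_mem _ _ hx)
  have hug : u ∈ genWt q M.T n c := hu ▸ hst' a ha v hv
  have hcm : ∀ l < n, ∀ l' < n, ∀ x, jm q M.T l (jm q M.T l' x) = jm q M.T l' (jm q M.T l x) :=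
    fun l hl l' hl' x => congr_fun (M.hT.jm_commute hl hl').eq x
  have hXv : symOp q M.T n gX v = s • u := by rw [hX v hv, hu]
  refine not_finRep_of_symOp hq M (gX := gX) (gY := gY) (gw := gw) (v := v) ?_ ?_ ?_ ?_
  · rw [hXv, map_smul, hX u hug, hua, sub_self, smul_zero, smul_zero]
  · rw [hXv, map_smul, hw u hug, hui, huj]
    simp
  · have hz : jm q M.T j (jm q M.T i v - c i • v) = c j • (jm q M.T i v - c i • v) := by
      rcases hiv with h | h
      · rw [h]; simp
      · rw [h, huj]
    rw [hY v hv, hY _ (hst' k hk v hv), hw _ (hst' k hk v hv)]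
    simp only [LinearMap.sub_apply, LinearMap.smul_apply, map_sub, map_smul] at hrel hz ⊢
    simp only [hcm j hj k hk, hcm i hi k hk] at hrel hz ⊢
    linear_combination (norm := module) hrel - (t * t') • hz -
      htj • (jm q M.T k v - t • jm q M.T i v) -
      hti • (jm q M.T k v - c k • v - t' • (jm q M.T j v - c j • v))
  · rw [hY v hv, hX _ (hst' k hk v hv)]
    have : jm q M.T a (jm q M.T k v - c k • v) - c a • (jm q M.T k v - c k • v) =
        jm q M.T k u - c k • u := by
      rw [← hu]
      simp only [map_sub, map_smul, hcm a ha k hk]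
      module
    rw [this]
    exact smul_ne_zero hs huk

end InfiniteType

section Counting

variable {α β q : K}

theorem zpow_eq_zpow_iff_of_lt (hq : q ≠ 0) {E : ℕ} (hE : ∀ j : ℕ, 0 < j → j < E → q ^ j ≠ 1)
    {a b : ℤ}
    (h1 : a - b < E) (h2 : b - a < E) : q ^ a = q ^ b ↔ a = b := by
  refine ⟨fun h => ?_, fun h => h ▸ rfl⟩
  have h3 : q ^ (a - b) = 1 := by rw [zpow_sub₀ hq, h, div_self (zpow_ne_zero _ hq)]
  have h4 : q ^ (b - a) = 1 := by rw [zpow_sub₀ hq, h, div_self (zpow_ne_zero _ hq)]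
  rcases lt_trichotomy a b with hab | hab | hab
  · obtain ⟨j, hj⟩ := Int.eq_ofNat_of_zero_le (sub_nonneg.2 hab.le)
    rw [hj, zpow_natCast] at h4
    exact absurd h4 (hE j (by omega) (by omega))
  · exact hab
  · obtain ⟨j, hj⟩ := Int.eq_ofNat_of_zero_le (sub_nonneg.2 hab.le)
    rw [hj, zpow_natCast] at h3
    exact absurd h3 (hE j (by omega) (by omega))

theorem count_wtRoots [DecidableEq K] (c : ℕ → K) (k : ℕ) (x : K) :
    (wtRoots α β q c k).count x = (if x = α then 1 else 0) + (if x = β then 1 else 0) +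
      (#{l ∈ range k | x = q * c l} +
        #{l ∈ range k | x = q⁻¹ * c l}) := by
  induction k with
  | zero => simp [wtRoots, Multiset.count_cons, Multiset.count_singleton, add_comm]
  | succ k ih =>
    simp only [wtRoots, Multiset.count_cons, ih, Finset.range_add_one, Finset.filter_insert]
    split_ifs <;> simp <;> omega

theorem count_dblRoots [DecidableEq K] (c : ℕ → K) (k : ℕ) (x : K) :
    (dblRoots c k).count x = 2 * #{l ∈ range k | x = c l} := by
  induction k with
  | zero => simp [dblRoots]
  | succ k ih =>
    simp only [dblRoots, Multiset.count_cons, ih, Finset.range_add_one, Finset.filter_insert]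
    split_ifs <;> simp <;> omega

theorem one_le_card_filter {p : ℕ → Prop} [DecidablePred p] (l : ℕ) (h : l < k) (h' : p l) :
    1 ≤ ((range k).filter p).card :=
  Finset.card_pos.2 ⟨l, by simp [h, h']⟩

theorem two_le_card_filter {p : ℕ → Prop} [DecidablePred p] (l m : ℕ) (h : l < k) (h' : p l)
    (hm : m < k) (hm' : p m) (hlm : l ≠ m) : 2 ≤ ((range k).filter p).card :=
  Finset.one_lt_card.2 ⟨l, by simp [h, h'], m, by simp [hm, hm'], hlm⟩

theorem card_filter_eq_zero {p : ℕ → Prop} [DecidablePred p] (h : ∀ l < k, ¬ p l) :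
    ((range k).filter p).card = 0 := by
  rw [Finset.card_eq_zero, Finset.filter_eq_empty_iff]
  exact fun l hl => h l (mem_range.1 hl)

theorem card_filter_le_one {p : ℕ → Prop} [DecidablePred p] (m : ℕ)
    (h : ∀ l < k, p l → l = m) : ((range k).filter p).card ≤ 1 := by
  rw [card_le_one]
  intro a ha b hb
  simp only [mem_filter, mem_range] at ha hb
  rw [h a ha.1 ha.2, h b hb.1 hb.2]

theorem mul_zpow_eq (hq : q ≠ 0) (z : ℤ) : q * q ^ z = q ^ (z + 1) := by
  rw [zpow_add_one₀ hq, mul_comm]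

theorem inv_mul_zpow_eq (hq : q ≠ 0) (z : ℤ) : q⁻¹ * q ^ z = q ^ (z - 1) := by
  rw [zpow_sub_one₀ hq, mul_comm]

end Counting

section InfiniteTypeCases

variable {K : Type} [Field K] {q : K}

theorem not_finRep_of_pow_eq_one (hq : q ≠ 0) {e : ℕ} (he : 3 ≤ e)
    (hE : ∀ j : ℕ, 0 < j → j < e → q ^ j ≠ 1) (hqe : q ^ e = 1) {f : ℕ} (hf : 2 * f ≤ e) :
    ¬ FinRep K 1 (q ^ f) q e := by
  classical
  obtain ⟨m, rfl⟩ : ∃ m, e = m + 2 := ⟨e - 2, by omega⟩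
  set c : ℕ → K := fun l => q ^ (l : ℤ) with hc
  have hinj : ∀ {a b : ℤ}, a - b < (m + 2 : ℕ) → b - a < (m + 2 : ℕ) → (q ^ a = q ^ b ↔ a = b) :=
    fun h1 h2 => zpow_eq_zpow_iff_of_lt hq hE h1 h2
  have hper : ∀ a b : ℤ, a = b + (m + 2 : ℕ) → q ^ a = q ^ b := fun a b h => by
    rw [h, zpow_add₀ hq, zpow_natCast, hqe, mul_one]
  have hdbl : ∀ l < m + 2, (dblRoots c l).count (c l) = 0 := fun l hl => by
    rw [count_dblRoots, card_filter_eq_zero, mul_zero]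
    intro l' hl' h
    have := (hinj (by omega) (by omega)).1 h
    omega
  have hα : (1 : K) = q ^ (0 : ℤ) := (zpow_zero q).symm
  have hβ : q ^ f = q ^ (f : ℤ) := (zpow_natCast q f).symm
  have hstep : ∀ l, c (l + 1) = q * c l := fun l => by
    simp only [hc, mul_zpow_eq hq]; push_cast; rfl
  have hlast : c (m + 1) = q⁻¹ * c 0 := by
    simp only [hc, inv_mul_zpow_eq hq]; exact hper _ _ (by push_cast; ring)
  obtain ⟨M, v, u, huk, hul, hv, hvu⟩ := HSys.exists_double_jordan_vector (K := K) (α := 1)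
    (β := q ^ f) (q := q) hq one_ne_zero (pow_ne_zero _ hq) (c := c) (fun k => zpow_ne_zero _ hq)
    (a := f) (k := m + 1) (by omega)
    (fun l hl => by
      rw [hdbl l (by omega), count_wtRoots]
      rcases l with _ | l
      · have : c 0 = 1 := by simp [hc]
        rw [if_pos this]; omega
      · have := one_le_card_filter (k := l + 1) (p := fun l' => c (l + 1) = q * c l') l
          (lt_succ_self l) (hstep l)
        omega)
    (by
      rw [hdbl f (by omega), count_wtRoots, if_pos (show c f = q ^ f by simp [hc])]
      rcases f with _ | f
      · rw [if_pos (by simp [hc])]; omega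
      · have := one_le_card_filter (k := f + 1) (p := fun l' => c (f + 1) = q * c l') f
          (lt_succ_self f) (hstep f)
        omega)
    (by
      rw [hdbl (m + 1) (by omega), count_wtRoots]
      have h1 := one_le_card_filter (k := m + 1) (p := fun l' => c (m + 1) = q * c l') m
        (lt_succ_self m) (hstep m)
      have h2 := one_le_card_filter (k := m + 1) (p := fun l' => c (m + 1) = q⁻¹ * c l') 0
        (Nat.succ_pos m) hlast
      omega)
  have hvg : v ∈ genWt q M.T (m + 2) c := mem_genWt.2 hv
  obtain ⟨gX, hX⟩ := exists_pick q M.T (m + 2) c (c f)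
  obtain ⟨gY, hY⟩ := exists_pick q M.T (m + 2) c (c (m + 1))
  obtain ⟨g0, h0⟩ := exists_pick q M.T (m + 2) c (c 0)
  obtain ⟨gm, hm⟩ := exists_pick q M.T (m + 2) c (c m)
  have hsum : ∀ k < m + 2, ∀ x : M.V, (∑ l ∈ range (m + 2),
      if c l = c k then jm q M.T l x - c k • x else 0) = jm q M.T k x - c k • x := fun k hk x => by
    rw [Finset.sum_eq_single_of_mem k (mem_range.2 hk), if_pos rfl]
    intro l hl hlk
    rw [if_neg]
    intro h
    have := (hinj (by rw [mem_range] at hl; omega) (by rw [mem_range] at hl; omega)).1 h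
    omega
  refine not_finRep_of_genWt hq M (c := c) (v := v) (u := u) (a := f) (k := m + 1) (i := 0) (j := m)
    (gX := gX) (gY := gY) (gw := q⁻¹ • g0 + q • gm) (s := 1) (t := q⁻¹) (t' := q)
    (by omega) (by omega) (by omega) (by omega) hvg hvu (hul f (by omega)) (hul 0 (by omega))
    (hul m (by omega)) huk one_ne_zero (fun x hx => ?_) (fun x hx => ?_) (fun x hx => ?_) hlast
    (hstep m) ?_ ?_
  · rw [hX x hx, hsum f (by omega), one_smul]
  · rw [hY x hx, hsum (m + 1) (by omega)]
  · rw [symOp_add, symOp_smul, symOp_smul, LinearMap.add_apply, LinearMap.smul_apply,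
      LinearMap.smul_apply, h0 x hx, hm x hx, hsum 0 (by omega), hsum m (by omega)]
  · have h := M.hT.rid_apply_eq_zero hq (k := m + 1) (by omega) hvg
    rw [rid, rid_eq_of_forall (m := 1) (by omega), rid, rid, ridFactor, ridFactor] at h
    · rw [if_neg, if_neg, if_neg, if_pos, if_pos, if_neg] at h
      · simp only [one_mul, mul_one] at h
        have hcm := (((Commute.refl (jm q M.T (m + 1))).sub_right
          ((M.hT.jm_commute (l := m) (by omega) (by omega)).smul_right q)).sub_left
          (((M.hT.jm_commute (k := 0) (l := m + 1) (by omega) (by omega)).sub_right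
            ((M.hT.jm_commute (k := 0) (l := m) (by omega) (by omega)).smul_right q)).smul_left q⁻¹))
        rw [hcm.eq] at h
        exact h
      · simp only [hc, inv_mul_zpow_eq hq]
        rw [hinj (by omega) (by omega)]; omega
      · exact hstep m
      · exact hlast
      · simp only [hc, mul_zpow_eq hq]
        rw [hinj (by push_cast; omega) (by push_cast; omega)]; omega
      · simp only [hc, hβ]
        rw [hinj (by push_cast; omega) (by push_cast; omega)]; omega
      · simp only [hc, hα]
        rw [hinj (by push_cast; omega) (by push_cast; omega)]; omega
    · intro l hl hl'
      simp only [hc, inv_mul_zpow_eq hq, mul_zpow_eq hq]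
      constructor
      · rw [ne_eq, hinj (by push_cast; omega) (by push_cast; omega)]; omega
      · rw [ne_eq, hinj (by push_cast; omega) (by push_cast; omega)]; omega
  · rcases Nat.eq_zero_or_pos f with rfl | hf0
    · exact Or.inr hvu
    · left
      have h := M.hT.rid_apply_eq_zero hq (k := 0) (by omega) hvg
      rw [rid, if_pos, if_neg] at h
      · simpa [hc, sub_eq_zero] using h
      · simp only [hc, hβ]
        rw [hinj (by push_cast; omega) (by push_cast; omega)]; omega
      · simp [hc]

end InfiniteTypeCases

section InfiniteTypeCases

variable {K : Type} [Field K] {q : K}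

theorem not_finRep_of_two_mul_add_four_lt (hq : q ≠ 0) {E f : ℕ}
    (hE : ∀ j : ℕ, 0 < j → j < E → q ^ j ≠ 1) (hf : 2 * f + 4 < E) :
    ¬ FinRep K 1 (q ^ f) q (2 * f + 4) := by
  classical
  set z : ℕ → ℤ := fun l => if l ≤ f + 1 then (f : ℤ) - l else (l : ℤ) - (f + 2 : ℕ) with hz
  set c : ℕ → K := fun l => q ^ z l with hc
  have hinj : ∀ {a b : ℤ}, a - b < E → b - a < E → (q ^ a = q ^ b ↔ a = b) :=
    fun h1 h2 => zpow_eq_zpow_iff_of_lt hq hE h1 h2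
  have hz1 : ∀ {l}, l ≤ f + 1 → z l = (f : ℤ) - l := fun {l} h => by simp only [hz, if_pos h]
  have hz2 : ∀ {l}, f + 1 < l → z l = (l : ℤ) - (f + 2 : ℕ) := fun {l} h => by
    simp only [hz, if_neg (not_le.2 h)]
  have hzc : ∀ l : ℕ, (l ≤ f + 1 ∧ z l = f - l) ∨ (f + 1 < l ∧ z l = l - (f + 2 : ℕ)) := fun l =>
    (le_or_gt l (f + 1)).imp (fun h => ⟨h, hz1 h⟩) fun h => ⟨h, hz2 h⟩
  have hzb : ∀ l < 2 * f + 4, -1 ≤ z l ∧ z l ≤ f + 1 := fun l hl => by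
    have := hzc l
    omega
  have hα : (1 : K) = q ^ (0 : ℤ) := (zpow_zero q).symm
  have hβ : q ^ f = q ^ (f : ℤ) := (zpow_natCast q f).symm
  have hmul : ∀ l, q * c l = q ^ (z l + 1) := fun l => mul_zpow_eq hq _
  have hinv : ∀ l, q⁻¹ * c l = q ^ (z l - 1) := fun l => inv_mul_zpow_eq hq _
  have hceq : ∀ l < 2 * f + 4, ∀ l' < 2 * f + 4, c l = c l' ↔ z l = z l' := fun l hl l' hl' => by
    have h1 := hzb l hl
    have h2 := hzb l' hl'
    exact hinj (by omega) (by omega)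
  have hcmul : ∀ l < 2 * f + 4, ∀ l' < 2 * f + 4, c l = q * c l' ↔ z l = z l' + 1 :=
    fun l hl l' hl' => by
    have := hzb l hl
    have := hzb l' hl'
    rw [hmul]
    exact hinj (by omega) (by omega)
  have hcinv : ∀ l < 2 * f + 4, ∀ l' < 2 * f + 4, c l = q⁻¹ * c l' ↔ z l = z l' - 1 :=
    fun l hl l' hl' => by
    have h1 := hzb l hl
    have h2 := hzb l' hl'
    rw [hinv]
    exact hinj (by omega) (by omega)
  have hcα : ∀ l < 2 * f + 4, c l = 1 ↔ z l = 0 := fun l hl => by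
    have h1 := hzb l hl
    rw [hα]
    exact hinj (by omega) (by omega)
  have hcβ : ∀ l < 2 * f + 4, c l = q ^ f ↔ z l = f := fun l hl => by
    have h1 := hzb l hl
    rw [hβ]
    exact hinj (by omega) (by omega)
  have hdbl1 : ∀ l ≤ f + 1, (dblRoots c l).count (c l) = 0 := fun l hl => by
    rw [count_dblRoots, card_filter_eq_zero, mul_zero]
    intro l' hl' h
    rw [hceq l (by omega) l' (by omega), hz1 hl, hz1 (by omega)] at h
    omega
  have hdbl2 : (dblRoots c (2 * f + 3)).count (c (2 * f + 3)) = 0 := by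
    rw [count_dblRoots, card_filter_eq_zero, mul_zero]
    intro l' hl' h
    rw [hceq _ (by omega) l' (by omega), hz2 (by omega)] at h
    have := hzc l'
    omega
  have hdbl3 : ∀ l, f + 1 < l → l < 2 * f + 3 → (dblRoots c l).count (c l) ≤ 2 := fun l hl hl' => by
    rw [count_dblRoots]
    have := card_filter_le_one (k := l) (p := fun m => c l = c m) (2 * f + 2 - l) fun m hm h => by
      rw [hceq l (by omega) m (by omega), hz2 hl] at h
      have := hzc m
      omega
    omega
  have hL : z (2 * f + 3) = f + 1 := by rw [hz2 (by omega)]; push_cast; ring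
  have hL' : z (2 * f + 2) = f := by rw [hz2 (by omega)]; push_cast; ring
  have hz0 : z 0 = f := by rw [hz1 (by omega)]; simp
  have hzf : z f = 0 := by rw [hz1 (by omega)]; simp
  have hzf1 : z (f + 1) = -1 := by rw [hz1 (by omega)]; push_cast; ring
  obtain ⟨M, v, u, huk, hul, hv, hvu⟩ := HSys.exists_double_jordan_vector (K := K) (α := 1)
    (β := q ^ f) (q := q) hq one_ne_zero (pow_ne_zero _ hq) (c := c) (fun k => zpow_ne_zero _ hq)
    (a := f) (k := 2 * f + 3) (by omega)
    (fun l hl => by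
      rw [count_wtRoots]
      rcases le_or_gt l (f + 1) with h | h
      · rw [hdbl1 l h]
        rcases l with _ | l
        · rw [if_pos ((hcβ 0 (by omega)).2 hz0)]; omega
        · have := one_le_card_filter (k := l + 1) (p := fun l' => c (l + 1) = q⁻¹ * c l') l
            (lt_succ_self l) ((hcinv _ (by omega) _ (by omega)).2 (by
              rw [hz1 h, hz1 (by omega)]; push_cast; ring))
          omega
      · have h2 := hdbl3 l h (by omega)
        have hA : ∀ l' < l, z l = z l' + 1 → c l = q * c l' := fun l' hl' h' =>
          (hcmul l (by omega) l' (by omega)).2 h'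
        have hB : ∀ l' < l, z l = z l' - 1 → c l = q⁻¹ * c l' := fun l' hl' h' =>
          (hcinv l (by omega) l' (by omega)).2 h'
        obtain ⟨j, rfl⟩ : ∃ j, l = f + 2 + j := ⟨l - (f + 2), by omega⟩
        have hzl : z (f + 2 + j) = j := by rw [hz2 h]; push_cast; ring
        rw [hzl] at hA hB
        have hzB : j < f → z (f - j - 1) = j + 1 := fun hj => by rw [hz1 (by omega)]; omega
        have hzA : z (f + 1 - j) = (j : ℤ) - 1 := by rw [hz1 (by omega)]; omega
        have h4 : j < f → _ := fun hj => one_le_card_filter (k := f + 2 + j)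
          (p := fun l' => c (f + 2 + j) = q⁻¹ * c l') (f - j - 1) (by omega)
          (hB _ (by omega) (by rw [hzB hj]; ring))
        have h5 := one_le_card_filter (k := f + 2 + j)
          (p := fun l' => c (f + 2 + j) = q * c l') (f + 1 - j) (by omega)
          (hA _ (by omega) (by rw [hzA]; ring))
        have h6 : 0 < j → _ := fun hj => two_le_card_filter (k := f + 2 + j)
          (p := fun l' => c (f + 2 + j) = q * c l') (f + 1 - j) (f + 1 + j) (by omega)
          (hA _ (by omega) (by rw [hzA]; ring)) (by omega)
          (hA _ (by omega) (by rw [hz2 (by omega)]; push_cast; ring)) (by omega)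
        have h7 : j = f → c (f + 2 + j) = q ^ f := fun hj => (hcβ _ (by omega)).2 (by rw [hzl, hj])
        have h8 : j = 0 → c (f + 2 + j) = 1 := fun hj => (hcα _ (by omega)).2 (by rw [hzl, hj]; rfl)
        rcases Nat.eq_zero_or_pos j with hj | hj
        · rw [if_pos (h8 hj)]
          rcases Nat.lt_or_ge j f with hjf | hjf
          · have := h4 hjf; omega
          · rw [if_pos (h7 (by omega))]; omega
        · have := h6 hj
          rcases Nat.lt_or_ge j f with hjf | hjf
          · have := h4 hjf; omega
          · rw [if_pos (h7 (by omega))]; omega)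
    (by
      rw [hdbl1 f (by omega), count_wtRoots, if_pos ((hcα f (by omega)).2 hzf)]
      rcases f with _ | f
      · rw [if_pos ((hcβ 0 (by omega)).2 hz0)]; omega
      · have := one_le_card_filter (k := f + 1) (p := fun l' => c (f + 1) = q⁻¹ * c l') f
          (lt_succ_self f) ((hcinv _ (by omega) _ (by omega)).2 (by
            rw [hzf, hz1 (by omega)]; push_cast; ring))
        omega)
    (by
      rw [hdbl2, count_wtRoots]
      have h6 := two_le_card_filter (k := 2 * f + 3)
          (p := fun l' => c (2 * f + 3) = q * c l') 0 (2 * f + 2) (by omega)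
          ((hcmul _ (by omega) _ (by omega)).2 (by rw [hL, hz0])) (by omega)
          ((hcmul _ (by omega) _ (by omega)).2 (by rw [hL, hL'])) (by omega)
      omega)
  have hvg : v ∈ genWt q M.T (2 * f + 4) c := mem_genWt.2 hv
  have hjm : ∀ {k l : ℕ}, k < 2 * f + 4 → l < 2 * f + 4 → Commute (jm q M.T k) (jm q M.T l) :=
    fun hk hl => M.hT.jm_commute hk hl
  obtain ⟨gX, hX⟩ := exists_pick q M.T (2 * f + 4) c (c (f + 1))
  obtain ⟨gY, hY⟩ := exists_pick q M.T (2 * f + 4) c (c (2 * f + 3))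
  obtain ⟨gw, hw⟩ := exists_pick q M.T (2 * f + 4) c (c 0)
  have hsum : ∀ k < 2 * f + 4, (∀ l < 2 * f + 4, z l = z k → l = k) → ∀ x : M.V,
      (∑ l ∈ range (2 * f + 4),
      if c l = c k then jm q M.T l x - c k • x else 0) = jm q M.T k x - c k • x :=
        fun k hk hzk x => by
    rw [Finset.sum_eq_single_of_mem k (mem_range.2 hk), if_pos rfl]
    intro l hl hlk
    rw [if_neg]
    intro h
    exact hlk (hzk l (mem_range.1 hl) ((hceq l (mem_range.1 hl) k hk).1 h))
  have hL1 : ∀ w ∈ genWt q M.T (2 * f + 4) c, jm q M.T (f + 1) w = q⁻¹ • jm q M.T f w := by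
    intro w hw
    have h := M.hT.rid_apply_eq_zero hq (k := f + 1) (by omega) hw
    rw [rid, rid_eq_of_forall (m := 0) (by omega), rid, ridFactor] at h
    · rw [if_neg, if_neg, if_neg, if_pos] at h
      · simp only [one_mul, LinearMap.sub_apply, LinearMap.smul_apply] at h
        exact sub_eq_zero.1 h
      · rw [hcinv _ (by omega) _ (by omega), hzf, hzf1]; ring
      · rw [hcmul _ (by omega) _ (by omega), hzf, hzf1]; omega
      · rw [hcβ _ (by omega), hzf1]; omega
      · rw [hcα _ (by omega), hzf1]; omega
    · intro l hl hl'
      rw [ne_eq, ne_eq, hcmul _ (by omega) _ (by omega), hcinv _ (by omega) _ (by omega), hzf1,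
        hz1 (by omega)]
      omega
  have hqc : c (f + 1) = q⁻¹ * c f := (hcinv _ (by omega) _ (by omega)).2 (by rw [hzf1, hzf]; ring)
  refine not_finRep_of_genWt hq M (c := c) (v := v) (u := u) (a := f) (k := 2 * f + 3) (i := 0)
    (j := 2 * f + 2)
    (gX := gX) (gY := gY) (gw := q • gw) (s := q⁻¹) (t := q) (t' := q)
    (by omega) (by omega) (by omega) (by omega) hvg hvu (hul f (by omega)) (hul 0 (by omega))
    (hul (2 * f + 2) (by omega)) huk (inv_ne_zero hq) (fun x hx => ?_) (fun x hx => ?_)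
    (fun x hx => ?_) ((hcmul _ (by omega) _ (by omega)).2 (by rw [hL, hz0]))
    ((hcmul _ (by omega) _ (by omega)).2 (by rw [hL, hL'])) ?_ ?_
  · rw [hX x hx, hsum (f + 1) (by omega), hL1 x hx, hqc, smul_sub, smul_smul]
    intro l hl h
    rw [hzf1] at h
    have := hzc l
    omega
  · rw [hY x hx, hsum (2 * f + 3) (by omega)]
    intro l hl h
    rw [hL] at h
    have := hzc l
    omega
  · rw [symOp_smul, LinearMap.smul_apply, hw x hx, ← smul_add]
    have hc0 : c 0 = c (2 * f + 2) := (hceq _ (by omega) _ (by omega)).2 (by rw [hz0, hL'])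
    congr 1
    rw [← add_sum_erase _ _ (mem_range.2 (show 0 < 2 * f + 4 by omega)), if_pos rfl]
    congr 1
    rw [Finset.sum_eq_single_of_mem (2 * f + 2) (by simp), if_pos hc0.symm, hc0]
    intro l hl hlk
    rw [Finset.mem_erase, mem_range] at hl
    rw [if_neg]
    intro h
    rw [hceq l hl.2 0 (by omega), hz0] at h
    have := hzc l
    omega
  · have h := M.hT.rid_apply_eq_zero hq (k := 2 * f + 3) (by omega) hvg
    rw [rid, rid_eq_of_forall (m := 1) (by omega), rid, rid, ridFactor, ridFactor] at h
    · rw [if_neg, if_neg, if_pos, if_neg, if_pos, if_neg] at h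
      · simp only [one_mul, mul_one] at h
        have hcm := (((Commute.refl (jm q M.T (2 * f + 3))).sub_right
          ((hjm (l := 2 * f + 2) (by omega) (by omega)).smul_right q)).sub_left
          (((hjm (k := 0) (l := 2 * f + 3) (by omega) (by omega)).sub_right
            ((hjm (k := 0) (l := 2 * f + 2) (by omega) (by omega)).smul_right q)).smul_left q))
        rw [hcm.eq] at h
        exact h
      · rw [hcinv _ (by omega) _ (by omega), hL, hL']; omega
      · exact (hcmul _ (by omega) _ (by omega)).2 (by rw [hL, hL'])
      · rw [hcinv _ (by omega) _ (by omega), hL, hz0]; omega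
      · exact (hcmul _ (by omega) _ (by omega)).2 (by rw [hL, hz0])
      · rw [hcβ _ (by omega), hL]; omega
      · rw [hcα _ (by omega), hL]; omega
    · intro l hl hl'
      rw [ne_eq, ne_eq, hcmul _ (by omega) _ (by omega), hcinv _ (by omega) _ (by omega), hL]
      have := hzc l
      omega
  · rcases Nat.eq_zero_or_pos f with rfl | hf0
    · exact Or.inr hvu
    · left
      have h := M.hT.rid_apply_eq_zero hq (k := 0) (by omega) hvg
      rw [rid, if_neg, if_pos] at h
      · have h2 : c 0 = q ^ f := (hcβ 0 (by omega)).2 hz0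
        rw [h2]
        simpa [sub_eq_zero] using h
      · exact (hcβ 0 (by omega)).2 hz0
      · rw [hcα _ (by omega), hz0]; omega

/-- The infinite type half of the classification. -/
theorem not_finRep_of_min_le (hq : q ≠ 0) (he : 3 ≤ multOrder q) (hf : ((2 * f : ℕ) :
    ℕ∞) ≤ multOrder q) (hn : min (multOrder q) ((2 * f + 4 : ℕ) : ℕ∞) ≤ n) :
    ¬ FinRep K 1 (q ^ f) q n := by
  have hmono : ∀ m ≤ n, ¬ FinRep K 1 (q ^ f) q m → ¬ FinRep K 1 (q ^ f) q n := by
    intro m hm h h'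
    clear hn
    induction n, hm using Nat.le_induction with
    | base => exact h h'
    | succ n hm ih => exact ih (h'.of_succ)
  rw [multOrder] at he hf hn
  split_ifs at he hf hn with h0
  · rw [min_eq_right le_top] at hn
    refine hmono (2 * f + 4) (by exact_mod_cast hn)
      (not_finRep_of_two_mul_add_four_lt hq (E := 2 * f + 5) (fun j hj _ h => ?_) (by omega))
    rw [orderOf_eq_zero_iff'] at h0
    exact h0 j hj h
  · have hE : ∀ j : ℕ, 0 < j → j < orderOf q → q ^ j ≠ 1 := fun j hj hj' h =>
      absurd (orderOf_le_of_pow_eq_one hj h) (not_le.2 hj')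
    have he' : 3 ≤ orderOf q := by exact_mod_cast he
    have hf' : 2 * f ≤ orderOf q := by exact_mod_cast hf
    have hn' : min (orderOf q) (2 * f + 4) ≤ n := by
      rcases min_le_iff.1 hn with h | h
      · exact (min_le_left _ _).trans (by exact_mod_cast h)
      · exact (min_le_right _ _).trans (by exact_mod_cast h)
    rcases le_or_gt (orderOf q) (2 * f + 4) with h | h
    · exact hmono (orderOf q) (by omega)
        (not_finRep_of_pow_eq_one hq he' hE (pow_orderOf_eq_one q) hf')
    · exact hmono (2 * f + 4) (by omega) (not_finRep_of_two_mul_add_four_lt hq hE h)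

end InfiniteTypeCases

section RelTrace

/-- Conjugation of a linear map by the `k`-th operators of two sequences. -/
def cj (T : ℕ → End K V) (T' : ℕ → End K W) (k : ℕ) (x : V →ₗ[K] W) : V →ₗ[K] W :=
  T' k ∘ₗ x ∘ₗ T k

/-- The relative trace map from the parabolic subalgebra on the first `k` generators. -/
noncomputable def relTr (Q q : K) (T : ℕ → End K V) (T' : ℕ → End K W) :
    ℕ → (V →ₗ[K] W) → (V →ₗ[K] W)
  | 0, _ => 0
  | k + 1, x => x - Q⁻¹ • (jm q T' k ∘ₗ x ∘ₗ jm q T k) + q⁻¹ • relTr Q q T T' k (cj T T' k x)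

variable {α β Q q : K} {T : ℕ → End K V} {T' : ℕ → End K W}
  {T'' : ℕ → End K U}

theorem cj_apply (k : ℕ) (x : V →ₗ[K] W) (v : V) : cj T T' k x v = T' k (x (T k v)) := rfl

theorem relTr_succ_apply (k : ℕ) (x : V →ₗ[K] W) (v : V) : relTr Q q T T' (k + 1) x v =
    x v - Q⁻¹ • jm q T' k (x (jm q T k v)) + q⁻¹ • relTr Q q T T' k (cj T T' k x) v := rfl

theorem relTr_add (k : ℕ) (x y : V →ₗ[K] W) :
    relTr Q q T T' k (x + y) = relTr Q q T T' k x + relTr Q q T T' k y := by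
  induction k generalizing x y with
  | zero => simp [relTr]
  | succ k ih =>
    have : cj T T' k (x + y) = cj T T' k x + cj T T' k y := by ext; simp [cj]
    ext v
    simp only [relTr_succ_apply, this, ih, LinearMap.add_apply, map_add]
    module

theorem relTr_smul (k : ℕ) (c : K) (x : V →ₗ[K] W) :
    relTr Q q T T' k (c • x) = c • relTr Q q T T' k x := by
  induction k generalizing x with
  | zero => simp [relTr]
  | succ k ih =>
    have : cj T T' k (c • x) = c • cj T T' k x := by ext; simp [cj]
    ext v
    simp only [relTr_succ_apply, this, ih, LinearMap.smul_apply, map_smul]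
    module

theorem relTr_sum {J : Type*} (s : Finset J) (k : ℕ) (x : J → V →ₗ[K] W) :
    relTr Q q T T' k (∑ j ∈ s, x j) = ∑ j ∈ s, relTr Q q T T' k (x j) := by
  classical
  induction s using Finset.induction_on with
  | empty => simpa using relTr_smul (Q := Q) (q := q) (T := T) (T' := T') k (0 : K) 0
  | insert j s hj ih => rw [sum_insert hj, sum_insert hj, relTr_add, ih]

theorem comp_relTr {g : W →ₗ[K] U} (hg : Intw k T' T'' g) (x : V →ₗ[K] W) :
    g ∘ₗ relTr Q q T T' k x = relTr Q q T T'' k (g ∘ₗ x) := by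
  induction k generalizing x with
  | zero => simp [relTr]
  | succ k ih =>
    have h1 : cj T T'' k (g ∘ₗ x) = g ∘ₗ cj T T' k x := by
      ext v; simp [cj, hg k k.lt_succ_self]
    have h2 := congr_fun (ih (hg.mono k.le_succ) (cj T T' k x))
    ext v
    simp only [comp_apply] at h2
    simp only [comp_apply, relTr_succ_apply, map_add, map_sub, map_smul,
      hg.jm k.lt_succ_self, h1, h2]

theorem relTr_comp {h : U →ₗ[K] V} (hh : Intw k T'' T h) (x : V →ₗ[K] W) :
    relTr Q q T T' k x ∘ₗ h = relTr Q q T'' T' k (x ∘ₗ h) := by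
  induction k generalizing x with
  | zero => simp [relTr]
  | succ k ih =>
    have h1 : cj T'' T' k (x ∘ₗ h) = cj T T' k x ∘ₗ h := by
      ext v; simp [cj, hh k k.lt_succ_self]
    have h2 := congr_fun (ih (hh.mono k.le_succ) (cj T T' k x))
    ext v
    simp only [comp_apply] at h2
    simp only [comp_apply, relTr_succ_apply,
      ← hh.jm k.lt_succ_self, h1, h2]

theorem cj_add_intertwine (hT : IsHecke α β q n T) (hT' : IsHecke α β q n T') (hq : q ≠ 0)
    (hi : 0 < i) (hin : i < n) (x : V →ₗ[K] W) (v : V) :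
    (x + q⁻¹ • cj T T' i x) (T i v) = T' i ((x + q⁻¹ • cj T T' i x) v) := by
  have h1 := congr_fun (hT.quad i hi hin) v
  have h2 := congr_fun (hT'.quad i hi hin) (x (T i v))
  simp only [mul_apply, LinearMap.add_apply, LinearMap.smul_apply, End.one_apply]
    at h1 h2
  simp only [LinearMap.add_apply, LinearMap.smul_apply, cj_apply, map_add, map_smul, h1, h2,
    smul_add, smul_smul, inv_mul_cancel₀ hq, one_smul]
  module

/-- The relative trace of a map commuting with the first `k` generators commutes with the first
`k + 1` generators. -/
theorem Intw.relTr (hT : IsHecke α β q n T) (hT' : IsHecke α β q n T') (hq : q ≠ 0)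
    (hα : α ≠ 0) (hβ : β ≠ 0) (hk : k < n) {x : V →ₗ[K] W} (hx : Intw k T T' x) :
    Intw (k + 1) T T' (relTr (α * β) q T T' (k + 1) x) := by
  have hQ : α * β ≠ 0 := mul_ne_zero hα hβ
  induction k generalizing x with
  | zero =>
    intro i hi v
    obtain rfl : i = 0 := by omega
    have h1 := congr_fun (hT.quad_zero hk) v
    have h2 := congr_fun (hT'.quad_zero hk) (x (T 0 v))
    simp only [mul_apply, LinearMap.add_apply, LinearMap.sub_apply,
      LinearMap.smul_apply, End.one_apply] at h1 h2
    rw [relTr_succ_apply, relTr_succ_apply]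
    simp only [_root_.jm, _root_.relTr, LinearMap.zero_apply, map_sub, map_add, map_smul,
      h1, h2, map_zero, smul_sub, smul_add, smul_smul, smul_zero, add_zero, inv_mul_cancel₀ hQ]
    module
  | succ j ih =>
    have hz : Intw j T T' (cj T T' (j + 1) x) := by
      intro i hi v
      have h1 := congr_fun (hT.comm i (j + 1) (by omega) hk) v
      have h2 := congr_fun (hT'.comm i (j + 1) (by omega) hk) (x (T (j + 1) v))
      simp only [mul_apply] at h1 h2
      rw [cj_apply, cj_apply, ← h1, hx i (by omega), h2]
    have hz' := ih (by omega) hz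
    intro i hi v
    rcases lt_succ_iff_lt_or_eq.1 hi with hi' | rfl
    · have h1 := congr_fun (hT.commute_jm_of_lt hi' hk) v
      have h2 := congr_fun (hT'.commute_jm_of_lt hi' hk) (x (_root_.jm q T (j + 1) v))
      simp only [mul_apply] at h1 h2
      rw [relTr_succ_apply (j + 1), relTr_succ_apply (j + 1), hz' i hi', map_add, map_sub, map_smul, map_smul,
        hx i hi', ← h1, hx i hi', h2]
    · set y : V →ₗ[K] W := _root_.jm q T' j ∘ₗ cj T T' (j + 1) x ∘ₗ _root_.jm q T j with hy
      have hw : Intw j T T (T (j + 1)) := Intw.of_commute fun i hi =>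
        (hT.comm i (j + 1) (by omega) hk).symm
      have hw' : Intw j T' T' (T' (j + 1)) := Intw.of_commute fun i hi =>
        (hT'.comm i (j + 1) (by omega) hk).symm
      have htr : ∀ v, _root_.relTr (α * β) q T T' (j + 1 + 1) x v =
          (x + q⁻¹ • cj T T' (j + 1) x) v - ((α * β)⁻¹ * q⁻¹) • (y + q⁻¹ • cj T T' (j + 1) y) v +
          (q⁻¹ * q⁻¹) • _root_.relTr (α * β) q T T' j (cj T T' j (cj T T' (j + 1) x)) v := by
        intro v
        rw [relTr_succ_apply, relTr_succ_apply]
        simp only [hy, _root_.jm, LinearMap.add_apply, LinearMap.smul_apply, cj_apply,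
          comp_apply, mul_apply, map_smul]
        module
      have hb : ∀ v, _root_.relTr (α * β) q T T' j (cj T T' j (cj T T' (j + 1) x)) (T (j + 1) v) =
          T' (j + 1) (_root_.relTr (α * β) q T T' j (cj T T' j (cj T T' (j + 1) x)) v) := by
        intro v
        have e1 := congr_fun
          (relTr_comp (Q := α * β) (q := q) (T' := T') hw (cj T T' j (cj T T' (j + 1) x))) v
        have e2 := congr_fun
          (comp_relTr (Q := α * β) (q := q) (T := T) hw' (cj T T' j (cj T T' (j + 1) x))) v
        simp only [comp_apply] at e1 e2
        rw [e1, e2]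
        rcases Nat.eq_zero_or_pos j with rfl | hj
        · rfl
        congr 2
        ext v
        have h1 := congr_fun (hT.braid j hj hk) v
        have h2 := congr_fun (hT'.braid j hj hk) (x (T (j + 1) (T j v)))
        simp only [mul_apply] at h1 h2
        simp only [comp_apply, cj_apply, h1, h2, hx j (by omega)]
      rw [htr, htr, hb, cj_add_intertwine hT hT' hq (by omega) hk,
        cj_add_intertwine hT hT' hq (by omega) hk, map_add, map_sub, map_smul, map_smul]

end RelTrace

section Higman

variable {K : Type} [Field K] {α β q : K}

theorem indPi_relTr_indJ {V W : Type*} [AddCommGroup V] [Module K V] [AddCommGroup W]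
    [Module K W] {T : ℕ → End K V} {T' : ℕ → End K W} (π : W →ₗ[K] V) (w : W) :
    indPi V K n n (relTr (α * β) q T' (indT α β q n T) (n + 1) (indJ V K n n ∘ₗ π) w) = π w := by
  have h0 : ∀ (k : ℕ), k ≤ n →
      indPi V K n n ∘ₗ relTr (α * β) q T' (indT α β q n T) k (cj T' (indT α β q n T) n
        (indJ V K n n ∘ₗ π)) = 0 := by
    intro k hk
    rw [comp_relTr ((intw_indPi le_rfl).mono hk) (T'' := T)]
    have : indPi V K n n ∘ₗ cj T' (indT α β q n T) n (indJ V K n n ∘ₗ π) = 0 := by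
      ext v
      simp [cj_apply, indPi_indT_indJ]
    rw [this]
    simpa using relTr_smul (Q := α * β) (q := q) (T := T') (T' := T) k (0 : K) 0
  have := congr_fun (h0 n le_rfl) w
  simp only [comp_apply, LinearMap.zero_apply] at this
  rw [relTr_succ_apply, map_add, map_sub, map_smul, map_smul, this]
  simp [indPi_indJ, indPi_jm_indJ]

/-- If the relative trace of some endomorphism of the restriction is invertible, then an
indecomposable system is a summand of an induced one. -/
theorem HSys.exists_summand_ind {M : HSys K α β q (n + 1)} (hM : Indec (n + 1) M.T) (hq : q ≠ 0)
    (hα : α ≠ 0) (hβ : β ≠ 0) {S : Type*} (X : S → HSys K α β q n)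
    (hX : ∀ Y : HSys K α β q n, Indec n Y.T → ∃ s, Y.Summand (X s))
    {x : End K M.V} (hx : Intw n M.T M.T x)
    (hu : IsUnit (relTr (α * β) q M.T M.T (n + 1) x)) : ∃ s, M.Summand (X s).ind := by
  obtain ⟨J, _, Y, ι, p, h, hsum⟩ := (M.res n.le_succ).exists_decomp
  have key : ∑ j, relTr (α * β) q M.T M.T (n + 1) (x ∘ₗ ι j ∘ₗ p j) =
      relTr (α * β) q M.T M.T (n + 1) x := by
    rw [← relTr_sum]
    congr 1
    ext v
    have := congrArg x (congr_fun hsum v)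
    simpa using this
  have hxj : ∀ j, Intw n M.T M.T (x ∘ₗ ι j ∘ₗ p j) := fun j =>
    hx.comp ((h j).2.1.comp (h j).2.2.1)
  obtain ⟨j, -, hj⟩ := hM.exists_isUnit_of_sum Finset.univ
    (fun j _ => (hxj j).relTr M.hT M.hT hq hα hβ n.lt_succ_self) (key ▸ hu)
  obtain ⟨s, i, r, hi, hr, hri⟩ := hX (Y j) (h j).1
  refine ⟨s, ?_⟩
  have hπ : Intw n M.T (X s).T (i ∘ₗ p j) := hi.comp (h j).2.2.1
  have hι : Intw n (X s).T M.T (x ∘ₗ ι j ∘ₗ r) := hx.comp ((h j).2.1.comp hr)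
  have ha : Intw (n + 1) M.T (X s).ind.T _ := ((X s).intw_indJ.comp hπ).relTr M.hT (X s).ind.hT hq
    hα hβ n.lt_succ_self
  have hb : Intw (n + 1) (X s).ind.T M.T _ := (hι.comp (X s).intw_indPi).relTr (X s).ind.hT M.hT hq
    hα hβ n.lt_succ_self
  refine HSys.summand_of_isUnit ha hb ?_
  rw [relTr_comp ha]
  convert hj using 2
  ext v
  simp only [comp_apply, indPi_relTr_indJ]
  congr 2
  exact congr_fun hri (p j v)

end Higman

section TraceFormula

variable {α β Q q : K}
 

theorem mul_relTr {g : End K V} (hg : Intw k T T g) (x : End K V) :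
    g * relTr Q q T T k x = relTr Q q T T k (g * x) := comp_relTr hg x

theorem relTr_mul {g : End K V} (hg : Intw k T T g) (x : End K V) :
    relTr Q q T T k x * g = relTr Q q T T k (x * g) := relTr_comp hg x

theorem relTr_sub (k : ℕ) (x y : End K V) :
    relTr Q q T T k (x - y) = relTr Q q T T k x - relTr Q q T T k y := by
  rw [sub_eq_add_neg, ← neg_one_smul K y, relTr_add, relTr_smul]
  module

theorem relTr_succ (k : ℕ) (x : End K V) : relTr Q q T T (k + 1) x =
    x - Q⁻¹ • (jm q T k * x * jm q T k) + q⁻¹ • relTr Q q T T k (T k * x * T k) := rfl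

theorem IsHecke.intw_jm (hT : IsHecke α β q n T) (hk : k < n) :
    Intw k T T (jm q T k) :=
  Intw.of_commute fun _ hi => (hT.commute_jm_of_lt hi hk).symm

theorem IsHecke.intw_gen (hT : IsHecke α β q n T) (hk : k + 1 < n) :
    Intw k T T (T (k + 1)) :=
  Intw.of_commute fun i hi => (hT.comm i (k + 1) (by omega) hk).symm

/-- The relative traces of the powers of a Jucys--Murphy element. -/
noncomputable def trPow (Q q : K) (T : ℕ → End K V) (k m : ℕ) : End K V :=
  relTr Q q T T k (jm q T (k - 1) ^ m)

theorem IsHecke.intw_trPow (hT : IsHecke α β q n T) (hq : q ≠ 0) (hα : α ≠ 0) (hβ : β ≠ 0)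
    (hk : k < n) (m : ℕ) : Intw (k + 1) T T (trPow (α * β) q T (k + 1) m) :=
  Intw.relTr hT hT hq hα hβ hk ((hT.intw_jm hk).pow m)

theorem trPow_zero_left (m : ℕ) : trPow Q q T 0 m = 0 := rfl

theorem trPow_succ (k m : ℕ) : trPow Q q T (k + 1) m = jm q T k ^ m - Q⁻¹ • jm q T k ^ (m + 2) +
    q⁻¹ • relTr Q q T T k (T k * jm q T k ^ m * T k) := by
  rw [trPow, relTr_succ, Nat.add_sub_cancel, ← pow_succ', ← pow_succ]

theorem IsHecke.trPow_recurrence (hT : IsHecke α β q n T) (hq : q ≠ 0) (hα : α ≠ 0) (hβ : β ≠ 0)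
    (hk : k < n) (m : ℕ) :
    trPow (α * β) q T (k + 1) (m + 2) = (2 : K) • (jm q T k * trPow (α * β) q T (k + 1) (m + 1)) -
      jm q T k * (jm q T k * trPow (α * β) q T (k + 1) m) + trPow (α * β) q T k (m + 2) -
      (q + q⁻¹) • (jm q T k * trPow (α * β) q T k (m + 1)) +
      jm q T k * (jm q T k * trPow (α * β) q T k m) := by
  set b := jm q T k with hb
  have hbI : Intw k T T b := hT.intw_jm hk
  set R : ℕ → End K V := fun m => relTr (α * β) q T T k (T k * b ^ m * T k) with hR
  have ht : ∀ m, trPow (α * β) q T (k + 1) m = b ^ m - (α * β)⁻¹ • b ^ (m + 2) + q⁻¹ • R m :=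
    fun m => trPow_succ k m
  have hcomm : ∀ m, b * R m = R m * b := by
    intro m
    have h1 : Commute b (trPow (α * β) q T (k + 1) m) := by
      ext v
      exact ((hT.intw_trPow hq hα hβ hk m).jm k.lt_succ_self q v).symm
    have h2 : R m = q • (trPow (α * β) q T (k + 1) m - b ^ m + (α * β)⁻¹ • b ^ (m + 2)) := by
      rw [ht]
      match_scalars <;> field_simp <;> ring
    rw [h2]
    exact ((h1.sub_right (Commute.pow_right rfl m)).add_right
      ((Commute.pow_right rfl _).smul_right _)).smul_right q
  have hrec : R (m + 2) - (2 : K) • (b * R (m + 1)) + b * (b * R m) =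
      q • trPow (α * β) q T k (m + 2) - (q ^ 2 + 1) • (b * trPow (α * β) q T k (m + 1)) +
      q • (b * (b * trPow (α * β) q T k m)) := by
    rcases k with _ | j
    · simp [hR, trPow, relTr]
    · have hp := hT.hPair hq hk
      rw [← hb] at hp
      have h3 : R (m + 2) - b * R (m + 1) - R (m + 1) * b + b * R m * b =
          relTr (α * β) q T T (j + 1) (q • jm q T j ^ (m + 2) -
            (q ^ 2 + 1) • (b * jm q T j ^ (m + 1)) + q • (b * (b * jm q T j ^ m))) := by
        simp only [hR, mul_relTr hbI, relTr_mul hbI, ← relTr_add, ← relTr_sub]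
        congr 1
        have e1 : (T (j + 1) * b - b * T (j + 1)) * b ^ m * (b * T (j + 1) - T (j + 1) * b) =
            -(jm q T j ^ m * ((q • jm q T j - b) * (q • b - jm q T j))) := by
          rw [← hp.phi_sq, ← neg_sub (b * T (j + 1)), ← hp.phi_eq, neg_mul, neg_mul, hp.phi_pow_b,
            mul_assoc]
        have e2 : b * jm q T j ^ (m + 1) = jm q T j ^ (m + 1) * b :=
          ((Commute.pow_left hp.comm (m + 1)).symm)
        have e3 : b * (b * jm q T j ^ m) = jm q T j ^ m * (b * b) := by
          have := (Commute.pow_left hp.comm m).symm.eq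
          rw [this, ← mul_assoc, this, mul_assoc]
        have e4 := hp.comm
        rw [e2, e3]
        simp only [pow_succ]
        have e5 : b * b ^ m = b ^ m * b := (pow_succ' b m).symm.trans (pow_succ b m)
        have e6 : ∀ x, b * (b ^ m * x) = b ^ m * (b * x) := fun x => by
          rw [← mul_assoc, e5, mul_assoc]
        linear_combination (norm := skip) e1 + jm q T j ^ m * e4
        simp only [mul_add, mul_sub, add_mul, sub_mul, smul_mul_assoc, mul_smul_comm, mul_assoc,
          e5, e6]
        module
      have e1 : R (m + 1) * b = b * R (m + 1) := (hcomm _).symm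
      have e2 : b * R m * b = b * (b * R m) := by rw [mul_assoc, ← hcomm]
      rw [e1, e2, relTr_add, relTr_sub, relTr_smul, relTr_smul, relTr_smul, ← mul_relTr hbI,
        ← mul_relTr hbI, ← mul_relTr hbI] at h3
      linear_combination (norm := skip) h3
      simp only [trPow, Nat.add_sub_cancel]
      module
  have h4 : R (m + 2) = (2 : K) • (b * R (m + 1)) - b * (b * R m) +
      (q • trPow (α * β) q T k (m + 2) - (q ^ 2 + 1) • (b * trPow (α * β) q T k (m + 1)) +
      q • (b * (b * trPow (α * β) q T k m))) := by
    rw [← hrec]; module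
  rw [ht, ht, ht, h4]
  simp only [mul_add, mul_sub, mul_smul_comm, ← pow_succ']
  match_scalars <;> field_simp <;> ring

theorem IsHecke.trPow_succ_zero (hT : IsHecke α β q n T) (hq : q ≠ 0) (hk : k < n) :
    trPow (α * β) q T (k + 1) 0 = trPow (α * β) q T k 0 + 1 - (α * β)⁻¹ • jm q T k ^ 2 +
      (1 - q⁻¹) • relTr (α * β) q T T k (T k) := by
  rw [_root_.trPow_succ]
  rcases k with _ | j
  · simp [relTr, trPow]
  · rw [pow_zero, mul_one, hT.quad _ (by omega) hk, relTr_add, relTr_smul, relTr_smul, trPow,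
      pow_zero]
    simp only [smul_add, smul_smul, inv_mul_cancel₀ hq, mul_sub, zero_add]
    module

/-- The relative trace of the next generator. -/
theorem IsHecke.relTr_gen (hT : IsHecke α β q n T) (hq : q ≠ 0) (hα : α ≠ 0) (hβ : β ≠ 0)
    (hq1 : q ≠ 1) (hk : k < n) :
    relTr (α * β) q T T k (T k) = -(q * (α * β * (q - 1))⁻¹) • (jm q T k * jm q T k -
      ((α + β) • jm q T k + (q - 2 + q⁻¹) • ((∑ l ∈ range k, jm q T l) * jm q T k)) +
      (α * β) • 1) := by
  have hq1' : q - 1 ≠ 0 := sub_ne_zero.2 hq1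
  induction k with
  | zero =>
    simp only [relTr, jm, hT.quad_zero hk, Finset.range_zero, Finset.sum_empty, zero_mul,
      LinearMap.zero_apply]
    module
  | succ j ih =>
    have hp := hT.hPair hq hk
    set a := jm q T j with ha
    set b := jm q T (j + 1) with hb
    set X := ∑ l ∈ range j, jm q T l with hX
    have hXT : T (j + 1) * X = X * T (j + 1) :=
      (Commute.sum_right _ _ _ fun l hl => hT.commute_jm_of_gt
        (by have := mem_range.1 hl; omega) hk)
    have hXb : X * b = b * X :=
      (Commute.sum_left _ _ _ fun l hl => hT.jm_commute
        (by have := mem_range.1 hl; omega) hk)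
    have h1 : relTr (α * β) q T T j (T j * T (j + 1) * T j) =
        T (j + 1) * relTr (α * β) q T T j (T j) * T (j + 1) := by
      rw [mul_relTr (hT.intw_gen hk), relTr_mul (hT.intw_gen hk)]
      rcases Nat.eq_zero_or_pos j with rfl | hj
      · rfl
      rw [hT.braid j hj hk]
    rw [relTr_succ, h1, ih (by omega), sum_range_succ, ← hX, ← ha]
    have e1 := hp.bT
    have e2 := hp.Tb
    have e3 := hp.TaT
    have e4 := hp.comm
    have e5 := hp.quad
    have e6 : T (j + 1) * (a * a) * T (j + 1) = q • (b * b) - (q - 1) • (a * b * T (j + 1)) := by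
      linear_combination (norm := skip) (-1 : K) • (e1 * a * T (j + 1)) + b * e3
        + (q - 1) • (e4 * T (j + 1))
      simp only [mul_add, mul_sub, add_mul, sub_mul, smul_mul_assoc, mul_smul_comm, mul_assoc]
      module
    have e7 : T (j + 1) * (X * a) * T (j + 1) = q • (X * b) := by
      rw [← mul_assoc, hXT, mul_assoc, mul_assoc, ← mul_assoc (T (j + 1)), e3, mul_smul_comm]
    have e8 : a * T (j + 1) * a = a * b * T (j + 1) - (q - 1) • (a * b) := by
      linear_combination (norm := skip) (-1 : K) • (a * e1)
      simp only [mul_add, mul_sub, add_mul, sub_mul, smul_mul_assoc, mul_smul_comm, mul_assoc]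
      module
    simp only [mul_add, mul_sub, add_mul, sub_mul, smul_mul_assoc, mul_smul_comm, mul_one,
      e3, e5, e6, e7, e8, ← mul_assoc a a]
    match_scalars <;> field_simp <;> ring

theorem IsHecke.trPow_succ_one (hT : IsHecke α β q n T) (hq : q ≠ 0) (hα : α ≠ 0) (hβ : β ≠ 0)
    (hq1 : q ≠ 1) (hk : k < n) :
    trPow (α * β) q T (k + 1) 1 = trPow (α * β) q T k 1 + jm q T k - (α * β)⁻¹ • jm q T k ^ 3 +
      (1 - q⁻¹) • ((2 : K) • (jm q T k * relTr (α * β) q T T k (T k)) -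
        (q - 1) • (jm q T k * trPow (α * β) q T k 0)) := by
  rw [_root_.trPow_succ]
  rcases k with _ | j
  · simp [relTr, trPow]
  · have hp := hT.hPair hq hk
    set b := jm q T (j + 1) with hb
    have hbI : Intw (j + 1) T T b := hT.intw_jm hk
    have e1 : T (j + 1) * b * T (j + 1) = (q - 1) • (b * T (j + 1)) + (q - 1) • (T (j + 1) * b) -
        (q - 1) ^ 2 • b + q • jm q T j := by
      linear_combination (norm := skip) hp.Tb * T (j + 1) +
        jm q T j * hp.quad - (q - 1) • hp.Tb
      simp only [mul_add, mul_sub, add_mul, sub_mul, smul_mul_assoc, mul_smul_comm, mul_assoc,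
        mul_one]
      module
    have e2 : relTr (α * β) q T T (j + 1) (T (j + 1)) * b =
        b * relTr (α * β) q T T (j + 1) (T (j + 1)) := by
      rw [hT.relTr_gen hq hα hβ hq1 hk, ← hb]
      have hX : Commute (∑ l ∈ range (j + 1), jm q T l) b :=
        Commute.sum_left _ _ _ fun l hl => hT.jm_commute
          (by have := mem_range.1 hl; omega) hk
      have h0 : Commute b b := Commute.refl b
      exact ((((h0.mul_left h0).sub_left ((h0.smul_left _).add_left
        ((hX.mul_left h0).smul_left _))).add_left ((Commute.one_left b).smul_left _)).smul_left _)
    have e3 : relTr (α * β) q T T (j + 1) b = b * trPow (α * β) q T (j + 1) 0 := by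
      rw [trPow, pow_zero, mul_relTr hbI, mul_one]
    rw [pow_one, e1, relTr_add, relTr_sub, relTr_add, relTr_smul, relTr_smul, relTr_smul,
      relTr_smul, ← mul_relTr hbI, ← relTr_mul hbI, e2, e3]
    simp only [trPow, Nat.add_sub_cancel, pow_one]
    match_scalars <;> field_simp <;> ring

/-- The generating sequence attached to the scalars `τ` by which the traces of powers act. -/
def trSeq (γ A Q : K) (τ : ℕ → K) : ℕ → K
  | 0 => γ
  | 1 => -(γ * A)
  | 2 => γ * Q + τ 0
  | m + 3 => τ (m + 1)

/-- The generating function of the relative traces of the powers of a Jucys--Murphy element. -/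
theorem IsHecke.exists_trPow_genFun (hT : IsHecke α β q n T) (hq : q ≠ 0) (hα : α ≠ 0)
    (hβ : β ≠ 0) (hq1 : q ≠ 1) {v : V}
    (hv0 : v ≠ 0) (hv : ∀ l < n, jm q T l v = c l • v) {k : ℕ}
    (hk : k ≤ n) : ∃ τ : ℕ → K, (∀ m, trPow (α * β) q T k m v = τ m • v) ∧
      (revPoly (dblRoots c k) : PowerSeries K) * PowerSeries.mk
        (trSeq (q * (α * β * (q - 1) ^ 2)⁻¹)
          (α + β + (q - 2 + q⁻¹) * ∑ l ∈ range k, c l) (α * β) τ) =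
      PowerSeries.C (q * (α * β * (q - 1) ^ 2)⁻¹) * (revPoly (wtRoots α β q c k) : PowerSeries K) := by
  have hq1' : q - 1 ≠ 0 := sub_ne_zero.2 hq1
  induction k with
  | zero =>
    refine ⟨0, fun m => by simp [trPow_zero_left], ?_⟩
    rw [dblRoots, revPoly_zero, Polynomial.coe_one, one_mul, wtRoots, Multiset.insert_eq_cons,
      ← Multiset.cons_zero, coe_revPoly_cons, coe_revPoly_cons, revPoly_zero, Polynomial.coe_one]
    have : (1 - PowerSeries.C α * PowerSeries.X) * ((1 - PowerSeries.C β * PowerSeries.X) * 1) =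
        1 - PowerSeries.C (α + β) * PowerSeries.X + PowerSeries.C (α * β) * PowerSeries.X ^ 2 := by
      simp only [map_add, map_mul]; ring
    rw [this]
    ext m
    rw [PowerSeries.coeff_C_mul, map_add, map_sub, PowerSeries.coeff_C_mul, PowerSeries.coeff_C_mul,
      PowerSeries.coeff_mk, PowerSeries.coeff_one, PowerSeries.coeff_X, PowerSeries.coeff_X_pow]
    rcases m with _ | _ | _ | m
    · simp [trSeq]
    · simp [trSeq]
      ring
    · simp [trSeq]
    · simp [trSeq]
  | succ k ih =>
    obtain ⟨τ', hτ', hgf⟩ := ih (by omega)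
    set γ := q * (α * β * (q - 1) ^ 2)⁻¹ with hγ
    set A := α + β + (q - 2 + q⁻¹) * ∑ l ∈ range k, c l with hA
    set σ := -(q * (α * β * (q - 1))⁻¹) * (c k * c k - A * c k + α * β) with hσ
    have hck := hv k hk
    have hS : relTr (α * β) q T T k (T k) v = σ • v := by
      have hsum : (∑ l ∈ range k, jm q T l) v = (∑ l ∈ range k, c l) • v := by
        rw [LinearMap.sum_apply, sum_smul]
        exact sum_congr rfl fun l hl => hv l (by have := mem_range.1 hl; omega)
      rw [hT.relTr_gen hq hα hβ hq1 hk]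
      simp only [LinearMap.smul_apply, LinearMap.add_apply, LinearMap.sub_apply,
        mul_apply, End.one_apply, hck, map_smul, hsum, hσ, hA]
      module
    have h0 : trPow (α * β) q T (k + 1) 0 v =
        (τ' 0 + 1 - (α * β)⁻¹ * c k ^ 2 + (1 - q⁻¹) * σ) • v := by
      rw [hT.trPow_succ_zero hq hk]
      simp only [LinearMap.smul_apply, LinearMap.add_apply, LinearMap.sub_apply, pow_two,
        mul_apply, End.one_apply, hck, map_smul, hS, hτ']
      module
    have h1 : trPow (α * β) q T (k + 1) 1 v =
        (τ' 1 + c k - (α * β)⁻¹ * c k ^ 3 +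
          (1 - q⁻¹) * (2 * (c k * σ) - (q - 1) * (c k * τ' 0))) • v := by
      rw [hT.trPow_succ_one hq hα hβ hq1 hk]
      simp only [LinearMap.smul_apply, LinearMap.add_apply, LinearMap.sub_apply, pow_succ, pow_zero,
        one_mul, mul_apply, End.one_apply, hck, map_smul, hS, hτ']
      module
    have hstep : ∀ m (x y : K), trPow (α * β) q T (k + 1) m v = x • v →
        trPow (α * β) q T (k + 1) (m + 1) v = y • v →
        trPow (α * β) q T (k + 1) (m + 2) v = (2 * (c k * y) - c k * (c k * x) + τ' (m + 2) -
          (q + q⁻¹) * (c k * τ' (m + 1)) + c k * (c k * τ' m)) • v := by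
      intro m x y hx hy
      rw [hT.trPow_recurrence hq hα hβ hk]
      simp only [LinearMap.smul_apply, LinearMap.add_apply, LinearMap.sub_apply,
        mul_apply, hck, map_smul, hx, hy, hτ']
      module
    have hex : ∀ m, ∃ x y : K, trPow (α * β) q T (k + 1) m v = x • v ∧
        trPow (α * β) q T (k + 1) (m + 1) v = y • v := by
      intro m
      induction m with
      | zero => exact ⟨_, _, h0, h1⟩
      | succ m ih =>
        obtain ⟨x, y, hx, hy⟩ := ih
        exact ⟨y, _, hy, hstep m x y hx hy⟩
    choose τ y hτ hτy using hex
    have hτ0 := smul_left_injective K hv0 ((hτ 0).symm.trans h0)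
    have hτ1 := smul_left_injective K hv0 ((hτ 1).symm.trans h1)
    have hτs : ∀ m, τ (m + 2) = 2 * (c k * τ (m + 1)) - c k * (c k * τ m) + τ' (m + 2) -
          (q + q⁻¹) * (c k * τ' (m + 1)) + c k * (c k * τ' m) := fun m => smul_left_injective K hv0 ((hτ (m + 2)).symm.trans
      (hstep m (τ m) (τ (m + 1)) (hτ m) (hτ (m + 1))))
    refine ⟨τ, hτ, ?_⟩
    have hσ' : (1 - q⁻¹) * σ = -(α * β)⁻¹ * (c k * c k - A * c k + α * β) := by
      rw [hσ]; field_simp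
    have hγ' : γ * (q - 2 + q⁻¹) = (α * β)⁻¹ := by
      rw [hγ]; field_simp; ring
    set A' := α + β + (q - 2 + q⁻¹) * ∑ l ∈ range (k + 1), c l with hA'
    have hAA : A' = A + (q - 2 + q⁻¹) * c k := by
      rw [hA', hA, sum_range_succ]; ring
    have key := powerSeries_eq_of_recurrence (u := c k) (w := c k) (u' := q * c k)
      (w' := q⁻¹ * c k) (x := trSeq γ A' (α * β) τ) (x' := trSeq γ A (α * β) τ') rfl
      (by simp only [trSeq]; rw [hAA]; ring)
      (by
        have hqq : q * c k * (q⁻¹ * c k) = c k * c k := by field_simp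
        rintro (_ | _ | _ | m)
        · simp only [trSeq, zero_add, hqq]
          rw [hAA, hτ0, hσ']
          linear_combination (2 * c k ^ 2 - c k * A) * hγ' - inv_mul_cancel₀ (mul_ne_zero hα hβ)
        · simp only [trSeq, zero_add, hqq]
          rw [hAA, hτ0, hτ1]
          linear_combination (c k * (α * β) - c k ^ 3) * hγ' +
            c k * inv_mul_cancel₀ (mul_ne_zero hα hβ) + c k * τ' 0 * inv_mul_cancel₀ hq
        · simp only [trSeq, zero_add, hqq]
          linear_combination hτs 0
        · simp only [trSeq, hqq]
          linear_combination hτs (m + 1))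
    rw [wtRoots, dblRoots, coe_revPoly_cons, coe_revPoly_cons, coe_revPoly_cons,
      coe_revPoly_cons]
    linear_combination (revPoly (dblRoots c k) : PowerSeries K) * key + (1 - PowerSeries.C (q * c k) * PowerSeries.X) * 
      (1 - PowerSeries.C (q⁻¹ * c k) * PowerSeries.X) * hgf

end TraceFormula

section Dominance

theorem IsHecke.two_mul_card_le [DecidableEq K] (hT : IsHecke α β q n T) (hq : q ≠ 0) (hα : α ≠ 0)
    (hβ : β ≠ 0) (hq1 : q ≠ 1) {v : V} (hv0 : v ≠ 0)
    (hv : ∀ l < n, jm q T l v = c l • v) (h : ∀ m, trPow (α * β) q T n m v = 0) {x : K}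
    (hx : x ≠ 0) :
    2 * #{l ∈ range n | x = c l} ≤
      (if x = α then 1 else 0) + (if x = β then 1 else 0) +
      (#{l ∈ range n | x = q * c l} +
        #{l ∈ range n | x = q⁻¹ * c l}) := by
  obtain ⟨τ, hτ, hgen⟩ := hT.exists_trPow_genFun hq hα hβ hq1 hv0 hv le_rfl
  have hτ0 : ∀ m, τ m = 0 := fun m =>
    (smul_eq_zero.1 ((hτ m).symm.trans (h m))).resolve_right hv0
  set γ := q * (α * β * (q - 1) ^ 2)⁻¹ with hγ
  have hγ0 : γ ≠ 0 := mul_ne_zero hq (inv_ne_zero (mul_ne_zero (mul_ne_zero hα hβ)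
    (pow_ne_zero _ (sub_ne_zero.2 hq1))))
  set A := α + β + (q - 2 + q⁻¹) * ∑ l ∈ range n, c l
  let p : K[X] := 1 - C A * X + C (α * β) * X ^ 2
  have hmk : PowerSeries.mk (trSeq γ A (α * β) τ) = ((C γ * p : K[X]) : PowerSeries K) := by
    ext m
    rw [PowerSeries.coeff_mk, Polynomial.coeff_coe, Polynomial.coeff_C_mul]
    simp only [p, Polynomial.coeff_add, Polynomial.coeff_sub, Polynomial.coeff_one,
      Polynomial.coeff_C_mul, Polynomial.coeff_X, Polynomial.coeff_X_pow]
    rcases m with _ | _ | _ | m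
    · simp [trSeq]
    · simp [trSeq]
    · simp [trSeq, hτ0]
    · simp [trSeq, hτ0]
  rw [hmk, ← Polynomial.coe_C, ← Polynomial.coe_mul, ← Polynomial.coe_mul, Polynomial.coe_inj] at hgen
  have hpol : revPoly (dblRoots c n) * p = revPoly (wtRoots α β q c n) := by
    refine mul_left_cancel₀ (Polynomial.C_ne_zero.2 hγ0) ?_
    rw [← hgen]; ring
  have := congrArg (Polynomial.rootMultiplicity x⁻¹) hpol
  rw [rootMultiplicity_mul (by rw [hpol]; exact revPoly_ne_zero _),
    rootMultiplicity_revPoly hx, rootMultiplicity_revPoly hx, count_dblRoots, count_wtRoots] at this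
  omega

end Dominance

section Concave

theorem sub_le_of_forall_two_mul_le {h s : ℤ → ℤ} {l r : ℤ} (hlr : l < r)
    (hD : ∀ j, l < j → j < r → 2 * h j ≤ h (j - 1) + h (j + 1) + s j) :
    h (l + 1) - h l - (h r - h (r - 1)) ≤ ∑ j ∈ Ioo l r, s j := by
  obtain ⟨d, rfl⟩ : ∃ d : ℕ, r = l + 1 + d := ⟨(r - l - 1).toNat, by omega⟩
  induction d with
  | zero =>
    have : Ioo l (l + 1 + (0 : ℕ)) = ∅ := by
      ext x; simp
    rw [this]; simp
  | succ d ih =>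
    have : Ioo l (l + 1 + (d + 1 : ℕ)) = insert (l + 1 + (d : ℤ)) (Ioo l (l + 1 + d)) := by
      ext x; simp; omega
    rw [this, sum_insert (by simp)]
    have h1 := ih (by omega) fun j hj hj' => hD j hj (by push_cast; omega)
    have h2 := hD (l + 1 + d) (by omega) (by push_cast; omega)
    push_cast
    rw [show l + 1 + ((d : ℤ) + 1) - 1 = l + 1 + d by ring]
    rw [show l + 1 + ((d : ℤ) + 1) = l + 1 + d + 1 by ring]
    linarith

variable {h : ℤ → ℤ} {l r lo hi : ℤ}

/-- A function with second differences bounded below by minus two unit masses, zero at the ends of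
an interval, positive next to them, is constant between the masses. -/
theorem eq_of_forall_two_mul_le (h1 : l < lo) (h2 : lo ≤ hi) (h3 : hi < r)
    (hD : ∀ j, l < j → j < r → 2 * h j ≤ h (j - 1) + h (j + 1) +
      ((if j = lo then 1 else 0) + (if j = hi then 1 else 0)))
    (hl : h l < h (l + 1)) (hr : h r < h (r - 1)) :
    (∀ j, lo ≤ j → j ≤ hi → h j = h lo) ∧ h (lo - 1) = h lo - 1 ∧ h (hi + 1) = h lo - 1 := by
  have key : ∀ a b, l ≤ a → a < b → b ≤ r → h (a + 1) - h a - (h b - h (b - 1)) ≤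
      (if a < lo ∧ lo < b then 1 else 0) + (if a < hi ∧ hi < b then 1 else 0) := by
    intro a b ha hab hb
    have := sub_le_of_forall_two_mul_le hab fun j hj hj' => hD j (by omega) (by omega)
    rw [Finset.sum_add_distrib] at this
    simpa [Finset.sum_ite_eq', Finset.mem_Ioo] using this
  have hslope : ∀ a, lo ≤ a → a < hi → h (a + 1) = h a := by
    intro a ha ha'
    have e1 := key l (a + 1) le_rfl (by omega) (by omega)
    have e2 := key a r (by omega) (by omega) le_rfl
    rw [if_pos (by omega), if_neg (by omega)] at e1
    rw [if_neg (by omega), if_pos (by omega)] at e2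
    rw [show a + 1 - 1 = a by ring] at e1
    omega
  have hconst : ∀ j, lo ≤ j → j ≤ hi → h j = h lo := by
    intro j hj
    induction j, hj using Int.leInduction with
    | base => exact fun _ => rfl
    | succ j hj ih => exact fun hj' => (hslope j hj (by omega)).trans (ih (by omega))
  have e1 := key l lo le_rfl h1 (by omega)
  rw [if_neg (by omega), if_neg (by omega)] at e1
  have e2 := key hi r (by omega) (by omega) le_rfl
  rw [if_neg (by omega), if_neg (by omega)] at e2
  have e3 := key (lo - 1) r (by omega) (by omega) le_rfl
  rw [if_pos (by omega), if_pos (by omega), show lo - 1 + 1 = lo by ring] at e3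
  have e4 := key l (hi + 1) le_rfl (by omega) (by omega)
  rw [if_pos (by omega), if_pos (by omega), show hi + 1 - 1 = hi by ring] at e4
  have := hconst hi h2 le_rfl
  refine ⟨hconst, by omega, by omega⟩

end Concave

section Balanced

variable [DecidableEq K]

theorem sum_card_filter_le {s : Finset ℤ} (hγ : γ ≠ 0)
    (hinj : ∀ a ∈ s, ∀ b ∈ s, q ^ a = q ^ b → a = b) :
    ∑ j ∈ s, #{l ∈ range n | γ * q ^ j = c l} ≤ n := by
  simp only [Finset.card_filter]
  rw [Finset.sum_comm]
  calc _ ≤ ∑ _l ∈ range n, 1 := Finset.sum_le_sum fun l _ => ?_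
    _ = n := by simp
  rw [← Finset.card_filter, card_le_one]
  intro a ha b hb
  rw [mem_filter] at ha hb
  exact hinj a ha.1 b hb.1 (mul_left_cancel₀ hγ (ha.2.trans hb.2.symm))

theorem exists_Ioo_card_filter_pos (hq : q ≠ 0) (hE : ∀ j : ℕ, 0 < j → j < n + 1 → q ^ j ≠ 1)
    {γ : K} (hγ : γ ≠ 0) (h0 : 0 < #{l ∈ range n | γ = c l}) :
    ∃ l r : ℤ, l < 0 ∧ 0 < r ∧ r - l ≤ n + 1 ∧
      #{i ∈ range n | γ * q ^ l = c i} = 0 ∧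
      #{i ∈ range n | γ * q ^ r = c i} = 0 ∧
      ∀ j, l < j → j < r → 0 < #{i ∈ range n | γ * q ^ j = c i} := by
  set N : ℤ → ℕ := fun j => #{i ∈ range n | γ * q ^ j = c i} with hN
  have hwin : ∀ a : ℤ, ∃ j, a ≤ j ∧ j < a + n + 1 ∧ N j = 0 := by
    intro a
    by_contra! H
    have h1 : ∑ j ∈ Ico a (a + n + 1), N j ≤ n :=
      sum_card_filter_le hγ fun x hx y hy h => by
        rw [mem_Ico] at hx hy
        exact (zpow_eq_zpow_iff_of_lt hq hE (by push_cast; omega) (by push_cast; omega)).1 h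
    have h2 : ∑ _j ∈ Ico a (a + n + 1), 1 ≤ ∑ j ∈ Ico a (a + n + 1), N j :=
      Finset.sum_le_sum fun j hj => by
        rw [mem_Ico] at hj
        exact Nat.one_le_iff_ne_zero.2 (H j hj.1 hj.2)
    rw [Finset.sum_const, smul_eq_mul, mul_one, Int.card_Ico] at h2
    omega
  have hN0 : N 0 ≠ 0 := by simpa [hN] using h0.ne'
  have hr : ∃ r : ℕ, N r = 0 := by
    obtain ⟨j, hj, -, h⟩ := hwin 0
    exact ⟨j.toNat, by rwa [Int.toNat_of_nonneg hj]⟩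
  have hl : ∃ l : ℕ, N (-l) = 0 := by
    obtain ⟨j, -, hj, h⟩ := hwin (-n)
    exact ⟨(-j).toNat, by rwa [Int.toNat_of_nonneg (by omega), neg_neg]⟩
  classical
  have hr1 := Nat.find_spec hr
  have hl1 := Nat.find_spec hl
  have hr2 : 0 < Nat.find hr := Nat.pos_of_ne_zero fun h => hN0 (by rw [h] at hr1; simpa using hr1)
  have hl2 : 0 < Nat.find hl := Nat.pos_of_ne_zero fun h => hN0 (by rw [h] at hl1; simpa using hl1)
  have hpos : ∀ j : ℤ, -(Nat.find hl : ℤ) < j → j < Nat.find hr → 0 < N j := by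
    intro j hj hj'
    rcases le_total 0 j with h | h
    · have := Nat.find_min hr (m := j.toNat) (by omega)
      rw [Int.toNat_of_nonneg h] at this
      exact Nat.pos_of_ne_zero this
    · have := Nat.find_min hl (m := (-j).toNat) (by omega)
      rw [Int.toNat_of_nonneg (by omega), neg_neg] at this
      exact Nat.pos_of_ne_zero this
  refine ⟨-(Nat.find hl : ℤ), Nat.find hr, by omega, by omega, ?_, hl1, hr1, hpos⟩
  obtain ⟨j, hj, hj', h⟩ := hwin (-(Nat.find hl : ℤ) + 1)
  by_contra! hlt
  exact (hpos j (by omega) (by omega)).ne' h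

theorem exists_eq_one_of_balanced (hq : q ≠ 0) (hE : ∀ j : ℕ, 0 < j → j < n + 1 → q ^ j ≠ 1)
    (hdom : ∀ x : K, x ≠ 0 → 2 * #{l ∈ range n | x = c l} ≤
      (if x = 1 then 1 else 0) + (if x = q ^ f then 1 else 0) +
      (#{l ∈ range n | x = q * c l} +
        #{l ∈ range n | x = q⁻¹ * c l}))
    {γ : K} (hγ : γ ≠ 0) (h0 : 0 < #{l ∈ range n | γ = c l}) :
    ∃ l r : ℤ, l < 0 ∧ 0 < r ∧ r - l ≤ n + 1 ∧
      #{i ∈ range n | γ * q ^ l = c i} = 0 ∧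
      #{i ∈ range n | γ * q ^ r = c i} = 0 ∧
      (∀ j, l < j → j < r → 0 < #{i ∈ range n | γ * q ^ j = c i}) ∧
      (∃ p, l < p ∧ p < r ∧ γ * q ^ p = 1) ∧ (∃ p, l < p ∧ p < r ∧ γ * q ^ p = q ^ f) ∧
      ∀ j : ℤ, 2 * (#{i ∈ range n | γ * q ^ j = c i} : ℤ) ≤
        ((range n).filter fun i => γ * q ^ (j - 1) = c i).card +
        ((range n).filter fun i => γ * q ^ (j + 1) = c i).card +
        ((if γ * q ^ j = 1 then 1 else 0) + (if γ * q ^ j = q ^ f then 1 else 0)) := by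
  obtain ⟨l, r, hl, hr, hlr, hNl, hNr, hpos⟩ := exists_Ioo_card_filter_pos hq hE hγ h0
  set N : ℤ → ℕ := fun j => #{i ∈ range n | γ * q ^ j = c i} with hN
  have hD : ∀ j, 2 * (N j : ℤ) ≤ N (j - 1) + N (j + 1) +
      ((if γ * q ^ j = 1 then 1 else 0) + (if γ * q ^ j = q ^ f then 1 else 0)) := by
    intro j
    have h1 := hdom (γ * q ^ j) (mul_ne_zero hγ (zpow_ne_zero _ hq))
    have e1 : ∀ i, γ * q ^ j = q * c i ↔ γ * q ^ (j - 1) = c i := fun i => by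
      rw [zpow_sub_one₀ hq, ← mul_assoc, mul_inv_eq_iff_eq_mul₀ hq, mul_comm q]
    have e2 : ∀ i, γ * q ^ j = q⁻¹ * c i ↔ γ * q ^ (j + 1) = c i := fun i => by
      rw [zpow_add_one₀ hq, ← mul_assoc, eq_inv_mul_iff_mul_eq₀ hq, mul_comm q]
    simp only [e1, e2] at h1
    zify at h1
    rw [add_comm] at h1
    exact h1
  have hsum := sub_le_of_forall_two_mul_le (h := fun j => (N j : ℤ)) (show l < r by omega)
    fun j _ _ => hD j
  have e1 := hpos (l + 1) (by omega) (by omega)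
  have e2 := hpos (r - 1) (by omega) (by omega)
  have hone : ∀ x : K, ∑ j ∈ Ioo l r, (if γ * q ^ j = x then (1 : ℤ) else 0) ≤ 1 := by
    intro x
    rw [← Finset.sum_filter, Finset.sum_const, nsmul_eq_mul, mul_one, ← Nat.cast_one, Nat.cast_le,
      card_le_one]
    intro a ha b hb
    simp only [mem_filter, Finset.mem_Ioo] at ha hb
    exact (zpow_eq_zpow_iff_of_lt hq hE (by push_cast; omega) (by push_cast; omega)).1
      (mul_left_cancel₀ hγ (ha.2.trans hb.2.symm))
  have hex : ∀ x : K, 0 < ∑ j ∈ Ioo l r, (if γ * q ^ j = x then (1 : ℤ) else 0) →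
      ∃ p, l < p ∧ p < r ∧ γ * q ^ p = x := by
    intro x hx
    obtain ⟨p, hp, hp'⟩ := Finset.exists_ne_zero_of_sum_ne_zero hx.ne'
    rw [Finset.mem_Ioo] at hp
    exact ⟨p, hp.1, hp.2, by by_contra H; simp [H] at hp'⟩
  rw [Finset.sum_add_distrib] at hsum
  have h1 := hone 1
  have h2 := hone (q ^ f)
  have e3 : (N l : ℤ) = 0 := by exact_mod_cast hNl
  have e4 : (N r : ℤ) = 0 := by exact_mod_cast hNr
  refine ⟨l, r, hl, hr, hlr, hNl, hNr, hpos, hex 1 ?_, hex _ ?_, hD⟩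
  all_goals
    zify at e1 e2
    change 0 < (N (l + 1) : ℤ) at e1
    change 0 < (N (r - 1) : ℤ) at e2
    linarith

/-- A balanced family of weights is a string joining the two parameters. -/
theorem exists_string_of_balanced (hq : q ≠ 0) (hE : ∀ j : ℕ, 0 < j → j < n + 2 → q ^ j ≠ 1)
    (hf : ∀ j : ℕ, 0 < j → j < 2 * f → q ^ j ≠ 1) (hnf : n + 1 < 2 * f + 4) (hc : ∀ l < n + 1, c l ≠ 0)
    (hdom : ∀ x : K, x ≠ 0 → 2 * #{l ∈ range (n + 1) | x = c l} ≤
      (if x = 1 then 1 else 0) + (if x = q ^ f then 1 else 0) +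
      (#{l ∈ range (n + 1) | x = q * c l} +
        #{l ∈ range (n + 1) | x = q⁻¹ * c l})) :
    ∃ α : K, ((α = 1 ∧ α * q ^ n = q ^ f) ∨ (α = q ^ f ∧ α * q ^ n = 1)) ∧
      (∀ l < n + 1, ∃ j ≤ n, c l = α * q ^ j) ∧ ∀ j ≤ n, ∃ l < n + 1, c l = α * q ^ j := by
  have hpos : ∀ i < n + 1, 0 < #{l ∈ range (n + 1) | c i = c l} := fun i hi =>
    one_le_card_filter i hi rfl
  have h1 : 0 < ((range (n + 1)).filter fun l => (1 : K) = c l).card := by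
    obtain ⟨l, r, -, -, -, -, -, hp, ⟨p, hp1, hp2, h⟩, -⟩ :=
      exists_eq_one_of_balanced hq hE hdom (hc 0 (by omega)) (hpos 0 (by omega))
    simpa only [h] using hp p hp1 hp2
  obtain ⟨l, r, hl, hr, hlr, hNl, hNr, hp, -, ⟨p, hp1, hp2, hpf⟩, hD⟩ :=
      exists_eq_one_of_balanced hq hE hdom one_ne_zero h1
  simp only [one_mul] at hNl hNr hp hpf hD
  set N : ℤ → ℕ := fun j => #{i ∈ range (n + 1) | q ^ j = c i} with hN
  have hzp : ∀ a b : ℤ, a - b < n + 2 → b - a < n + 2 → (q ^ a = q ^ b ↔ a = b) := fun a b h h' =>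
    zpow_eq_zpow_iff_of_lt hq hE (by push_cast; omega) (by push_cast; omega)
  have hpf' : (f : ℤ) ≤ |p| := by
    by_contra! hlt
    obtain ⟨j, hj⟩ : ∃ j : ℕ, (f : ℤ) - p = j := ⟨((f : ℤ) - p).toNat, by
      rw [Int.toNat_of_nonneg]; have := abs_lt.1 hlt; omega⟩
    have hb := abs_lt.1 hlt
    refine hf j (by omega) (by omega) ?_
    rw [← zpow_natCast, ← hj, zpow_sub₀ hq, hpf, zpow_natCast, div_self (pow_ne_zero _ hq)]
  obtain ⟨lo, hi, hlohi, hcase⟩ : ∃ lo hi : ℤ, lo ≤ hi ∧ ((lo = 0 ∧ hi = p) ∨ (lo = p ∧ hi = 0)) := by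
    rcases le_total 0 p with h | h
    · exact ⟨0, p, h, Or.inl ⟨rfl, rfl⟩⟩
    · exact ⟨p, 0, h, Or.inr ⟨rfl, rfl⟩⟩
  have hwidth : (f : ℤ) ≤ hi - lo := by
    rcases hcase with ⟨rfl, rfl⟩ | ⟨rfl, rfl⟩
    · rwa [abs_of_nonneg hlohi, ← sub_zero hi] at hpf'
    · rwa [abs_of_nonpos hlohi, ← zero_sub lo] at hpf'
  have hllo : l < lo := by omega
  have hhir : hi < r := by omega
  obtain ⟨hconst, hlo1, hhi1⟩ := eq_of_forall_two_mul_le (h := fun j => (N j : ℤ)) hllo hlohi hhir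
    (fun j hj hj' => by
      have := hD j
      have e1 : q ^ j = 1 ↔ j = 0 := by rw [← zpow_zero q, hzp j 0 (by omega) (by omega)]
      have e2 : q ^ j = q ^ f ↔ j = p := by rw [← hpf, hzp j p (by omega) (by omega)]
      simp only [e1, e2] at this
      rcases hcase with ⟨rfl, rfl⟩ | ⟨rfl, rfl⟩
      · exact this
      · rw [add_comm (if j = lo then (1 : ℤ) else 0)]; exact this)
    (by
      have := hp (l + 1) (by omega) (by omega)
      change (N l : ℤ) < N (l + 1)
      have e : N l = 0 := hNl
      change 0 < N (l + 1) at this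
      omega)
    (by
      have := hp (r - 1) (by omega) (by omega)
      change (N r : ℤ) < N (r - 1)
      have e : N r = 0 := hNr
      change 0 < N (r - 1) at this
      omega)
  have hsum : ∀ s : Finset ℤ, (∀ j ∈ s, l < j ∧ j < r) → ∑ j ∈ s, N j ≤ n + 1 := fun s hs => by
    have := sum_card_filter_le (q := q) (s := s) (n := n + 1) (c := c) one_ne_zero fun a ha b hb h =>
      (hzp a b (by have := hs a ha; have := hs b hb; omega)
        (by have := hs a ha; have := hs b hb; omega)).1 h
    simpa only [one_mul] using this
  have hlopos : 0 < N lo := hp lo hllo (by omega)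
  have hsum1 : ∑ j ∈ Icc lo hi, N j = N lo * (hi - lo + 1).toNat := by
    rw [sum_congr rfl fun j hj => ?_, Finset.sum_const, Int.card_Icc, smul_eq_mul, mul_comm]
    · congr 2; omega
    · rw [mem_Icc] at hj
      exact_mod_cast hconst j hj.1 hj.2
  have hNlo : N lo = 1 := by
    by_contra hne
    have h2 : 2 ≤ N lo := by omega
    have hl' : l < lo - 1 := by
      by_contra hge
      have : lo - 1 = l := by omega
      have e : N l = 0 := hNl
      rw [this, e] at hlo1
      omega
    have hr' : hi + 1 < r := by
      by_contra hge
      have : hi + 1 = r := by omega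
      have e : N r = 0 := hNr
      rw [this, e] at hhi1
      omega
    have hins : Icc (lo - 1) (hi + 1) = insert (lo - 1) (insert (hi + 1) (Icc lo hi)) := by
      ext x; simp only [mem_Icc, mem_insert]; omega
    have h3 := hsum (Icc (lo - 1) (hi + 1)) fun j hj => by
      rw [mem_Icc] at hj; omega
    rw [hins, sum_insert (by simp only [mem_insert, mem_Icc]; omega),
      sum_insert (by simp only [mem_Icc]; omega), hsum1] at h3
    have h4 : 2 * (f + 1) ≤ N lo * (hi - lo + 1).toNat := Nat.mul_le_mul h2 (by omega)
    omega
  have hl1 : l = lo - 1 := by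
    by_contra hne
    have : 0 < N (lo - 1) := hp (lo - 1) (by omega) (by omega)
    omega
  have hr1 : r = hi + 1 := by
    by_contra hne
    have : 0 < N (hi + 1) := hp (hi + 1) (by omega) (by omega)
    omega
  have hmem : ∀ i < n + 1, ∃ j ∈ Icc lo hi, q ^ j = c i := by
    intro i hi'
    obtain ⟨l', r', hl', hr', -, -, -, hp', ⟨p', hp1', hp2', h⟩, -⟩ :=
      exists_eq_one_of_balanced hq hE hdom (hc i hi') (hpos i hi')
    have hci : ∀ j : ℤ, c i * q ^ (p' + j) = q ^ j := fun j => by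
      rw [zpow_add₀ hq, ← mul_assoc, h, one_mul]
    have hbet : ∀ j : ℤ, l' < p' + j → p' + j < r' → N j ≠ 0 := fun j hj hj' => by
      have := (hp' _ hj hj').ne'
      simpa only [hci] using this
    refine ⟨-p', mem_Icc.2 ⟨?_, ?_⟩, by simpa using (hci (-p')).symm⟩
    · by_contra hlt
      exact hbet l (by omega) (by omega) hNl
    · by_contra hlt
      exact hbet r (by omega) (by omega) hNr
  have hlen : hi - lo = n := by
    have h3 := hsum (Icc lo hi) fun j hj => by
      rw [mem_Icc] at hj; omega
    have h4 : n + 1 ≤ ∑ j ∈ Icc lo hi, N j := by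
      simp only [hN, Finset.card_filter]
      rw [Finset.sum_comm]
      calc n + 1 = ∑ _l ∈ range (n + 1), 1 := by simp
        _ ≤ _ := Finset.sum_le_sum fun i hi' => ?_
      obtain ⟨j, hj, hj'⟩ := hmem i (mem_range.1 hi')
      calc 1 = if q ^ j = c i then 1 else 0 := by rw [if_pos hj']
        _ ≤ _ := Finset.single_le_sum (f := fun j => if q ^ j = c i then 1 else 0)
          (fun _ _ => Nat.zero_le _) hj
    rw [hsum1, hNlo] at h3 h4
    omega
  have hpow : ∀ j : ℕ, q ^ lo * q ^ j = q ^ (lo + j) := fun j => by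
    rw [zpow_add₀ hq, zpow_natCast]
  refine ⟨q ^ lo, ?_, fun i hi' => ?_, fun j hj => ?_⟩
  · rw [hpow, ← hlen, add_sub_cancel]
    rcases hcase with ⟨rfl, rfl⟩ | ⟨rfl, rfl⟩
    · exact Or.inl ⟨zpow_zero q, hpf⟩
    · exact Or.inr ⟨hpf, zpow_zero q⟩
  · obtain ⟨j, hj, h⟩ := hmem i hi'
    rw [mem_Icc] at hj
    refine ⟨(j - lo).toNat, by omega, ?_⟩
    rw [hpow, ← h, Int.toNat_of_nonneg (by omega), add_sub_cancel]
  · have : 0 < N (lo + j) := hp _ (by omega) (by omega)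
    obtain ⟨i, hi'⟩ := Finset.card_pos.1 this
    rw [mem_filter, mem_range] at hi'
    exact ⟨i, hi'.1, by rw [hpow, hi'.2]⟩

end Balanced

/-- The subalgebra generated by the first `k` members of a sequence. -/
def genAlg (K : Type*) {A : Type*} [Field K] [Ring A] [Algebra K A] (T : ℕ → A) (k : ℕ) :
    Subalgebra K A :=
  Algebra.adjoin K {x | ∃ i < k, x = T i}

section GenAlg

variable {T : ℕ → A}

theorem mem_genAlg (h : i < k) : T i ∈ genAlg K T k :=
  Algebra.subset_adjoin ⟨i, h, rfl⟩

theorem genAlg_mono (h : k ≤ l) : genAlg K T k ≤ genAlg K T l :=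
  Algebra.adjoin_mono fun _ ⟨i, hi, hx⟩ => ⟨i, hi.trans_le h, hx⟩

theorem jm_mem_genAlg : ∀ {k : ℕ}, k < l → jm q T k ∈ genAlg K T l
  | 0, h => mem_genAlg h
  | k + 1, h => (genAlg K T l).smul_mem
      (mul_mem (mul_mem (mem_genAlg h) (jm_mem_genAlg (by omega))) (mem_genAlg h)) _

theorem aeval_mem_subalgebra {B : Subalgebra K A} {a : A} (ha : a ∈ B) (p : K[X]) :
    aeval a p ∈ B := by
  have h : aeval a p = B.val (aeval (⟨a, ha⟩ : B) p) := by
    rw [← Polynomial.aeval_algHom_apply]; rfl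
  rw [h]
  exact (aeval (⟨a, ha⟩ : B) p).2

theorem commute_of_mem_genAlg {x y : A} (h : ∀ i < k, Commute (T i) y)
    (hx : x ∈ genAlg K T k) : Commute x y := by
  refine Algebra.adjoin_induction (p := fun x _ => Commute x y) ?_ ?_ ?_ ?_ hx
  · rintro _ ⟨i, hi, rfl⟩
    exact h i hi
  · intro r
    exact Algebra.commutes r y
  · intro _ _ _ _ h1 h2
    exact h1.add_left h2
  · intro _ _ _ _ h1 h2
    exact h1.mul_left h2

theorem IsHecke.commute_genAlg_jm (hT : IsHecke α β q n T) (hkl : k ≤ l) (hl : l < n)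
    {x : A} (hx : x ∈ genAlg K T k) : Commute x (jm q T l) :=
  commute_of_mem_genAlg (fun _ hi => hT.commute_jm_of_lt (by omega) hl) hx

theorem IsHecke.commute_genAlg (hT : IsHecke α β q n T) (hkl : k < l) (hl : l < n)
    {x : A} (hx : x ∈ genAlg K T k) : Commute x (T l) :=
  commute_of_mem_genAlg (fun _ hi => hT.comm _ _ (by omega) hl) hx

/-- The Mackey decomposition for consecutive subalgebras of a Hecke algebra of type `B`. -/
theorem IsHecke.genAlg_succ_le (hT : IsHecke α β q n T) (hq : q ≠ 0) (hk : k < n)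
    (N : Submodule K A) (hL : ∀ y ∈ genAlg K T k, ∀ j : ℕ, y * jm q T k ^ j ∈ N)
    (hTk : 0 < k → ∀ y ∈ genAlg K T k, ∀ z ∈ genAlg K T k, y * T k * z ∈ N) :
    ∀ x ∈ genAlg K T (k + 1), x ∈ N := by
  induction k generalizing N with
  | zero =>
    intro x hx
    have key : ∃ p : K[X], x = aeval (jm q T 0) p := by
      have h : genAlg K T 1 ≤ (aeval (R := K) (jm q T 0)).range := by
        refine Algebra.adjoin_le ?_
        rintro _ ⟨i, hi, rfl⟩
        obtain rfl : i = 0 := by omega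
        exact ⟨X, by simp [jm]⟩
      obtain ⟨p, hp⟩ := h hx
      exact ⟨p, hp.symm⟩
    obtain ⟨p, rfl⟩ := key
    rw [Polynomial.aeval_eq_sum_range]
    exact N.sum_mem fun j _ => N.smul_mem _ (by simpa using hL 1 (one_mem _) j)
  | succ k ih =>
    set a := jm q T k
    set b := jm q T (k + 1)
    set t := T (k + 1)
    have hp : HPair q t a b := hT.hPair hq hk
    have ha : a ∈ genAlg K T (k + 1) := jm_mem_genAlg (lt_succ_self k)
    set S : Set A := {x | (∃ y ∈ genAlg K T (k + 1), ∃ j : ℕ, x = y * b ^ j) ∨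
      ∃ y ∈ genAlg K T (k + 1), ∃ z ∈ genAlg K T (k + 1), x = y * t * z}
    set M := Submodule.span K S
    have hMN : M ≤ N := by
      refine Submodule.span_le.2 ?_
      rintro _ (⟨y, hy, j, rfl⟩ | ⟨y, hy, z, hz, rfl⟩)
      · exact hL y hy j
      · exact hTk (Nat.succ_pos k) y hy z hz
    have hMb : ∀ y ∈ genAlg K T (k + 1), ∀ j : ℕ, y * b ^ j ∈ M := fun y hy j =>
      Submodule.subset_span (Or.inl ⟨y, hy, j, rfl⟩)
    have hMt : ∀ y ∈ genAlg K T (k + 1), ∀ z ∈ genAlg K T (k + 1), y * t * z ∈ M :=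
      fun y hy z hz => Submodule.subset_span (Or.inr ⟨y, hy, z, hz, rfl⟩)
    have hcb : ∀ y ∈ genAlg K T (k + 1), Commute y b := fun y hy =>
      hT.commute_genAlg_jm le_rfl hk hy
    have hind : ∀ g : A →ₗ[K] A, (∀ y ∈ genAlg K T (k + 1), ∀ j : ℕ, g (y * b ^ j) ∈ M) →
        (∀ y ∈ genAlg K T (k + 1), ∀ z ∈ genAlg K T (k + 1), g (y * t * z) ∈ M) →
        ∀ x ∈ M, g x ∈ M := by
      intro g h1 h2 x hx
      have : M ≤ M.comap g := by
        refine Submodule.span_le.2 ?_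
        rintro _ (⟨y, hy, j, rfl⟩ | ⟨y, hy, z, hz, rfl⟩)
        · exact h1 y hy j
        · exact h2 y hy z hz
      exact this hx
    have hleft : ∀ u ∈ genAlg K T (k + 1), ∀ x ∈ M, u * x ∈ M := fun u hu =>
      hind (LinearMap.mulLeft K u)
        (fun y hy j => by
          simpa only [mulLeft_apply, mul_assoc] using hMb _ (mul_mem hu hy) j)
        (fun y hy z hz => by
          simpa only [mulLeft_apply, mul_assoc] using hMt _ (mul_mem hu hy) z hz)
    have hright : ∀ u ∈ genAlg K T (k + 1), ∀ x ∈ M, x * u ∈ M := fun u hu =>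
      hind (LinearMap.mulRight K u)
        (fun y hy j => by
          have := hMb _ (mul_mem hy hu) j
          rwa [mul_assoc, ((hcb u hu).pow_right j).eq, ← mul_assoc] at this)
        (fun y hy z hz => by
          simpa only [mulRight_apply, mul_assoc] using hMt _ hy _ (mul_mem hz hu))
    have hb : ∀ x ∈ M, b * x ∈ M := by
      refine hind (LinearMap.mulLeft K b) (fun y hy j => ?_) (fun y hy z hz => ?_)
      · have := hMb y hy (j + 1)
        rwa [pow_succ', ← mul_assoc, (hcb y hy).eq, mul_assoc] at this
      · have h1 := hMt y hy _ (mul_mem ha hz)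
        have h2 := hMb _ (mul_mem hy hz) 1
        have h3 : b * (y * t * z) = y * t * (a * z) + (q - 1) • (y * z * b ^ 1) := by
          rw [pow_one, mul_assoc y z b, (hcb z hz).eq, ← mul_assoc y b z, mul_assoc y t z,
            ← mul_assoc b, ← (hcb y hy).eq, mul_assoc y b, ← mul_assoc b t z, hp.bT]
          simp only [mul_add, add_mul, smul_mul_assoc, mul_smul_comm, mul_assoc]
        rw [mulLeft_apply, h3]
        exact M.add_mem h1 (M.smul_mem _ h2)
    have htb : ∀ j : ℕ, ∀ y ∈ genAlg K T (k + 1), t * (y * b ^ j) ∈ M := by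
      intro j
      induction j with
      | zero =>
        intro y hy
        simpa using hMt 1 (one_mem _) y hy
      | succ j ihj =>
        intro y hy
        have h3 : t * (y * b ^ (j + 1)) = a * (t * (y * b ^ j)) + (q - 1) • (y * b ^ (j + 1)) := by
          rw [pow_succ', ← mul_assoc y b, (hcb y hy).eq, mul_assoc b, ← mul_assoc t b, hp.Tb]
          simp only [add_mul, smul_mul_assoc, mul_assoc]
        rw [h3]
        exact M.add_mem (hleft a ha _ (ihj y hy)) (M.smul_mem _ (hMb y hy _))
    have hat : ∀ j : ℕ, t * a ^ j * t ∈ M := by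
      intro j
      induction j with
      | zero =>
        rw [pow_zero, mul_one, hp.quad]
        refine M.add_mem (M.smul_mem _ ?_) (M.smul_mem _ ?_)
        · simpa using hMt 1 (one_mem _) 1 (one_mem _)
        · simpa using hMb 1 (one_mem _) 0
      | succ j ihj =>
        have h1 : t * a = b * t - (q - 1) • b := by rw [hp.bT]; abel
        have h3 : t * a ^ (j + 1) * t = b * (t * a ^ j * t) - (q - 1) • (b * (a ^ j * t)) := by
          rw [pow_succ', ← mul_assoc, h1]
          simp only [sub_mul, smul_mul_assoc, mul_assoc]
        rw [h3]
        refine M.sub_mem (hb _ ihj) (M.smul_mem _ (hb _ ?_))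
        simpa using hMt _ (pow_mem ha j) 1 (one_mem _)
    have htt : ∀ y ∈ genAlg K T (k + 1), t * y * t ∈ M := by
      intro y hy
      refine ih (by omega) (M.comap (LinearMap.mulRight K t ∘ₗ LinearMap.mulLeft K t)) ?_ ?_ y hy
      · intro y1 hy1 j
        have hc : Commute y1 t := hT.commute_genAlg (lt_succ_self k) hk hy1
        have h3 : t * (y1 * a ^ j) * t = y1 * (t * a ^ j * t) := by
          rw [← mul_assoc t, ← hc.eq]; simp only [mul_assoc]
        rw [Submodule.mem_comap, comp_apply, mulLeft_apply,
          mulRight_apply, h3]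
        exact hleft _ (genAlg_mono (Nat.le_succ k) hy1) _ (hat j)
      · intro hk0 y1 hy1 z1 hz1
        have hc : Commute y1 t := hT.commute_genAlg (lt_succ_self k) hk hy1
        have hc' : Commute z1 t := hT.commute_genAlg (lt_succ_self k) hk hz1
        have hbr := hT.braid k hk0 hk
        have h3 : t * (y1 * T k * z1) * t = (y1 * T k) * t * (T k * z1) := by
          calc t * (y1 * T k * z1) * t = (t * y1) * T k * (z1 * t) := by simp only [mul_assoc]
            _ = y1 * (t * T k * t) * z1 := by rw [← hc.eq, hc'.eq]; simp only [mul_assoc]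
            _ = _ := by rw [hbr]; simp only [mul_assoc, t]
        rw [Submodule.mem_comap, comp_apply, mulLeft_apply,
          mulRight_apply, h3]
        have h4 : T k ∈ genAlg K T (k + 1) := mem_genAlg (lt_succ_self k)
        exact hMt _ (mul_mem (genAlg_mono (Nat.le_succ k) hy1) h4) _
          (mul_mem h4 (genAlg_mono (Nat.le_succ k) hz1))
    have ht : ∀ x ∈ M, t * x ∈ M :=
      hind (LinearMap.mulLeft K t) (fun y hy j => htb j y hy) fun y hy z hz => by
        have := hright z hz _ (htt y hy)
        simpa only [mulLeft_apply, mul_assoc] using this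
    intro x hx
    have hstab : ∀ m ∈ M, x * m ∈ M := by
      refine Algebra.adjoin_induction (p := fun x _ => ∀ m ∈ M, x * m ∈ M) ?_ ?_ ?_ ?_ hx
      · rintro _ ⟨i, hi, rfl⟩
        rcases lt_succ_iff_lt_or_eq.1 hi with h | rfl
        · exact hleft _ (mem_genAlg h)
        · exact ht
      · intro r m hm
        rw [← Algebra.smul_def]
        exact M.smul_mem r hm
      · intro u v _ _ hu hv m hm
        rw [add_mul]
        exact M.add_mem (hu m hm) (hv m hm)
      · intro u v _ _ hu hv m hm
        rw [mul_assoc]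
        exact hu _ (hv m hm)
    have h1 : (1 : A) ∈ M := by simpa using hMb 1 (one_mem _) 0
    simpa using hMN (hstab 1 h1)

end GenAlg

/-- The word `d 0, …, d (k - 1)` lists letters of `{0, …, m}`, each being either the smallest or
the largest letter not yet listed, and `b` of them are smallest letters. -/
inductive IsWord (m : ℕ) (d : ℕ → ℕ) : ℕ → ℕ → Prop
  | nil : IsWord m d 0 0
  | left {k b : ℕ} : IsWord m d k b → d k = b → IsWord m d (k + 1) (b + 1)
  | right {k b : ℕ} : IsWord m d k b → d k + (k - b) = m → IsWord m d (k + 1) b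

/-- The word starting with `0, …, b - 1` and continuing with `m, m - 1, …`. -/
def stdWord (m b : ℕ) : ℕ → ℕ := fun l => if l < b then l else m - (l - b)

/-- The word starting with `0, …, b - 1` and continuing with `m, m - 1, …`, with `b` inserted at
the place `p`. -/
def insWord (m b p : ℕ) : ℕ → ℕ := fun l =>
  if l < b then l else if l < p then m - (l - b) else if l = p then b else m - (l - 1 - b)

section Word

theorem IsWord.le (h : IsWord m d k b) : b ≤ k := by
  induction h with
  | nil => exact le_rfl
  | left _ _ ih => omega
  | right _ _ ih => omega

theorem IsWord.congr (h : IsWord m d k b) (hd : ∀ l < k, d l = d' l) :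
    IsWord m d' k b := by
  induction h with
  | nil => exact IsWord.nil
  | left _ h1 ih => exact IsWord.left (ih fun l hl => hd l (by omega)) (by rw [← hd _ (by omega), h1])
  | right _ h1 ih =>
    exact IsWord.right (ih fun l hl => hd l (by omega)) (by rw [← hd _ (by omega), h1])

theorem IsWord.exists_of_le (h : IsWord m d k b) (hl : l ≤ k) :
    ∃ b', IsWord m d l b' := by
  induction h with
  | nil => exact ⟨0, by obtain rfl : l = 0 := by omega
                        exact IsWord.nil⟩
  | left h1 h2 ih =>
    rcases Nat.lt_or_eq_of_le hl with h | rfl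
    · exact ih (by omega)
    · exact ⟨_, IsWord.left h1 h2⟩
  | right h1 h2 ih =>
    rcases Nat.lt_or_eq_of_le hl with h | rfl
    · exact ih (by omega)
    · exact ⟨_, IsWord.right h1 h2⟩

theorem IsWord.sum_ite (h : IsWord m d k b) (hk : k ≤ m) (hx : x ≤ m) :
    ∑ l ∈ range k, (if d l = x then 1 else 0 : K) =
      if x < b ∨ m - (k - b) < x then 1 else 0 := by
  induction h with
  | nil => simp; omega
  | @left k b h1 h2 ih =>
    have := h1.le
    rw [sum_range_succ, ih (by omega), h2]
    by_cases h : b = x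
    · rw [if_neg (by omega), if_pos h, if_pos (by omega), zero_add]
    · rw [if_neg h, add_zero]
      exact if_congr (by omega) rfl rfl
  | @right k b h1 h2 ih =>
    have := h1.le
    rw [sum_range_succ, ih (by omega)]
    by_cases h : d k = x
    · rw [if_neg (by omega), if_pos h, if_pos (by omega), zero_add]
    · rw [if_neg h, add_zero]
      exact if_congr (by omega) rfl rfl

theorem IsWord.unique {k b b' : ℕ} (h : IsWord m d k b) (h' : IsWord m d k b') (hk : k ≤ m) :
    b = b' := by
  by_contra hne
  wlog hlt : b < b' generalizing b b'
  · exact this h' h (Ne.symm hne) (by omega)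
  have h1 := h.le
  have h2 := h'.le
  have h3 := h.sum_ite (K := ℚ) hk (x := b) (by omega)
  have h4 := h'.sum_ite (K := ℚ) hk (x := b) (by omega)
  rw [if_neg (by omega)] at h3
  rw [h3, if_pos (by omega)] at h4
  exact zero_ne_one h4

theorem IsWord.le_of_lt (h : IsWord m d k b) (hk : k ≤ m) (hl : l < k) : d l ≤ m := by
  induction h with
  | nil => omega
  | left h1 h2 ih =>
    have := h1.le
    rcases lt_succ_iff_lt_or_eq.1 hl with h | rfl
    · exact ih (by omega) h
    · omega
  | right h1 h2 ih =>
    rcases lt_succ_iff_lt_or_eq.1 hl with h | rfl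
    · exact ih (by omega) h
    · omega

/-- The letters of a word are distinct. -/
theorem IsWord.ne (h : IsWord m d k b) (hk : k ≤ m) (hij : i < j) (hj : j < k) :
    d i ≠ d j := by
  intro he
  have h1 := h.sum_ite (K := ℚ) hk (h.le_of_lt hk hj)
  have h2 : ∑ l ∈ {i, j}, (if d l = d j then 1 else 0 : ℚ) ≤
      ∑ l ∈ range k, (if d l = d j then 1 else 0 : ℚ) := by
    refine Finset.sum_le_sum_of_subset_of_nonneg ?_ fun _ _ _ => by positivity
    intro x hx
    simp only [mem_insert, Finset.mem_singleton, mem_range] at hx ⊢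
    omega
  rw [Finset.sum_pair (by omega), if_pos he, if_pos rfl, h1] at h2
  split_ifs at h2 <;> norm_num at h2

theorem isWord_stdWord (hb : b ≤ k) (hk : k ≤ m) : IsWord m (stdWord m b) k b := by
  have h1 : ∀ j ≤ b, IsWord m (stdWord m b) j j := by
    intro j
    induction j with
    | zero => exact fun _ => IsWord.nil
    | succ j ih => exact fun hj => IsWord.left (ih (by omega)) (by simp [stdWord]; omega)
  induction k, hb using Nat.le_induction with
  | base => exact h1 b le_rfl
  | succ k hk' ih =>
    refine IsWord.right (ih (by omega)) ?_
    simp only [stdWord]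
    rw [if_neg (by omega)]
    omega

theorem insWord_self (b : ℕ) : insWord m b b = stdWord m (b + 1) := by
  funext l
  simp only [insWord, stdWord]
  split_ifs <;> omega

theorem insWord_of_lt (hl : l < p) : insWord m b p l = stdWord m b l := by
  simp only [insWord, stdWord]
  split_ifs <;> omega

theorem insWord_at (h : b ≤ p) : insWord m b p p = b := by
  simp only [insWord]
  split_ifs <;> omega

theorem isWord_insWord (hb : b ≤ k) (hk : k ≤ m) :
    IsWord m (insWord m b k) (k + 1) (b + 1) :=
  IsWord.left ((isWord_stdWord hb hk).congr fun l hl => (insWord_of_lt hl).symm) (insWord_at hb)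

end Word

/-- The Lagrange polynomial of the node `α * q ^ r` among `α, α * q, …, α * q ^ m`. -/
noncomputable def lagr (α q : K) (m r : ℕ) : K[X] :=
  Lagrange.basis (range (m + 1)) (fun j => α * q ^ j) r

/-- The projection to the eigenspace of a Jucys--Murphy element. -/
noncomputable def jmIdem (α q : K) (m : ℕ)
    (T : ℕ → R) (l r : ℕ) : R := aeval (jm q T l) (lagr α q m r)

/-- The projection to a simultaneous eigenspace of the first `k` Jucys--Murphy elements. -/
noncomputable def wtIdem (α q : K) (m : ℕ)
    (T : ℕ → R) (d : ℕ → ℕ) : ℕ → R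
  | 0 => 1
  | k + 1 => wtIdem α q m T d k * jmIdem α q m T k (d k)

/-- The first `s` Jucys--Murphy elements are diagonalisable with eigenvalues among
`α, α * q, …, α * q ^ m`. -/
structure IsDiag (α q : K) (m s : ℕ)
    (T : ℕ → R) : Prop where
  hs : s ≤ m
  hq : q ≠ 0
  hα : α ≠ 0
  hE : ∀ j, 0 < j → j ≤ m + 1 → q ^ j ≠ 1
  hT : IsHecke α (α * q ^ m) q (m + 1) T
  jm_poly : ∀ k < s, aeval (jm q T k)
    (∏ j ∈ range (m + 1), (X - C (α * q ^ j))) = 0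

/-- The axioms for the block of the Hecke algebra of type `B` whose weights are
orderings of `α, α * q, …, α * q ^ m`. -/
structure IsBlock (α q : K) (m : ℕ)
    (T : ℕ → R) : Prop extends IsDiag α q m m T where
  wt_zero : ∀ d : ℕ → ℕ, (∀ l < m, d l ≤ m) → (∀ b, ¬ IsWord m d m b) → wtIdem α q m T d m = 0
  jm_sq : ∀ d b, IsWord m d m b → (jm q T m - algebraMap K R (α * q ^ b)) *
    (jm q T m - algebraMap K R (α * q ^ b)) * wtIdem α q m T d m = 0

theorem Commute.aeval_right_alg {x a : R}
    (h : Commute x a) (p : K[X]) : Commute x (aeval a p) := by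
  rw [Polynomial.aeval_eq_sum_range]
  exact Commute.sum_right _ _ _ fun j _ => (h.pow_right j).smul_right _

theorem wtIdem_congr {T : ℕ → R} (h : ∀ l < k, d l = d' l) :
    wtIdem α q m T d k = wtIdem α q m T d' k := by
  induction k with
  | zero => rfl
  | succ k ih => rw [wtIdem, wtIdem, ih fun l hl => h l (by omega), h k (lt_succ_self k)]

theorem jmIdem_mem {T : ℕ → R} (h : l < k) : jmIdem α q m T l r ∈ genAlg K T k :=
  aeval_mem_subalgebra (jm_mem_genAlg h) _

theorem wtIdem_mem {T : ℕ → R} (h : l ≤ k) : wtIdem α q m T d l ∈ genAlg K T k := by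
  induction l with
  | zero => exact one_mem _
  | succ l ih => exact mul_mem (ih (by omega)) (jmIdem_mem (by omega))

namespace IsDiag

variable {T : ℕ → R}
  (hB : IsDiag α q m s T)

include hB

theorem pow_ne (hi : i ≤ m + 1) (hj : j ≤ m + 1) (hij : i ≠ j) :
    α * q ^ i ≠ α * q ^ j := by
  intro h
  have h := mul_left_cancel₀ hB.hα h
  rcases lt_or_gt_of_ne hij with h' | h'
  · obtain ⟨t, rfl⟩ := Nat.exists_eq_add_of_lt h'
    rw [add_assoc, pow_add] at h
    exact hB.hE (t + 1) (by omega) (by omega)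
      (mul_left_cancel₀ (pow_ne_zero i hB.hq) (by rw [mul_one]; exact h.symm))
  · obtain ⟨t, rfl⟩ := Nat.exists_eq_add_of_lt h'
    rw [add_assoc, pow_add] at h
    exact hB.hE (t + 1) (by omega) (by omega)
      (mul_left_cancel₀ (pow_ne_zero j hB.hq) (by rw [mul_one]; exact h))

theorem injOn : Set.InjOn (fun j => α * q ^ j) (range (m + 1) : Set ℕ) := by
  intro i hi j hj h
  rw [Finset.mem_coe, mem_range] at hi hj
  by_contra hne
  exact hB.pow_ne (by omega) (by omega) hne h

theorem eval_lagr (hr : r ≤ m) (hj : j ≤ m) :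
    (lagr α q m r).eval (α * q ^ j) = if j = r then 1 else 0 := by
  split_ifs with h
  · subst h
    exact Lagrange.eval_basis_self (v := fun j => α * q ^ j) hB.injOn
      (mem_range.2 (by omega))
  · exact Lagrange.eval_basis_of_ne (v := fun j => α * q ^ j) (Ne.symm h)
      (mem_range.2 (by omega))

theorem aeval_eq_zero (hk : k < s) {p : K[X]}
    (h : ∀ j ≤ m, p.eval (α * q ^ j) = 0) : aeval (jm q T k) p = 0 := by
  have hd : (∏ j ∈ range (m + 1), (X - C (α * q ^ j))) ∣ p := by
    refine Finset.prod_dvd_of_coprime ?_ fun j hj => ?_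
    · intro i hi j hj hij
      exact Polynomial.isCoprime_X_sub_C_of_isUnit_sub
        (sub_ne_zero.2 fun h => hij (hB.injOn hi hj h)).isUnit
    · rw [Polynomial.dvd_iff_isRoot]
      exact h j (by rw [mem_range] at hj; omega)
  obtain ⟨r, rfl⟩ := hd
  rw [map_mul, hB.jm_poly k hk, zero_mul]

theorem aeval_eq (hk : k < s) {p p' : K[X]}
    (h : ∀ j ≤ m, p.eval (α * q ^ j) = p'.eval (α * q ^ j)) :
    aeval (jm q T k) p = aeval (jm q T k) p' := by
  rw [← sub_eq_zero, ← map_sub]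
  exact hB.aeval_eq_zero hk fun j hj => by rw [Polynomial.eval_sub, h j hj, sub_self]

theorem sum_jmIdem (k : ℕ) : ∑ r ∈ range (m + 1), jmIdem α q m T k r = 1 := by
  simp only [jmIdem, ← map_sum, lagr]
  rw [Lagrange.sum_basis hB.injOn ⟨0, mem_range.2 (by omega)⟩, map_one]

theorem aeval_mul_jmIdem (hk : k < s) (hr : r ≤ m) (p : K[X]) :
    aeval (jm q T k) p * jmIdem α q m T k r = p.eval (α * q ^ r) • jmIdem α q m T k r := by
  rw [jmIdem, ← map_mul, ← map_smul]
  refine hB.aeval_eq hk fun j hj => ?_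
  rw [Polynomial.eval_mul, Polynomial.eval_smul, hB.eval_lagr hr hj, smul_eq_mul]
  split_ifs with h
  · rw [h]
  · simp

theorem jm_mul_jmIdem (hk : k < s) (hr : r ≤ m) :
    jm q T k * jmIdem α q m T k r = (α * q ^ r) • jmIdem α q m T k r := by
  simpa using hB.aeval_mul_jmIdem hk hr X

theorem jmIdem_mul_jmIdem {k r t : ℕ} (hk : k < s) (hr : r ≤ m) (ht : t ≤ m) :
    jmIdem α q m T k t * jmIdem α q m T k r = if r = t then jmIdem α q m T k r else 0 := by
  have := hB.aeval_mul_jmIdem hk hr (lagr α q m t)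
  rw [hB.eval_lagr ht hr] at this
  rw [jmIdem, this]
  split_ifs <;> simp

theorem commute_jmIdem (hk : k ≤ m) {x : R} (hx : x ∈ genAlg K T k) (r : ℕ) :
    Commute x (jmIdem α q m T k r) :=
  (show Commute x (jm q T k) from
    hB.hT.commute_genAlg_jm le_rfl (by omega) hx).aeval_right_alg _

end IsDiag

namespace IsDiag

variable {T : ℕ → R}
  (hB : IsDiag α q m s T)

include hB

theorem aeval_mul_wtIdem (hk : k ≤ s) (hd : ∀ l < k, d l ≤ m) (hl : l < k)
    (p : K[X]) : aeval (jm q T l) p * wtIdem α q m T d k =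
      p.eval (α * q ^ d l) • wtIdem α q m T d k := by
  induction k with
  | zero => omega
  | succ k ih =>
    rw [wtIdem]
    rcases lt_succ_iff_lt_or_eq.1 hl with h | rfl
    · rw [← mul_assoc, ih (by omega) (fun l hl => hd l (by omega)) h, smul_mul_assoc]
    · have hs := hB.hs
      have hc : Commute (wtIdem α q m T d l) (aeval (jm q T l) p) :=
        (show Commute _ (jm q T l) from hB.hT.commute_genAlg_jm le_rfl (by omega)
          (wtIdem_mem le_rfl)).aeval_right_alg _
      rw [← mul_assoc, ← hc.eq, mul_assoc, hB.aeval_mul_jmIdem (by omega) (hd l hl), mul_smul_comm]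

theorem jm_mul_wtIdem (hk : k ≤ s) (hd : ∀ l < k, d l ≤ m) (hl : l < k) :
    jm q T l * wtIdem α q m T d k = (α * q ^ d l) • wtIdem α q m T d k := by
  simpa using hB.aeval_mul_wtIdem hk hd hl X

theorem wtIdem_mul_wtIdem (hk : k ≤ s) (hd : ∀ l < k, d l ≤ m)
    (hd' : ∀ l < k, d' l ≤ m) : wtIdem α q m T d k * wtIdem α q m T d' k =
      if ∀ l < k, d l = d' l then wtIdem α q m T d k else 0 := by
  induction k with
  | zero => simp [wtIdem]
  | succ k ih =>
    have hs := hB.hs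
    have hc := hB.commute_jmIdem (by omega) (wtIdem_mem (α := α) (q := q) (m := m) (T := T)
      (d := d') (le_refl k)) (d k)
    have h1 : wtIdem α q m T d (k + 1) * wtIdem α q m T d' (k + 1) =
        (wtIdem α q m T d k * wtIdem α q m T d' k) *
          (jmIdem α q m T k (d k) * jmIdem α q m T k (d' k)) := by
      simp only [wtIdem, mul_assoc]
      rw [← mul_assoc (jmIdem α q m T k (d k)), ← hc.eq]
      simp only [mul_assoc]
    rw [h1, ih (by omega) (fun l hl => hd l (by omega)) fun l hl => hd' l (by omega),
      hB.jmIdem_mul_jmIdem (by omega) (hd' k (by omega)) (hd k (by omega))]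
    by_cases h2 : ∀ l < k, d l = d' l
    · rw [if_pos h2]
      by_cases h3 : d' k = d k
      · have h4 : ∀ l < k + 1, d l = d' l := fun l hl => by
          rcases lt_succ_iff_lt_or_eq.1 hl with h | rfl
          · exact h2 l h
          · exact h3.symm
        rw [if_pos h3, if_pos h4, wtIdem, h3]
      · rw [if_neg h3, mul_zero, if_neg fun h => h3 (h k (lt_succ_self k)).symm]
    · rw [if_neg h2, zero_mul, if_neg fun h => h2 fun l hl => h l (by omega)]

theorem wtIdem_mul_self (hk : k ≤ s) (hd : ∀ l < k, d l ≤ m) :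
    wtIdem α q m T d k * wtIdem α q m T d k = wtIdem α q m T d k := by
  rw [hB.wtIdem_mul_wtIdem hk hd hd, if_pos fun _ _ => rfl]

theorem wtIdem_eq_sum (d : ℕ → ℕ) (k : ℕ) : wtIdem α q m T d k =
    ∑ r ∈ range (m + 1), wtIdem α q m T (update d k r) (k + 1) := by
  have : ∀ r, wtIdem α q m T (update d k r) (k + 1) =
      wtIdem α q m T d k * jmIdem α q m T k r := fun r => by
    rw [wtIdem, update_self]
    congr 1
    exact wtIdem_congr fun l hl => update_of_ne (by omega) _ _
  simp only [this]
  rw [← mul_sum, hB.sum_jmIdem, mul_one]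

end IsDiag

namespace IsBlock

variable {T : ℕ → R}
  (hB : IsBlock α q m T)

include hB

theorem wtIdem_eq_zero (hk : k ≤ m) : ∀ d : ℕ → ℕ, (∀ l < k, d l ≤ m) →
    (∀ b, ¬ IsWord m d k b) → wtIdem α q m T d k = 0 := by
  induction hk using Nat.decreasingInduction with
  | self => exact hB.wt_zero
  | of_succ k hk ih =>
    intro d hd hw
    rw [hB.wtIdem_eq_sum d k]
    refine sum_eq_zero fun r hr => ih _ ?_ ?_
    · intro l hl
      rcases lt_succ_iff_lt_or_eq.1 hl with h | rfl
      · rw [update_of_ne (by omega)]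
        exact hd l h
      · rw [update_self]
        rw [mem_range] at hr
        omega
    · intro b hb
      obtain ⟨b', hb'⟩ := hb.exists_of_le (Nat.le_succ k)
      exact hw b' (hb'.congr fun l hl => update_of_ne (by omega) _ _)

theorem mem_of_forall_wtIdem (hk : k ≤ m) (N : Submodule K R) (F : R →ₗ[K] R)
    (h : ∀ d b, IsWord m d k b → F (wtIdem α q m T d k) ∈ N) : F 1 ∈ N := by
  have key : ∀ j ≤ k, ∀ d : ℕ → ℕ, (∀ l < j, d l ≤ m) → F (wtIdem α q m T d j) ∈ N := by
    intro j hj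
    induction hj using Nat.decreasingInduction with
    | self =>
      intro d hd
      by_cases hw : ∃ b, IsWord m d k b
      · exact h d _ hw.choose_spec
      · rw [hB.wtIdem_eq_zero hk d hd (not_exists.1 hw), map_zero]
        exact N.zero_mem
    | of_succ j hj ih =>
      intro d hd
      rw [hB.wtIdem_eq_sum d j, map_sum]
      refine N.sum_mem fun r hr => ih _ fun l hl => ?_
      rcases lt_succ_iff_lt_or_eq.1 hl with h | rfl
      · rw [update_of_ne (by omega)]
        exact hd l h
      · rw [update_self]
        rw [mem_range] at hr
        omega
  exact key 0 (Nat.zero_le k) (fun _ => 0) fun _ _ => Nat.zero_le m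

theorem jmIdem_mul_jmIdem_succ (hk : k + 1 < m) (hs : s ≤ m) :
    jmIdem α q m T k s * jmIdem α q m T (k + 1) s = 0 := by
  have := hB.mem_of_forall_wtIdem (k := k) (by omega) ⊥
    (LinearMap.mulRight K (jmIdem α q m T k s * jmIdem α q m T (k + 1) s)) ?_
  · simpa using this
  intro d b hd
  rw [Submodule.mem_bot, mulRight_apply]
  set d' := update (update d k s) (k + 1) s
  have h1 : wtIdem α q m T d k = wtIdem α q m T d' k := wtIdem_congr fun l hl => by
    simp only [d']
    rw [update_of_ne (by omega), update_of_ne (by omega)]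
  have h2 : d' k = s := by
    simp only [d']
    rw [update_of_ne (by omega), update_self]
  have h3 : d' (k + 1) = s := update_self ..
  have h4 : wtIdem α q m T d k * (jmIdem α q m T k s * jmIdem α q m T (k + 1) s) =
      wtIdem α q m T d' (k + 2) := by
    rw [wtIdem, wtIdem, h1, h2, h3, mul_assoc]
  rw [h4]
  refine hB.wtIdem_eq_zero (by omega) d' ?_ ?_
  · intro l hl
    rcases lt_succ_iff_lt_or_eq.1 hl with h | rfl
    · rcases lt_succ_iff_lt_or_eq.1 h with h | rfl
      · simp only [d']
        rw [update_of_ne (by omega), update_of_ne (by omega)]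
        exact hd.le_of_lt (by omega) h
      · omega
    · omega
  · intro b' hb'
    exact hb'.ne (by omega) (lt_succ_self k) (lt_succ_self (k + 1)) (by rw [h2, h3])

theorem exists_jmIdem_T_jmIdem (hk : k + 1 < m) (hs : s ≤ m) : ∃ h ∈ genAlg K T (k + 1),
    jmIdem α q m T (k + 1) s * T (k + 1) * jmIdem α q m T (k + 1) s =
      h * jmIdem α q m T (k + 1) s := by
  set a := jm q T k
  set b := jm q T (k + 1)
  set E := jmIdem α q m T (k + 1) s
  set c : K := α * q ^ s
  set h : R := ∑ r ∈ (range (m + 1)).erase s, (c - α * q ^ r)⁻¹ • jmIdem α q m T k r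
  have hp : HPair q (T (k + 1)) a b := hB.hT.hPair hB.hq (by omega)
  have hbE : b * E = c • E := hB.jm_mul_jmIdem hk hs
  have hEE : E * E = E := by
    rw [hB.jmIdem_mul_jmIdem hk hs hs, if_pos rfl]
  have ha : a ∈ genAlg K T (k + 1) := jm_mem_genAlg (lt_succ_self k)
  have haE : Commute a E := hB.commute_jmIdem (by omega) ha s
  have hh : h ∈ genAlg K T (k + 1) := Subalgebra.sum_mem _ fun r _ =>
    Subalgebra.smul_mem _ (jmIdem_mem (lt_succ_self k)) _
  have h1 : c • (E * T (k + 1) * E) = a * (E * T (k + 1) * E) + ((q - 1) * c) • E := by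
    calc c • (E * T (k + 1) * E) = E * (T (k + 1) * b) * E := by
          simp only [mul_assoc, hbE, mul_smul_comm]
      _ = E * a * T (k + 1) * E + (q - 1) • (E * (b * E)) := by
          rw [hp.Tb]; simp only [mul_add, add_mul, mul_smul_comm, smul_mul_assoc, mul_assoc]
      _ = _ := by
          rw [← haE.eq, hbE, mul_smul_comm, hEE, smul_smul]; simp only [mul_assoc]
  have h2 : h * (algebraMap K R c - a) = 1 - jmIdem α q m T k s := by
    have hr : ∀ r ∈ (range (m + 1)).erase s,
        (c - α * q ^ r)⁻¹ • jmIdem α q m T k r * (algebraMap K R c - a) =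
          jmIdem α q m T k r := by
      intro r hr
      rw [Finset.mem_erase, mem_range] at hr
      have hc : jmIdem α q m T k r * a = (α * q ^ r) • jmIdem α q m T k r := by
        rw [← hB.jm_mul_jmIdem (by omega) (by omega : r ≤ m)]
        exact ((Commute.refl a).aeval_right_alg _).symm.eq
      have hne : c - α * q ^ r ≠ 0 := sub_ne_zero.2 (hB.pow_ne (by omega) (by omega) hr.1.symm)
      rw [smul_mul_assoc, mul_sub, hc, ← Algebra.commutes, ← Algebra.smul_def, ← sub_smul, smul_smul,
        inv_mul_cancel₀ hne, one_smul]
    rw [sum_mul, sum_congr rfl hr, ← hB.sum_jmIdem k,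
      ← add_sum_erase _ _ (mem_range.2 (by omega : s < m + 1)), add_sub_cancel_left]
  have h3 : jmIdem α q m T k s * E = 0 := hB.jmIdem_mul_jmIdem_succ hk hs
  have h4 : (algebraMap K R c - a) * (E * T (k + 1) * E) = ((q - 1) * c) • E := by
    rw [sub_mul, ← Algebra.smul_def, h1, add_sub_cancel_left]
  refine ⟨((q - 1) * c) • h, Subalgebra.smul_mem _ hh _, ?_⟩
  have h5 : h * ((algebraMap K R c - a) * (E * T (k + 1) * E)) = E * T (k + 1) * E := by
    rw [← mul_assoc, h2, sub_mul, one_mul, ← mul_assoc, ← mul_assoc, h3]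
    simp
  rw [← h5, h4, mul_smul_comm, smul_mul_assoc]

/-- A simultaneous eigenspace of the Jucys--Murphy elements in an irreducible module over the
subalgebra generated by `T 0, …, T (k - 1)` is one-dimensional. -/
theorem exists_wtIdem_mul_mul (hk : k ≤ m) (hd : ∀ l < k, d l ≤ m) {x : R}
    (hx : x ∈ genAlg K T k) : ∃ c : K, wtIdem α q m T d k * x * wtIdem α q m T d k =
      c • wtIdem α q m T d k := by
  induction k generalizing x with
  | zero =>
    have h : genAlg K T 0 ≤ ⊥ := Algebra.adjoin_le fun x ⟨i, hi, _⟩ => by omega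
    obtain ⟨c, rfl⟩ := Algebra.mem_bot.1 (h hx)
    exact ⟨c, by simp [wtIdem, Algebra.algebraMap_eq_smul_one]⟩
  | succ k ih =>
    replace ih := fun {x} => ih (x := x) (by omega) (fun l hl => hd l (by omega))
    set w := wtIdem α q m T d k
    set E := jmIdem α q m T k (d k)
    have hw : w ∈ genAlg K T k := wtIdem_mem le_rfl
    have hdk := hd k (lt_succ_self k)
    have hEE : E * E = E := by
      rw [hB.jmIdem_mul_jmIdem (by omega) hdk hdk, if_pos rfl]
    have hc : ∀ y ∈ genAlg K T k, Commute y E := fun y hy => hB.commute_jmIdem (by omega) hy _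
    set S : Submodule K R := (K ∙ (w * E)).comap (LinearMap.mulRight K (w * E) ∘ₗ
      LinearMap.mulLeft K (w * E))
    have hS : ∀ x, x ∈ S ↔ ∃ c : K, w * E * x * (w * E) = c • (w * E) := fun x => by
      simp only [S, Submodule.mem_comap, comp_apply, mulLeft_apply,
        mulRight_apply, Submodule.mem_span_singleton, eq_comm]
    have hyE : ∀ y ∈ genAlg K T k, ∃ c : K, w * y * w * E = c • (w * E) := fun y hy => by
      obtain ⟨c, h⟩ := ih hy
      exact ⟨c, by rw [h, smul_mul_assoc]⟩
    rw [wtIdem]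
    rw [← hS]
    refine hB.hT.genAlg_succ_le hB.hq (by omega) S ?_ ?_ x hx
    · intro y hy j
      obtain ⟨c, h⟩ := hyE y hy
      rw [hS]
      refine ⟨(X ^ j : K[X]).eval (α * q ^ d k) * c, ?_⟩
      have h1 : jm q T k ^ j * E = (X ^ j : K[X]).eval (α * q ^ d k) • E := by
        simpa using hB.aeval_mul_jmIdem (by omega) hdk (X ^ j)
      calc w * E * (y * jm q T k ^ j) * (w * E) = w * (E * y) * jm q T k ^ j * (w * E) := by
            simp only [mul_assoc]
        _ = w * y * (jm q T k ^ j * E) * (w * E) := by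
            rw [← (hc y hy).eq, ← mul_assoc w y E, mul_assoc (w * y) E,
              show E * jm q T k ^ j = jm q T k ^ j * E from
                ((Commute.refl (jm q T k)).pow_left j |>.aeval_right_alg _).eq.symm]
        _ = _ := by
            rw [h1, (hc w hw).eq, mul_smul_comm, smul_mul_assoc, mul_assoc (w * y) E,
              ← mul_assoc E E, hEE, ← (hc w hw).eq, ← mul_assoc, h, smul_smul]
    · intro hk0 y hy z hz
      obtain ⟨k, rfl⟩ : ∃ k', k = k' + 1 := ⟨k - 1, by omega⟩
      obtain ⟨u, hu, hu'⟩ := hB.exists_jmIdem_T_jmIdem (k := k) (by omega) hdk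
      replace hu' : E * T (k + 1) * E = u * E := hu'
      obtain ⟨c, h⟩ := hyE (y * u * z) (mul_mem (mul_mem hy hu) hz)
      rw [hS]
      refine ⟨c, ?_⟩
      rw [← h]
      calc w * E * (y * T (k + 1) * z) * (w * E) =
            w * (E * y) * T (k + 1) * (z * w * E) := by simp only [mul_assoc]
        _ = w * y * (E * T (k + 1) * E) * (z * w) := by
            rw [← (hc y hy).eq, (hc _ (mul_mem hz hw)).eq]; simp only [mul_assoc]
        _ = w * y * u * (E * (z * w)) := by rw [hu']; simp only [mul_assoc]
        _ = w * (y * u * z) * w * E := by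
            rw [← (hc _ (mul_mem hz hw)).eq]; simp only [mul_assoc]

theorem wtIdem_mul_mul_eq_zero {b b' : ℕ} (hd : IsWord m d m b)
    (hd' : IsWord m d' m b') (hb : b ≠ b') {x : R} (hx : x ∈ genAlg K T m) :
    wtIdem α q m T d m * x * wtIdem α q m T d' m = 0 := by
  set z := symOp q T m (lagr α q m b)
  have hbm := hd.le
  have hbm' := hd'.le
  have hz : ∀ {d b'}, IsWord m d m b' → z * wtIdem α q m T d m =
      (if b < b' ∨ m - (m - b') < b then 1 else 0 : K) • wtIdem α q m T d m := by
    intro d b' hd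
    rw [← hd.sum_ite le_rfl hbm, sum_smul, show z = _ from symOp.eq_1 .., sum_mul]
    refine sum_congr rfl fun l hl => ?_
    rw [mem_range] at hl
    rw [hB.aeval_mul_wtIdem le_rfl (fun _ => hd.le_of_lt le_rfl) hl,
      hB.eval_lagr hbm (hd.le_of_lt le_rfl hl)]
  have hc : ∀ y ∈ genAlg K T m, Commute y z := fun y hy =>
    commute_of_mem_genAlg (fun i hi => (hB.hT.mono (Nat.le_succ m)).commute_symOp hB.hq _ hi) hy
  have h1 := hz hd
  have h2 := hz hd'
  rw [if_neg (by omega), zero_smul] at h1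
  rw [if_pos (by omega), one_smul] at h2
  rw [← h2, mul_assoc, ← mul_assoc x, (hc x hx).eq, ← mul_assoc, ← mul_assoc,
    (hc _ (wtIdem_mem le_rfl)).eq, h1, zero_mul, zero_mul]

end IsBlock

/-- Two idempotents conjugate by explicit elements of a subalgebra. -/
structure WConj (B : Subalgebra K R)
    (p p' θ η : R) : Prop where
  θ_mem : θ ∈ B
  η_mem : η ∈ B
  θ_mul : θ * p = p' * θ
  η_mul : η * p' = p * η
  ηθ : η * θ * p = p
  θη : θ * η * p' = p'

section WConj

variable {B B' : Subalgebra K R}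
  {p p' p'' θ η θ' η' : R}

theorem WConj.refl (B : Subalgebra K R) (p : R) : WConj B p p 1 1 where
  θ_mem := one_mem _
  η_mem := one_mem _
  θ_mul := by simp
  η_mul := by simp
  ηθ := by simp
  θη := by simp

theorem WConj.symm (h : WConj B p p' θ η) : WConj B p' p η θ :=
  ⟨h.η_mem, h.θ_mem, h.η_mul, h.θ_mul, h.θη, h.ηθ⟩

theorem WConj.trans (h : WConj B p p' θ η) (h' : WConj B p' p'' θ' η') :
    WConj B p p'' (θ' * θ) (η * η') where
  θ_mem := mul_mem h'.θ_mem h.θ_mem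
  η_mem := mul_mem h.η_mem h'.η_mem
  θ_mul := by rw [mul_assoc, h.θ_mul, ← mul_assoc, h'.θ_mul, mul_assoc]
  η_mul := by rw [mul_assoc, h'.η_mul, ← mul_assoc, h.η_mul, mul_assoc]
  ηθ := by
    calc η * η' * (θ' * θ) * p = η * (η' * θ' * (θ * p)) := by simp only [mul_assoc]
      _ = η * ((η' * θ' * p') * θ) := by rw [h.θ_mul]; simp only [mul_assoc]
      _ = p := by rw [h'.ηθ, ← h.θ_mul, ← mul_assoc, h.ηθ]
  θη := by
    calc θ' * θ * (η * η') * p'' = θ' * (θ * η * (η' * p'')) := by simp only [mul_assoc]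
      _ = θ' * ((θ * η * p') * η') := by rw [h'.η_mul]; simp only [mul_assoc]
      _ = p'' := by rw [h.θη, ← h'.η_mul, ← mul_assoc, h'.θη]

theorem WConj.mul_right (h : WConj B p p' θ η) (hB : B ≤ B') {e : R}
    (he : ∀ x ∈ B, Commute x e) : WConj B' (p * e) (p' * e) θ η where
  θ_mem := hB h.θ_mem
  η_mem := hB h.η_mem
  θ_mul := by rw [← mul_assoc, h.θ_mul, mul_assoc, (he _ h.θ_mem).eq, mul_assoc]
  η_mul := by rw [← mul_assoc, h.η_mul, mul_assoc, (he _ h.η_mem).eq, mul_assoc]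
  ηθ := by rw [← mul_assoc, h.ηθ]
  θη := by rw [← mul_assoc, h.θη]

end WConj

/-- The intertwiner of two consecutive Jucys--Murphy elements. -/
def jphi (q : K) (T : ℕ → R) (i : ℕ) : R :=
  T (i + 1) * jm q T i - jm q T i * T (i + 1)

/-- The scalar by which the square of an intertwiner acts. -/
def swapScalar (α q : K) (x y : ℕ) : K :=
  (q * (α * q ^ x) - α * q ^ y) * (q * (α * q ^ y) - α * q ^ x)

theorem swapScalar_comm (α q : K) (x y : ℕ) :
    swapScalar α q x y = swapScalar α q y x := mul_comm _ _

/-- The product of intertwiners moving the letter at place `b` to the place `b + j`. -/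
def moveRight (q : K) (T : ℕ → R) (b : ℕ) : ℕ → R
  | 0 => 1
  | j + 1 => jphi q T (b + j) * moveRight q T b j

/-- The product of normalised intertwiners moving the letter `b` at place `b + j` to the
place `b`. -/
def moveLeft (α q : K) (m : ℕ) (T : ℕ → R)
    (b : ℕ) : ℕ → R
  | 0 => 1
  | j + 1 => moveLeft α q m T b j * ((swapScalar α q b (m - j))⁻¹ • jphi q T (b + j))

theorem IsHecke.jphi_mem {T : ℕ → R}
    (h : i + 1 < k) : jphi q T i ∈ genAlg K T k :=
  sub_mem (mul_mem (mem_genAlg h) (jm_mem_genAlg (by omega)))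
    (mul_mem (jm_mem_genAlg (by omega)) (mem_genAlg h))

namespace IsBlock

variable {T : ℕ → R}
  (hB : IsBlock α q m T)

include hB

theorem swapScalar_ne_zero {x y : ℕ} (hx : x ≤ m) (hy : y ≤ m) (h : x + 1 < y ∨ y + 1 < x) :
    swapScalar α q x y ≠ 0 := by
  have key : ∀ x y : ℕ, q * (α * q ^ x) - α * q ^ y = α * q ^ (x + 1) - α * q ^ y :=
    fun x y => by ring
  rw [swapScalar, key, key]
  exact mul_ne_zero (sub_ne_zero.2 (hB.pow_ne (by omega) (by omega) (by omega)))
    (sub_ne_zero.2 (hB.pow_ne (by omega) (by omega) (by omega)))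

theorem hPair (hi : i < m) : HPair q (T (i + 1)) (jm q T i) (jm q T (i + 1)) :=
  hB.hT.hPair hB.hq (by omega)

theorem commute_genAlg_jphi (hi : i < m) {x : R} (hx : x ∈ genAlg K T i) :
    Commute x (jphi q T i) := by
  have h1 : Commute x (T (i + 1)) := hB.hT.commute_genAlg (lt_succ_self i) (by omega) hx
  have h2 : Commute x (jm q T i) := hB.hT.commute_genAlg_jm le_rfl (by omega) hx
  exact (h1.mul_right h2).sub_right (h2.mul_right h1)

theorem jphi_mul_wtIdem (hk : i + 2 ≤ k) (hkm : k ≤ m)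
    (h1 : d' i = d (i + 1)) (h2 : d' (i + 1) = d i)
    (h : ∀ l < k, l ≠ i → l ≠ i + 1 → d l = d' l) :
    jphi q T i * wtIdem α q m T d k = wtIdem α q m T d' k * jphi q T i := by
  induction k, hk using Nat.le_induction with
  | base =>
    have hp := hB.hPair (i := i) (by omega)
    have hw : wtIdem α q m T d i = wtIdem α q m T d' i :=
      wtIdem_congr fun l hl => h l (by omega) (by omega) (by omega)
    have hc := hB.commute_genAlg_jphi (i := i) (by omega)
      (wtIdem_mem (α := α) (q := q) (m := m) (T := T) (d := d') (le_refl i))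
    have ha : ∀ r, jphi q T i * jmIdem α q m T i r = jmIdem α q m T (i + 1) r * jphi q T i :=
      fun r => hp.phi_aeval_a _
    have hb : ∀ r, jphi q T i * jmIdem α q m T (i + 1) r = jmIdem α q m T i r * jphi q T i :=
      fun r => hp.phi_aeval_b _
    have hcc : ∀ r s, Commute (jmIdem α q m T i r) (jmIdem α q m T (i + 1) s) := fun r s =>
      hB.commute_jmIdem (by omega) (jmIdem_mem (by omega)) s
    show jphi q T i * (wtIdem α q m T d i * jmIdem α q m T i (d i) *
      jmIdem α q m T (i + 1) (d (i + 1))) = wtIdem α q m T d' i * jmIdem α q m T i (d' i) *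
      jmIdem α q m T (i + 1) (d' (i + 1)) * jphi q T i
    rw [hw, h1, h2, ← mul_assoc, ← mul_assoc, ← hc.eq, mul_assoc (wtIdem α q m T d' i), ha,
      mul_assoc, mul_assoc, hb, mul_assoc (wtIdem α q m T d' i), mul_assoc (wtIdem α q m T d' i),
      ← mul_assoc, ← mul_assoc, ← mul_assoc, ← mul_assoc, mul_assoc _ _ (jmIdem α q m T i _),
      ← (hcc _ _).eq, ← mul_assoc]
  | succ k hk ih =>
    have hc : Commute (jphi q T i) (jmIdem α q m T k (d k)) :=
      hB.commute_jmIdem (by omega) (IsHecke.jphi_mem (by omega)) _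
    rw [wtIdem, wtIdem, ← mul_assoc,
      ih (by omega) fun l hl => h l (by omega), mul_assoc, hc.eq, ← mul_assoc,
      h k (by omega) (by omega) (by omega)]

theorem jphi_sq_mul_wtIdem (hk : i + 2 ≤ k) (hkm : k ≤ m)
    (hd : ∀ l < k, d l ≤ m) : jphi q T i * jphi q T i * wtIdem α q m T d k =
      swapScalar α q (d i) (d (i + 1)) • wtIdem α q m T d k := by
  have hp := hB.hPair (i := i) (by omega)
  have ha := hB.jm_mul_wtIdem hkm hd (by omega : i < k)
  have hb := hB.jm_mul_wtIdem hkm hd (by omega : i + 1 < k)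
  have h1 : jphi q T i * jphi q T i = _ := hp.phi_sq
  rw [h1, mul_assoc, sub_mul _ _ (wtIdem α q m T d k), smul_mul_assoc, ha, hb, smul_smul,
    ← sub_smul, mul_smul_comm, sub_mul, smul_mul_assoc, ha, hb, smul_smul, ← sub_smul, smul_smul,
    swapScalar, mul_comm]

theorem wconj_swap (hk : i + 2 ≤ k) (hkm : k ≤ m)
    (hd : ∀ l < k, d l ≤ m) (h1 : d' i = d (i + 1)) (h2 : d' (i + 1) = d i)
    (h : ∀ l < k, l ≠ i → l ≠ i + 1 → d l = d' l) (hne : d i + 1 < d (i + 1) ∨ d (i + 1) + 1 < d i) :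
    WConj (genAlg K T k) (wtIdem α q m T d k) (wtIdem α q m T d' k) (jphi q T i)
      ((swapScalar α q (d i) (d (i + 1)))⁻¹ • jphi q T i) := by
  have hs := hB.swapScalar_ne_zero (hd i (by omega)) (hd (i + 1) (by omega)) hne
  have hd' : ∀ l < k, d' l ≤ m := fun l hl => by
    by_cases hi : l = i
    · rw [hi, h1]; exact hd _ (by omega)
    by_cases hi' : l = i + 1
    · rw [hi', h2]; exact hd _ (by omega)
    · rw [← h l hl hi hi']; exact hd l hl
  have hm : jphi q T i ∈ genAlg K T k := IsHecke.jphi_mem (by omega)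
  refine ⟨hm, Subalgebra.smul_mem _ hm _, hB.jphi_mul_wtIdem hk hkm h1 h2 h, ?_, ?_, ?_⟩
  · rw [smul_mul_assoc, hB.jphi_mul_wtIdem hk hkm h2.symm h1.symm fun l hl a b => (h l hl a b).symm,
      mul_smul_comm]
  · rw [smul_mul_assoc, smul_mul_assoc, hB.jphi_sq_mul_wtIdem hk hkm hd, smul_smul,
      inv_mul_cancel₀ hs, one_smul]
  · rw [mul_smul_comm, smul_mul_assoc, hB.jphi_sq_mul_wtIdem hk hkm hd', h1, h2,
      swapScalar_comm α q (d (i + 1)), smul_smul, inv_mul_cancel₀ hs, one_smul]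

theorem wconj_move (hk : k ≤ m) (hj : b + j < k) :
    WConj (genAlg K T k) (wtIdem α q m T (stdWord m (b + 1)) k)
      (wtIdem α q m T (insWord m b (b + j)) k) (moveRight q T b j) (moveLeft α q m T b j) := by
  induction j with
  | zero =>
    rw [add_zero, insWord_self]
    exact WConj.refl _ _
  | succ j ih =>
    have h1 : insWord m b (b + j) (b + j) = b := insWord_at (by omega)
    have h2 : insWord m b (b + j) (b + j + 1) = m - j := by
      simp only [insWord]; split_ifs <;> omega
    have h3 := hB.wconj_swap (d := insWord m b (b + j)) (d' := insWord m b (b + (j + 1)))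
      (i := b + j) (k := k) (by omega) hk
      (fun l hl => by simp only [insWord]; split_ifs <;> omega)
      (by rw [h2]; simp only [insWord]; split_ifs <;> omega)
      (by rw [h1, add_assoc, insWord_at (by omega)])
      (fun l hl hl1 hl2 => by simp only [insWord]; split_ifs <;> omega)
      (by rw [h1, h2]; omega)
    rw [h1, h2] at h3
    exact (ih (by omega)).trans h3

theorem exists_wconj (hk : k ≤ m) (hd : IsWord m d k b) :
    ∃ θ η, WConj (genAlg K T k) (wtIdem α q m T d k) (wtIdem α q m T (stdWord m b) k) θ η := by
  have ext : ∀ {k b : ℕ}, k + 1 ≤ m → (∃ θ η, WConj (genAlg K T k) (wtIdem α q m T d k)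
      (wtIdem α q m T (stdWord m b) k) θ η) → ∃ θ η, WConj (genAlg K T (k + 1))
        (wtIdem α q m T d (k + 1)) (wtIdem α q m T (stdWord m b) k * jmIdem α q m T k (d k)) θ η := by
    rintro k b hk ⟨θ, η, h⟩
    exact ⟨θ, η, h.mul_right (genAlg_mono (Nat.le_succ k))
      fun x hx => hB.commute_jmIdem (by omega) hx _⟩
  induction hd with
  | nil => exact ⟨1, 1, WConj.refl _ _⟩
  | @left k b h1 h2 ih =>
    have hbk := h1.le
    obtain ⟨θ, η, h⟩ := ext hk (ih (by omega))
    have h3 : wtIdem α q m T (stdWord m b) k * jmIdem α q m T k (d k) =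
        wtIdem α q m T (insWord m b k) (k + 1) := by
      rw [wtIdem, insWord_at hbk, h2]
      congr 1
      exact wtIdem_congr fun l hl => (insWord_of_lt hl).symm
    have h4 := hB.wconj_move (b := b) (j := k - b) hk (by omega)
    rw [Nat.add_sub_cancel' hbk, ← h3] at h4
    exact ⟨_, _, h.trans h4.symm⟩
  | @right k b h1 h2 ih =>
    have hbk := h1.le
    obtain ⟨θ, η, h⟩ := ext hk (ih (by omega))
    have h3 : stdWord m b k = d k := by
      simp only [stdWord]; split_ifs <;> omega
    refine ⟨θ, η, ?_⟩
    rwa [← h3] at h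

theorem one_mem_of_forall (hk : k ≤ m) (N : Submodule K R)
    (h : ∀ b ≤ k, ∀ x ∈ genAlg K T k, ∀ y ∈ genAlg K T k,
      x * wtIdem α q m T (stdWord m b) k * y ∈ N) : (1 : R) ∈ N := by
  refine hB.mem_of_forall_wtIdem hk N LinearMap.id fun d b hd => ?_
  obtain ⟨θ, η, hc⟩ := hB.exists_wconj hk hd
  rw [LinearMap.id_apply, ← hc.ηθ, mul_assoc, hc.θ_mul, ← mul_assoc]
  exact h b hd.le _ hc.η_mem _ hc.θ_mem

end IsBlock

/-- Two idempotents `e` and `p` interchanged by the intertwiner of a pair of consecutive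
Jucys--Murphy elements, together with a conjugate `e'` of `p`. -/
structure IsEdge (q c : K)
    (t a L e p e' θ η : R) : Prop where
  pair : HPair q t a L
  θL : Commute θ L
  ηL : Commute η L
  eL : Commute e L
  pL : Commute p L
  θe : θ * e' = p * θ
  ηp : η * p = e' * η
  ηθ : η * θ * e' = e'
  θη : θ * η * p = p
  ee : e * e = e
  ee' : e' * e' = e'
  ep : e * p = 0
  pe : p * e = 0
  ae : a * e = (q * c) • e
  ap : a * p = c • p
  Le : (L - algebraMap K R c) * ((L - algebraMap K R c) * e) = 0
  Lp : (L - algebraMap K R (q * c)) * ((L - algebraMap K R (q * c)) * p) = 0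
  φe : p * ((t * a - a * t) * e) = (t * a - a * t) * e
  φp : e * ((t * a - a * t) * p) = (t * a - a * t) * p
  φLe : (t * a - a * t) * ((L - algebraMap K R c) * e) = 0
  φLp : (t * a - a * t) * ((L - algebraMap K R (q * c)) * p) = 0

/-- Membership in a subalgebra can be tested after multiplication by a unit close to a scalar. -/
theorem mem_of_mul_sub {L : R}
    {S : Subalgebra K R} (hL : L ∈ S) {r s : K} (hrs : s ≠ r) {x : R}
    (hx : x * ((L - algebraMap K R r) * (L - algebraMap K R r)) = 0)
    (hxS : x * (L - algebraMap K R s) ∈ S) : x ∈ S := by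
  have hr : L - algebraMap K R r ∈ S := sub_mem hL (S.algebraMap_mem r)
  have h1 : x = -(x * (L - algebraMap K R s) * (((s - r)⁻¹ : K) • (1 : R) +
      (((s - r)⁻¹) ^ 2 : K) • (L - algebraMap K R r))) := by
    have h2 : L - algebraMap K R s = (L - algebraMap K R r) - (s - r) • (1 : R) := by
      rw [sub_smul, ← Algebra.algebraMap_eq_smul_one, ← Algebra.algebraMap_eq_smul_one]; abel
    have hne := sub_ne_zero.2 hrs
    set N := L - algebraMap K R r
    have h3 : x * N * N = 0 := by rw [mul_assoc]; exact hx
    rw [h2]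
    simp only [mul_sub, mul_add, sub_mul, mul_smul_comm, smul_mul_assoc, mul_one, h3]
    match_scalars <;> field_simp
    ring
  rw [h1]
  exact neg_mem (mul_mem hxS (add_mem (S.smul_mem (one_mem S) _) (S.smul_mem hr _)))

namespace IsEdge

variable {q c : K} {t a L e p e' θ η : R}
  (h : IsEdge q c t a L e p e' θ η)

include h

theorem u_left : e' * (η * ((t * a - a * t) * e)) = η * ((t * a - a * t) * e) := by
  rw [← mul_assoc, ← h.ηp, mul_assoc, h.φe]

theorem d_left : e * ((t * a - a * t) * (θ * e')) = (t * a - a * t) * (θ * e') := by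
  rw [h.θe, ← mul_assoc _ p θ, ← mul_assoc, h.φp]

theorem φ_sub_c {r : K} : (L - algebraMap K R r) * (t * a - a * t) =
    (t * a - a * t) * (a - algebraMap K R r) := by
  have := h.pair.phi_a
  rw [sub_mul L _ (t * a - a * t), mul_sub (t * a - a * t) a, this, ← Algebra.commutes]

theorem y_u : (L - algebraMap K R (q * c)) * e' * (η * ((t * a - a * t) * e)) = 0 := by
  have hc : (L - algebraMap K R (q * c)) * η = η * (L - algebraMap K R (q * c)) := by
    rw [sub_mul, mul_sub, h.ηL.eq, Algebra.commutes]
  rw [mul_assoc, h.u_left, ← mul_assoc, hc, mul_assoc, ← mul_assoc _ (t * a - a * t), h.φ_sub_c,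
    mul_assoc _ _ e, sub_mul a _ e, h.ae, ← Algebra.smul_def, sub_self, mul_zero, mul_zero]

theorem u_y : η * ((t * a - a * t) * e) * ((L - algebraMap K R c) * e) = 0 := by
  have hc : Commute e (L - algebraMap K R c) := h.eL.sub_right (Algebra.commutes _ _).symm
  rw [mul_assoc, mul_assoc _ e, ← mul_assoc e, hc.eq, mul_assoc _ e, h.ee, h.φLe, mul_zero]

theorem y_d : (L - algebraMap K R c) * e * ((t * a - a * t) * (θ * e')) = 0 := by
  rw [mul_assoc, h.d_left, ← mul_assoc, h.φ_sub_c, mul_assoc, h.θe, ← mul_assoc _ p, sub_mul a _ p, h.ap,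
    ← Algebra.smul_def, sub_self, zero_mul, mul_zero]

theorem d_y : (t * a - a * t) * (θ * e') * ((L - algebraMap K R (q * c)) * e') = 0 := by
  have hc : Commute θ (L - algebraMap K R (q * c)) :=
    h.θL.sub_right (Algebra.commutes _ _).symm
  have hp : Commute p (L - algebraMap K R (q * c)) :=
    h.pL.sub_right (Algebra.commutes _ _).symm
  calc (t * a - a * t) * (θ * e') * ((L - algebraMap K R (q * c)) * e')
      = (t * a - a * t) * ((p * θ) * ((L - algebraMap K R (q * c)) * e')) := by
        rw [h.θe, mul_assoc]
    _ = (t * a - a * t) * ((L - algebraMap K R (q * c)) * p) * (θ * e') := by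
        rw [← hp.eq, mul_assoc p θ, ← mul_assoc θ, hc.eq]; simp only [mul_assoc]
    _ = 0 := by rw [h.φLp, zero_mul]

theorem d_u : (t * a - a * t) * (θ * e') * (η * ((t * a - a * t) * e)) =
    (q * (q ^ 2 - 1) * c) • ((L - algebraMap K R c) * e) := by
  have h1 : (t * a - a * t) * (θ * e') * (η * ((t * a - a * t) * e)) =
      (t * a - a * t) * (t * a - a * t) * e := by
    have : θ * (η * ((t * a - a * t) * e)) = (t * a - a * t) * e := by
      rw [← h.φe, ← mul_assoc, ← mul_assoc, h.θη]
    rw [mul_assoc, mul_assoc θ, h.u_left, this, mul_assoc]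
  have hL : L * ((L - algebraMap K R c) * e) = c • ((L - algebraMap K R c) * e) := by
    have := h.Le
    rwa [sub_mul L _ (_ * e), ← Algebra.smul_def, sub_eq_zero] at this
  have ha : a * ((L - algebraMap K R c) * e) = (q * c) • ((L - algebraMap K R c) * e) := by
    rw [← mul_assoc, mul_sub, h.pair.comm, ← Algebra.commutes, ← sub_mul, mul_assoc, h.ae,
      mul_smul_comm]
  have h2 : (q • L - a) * e = q • ((L - algebraMap K R c) * e) := by
    rw [sub_mul, sub_mul, h.ae, ← Algebra.smul_def, smul_mul_assoc, smul_sub, smul_smul]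
  rw [h1, h.pair.phi_sq, mul_assoc, h2, mul_smul_comm, sub_mul, smul_mul_assoc, ha, hL]
  module

theorem u_d : η * ((t * a - a * t) * e) * ((t * a - a * t) * (θ * e')) =
    (-((q ^ 2 - 1) * c)) • ((L - algebraMap K R (q * c)) * e') := by
  set z := (L - algebraMap K R (q * c)) * p with hz
  have hL : L * z = (q * c) • z := by
    have := h.Lp
    rwa [sub_mul L _ (_ * p), ← Algebra.smul_def, sub_eq_zero] at this
  have ha : a * z = c • z := by
    rw [hz, ← mul_assoc, mul_sub, h.pair.comm, ← Algebra.commutes, ← sub_mul, mul_assoc, h.ap,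
      mul_smul_comm]
  have hLp : L * p = z + (q * c) • p := by
    rw [hz, sub_mul, ← Algebra.smul_def]; abel
  have h1 : η * ((t * a - a * t) * e) * ((t * a - a * t) * (θ * e')) =
      η * ((t * a - a * t) * (t * a - a * t) * p) * θ := by
    rw [mul_assoc, mul_assoc _ e, h.d_left, h.θe]
    simp only [mul_assoc]
  have h2 : (t * a - a * t) * (t * a - a * t) * p = (-((q ^ 2 - 1) * c)) • z := by
    rw [h.pair.phi_sq, mul_assoc, sub_mul _ _ p, smul_mul_assoc, h.ap, hLp, sub_mul]
    simp only [smul_add, mul_sub, mul_add, mul_smul_comm, smul_mul_assoc, ha, hL, h.ap, hLp]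
    module
  have hc : η * (L - algebraMap K R (q * c)) = (L - algebraMap K R (q * c)) * η := by
    rw [sub_mul, mul_sub, h.ηL.eq, Algebra.commutes]
  have h3 : η * z * θ = (L - algebraMap K R (q * c)) * e' := by
    calc η * z * θ = (L - algebraMap K R (q * c)) * (η * (p * θ)) := by
          rw [hz, ← mul_assoc, hc]; simp only [mul_assoc]
      _ = _ := by rw [← h.θe, ← mul_assoc η, h.ηθ]
  rw [h1, h2, mul_smul_comm, smul_mul_assoc, h3]

theorem t_mem (S : Subalgebra K R) (hL : L ∈ S) (he : e ∈ S) (he' : e' ∈ S)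
    (hu : η * ((t * a - a * t) * e) ∈ S) (hd : (t * a - a * t) * (θ * e') ∈ S) (hqc : q * c ≠ c) :
    e * t * e ∈ S ∧ e * t * (θ * e') ∈ S ∧ e' * η * t * e ∈ S ∧ e' * η * t * (θ * e') ∈ S := by
  set φ := t * a - a * t with hφ
  have hcL : ∀ r : K, Commute (L - algebraMap K R r) L := fun r =>
    (Commute.refl L).sub_left (Algebra.commutes _ _)
  have hcr : ∀ (r : K) {x : R}, Commute x L → Commute x (L - algebraMap K R r) := fun r x hx =>
    hx.sub_right (Algebra.commutes _ _).symm
  have ht : t * (a - L) = φ - (q - 1) • L := by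
    rw [hφ, mul_sub, h.pair.Tb]; abel
  have hte : t * e * (L - algebraMap K R (q * c)) = (q - 1) • (L * e) - φ * e := by
    have h1 : t * (a - L) * e = φ * e - (q - 1) • (L * e) := by
      rw [ht, sub_mul, smul_mul_assoc]
    rw [mul_assoc, sub_mul a, h.ae] at h1
    rw [mul_assoc, (hcr _ h.eL).eq, sub_mul, ← Algebra.smul_def, ← neg_sub, mul_neg, h1]
    abel
  have hθ : t * (θ * e') * (L - algebraMap K R c) = (q - 1) • (L * (θ * e')) - φ * (θ * e') := by
    have h1 : t * (a - L) * p = φ * p - (q - 1) • (L * p) := by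
      rw [ht, sub_mul, smul_mul_assoc]
    rw [mul_assoc, sub_mul a, h.ap] at h1
    have h2 : t * p * (L - algebraMap K R c) = (q - 1) • (L * p) - φ * p := by
      rw [mul_assoc, (hcr _ h.pL).eq, sub_mul, ← Algebra.smul_def, ← neg_sub, mul_neg, h1]
      abel
    calc t * (θ * e') * (L - algebraMap K R c) = t * p * (L - algebraMap K R c) * θ := by
          rw [h.θe, mul_assoc, mul_assoc p, (hcr _ h.θL).eq]; simp only [mul_assoc]
      _ = _ := by rw [h2, h.θe, sub_mul, smul_mul_assoc]; simp only [mul_assoc]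
  have hsqe : e * ((L - algebraMap K R c) * (L - algebraMap K R c)) = 0 := by
    rw [((hcr c h.eL).mul_right (hcr c h.eL)).eq, mul_assoc]
    exact h.Le
  have hsqθ : θ * e' * ((L - algebraMap K R (q * c)) * (L - algebraMap K R (q * c))) = 0 := by
    have := h.Lp
    rw [h.θe, mul_assoc, ((hcr (q * c) h.θL).mul_right (hcr (q * c) h.θL)).eq, ← mul_assoc,
      ((hcr (q * c) h.pL).mul_right (hcr (q * c) h.pL)).eq, mul_assoc _ _ p, this, zero_mul]
  have hηe : e' * η * e = 0 := by rw [← h.ηp, mul_assoc, h.pe, mul_zero]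
  have heθ : e * (θ * e') = 0 := by rw [h.θe, ← mul_assoc, h.ep, zero_mul]
  have heφe : e * (φ * e) = 0 := by rw [← h.φe, ← mul_assoc, h.ep, zero_mul]
  have hηφθ : e' * η * (φ * (θ * e')) = 0 := by
    rw [← h.d_left, ← mul_assoc, hηe, zero_mul]
  have hηθe : e' * η * (θ * e') = e' := by
    rw [mul_assoc, ← mul_assoc η, h.ηθ, h.ee']
  have hηL : e' * η * L = L * (e' * η) := by
    rw [← h.ηp, mul_assoc, h.pL.eq, ← mul_assoc, h.ηL.eq, mul_assoc]
  refine ⟨?_, ?_, ?_, ?_⟩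
  · refine mem_of_mul_sub hL (s := q * c) (r := c) hqc (by rw [mul_assoc, hsqe, mul_zero]) ?_
    rw [mul_assoc, mul_assoc, ← mul_assoc t, hte, mul_sub, heφe, sub_zero, mul_smul_comm]
    exact S.smul_mem (mul_mem he (mul_mem hL he)) _
  · refine mem_of_mul_sub hL (s := c) (r := q * c) hqc.symm
      (by rw [mul_assoc, hsqθ, mul_zero]) ?_
    rw [mul_assoc, mul_assoc, ← mul_assoc t, hθ, mul_sub, h.d_left, mul_smul_comm, ← mul_assoc,
      h.eL.eq, mul_assoc, heθ, mul_zero, smul_zero, zero_sub]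
    exact neg_mem hd
  · refine mem_of_mul_sub hL (s := q * c) (r := c) hqc (by rw [mul_assoc, hsqe, mul_zero]) ?_
    rw [mul_assoc, mul_assoc, ← mul_assoc t, hte, mul_sub, mul_smul_comm, ← mul_assoc _ L, hηL,
      mul_assoc L, hηe, mul_zero, smul_zero, zero_sub, mul_assoc, h.u_left]
    exact neg_mem hu
  · refine mem_of_mul_sub hL (s := c) (r := q * c) hqc.symm
      (by rw [mul_assoc, hsqθ, mul_zero]) ?_
    rw [mul_assoc, mul_assoc, ← mul_assoc t, hθ, mul_sub, hηφθ, sub_zero, mul_smul_comm,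
      ← mul_assoc _ L, hηL, mul_assoc L, hηθe]
    exact S.smul_mem (mul_mem hL he') _

end IsEdge

/-- The weight idempotents of the vertices of a block. -/
noncomputable def zvert (α q : K) (m : ℕ) (T : ℕ → R) (b : ℕ) :
    R :=
  wtIdem α q m T (stdWord m b) m

/-- The loops at the vertices of a block. -/
noncomputable def zloop (α q : K) (m : ℕ) (T : ℕ → R) (b : ℕ) :
    R :=
  (jm q T m - algebraMap K R (α * q ^ b)) * zvert α q m T b

/-- The arrows raising the vertices of a block. -/
noncomputable def zup (α q : K) (m : ℕ) (T : ℕ → R) (b : ℕ) :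
    R :=
  moveLeft α q m T b (m - 1 - b) *
    ((T m * jm q T (m - 1) - jm q T (m - 1) * T m) * zvert α q m T b)

/-- The arrows lowering the vertices of a block. -/
noncomputable def zdown (α q : K) (m : ℕ) (T : ℕ → R) (b : ℕ) :
    R :=
  (T m * jm q T (m - 1) - jm q T (m - 1) * T m) *
    (moveRight q T b (m - 1 - b) * zvert α q m T (b + 1))

namespace IsBlock

section

variable {T : ℕ → R} (hB : IsBlock α q m T)

include hB

/-- An element killed by the square of a linear factor of a diagonalisable element is an
eigenvector. -/
theorem jmIdem_mul_of_sq (hk : k < m) (hb : b ≤ m) {X : R}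
    (h : (jm q T k - algebraMap K R (α * q ^ b)) *
      ((jm q T k - algebraMap K R (α * q ^ b)) * X) = 0) :
    jmIdem α q m T k b * X = X ∧ (jm q T k - algebraMap K R (α * q ^ b)) * X = 0 := by
  have h1 : ∀ r ≤ m, r ≠ b → jmIdem α q m T k r * X = 0 := by
    intro r hr hrb
    have hp := hB.aeval_mul_jmIdem hk hr
      ((.X - C (α * q ^ b)) * (.X - C (α * q ^ b)))
    have hc : aeval (jm q T k) ((.X - C (α * q ^ b)) *
        (.X - C (α * q ^ b))) = (jm q T k - algebraMap K R (α * q ^ b)) *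
          (jm q T k - algebraMap K R (α * q ^ b)) := by simp
    have hcom : Commute (jmIdem α q m T k r) ((jm q T k - algebraMap K R (α * q ^ b)) *
          (jm q T k - algebraMap K R (α * q ^ b))) := by
      rw [← hc, jmIdem]; exact (Commute.all _ _).map (aeval (jm q T k))
    rw [hc, ← hcom.eq] at hp
    have h2 := congrArg (· * X) hp
    simp only [mul_assoc, h, mul_zero, smul_mul_assoc] at h2
    refine (smul_eq_zero.1 h2.symm).resolve_left ?_
    simp only [Polynomial.eval_mul, Polynomial.eval_sub, Polynomial.eval_X, Polynomial.eval_C]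
    exact mul_ne_zero (sub_ne_zero.2 (hB.pow_ne (by omega) (by omega) hrb))
      (sub_ne_zero.2 (hB.pow_ne (by omega) (by omega) hrb))
  have h2 : jmIdem α q m T k b * X = X := by
    have := congrArg (· * X) (hB.sum_jmIdem k)
    simp only [sum_mul, one_mul] at this
    rwa [sum_eq_single b (fun r hr hrb => h1 r (by simpa [lt_succ_iff] using hr) hrb)
      (fun hn => absurd (mem_range.2 (by omega)) hn)] at this
  refine ⟨h2, ?_⟩
  rw [← h2, ← mul_assoc, sub_mul, hB.jm_mul_jmIdem hk hb, ← Algebra.smul_def, sub_self, zero_mul]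

end

variable {T : ℕ → R} (hB : IsBlock α q (i + 1) T)

include hB

theorem jphi_mul_wtIdem_of_isWord (hd : IsWord (i + 1) d (i + 1) b) :
    jmIdem α q (i + 1) T i b * (jphi q T i * wtIdem α q (i + 1) T d (i + 1)) =
      jphi q T i * wtIdem α q (i + 1) T d (i + 1) ∧
    jphi q T i * ((jm q T (i + 1) - algebraMap K R (α * q ^ b)) *
      wtIdem α q (i + 1) T d (i + 1)) = 0 := by
  have hp : ∀ r : K, (jm q T i - algebraMap K R r) * jphi q T i =
      jphi q T i * (jm q T (i + 1) - algebraMap K R r) := fun r => by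
    have := (hB.hPair (lt_succ_self i)).phi_b
    rw [jphi] at *
    rw [sub_mul (jm q T i), mul_sub _ (jm q T (i + 1)), this, ← Algebra.commutes]
  have hs := hB.jm_sq d b hd
  have h1 : (jm q T i - algebraMap K R (α * q ^ b)) * ((jm q T i - algebraMap K R (α * q ^ b)) *
      (jphi q T i * wtIdem α q (i + 1) T d (i + 1))) = 0 := by
    rw [← mul_assoc _ (jphi q T i), hp, mul_assoc (jphi q T i), ← mul_assoc _ (jphi q T i), hp,
      mul_assoc (jphi q T i), ← mul_assoc (_ - _), hs, mul_zero]
  have h2 := hB.jmIdem_mul_of_sq (lt_succ_self i) hd.le h1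
  refine ⟨h2.1, ?_⟩
  rw [← mul_assoc, ← hp, mul_assoc]
  exact h2.2

omit hB in
theorem zvert_eq (hb : b ≤ i) : zvert α q (i + 1) T b =
    wtIdem α q (i + 1) T (stdWord (i + 1) b) i * jmIdem α q (i + 1) T i (b + 1) := by
  rw [zvert, wtIdem]
  congr 2
  simp only [stdWord, if_neg (not_lt.2 hb)]
  omega

omit hB in
theorem wtIdem_insWord (hb : b ≤ i) :
    wtIdem α q (i + 1) T (insWord (i + 1) b i) (i + 1) =
    wtIdem α q (i + 1) T (stdWord (i + 1) b) i * jmIdem α q (i + 1) T i b := by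
  rw [wtIdem, insWord_at hb]
  congr 1
  exact wtIdem_congr fun l hl => insWord_of_lt hl

theorem isEdge (hb : b ≤ i) : IsEdge q (α * q ^ b) (T (i + 1)) (jm q T i)
    (jm q T (i + 1)) (zvert α q (i + 1) T b)
    (wtIdem α q (i + 1) T (insWord (i + 1) b i) (i + 1)) (zvert α q (i + 1) T (b + 1))
    (moveRight q T b (i - b)) (moveLeft α q (i + 1) T b (i - b)) := by
  have hw := hB.wconj_move (b := b) (j := i - b) (le_refl (i + 1)) (by omega)
  rw [Nat.add_sub_cancel' hb] at hw
  have hs := isWord_stdWord (m := i + 1) (b := b) (k := i + 1) (by omega) le_rfl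
  have hs' := isWord_insWord (m := i + 1) (b := b) (k := i) (by omega) (by omega)
  have hsl : ∀ l < i + 1, stdWord (i + 1) b l ≤ i + 1 := fun l hl => hs.le_of_lt le_rfl hl
  have hsl' : ∀ l < i + 1, insWord (i + 1) b i l ≤ i + 1 := fun l hl => hs'.le_of_lt le_rfl hl
  have hr := isWord_stdWord (m := i + 1) (b := b + 1) (k := i + 1) (by omega) le_rfl
  have hrl : ∀ l < i + 1, stdWord (i + 1) (b + 1) l ≤ i + 1 := fun l hl => hr.le_of_lt le_rfl hl
  have hcomm : ∀ x ∈ genAlg K T (i + 1), Commute x (jm q T (i + 1)) := fun x hx =>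
    hB.hT.commute_genAlg_jm le_rfl (by omega) hx
  have hqc : q * (α * q ^ b) = α * q ^ (b + 1) := by ring
  have hP : Commute (wtIdem α q (i + 1) T (stdWord (i + 1) b) i) (jphi q T i) :=
    hB.commute_genAlg_jphi (lt_succ_self i) (wtIdem_mem le_rfl)
  have hPi : ∀ r, Commute (wtIdem α q (i + 1) T (stdWord (i + 1) b) i)
      (jmIdem α q (i + 1) T i r) := hB.commute_jmIdem (by omega) (wtIdem_mem le_rfl)
  have hPP := hB.wtIdem_mul_self (d := stdWord (i + 1) b) (k := i) (by omega)
    (fun l hl => hsl l (by omega))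
  have hne : ∀ k < i + 1, insWord (i + 1) b i k = stdWord (i + 1) b k → k ≠ i := by
    rintro k - h rfl
    rw [insWord_at hb] at h
    simp only [stdWord, if_neg (not_lt.2 hb)] at h
    omega
  have hA := hB.jphi_mul_wtIdem_of_isWord hs
  have hA' := hB.jphi_mul_wtIdem_of_isWord hs'
  have hPz : wtIdem α q (i + 1) T (stdWord (i + 1) b) i * zvert α q (i + 1) T b =
      zvert α q (i + 1) T b := by rw [zvert_eq hb, ← mul_assoc, hPP]
  have hPp : wtIdem α q (i + 1) T (stdWord (i + 1) b) i *
      wtIdem α q (i + 1) T (insWord (i + 1) b i) (i + 1) =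
      wtIdem α q (i + 1) T (insWord (i + 1) b i) (i + 1) := by
    rw [wtIdem_insWord hb, ← mul_assoc, hPP]
  exact
  { pair := hB.hPair (lt_succ_self i)
    θL := hcomm _ hw.θ_mem
    ηL := hcomm _ hw.η_mem
    eL := hcomm _ (wtIdem_mem le_rfl)
    pL := hcomm _ (wtIdem_mem le_rfl)
    θe := hw.θ_mul
    ηp := hw.η_mul
    ηθ := hw.ηθ
    θη := hw.θη
    ee := hB.wtIdem_mul_self le_rfl hsl
    ee' := hB.wtIdem_mul_self le_rfl hrl
    ep := by
      rw [zvert, hB.wtIdem_mul_wtIdem le_rfl hsl hsl', if_neg]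
      exact fun h => hne i (by omega) (h i (by omega)).symm rfl
    pe := by
      rw [zvert, hB.wtIdem_mul_wtIdem le_rfl hsl' hsl, if_neg]
      exact fun h => hne i (by omega) (h i (by omega)) rfl
    ae := by
      rw [zvert, hB.jm_mul_wtIdem le_rfl hsl (by omega), hqc]
      simp only [stdWord, if_neg (not_lt.2 hb)]
      congr 3
      omega
    ap := by
      rw [hB.jm_mul_wtIdem le_rfl hsl' (by omega), insWord_at hb]
    Le := by
      have := hB.jm_sq _ _ hs
      rwa [mul_assoc] at this
    Lp := by
      have := hB.jm_sq _ _ hs'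
      rwa [mul_assoc, ← hqc] at this
    φe := by
      have h1 := hA.1
      rw [jphi] at h1 hP
      rw [wtIdem_insWord hb, mul_assoc, zvert, h1, ← mul_assoc, hP.eq, mul_assoc]
      exact congrArg _ hPz
    φp := by
      have h1 := hA'.1
      rw [jphi] at h1 hP
      rw [zvert_eq hb, mul_assoc, h1, ← mul_assoc, hP.eq, mul_assoc, hPp]
    φLe := hA.2
    φLp := by rw [hqc]; exact hA'.2 }

end IsBlock

/-- The sum of the vertex idempotents of a block. -/
noncomputable def zsum (α q : K) (m : ℕ)
    (T : ℕ → R) : R :=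
  ∑ a ∈ range (m + 1), zvert α q m T a

namespace IsBlock

variable {T : ℕ → R}

theorem zvert_mem (hk : m ≤ k) : zvert α q m T a ∈ genAlg K T k := wtIdem_mem hk

theorem zsum_mem (hk : m ≤ k) : zsum α q m T ∈ genAlg K T k :=
  sum_mem fun _ _ => zvert_mem hk

variable (hB : IsBlock α q m T)

include hB

theorem isEdge' (hb : b < m) : IsEdge q (α * q ^ b) (T m) (jm q T (m - 1)) (jm q T m)
    (zvert α q m T b) (wtIdem α q m T (insWord m b (m - 1)) m) (zvert α q m T (b + 1))
    (moveRight q T b (m - 1 - b)) (moveLeft α q m T b (m - 1 - b)) := by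
  obtain ⟨i, rfl⟩ : ∃ i, m = i + 1 := ⟨m - 1, by omega⟩
  exact hB.isEdge (lt_succ_iff.1 hb)

theorem zvert_mul_zvert (ha : a ≤ m) (hb : b ≤ m) :
    zvert α q m T a * zvert α q m T b = if a = b then zvert α q m T a else 0 := by
  have h : ∀ {a}, a ≤ m → ∀ l < m, stdWord m a l ≤ m := fun ha l hl =>
    (isWord_stdWord ha le_rfl).le_of_lt le_rfl hl
  split_ifs with hab
  · subst hab
    exact hB.wtIdem_mul_self le_rfl (h ha)
  · rw [zvert, zvert, ← hB.wtIdem_mul_self le_rfl (h ha), mul_assoc, ← mul_assoc]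
    have := hB.wtIdem_mul_mul_eq_zero (isWord_stdWord ha le_rfl) (isWord_stdWord hb le_rfl) hab
      (one_mem _)
    rw [mul_one] at this
    rw [mul_assoc, this, mul_zero]

theorem zvert_mul_zsum (ha : a ≤ m) :
    zvert α q m T a * zsum α q m T = zvert α q m T a := by
  rw [zsum, mul_sum, sum_eq_single a, hB.zvert_mul_zvert ha ha, if_pos rfl]
  · intro b hb hba
    rw [hB.zvert_mul_zvert ha (by simpa [lt_succ_iff] using hb), if_neg hba.symm]
  · exact fun h => absurd (mem_range.2 (by omega)) h

theorem zsum_mul_zvert (ha : a ≤ m) :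
    zsum α q m T * zvert α q m T a = zvert α q m T a := by
  rw [zsum, sum_mul, sum_eq_single a, hB.zvert_mul_zvert ha ha, if_pos rfl]
  · intro b hb hba
    rw [hB.zvert_mul_zvert (by simpa [lt_succ_iff] using hb) ha, if_neg hba]
  · exact fun h => absurd (mem_range.2 (by omega)) h

theorem zsum_mul_zsum : zsum α q m T * zsum α q m T = zsum α q m T := by
  conv_lhs => rw [zsum, sum_mul]
  exact sum_congr rfl fun a ha => hB.zvert_mul_zsum (by simpa [lt_succ_iff] using ha)

theorem commute_zvert_jm (a : ℕ) : Commute (zvert α q m T a) (jm q T m) :=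
  hB.hT.commute_genAlg_jm le_rfl (by omega) (zvert_mem le_rfl)

theorem commute_zsum_jm : Commute (zsum α q m T) (jm q T m) :=
  hB.hT.commute_genAlg_jm le_rfl (by omega) (zsum_mem le_rfl)

theorem exists_zvert_mul_mul_zsum (hb : b ≤ m) {x : R} (hx : x ∈ genAlg K T m) :
    ∃ c : K, zvert α q m T b * x * zsum α q m T = c • zvert α q m T b := by
  obtain ⟨c, hc⟩ := hB.exists_wtIdem_mul_mul le_rfl
    (fun l hl => (isWord_stdWord hb le_rfl).le_of_lt le_rfl hl) hx
  refine ⟨c, ?_⟩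
  rw [zsum, mul_sum, sum_eq_single b]
  · exact hc
  · intro a ha hab
    exact hB.wtIdem_mul_mul_eq_zero (isWord_stdWord hb le_rfl)
      (isWord_stdWord (by simpa [lt_succ_iff] using ha) le_rfl) hab.symm hx
  · exact fun h => absurd (mem_range.2 (by omega)) h

theorem exists_zsum_mul_mul_zvert (hb : b ≤ m) {x : R} (hx : x ∈ genAlg K T m) :
    ∃ c : K, zsum α q m T * x * zvert α q m T b = c • zvert α q m T b := by
  obtain ⟨c, hc⟩ := hB.exists_wtIdem_mul_mul le_rfl
    (fun l hl => (isWord_stdWord hb le_rfl).le_of_lt le_rfl hl) hx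
  refine ⟨c, ?_⟩
  rw [zsum, sum_mul, sum_mul, sum_eq_single b]
  · exact hc
  · intro a ha hab
    exact hB.wtIdem_mul_mul_eq_zero (isWord_stdWord (by simpa [lt_succ_iff] using ha) le_rfl)
      (isWord_stdWord hb le_rfl) hab hx
  · exact fun h => absurd (mem_range.2 (by omega)) h

theorem wtIdem_stdWord_eq_add (hb : b < m) : wtIdem α q m T (stdWord m b) (m - 1) =
    zvert α q m T b + wtIdem α q m T (insWord m b (m - 1)) m := by
  obtain ⟨i, rfl⟩ : ∃ i, m = i + 1 := ⟨m - 1, by omega⟩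
  have hb : b ≤ i := lt_succ_iff.1 hb
  rw [zvert_eq hb, Nat.add_sub_cancel, wtIdem_insWord hb]
  have hu : ∀ r, wtIdem α q (i + 1) T (update (stdWord (i + 1) b) i r) (i + 1) =
      wtIdem α q (i + 1) T (stdWord (i + 1) b) i * jmIdem α q (i + 1) T i r := fun r => by
    rw [wtIdem, update_self]
    congr 1
    exact wtIdem_congr fun l hl => update_of_ne (by omega) _ _
  have hs := isWord_stdWord (m := i + 1) (b := b) (k := i) hb (by omega)
  conv_lhs => rw [hB.wtIdem_eq_sum]
  rw [← Finset.sum_subset (s₁ := {b + 1, b}), Finset.sum_pair (by omega)]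
  · rw [hu, hu]
  · intro r hr
    simp only [mem_insert, Finset.mem_singleton, mem_range] at hr ⊢
    omega
  · intro r hr hr'
    simp only [mem_insert, Finset.mem_singleton, mem_range, not_or] at hr hr'
    refine hB.wtIdem_eq_zero le_rfl _ (fun l hl => ?_) fun b' hw => ?_
    · rcases lt_succ_iff_lt_or_eq.1 hl with h | rfl
      · rw [update_of_ne (by omega)]
        exact hs.le_of_lt (by omega) h
      · rw [update_self]; omega
    · have hc : ∀ b₀, IsWord (i + 1) (update (stdWord (i + 1) b) i r) i b₀ → b₀ = b :=
        fun b₀ h => (h.congr fun l hl => update_of_ne (by omega) _ _).unique hs (by omega)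
      cases hw with
      | left h1 h2 =>
        rw [update_self] at h2
        have := hc _ h1
        omega
      | right h1 h2 =>
        rw [update_self] at h2
        have := hc _ h1
        omega

/-- The subalgebra cut out by the vertex idempotents of a block is spanned by few elements. -/
theorem zsum_mul_mul_zsum_mem (N : Submodule K R)
    (hL : ∀ a ≤ m, ∀ j : ℕ, zvert α q m T a * jm q T m ^ j ∈ N)
    (h1 : ∀ b < m, zvert α q m T b * T m * zvert α q m T b ∈ N)
    (h2 : ∀ b < m, zvert α q m T b * T m *
      (moveRight q T b (m - 1 - b) * zvert α q m T (b + 1)) ∈ N)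
    (h3 : ∀ b < m, zvert α q m T (b + 1) * moveLeft α q m T b (m - 1 - b) * T m *
      zvert α q m T b ∈ N)
    (h4 : ∀ b < m, zvert α q m T (b + 1) * moveLeft α q m T b (m - 1 - b) * T m *
      (moveRight q T b (m - 1 - b) * zvert α q m T (b + 1)) ∈ N) :
    ∀ x ∈ genAlg K T (m + 1), zsum α q m T * x * zsum α q m T ∈ N := by
  refine hB.hT.genAlg_succ_le hB.hq (lt_succ_self m)
    (N.comap (LinearMap.mulLeftRight K (zsum α q m T, zsum α q m T))) ?_ ?_
  · intro y hy j
    rw [Submodule.mem_comap, mulLeftRight_apply]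
    have hc := (hB.commute_zsum_jm.pow_right j).eq
    have h : zsum α q m T * (y * jm q T m ^ j) * zsum α q m T =
        ∑ a ∈ range (m + 1), zvert α q m T a * y * zsum α q m T * jm q T m ^ j := by
      rw [← sum_mul, ← sum_mul, ← sum_mul, mul_assoc, mul_assoc, ← hc,
        ← mul_assoc, ← mul_assoc]
      rfl
    rw [h]
    refine sum_mem fun a ha => ?_
    obtain ⟨c, h⟩ := hB.exists_zvert_mul_mul_zsum (b := a)
      (by simpa [lt_succ_iff] using ha) hy
    rw [h, smul_mul_assoc]
    exact N.smul_mem _ (hL a (by simpa [lt_succ_iff] using ha) j)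
  · intro hm y hy z hz
    rw [Submodule.mem_comap, mulLeftRight_apply]
    have key := hB.one_mem_of_forall (k := m - 1) (by omega) (N.comap
      (LinearMap.mulLeftRight K (zsum α q m T * y, T m * (z * zsum α q m T)))) ?_
    · rw [Submodule.mem_comap, mulLeftRight_apply, mul_one] at key
      simpa only [mul_assoc] using key
    intro b hb x hx y' hy'
    rw [Submodule.mem_comap, mulLeftRight_apply]
    have hbm : b < m := by omega
    have hE := hB.isEdge' hbm
    set p := wtIdem α q m T (stdWord m b) (m - 1) with hp
    have hpm : p ∈ genAlg K T (m - 1) := wtIdem_mem le_rfl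
    have hpp : p * p = p := hB.wtIdem_mul_self (by omega) fun l hl =>
      (isWord_stdWord hb (by omega)).le_of_lt (by omega) hl
    have hT : ∀ w ∈ genAlg K T (m - 1), w * T m = T m * w := fun w hw =>
      (hB.hT.commute_genAlg (by omega) (by omega) hw).eq
    have hmono : genAlg K T (m - 1) ≤ genAlg K T m := genAlg_mono (by omega)
    have h : zsum α q m T * y * (x * p * y') * (T m * (z * zsum α q m T)) =
        zsum α q m T * (y * x) * p * T m * (p * (y' * z) * zsum α q m T) := by
      calc zsum α q m T * y * (x * p * y') * (T m * (z * zsum α q m T))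
          = zsum α q m T * y * x * (p * p) * (y' * T m) * (z * zsum α q m T) := by
            rw [hpp]; simp only [mul_assoc]
        _ = zsum α q m T * y * x * p * (p * T m) * y' * (z * zsum α q m T) := by
            rw [hT _ hy']; simp only [mul_assoc]
        _ = _ := by rw [hT _ hpm]; simp only [mul_assoc]
    rw [h]
    have hpe : p = zvert α q m T b + wtIdem α q m T (insWord m b (m - 1)) m :=
      hB.wtIdem_stdWord_eq_add hbm
    set e := zsum α q m T
    set eb := zvert α q m T b
    set eb' := zvert α q m T (b + 1)
    set p' := wtIdem α q m T (insWord m b (m - 1)) m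
    have hY : y * x ∈ genAlg K T m := mul_mem hy (hmono hx)
    have hZ : y' * z ∈ genAlg K T m := mul_mem (hmono hy') hz
    have hw := hB.wconj_move (b := b) (j := m - 1 - b) (le_refl m) (by omega)
    obtain ⟨l1, e1⟩ := hB.exists_zsum_mul_mul_zvert hbm.le hY
    obtain ⟨l2, e2⟩ := hB.exists_zvert_mul_mul_zsum hbm.le hZ
    obtain ⟨l3, e3⟩ := hB.exists_zsum_mul_mul_zvert (b := b + 1) (by omega)
      (mul_mem hY hw.θ_mem)
    obtain ⟨l4, e4⟩ := hB.exists_zvert_mul_mul_zsum (b := b + 1) (by omega)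
      (mul_mem hw.η_mem hZ)
    set θ := moveRight q T b (m - 1 - b)
    set η := moveLeft α q m T b (m - 1 - b)
    have hpl : p' = θ * eb' * η := by rw [mul_assoc, ← hE.ηp, ← mul_assoc, hE.θη]
    have f1 : e * (y * x) * p = l1 • eb + l3 • (eb' * η) := by
      calc e * (y * x) * p = e * (y * x) * eb + e * (y * x * θ) * eb' * η := by
            rw [hpe, hpl, mul_add]; simp only [mul_assoc]
        _ = _ := by rw [e1, e3, smul_mul_assoc]
    have f2 : p * (y' * z) * e = l2 • eb + l4 • (θ * eb') := by
      calc p * (y' * z) * e = eb * (y' * z) * e + θ * (eb' * (η * (y' * z)) * e) := by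
            rw [hpe, hpl, add_mul, add_mul]; simp only [mul_assoc]
        _ = _ := by rw [e2, e4, mul_smul_comm]
    rw [f1, f2]
    simp only [add_mul, mul_add, smul_mul_assoc, mul_smul_comm, smul_add]
    refine add_mem (add_mem ?_ ?_) (add_mem ?_ ?_)
    · exact N.smul_mem _ (N.smul_mem _ (h1 b hbm))
    · exact N.smul_mem _ (N.smul_mem _ (h3 b hbm))
    · exact N.smul_mem _ (N.smul_mem _ (h2 b hbm))
    · exact N.smul_mem _ (N.smul_mem _ (h4 b hbm))

end IsBlock

/-- Representatives of the arrows of a zigzag quiver with vertices `0, …, m`. -/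
structure IsZig (m : ℕ) (κ κ' : ℕ → K)
    (e u d y : ℕ → R) : Prop where
  ee : ∀ a ≤ m, e a * e a = e a
  eo : ∀ a ≤ m, ∀ b ≤ m, a ≠ b → e a * e b = 0
  eu : ∀ b < m, e (b + 1) * u b = u b
  ue : ∀ b < m, u b * e b = u b
  ed : ∀ b < m, e b * d b = d b
  de : ∀ b < m, d b * e (b + 1) = d b
  ey : ∀ a ≤ m, e a * y a = y a
  ye : ∀ a ≤ m, y a * e a = y a
  yy : ∀ a ≤ m, y a * y a = 0
  yu : ∀ b < m, y (b + 1) * u b = 0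
  uy : ∀ b < m, u b * y b = 0
  yd : ∀ b < m, y b * d b = 0
  dy : ∀ b < m, d b * y (b + 1) = 0
  du : ∀ b < m, d b * u b = κ b • y b
  ud : ∀ b < m, u b * d b = κ' b • y (b + 1)
  uu : ∀ b, b + 1 < m → u (b + 1) * u b = 0
  dd : ∀ b, b + 1 < m → d b * d (b + 1) = 0

namespace IsBlock

variable {T : ℕ → R}
  (hB : IsBlock α q m T)

include hB

theorem zvert_mul_mul_zvert_eq_zero (ha : a ≤ m) (hb : b ≤ m)
    (hab : a + 1 < b ∨ b + 1 < a) {x : R} (hx : x ∈ genAlg K T (m + 1)) :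
    zvert α q m T a * x * zvert α q m T b = 0 := by
  have ho : ∀ {c c'}, c ≤ m → c' ≤ m → c ≠ c' → zvert α q m T c * zvert α q m T c' = 0 := by
    intro c c' hc hc' h
    rw [hB.zvert_mul_zvert hc hc', if_neg h]
  have key : ∀ c c' : ℕ, c ≤ m → c' ≤ m → (c ≠ a ∨ c' ≠ b) → ∀ x : R,
      zvert α q m T c * x * zvert α q m T c' ∈
        LinearMap.ker (LinearMap.mulLeftRight K (zvert α q m T a, zvert α q m T b)) := by
    intro c c' hc hc' h x
    rw [mem_ker, mulLeftRight_apply]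
    rcases h with h | h
    · rw [← mul_assoc, ← mul_assoc, ho ha hc h.symm, zero_mul, zero_mul, zero_mul]
    · rw [mul_assoc, mul_assoc, ho hc' hb h, mul_zero, mul_zero]
  have h := hB.zsum_mul_mul_zsum_mem
    (LinearMap.ker (LinearMap.mulLeftRight K (zvert α q m T a, zvert α q m T b)))
    ?_ ?_ ?_ ?_ ?_ x hx
  · rw [mem_ker, mulLeftRight_apply, ← mul_assoc, ← mul_assoc,
      hB.zvert_mul_zsum ha, mul_assoc, hB.zsum_mul_zvert hb] at h
    exact h
  · intro c hc j
    have := key c c hc hc (by omega) (jm q T m ^ j)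
    rwa [mul_assoc, ← ((hB.commute_zvert_jm c).pow_right j).eq, ← mul_assoc,
      hB.zvert_mul_zvert hc hc, if_pos rfl] at this
  · exact fun c hc => key c c (by omega) (by omega) (by omega) _
  · intro c hc
    rw [← mul_assoc, mul_assoc (zvert α q m T c)]
    exact key c (c + 1) (by omega) (by omega) (by omega) _
  · intro c hc
    rw [mul_assoc (zvert α q m T (c + 1))]
    exact key (c + 1) c (by omega) (by omega) (by omega) _
  · intro c hc
    rw [← mul_assoc, mul_assoc (zvert α q m T (c + 1)), mul_assoc (zvert α q m T (c + 1))]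
    exact key (c + 1) (c + 1) (by omega) (by omega) (by omega) _

theorem zup_mem (hb : b < m) : zup α q m T b ∈ genAlg K T (m + 1) := by
  have hw := hB.wconj_move (b := b) (j := m - 1 - b) (le_refl m) (by omega)
  have hj : jm q T (m - 1) ∈ genAlg K T (m + 1) := jm_mem_genAlg (by omega)
  have ht : T m ∈ genAlg K T (m + 1) := mem_genAlg (by omega)
  exact mul_mem (genAlg_mono (Nat.le_succ m) hw.η_mem)
    (mul_mem (sub_mem (mul_mem ht hj) (mul_mem hj ht)) (zvert_mem (Nat.le_succ m)))

theorem zdown_mem (hb : b < m) : zdown α q m T b ∈ genAlg K T (m + 1) := by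
  have hw := hB.wconj_move (b := b) (j := m - 1 - b) (le_refl m) (by omega)
  have hj : jm q T (m - 1) ∈ genAlg K T (m + 1) := jm_mem_genAlg (by omega)
  have ht : T m ∈ genAlg K T (m + 1) := mem_genAlg (by omega)
  exact mul_mem (sub_mem (mul_mem ht hj) (mul_mem hj ht))
    (mul_mem (genAlg_mono (Nat.le_succ m) hw.θ_mem) (zvert_mem (Nat.le_succ m)))

theorem isZig : IsZig m (fun b => q * (q ^ 2 - 1) * (α * q ^ b))
    (fun b => -((q ^ 2 - 1) * (α * q ^ b))) (zvert α q m T) (zup α q m T) (zdown α q m T)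
    (zloop α q m T) := by
  have hqc : ∀ b : ℕ, q * (α * q ^ b) = α * q ^ (b + 1) := fun b => by ring
  have hee : ∀ a ≤ m, zvert α q m T a * zvert α q m T a = zvert α q m T a := fun a ha => by
    rw [hB.zvert_mul_zvert ha ha, if_pos rfl]
  have hey : ∀ a ≤ m, zvert α q m T a * zloop α q m T a = zloop α q m T a := fun a ha => by
    have hc := (hB.commute_zvert_jm a).sub_right
      (Algebra.commutes (α * q ^ a) (zvert α q m T a)).symm
    rw [zloop, ← mul_assoc, hc.eq, mul_assoc, hee a ha]
  have heu : ∀ b < m, zvert α q m T (b + 1) * zup α q m T b = zup α q m T b := fun b hb =>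
    (hB.isEdge' hb).u_left
  have hue : ∀ b < m, zup α q m T b * zvert α q m T b = zup α q m T b := fun b hb => by
    rw [zup, mul_assoc, mul_assoc, hee b hb.le]
  have hed : ∀ b < m, zvert α q m T b * zdown α q m T b = zdown α q m T b := fun b hb =>
    (hB.isEdge' hb).d_left
  have hde : ∀ b < m, zdown α q m T b * zvert α q m T (b + 1) = zdown α q m T b := fun b hb => by
    rw [zdown, mul_assoc, mul_assoc, hee _ hb]
  exact
  { ee := hee
    eo := fun a ha b hb hab => by rw [hB.zvert_mul_zvert ha hb, if_neg hab]
    eu := heu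
    ue := hue
    ed := hed
    de := hde
    ey := hey
    ye := fun a ha => by rw [zloop, mul_assoc, hee a ha]
    yy := fun a ha => by
      have h := hB.jm_sq _ _ (isWord_stdWord ha (le_refl m))
      have h2 := hey a ha
      rw [zloop] at h2 ⊢
      rw [mul_assoc, h2, ← mul_assoc]
      exact h
    yu := fun b hb => by
      have h := (hB.isEdge' hb).y_u
      rw [hqc] at h
      exact h
    uy := fun b hb => (hB.isEdge' hb).u_y
    yd := fun b hb => (hB.isEdge' hb).y_d
    dy := fun b hb => by
      have h := (hB.isEdge' hb).d_y
      rw [hqc] at h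
      exact h
    du := fun b hb => (hB.isEdge' hb).d_u
    ud := fun b hb => by
      have h := (hB.isEdge' hb).u_d
      rw [hqc] at h
      exact h
    uu := fun b hb => by
      have h := hB.zvert_mul_mul_zvert_eq_zero (a := b + 1 + 1) (b := b) (by omega) (by omega)
        (by omega) (mul_mem (hB.zup_mem (b := b + 1) hb) (hB.zup_mem (b := b) (by omega)))
      rwa [← mul_assoc, heu _ hb, mul_assoc, hue _ (by omega)] at h
    dd := fun b hb => by
      have h := hB.zvert_mul_mul_zvert_eq_zero (a := b) (b := b + 1 + 1) (by omega) (by omega)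
        (by omega) (mul_mem (hB.zdown_mem (b := b) (by omega)) (hB.zdown_mem (b := b + 1) hb))
      rwa [← mul_assoc, hed _ (by omega), mul_assoc, hde _ hb] at h }

/-- Endomorphisms of the representation of the zigzag quiver commute with the whole idempotent
subalgebra. -/
theorem commute_zsum_mul_mul_zsum {g : R} (hg : g * zsum α q m T = g) (hg' : zsum α q m T * g = g)
    (he : ∀ a ≤ m, Commute (zvert α q m T a) g) (hy : ∀ a ≤ m, Commute (zloop α q m T a) g)
    (hu : ∀ b < m, Commute (zup α q m T b) g) (hd : ∀ b < m, Commute (zdown α q m T b) g) {x : R}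
    (hx : x ∈ genAlg K T (m + 1)) : Commute (zsum α q m T * x * zsum α q m T) g := by
  have hLa : ∀ a, jm q T m * zvert α q m T a = zloop α q m T a + (α * q ^ a) • zvert α q m T a :=
    fun a => by rw [zloop, sub_mul, Algebra.smul_def]; abel
  have hL1 : Commute (zsum α q m T * jm q T m) g := by
    rw [zsum, sum_mul]
    refine Commute.sum_left _ _ _ fun a ha => ?_
    have ha : a ≤ m := by simpa [lt_succ_iff] using ha
    rw [(hB.commute_zvert_jm a).eq, hLa]
    exact (hy a ha).add_left ((he a ha).smul_left _)
  have hL : Commute (jm q T m) g := by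
    have h := hL1.eq
    rw [mul_assoc, ← mul_assoc g, hg] at h
    have h2 : zsum α q m T * (jm q T m * g) = jm q T m * g := by
      rw [← mul_assoc, hB.commute_zsum_jm.eq, mul_assoc, hg']
    exact h2.symm.trans h
  have mem : ∀ {z : R}, Commute z g → z ∈ Subalgebra.centralizer K {g} := fun {z} hz => by
    rw [Subalgebra.mem_centralizer_iff]
    rintro _ rfl
    exact hz.eq.symm
  have ht : ∀ b (hb : b < m), _ := fun b hb => (hB.isEdge' hb).t_mem
    (Subalgebra.centralizer K {g}) (mem hL) (mem (he b hb.le)) (mem (he (b + 1) hb))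
    (mem (hu b hb)) (mem (hd b hb)) (by
      rw [show q * (α * q ^ b) = α * q ^ (b + 1) by ring]
      exact hB.pow_ne (by omega) (by omega) (by omega))
  have h := hB.zsum_mul_mul_zsum_mem (Subalgebra.toSubmodule (Subalgebra.centralizer K {g}))
    (fun a ha j => mem ((he a ha).mul_left (hL.pow_left j)))
    (fun b hb => (ht b hb).1) (fun b hb => (ht b hb).2.1) (fun b hb => (ht b hb).2.2.1)
    (fun b hb => (ht b hb).2.2.2) x hx
  rw [Subalgebra.mem_toSubmodule, Subalgebra.mem_centralizer_iff] at h
  exact (h g rfl).symm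

/-- Endomorphisms of the representation of the zigzag quiver extend to elements commuting with
the Hecke algebra. -/
theorem exists_commute_of_commute {g : R} (hg : g * zsum α q m T = g) (hg' : zsum α q m T * g = g)
    (he : ∀ a ≤ m, Commute (zvert α q m T a) g) (hy : ∀ a ≤ m, Commute (zloop α q m T a) g)
    (hu : ∀ b < m, Commute (zup α q m T b) g) (hd : ∀ b < m, Commute (zdown α q m T b) g) :
    ∃ w, (∀ x ∈ genAlg K T (m + 1), Commute x w) ∧ zsum α q m T * w = g := by
  have hcomm := fun {x : R} (hx : x ∈ genAlg K T (m + 1)) =>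
    (hB.commute_zsum_mul_mul_zsum hg hg' he hy hu hd hx).eq
  have hle : genAlg K T m ≤ genAlg K T (m + 1) := genAlg_mono (Nat.le_succ m)
  set e := zsum α q m T with hedef
  have hemem : e ∈ genAlg K T (m + 1) := zsum_mem (Nat.le_succ m)
  have hee : e * e = e := hB.zsum_mul_zsum
  let N : Submodule K R :=
    { carrier := {z | ∃ w, ∀ s ∈ genAlg K T (m + 1), ∀ t ∈ genAlg K T (m + 1),
        e * (s * w * t) * e = e * (s * z * t) * e * g}
      zero_mem' := ⟨0, fun s _ t _ => by simp⟩
      add_mem' := by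
        rintro z z' ⟨w, h⟩ ⟨w', h'⟩
        refine ⟨w + w', fun s hs t ht => ?_⟩
        simp only [mul_add, add_mul, h s hs t ht, h' s hs t ht]
      smul_mem' := by
        rintro c z ⟨w, h⟩
        refine ⟨c • w, fun s hs t ht => ?_⟩
        simp only [mul_smul_comm, smul_mul_assoc, h s hs t ht] }
  obtain ⟨w, hw⟩ : (1 : R) ∈ N := by
    refine hB.one_mem_of_forall le_rfl N fun b hb x hx y hy => ?_
    change x * zvert α q m T b * y ∈ N
    refine ⟨x * zvert α q m T b * g * y, fun s hs t ht => ?_⟩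
    have h1 : zvert α q m T b * g = zvert α q m T b * e * g * e := by
      rw [hB.zvert_mul_zsum hb, mul_assoc, hg]
    calc e * (s * (x * zvert α q m T b * g * y) * t) * e
        = e * s * x * (zvert α q m T b * g) * (y * t * e) := by simp only [mul_assoc]
      _ = e * s * x * zvert α q m T b * e * (g * (e * (y * t) * e)) := by
          rw [h1]; simp only [mul_assoc]
      _ = e * s * x * (zvert α q m T b * e * e) * (y * t) * e * g := by
          rw [← hcomm (mul_mem (hle hy) ht)]; simp only [mul_assoc]
      _ = _ := by
          rw [hB.zvert_mul_zsum hb, hB.zvert_mul_zsum hb]; simp only [mul_assoc]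
  have faithful : ∀ z : R, (∀ s ∈ genAlg K T (m + 1), ∀ t ∈ genAlg K T (m + 1),
      e * (s * z * t) * e = 0) → z = 0 := by
    intro z hz
    have h1 : ∀ t ∈ genAlg K T (m + 1), z * t * e = 0 := by
      intro t ht
      have := hB.one_mem_of_forall le_rfl (LinearMap.ker (LinearMap.mulRight K (z * t * e))) ?_
      · simpa using this
      intro b hb x hx y hy
      change x * zvert α q m T b * y ∈ _
      rw [mem_ker, mulRight_apply, ← hB.zvert_mul_zsum hb]
      calc x * (zvert α q m T b * e) * y * (z * t * e)
          = x * zvert α q m T b * (e * (y * z * t) * e) := by simp only [mul_assoc]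
        _ = 0 := by rw [hz y (hle hy) t ht, mul_zero]
    have := hB.one_mem_of_forall le_rfl (LinearMap.ker (LinearMap.mulLeft K z)) ?_
    · simpa using this
    intro b hb x hx y hy
    change x * zvert α q m T b * y ∈ _
    rw [mem_ker, mulLeft_apply, ← hB.zsum_mul_zvert hb]
    calc z * (x * (e * zvert α q m T b) * y) = z * x * e * (zvert α q m T b * y) := by
          simp only [mul_assoc]
      _ = 0 := by rw [h1 x (hle hx), zero_mul]
  have hwc : ∀ x ∈ genAlg K T (m + 1), Commute x w := by
    intro x hx
    refine sub_eq_zero.1 (faithful _ fun s hs t ht => ?_)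
    have h1 := hw (s * x) (mul_mem hs hx) t ht
    have h2 := hw s hs (x * t) (mul_mem hx ht)
    rw [show s * (x * w - w * x) * t = s * x * w * t - s * w * (x * t) by
      simp only [mul_sub, sub_mul, mul_assoc], mul_sub, sub_mul, h1, h2]
    simp only [mul_one, mul_assoc, sub_self]
  refine ⟨w, hwc, ?_⟩
  have h := hw 1 (one_mem _) 1 (one_mem _)
  simp only [one_mul, mul_one, hee] at h
  rw [mul_assoc, ← (hwc e hemem).eq, ← mul_assoc, hee, hg'] at h
  exact h

end IsBlock

theorem IsWord.exists_iff (h : IsWord m d k b) (hk : k ≤ m) (hx : x ≤ m) :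
    (∃ l < k, d l = x) ↔ x < b ∨ m - (k - b) < x := by
  have key : ∀ k, (∃ l < k + 1, d l = x) ↔ (∃ l < k, d l = x) ∨ d k = x := fun k => by
    simp only [lt_succ_iff_lt_or_eq, or_and_right, exists_or, exists_eq_left]
  induction h with
  | nil => simp; omega
  | left h1 h2 ih =>
    have := h1.le
    refine (key _).trans ((or_congr_left (ih (by clear ih key; omega))).trans ?_)
    clear ih key
    omega
  | right h1 h2 ih =>
    have := h1.le
    refine (key _).trans ((or_congr_left (ih (by clear ih key; omega))).trans ?_)
    clear ih key
    omega

section Weights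

theorem aeval_apply_of_apply_eq_smul {f : End K V} {r : K} {x : V} (h : f x = r • x)
    (p : K[X]) : aeval f p x = p.eval r • x := by
  induction p using induction_on' with
  | add p p' hp hp' => rw [map_add, LinearMap.add_apply, hp, hp', Polynomial.eval_add, add_smul]
  | monomial j c =>
    have : ∀ j : ℕ, (f ^ j) x = r ^ j • x := fun j => by
      induction j with
      | zero => simp
      | succ j ih => rw [pow_succ', mul_apply, ih, map_smul, h, smul_smul, pow_succ]
    rw [aeval_monomial, Polynomial.eval_monomial, ← Algebra.smul_def,
      LinearMap.smul_apply, this, smul_smul]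

theorem symOp_apply_of_weight {x : V} (hx : ∀ l < n, jm q T l x = c l • x)
    (g : K[X]) : symOp q T n g x = (∑ l ∈ range n, g.eval (c l)) • x := by
  rw [symOp, LinearMap.sum_apply, sum_smul]
  exact sum_congr rfl fun l hl => aeval_apply_of_apply_eq_smul (hx l (mem_range.1 hl)) g

theorem Indec.sum_eval_eq [FiniteDimensional K V] (hV : Indec n T) (hT : IsHecke α β q n T)
    (hq : q ≠ 0) {c c' : ℕ → K} {v x : V} (hv0 : v ≠ 0) (hv : ∀ l < n, jm q T l v = c l • v)
    (hx0 : x ≠ 0) (hx : ∀ l < n, jm q T l x = c' l • x) (g : K[X]) :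
    ∑ l ∈ range n, g.eval (c' l) = ∑ l ∈ range n, g.eval (c l) := by
  set s := ∑ l ∈ range n, g.eval (c l)
  have hf : Intw n T T (symOp q T n g - s • (1 : End K V)) :=
    Intw.of_commute fun i hi => ((hT.commute_symOp hq g hi).sub_right
      ((Commute.one_right (T i)).smul_right s)).symm
  have hfv : ∀ {c : ℕ → K} {y : V}, (∀ l < n, jm q T l y = c l • y) →
      (symOp q T n g - s • (1 : End K V)) y =
        (∑ l ∈ range n, g.eval (c l) - s) • y := fun hy => by
    rw [LinearMap.sub_apply, symOp_apply_of_weight hy, sub_smul]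
    rfl
  rcases hV.isUnit_or_isNilpotent hf with h | ⟨j, h⟩
  · have h1 := hfv hv
    rw [sub_self, zero_smul] at h1
    exact absurd (((End.isUnit_iff _).1 h).1 (h1.trans (map_zero _).symm)) hv0
  · have h1 := aeval_apply_of_apply_eq_smul (hfv hx) (X ^ j)
    rw [map_pow, Polynomial.aeval_X, h, LinearMap.zero_apply, Polynomial.eval_pow,
      Polynomial.eval_X] at h1
    exact sub_eq_zero.1 (eq_zero_of_pow_eq_zero ((smul_eq_zero.1 h1.symm).resolve_right hx0))

/-- Every simultaneous eigenvector of the Jucys--Murphy elements has as its weights an ordering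
of `α, α * q, …, α * q ^ m`. -/
def HasStringWeights (α q : K) (m : ℕ) (T : ℕ → End K V) : Prop :=
  ∀ (c : ℕ → K) (x : V), x ≠ 0 → (∀ l < m + 1, jm q T l x = c l • x) → ∃ d : ℕ → ℕ,
    (∀ l < m + 1, d l ≤ m ∧ c l = α * q ^ d l) ∧ ∀ i < m + 1, ∀ j < m + 1, d i = d j → i = j

theorem exists_string_letters (hinj : Set.InjOn (fun j => α * q ^ j) (range (m + 1) : Set ℕ))
    (h : ∀ j ≤ m, ∃ l < m + 1, c l = α * q ^ j) : ∃ d : ℕ → ℕ,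
      (∀ l < m + 1, d l ≤ m ∧ c l = α * q ^ d l) ∧
        ∀ i < m + 1, ∀ j < m + 1, d i = d j → i = j := by
  choose! σ hσ using h
  have hσi : Set.InjOn σ (range (m + 1) : Set ℕ) := fun i hi j hj hij => by
    have hi' := mem_range.1 hi
    have hj' := mem_range.1 hj
    refine hinj hi hj ?_
    simp only
    rw [← (hσ i (by omega)).2, ← (hσ j (by omega)).2, hij]
  have him : (range (m + 1)).image σ = range (m + 1) := by
    refine Finset.eq_of_subset_of_card_le (fun l hl => ?_) ?_
    · obtain ⟨j, hj, rfl⟩ := Finset.mem_image.1 hl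
      exact mem_range.2 (hσ j (by have := mem_range.1 hj; omega)).1
    · rw [Finset.card_image_of_injOn hσi]
  have hs : ∀ l < m + 1, ∃ j ≤ m, σ j = l := fun l hl => by
    have := him.symm ▸ mem_range.2 hl
    obtain ⟨j, hj, rfl⟩ := Finset.mem_image.1 this
    exact ⟨j, by have := mem_range.1 hj; omega, rfl⟩
  choose! d hd using hs
  refine ⟨d, fun l hl => ⟨(hd l hl).1, ?_⟩, fun i hi j hj hij => ?_⟩
  · rw [← (hσ _ (hd l hl).1).2, (hd l hl).2]
  · rw [← (hd i hi).2, hij, (hd j hj).2]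

theorem Indec.hasStringWeights [FiniteDimensional K V] (hV : Indec (m + 1) T)
    (hT : IsHecke α β q (m + 1) T) (hq : q ≠ 0)
    (hinj : Set.InjOn (fun j => α * q ^ j) (range (m + 1) : Set ℕ)) {c : ℕ → K} {v : V}
    (hv0 : v ≠ 0) (hv : ∀ l < m + 1, jm q T l v = c l • v)
    (hc : ∀ j ≤ m, ∃ l < m + 1, c l = α * q ^ j) : HasStringWeights α q m T := by
  classical
  intro c' x hx0 hx
  refine exists_string_letters hinj fun j hj => ?_
  by_contra hne
  push Not at hne
  obtain ⟨d, hd, hdi⟩ := exists_string_letters hinj hc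
  obtain ⟨i, hi, hij⟩ := hc j hj
  set S : Finset K := (range (m + 1)).image c' ∪ (range (m + 1)).image c
  have hS : c i ∈ S := Finset.mem_union_right _ (Finset.mem_image_of_mem _ (mem_range.2 hi))
  have h1 := hV.sum_eval_eq hT hq hv0 hv hx0 hx (Lagrange.basis S id (c i))
  rw [sum_eq_zero fun l hl => ?_, sum_eq_single i (fun l hl hli => ?_) fun h => ?_] at h1
  · exact zero_ne_one (h1.trans (Lagrange.eval_basis_self (v := id) (Set.injOn_id _) hS))
  · have hl' := mem_range.1 hl
    refine Lagrange.eval_basis_of_ne (v := id) (fun h => hli ?_)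
      (Finset.mem_union_right _ (Finset.mem_image_of_mem _ hl))
    have h2 : α * q ^ d i = α * q ^ d l := by rw [← (hd i hi).2, ← (hd l hl').2, h]
    exact (hdi i hi l hl' (hinj (mem_range.2 (by have := (hd i hi).1; omega))
      (mem_range.2 (by have := (hd l hl').1; omega)) h2)).symm
  · exact absurd (mem_range.2 hi) h
  · refine Lagrange.eval_basis_of_ne (v := id) (fun h => ?_)
      (Finset.mem_union_left _ (Finset.mem_image_of_mem _ hl))
    exact hne l (mem_range.1 hl) (h.symm.trans hij)

end Weights

section Multiplicity

theorem card_filter_le_one_of_inj {s : Finset ℕ} {P : ℕ → Prop} [DecidablePred P]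
    (h : ∀ i ∈ s, ∀ j ∈ s, P i → P j → i = j) : (s.filter P).card ≤ 1 := by
  rw [card_le_one]
  intro i hi j hj
  rw [mem_filter] at hi hj
  exact h i hi.1 j hj.1 hi.2 hj.2

theorem card_filter_eq_zero_of {s : Finset ℕ} {P : ℕ → Prop} [DecidablePred P]
    (h : ∀ i ∈ s, ¬ P i) : (s.filter P).card = 0 := by
  rw [Finset.card_eq_zero, Finset.filter_eq_empty_iff]
  exact fun i hi => h i hi

theorem IsWord.letter_not_mem (h : IsWord m d k b) (hk : k ≤ m)
    (hdi : ∀ i < k + 1, ∀ j < k + 1, d i = d j → i = j) (hdk : d k ≤ m) :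
    b ≤ d k ∧ d k + (k - b) ≤ m := by
  have := mt (h.exists_iff hk hdk).2 fun ⟨l, hl, h⟩ => by
    have := hdi l (by omega) k (by omega) h
    omega
  omega

theorem IsWord.count_wtRoots_le [DecidableEq K] (h : IsWord m d k b) (hk : k ≤ m)
    (hq : q ≠ 0) (hpow : ∀ i ≤ m + 1, ∀ j ≤ m + 1, α * q ^ i = α * q ^ j → i = j)
    (hd : ∀ l < k + 1, d l ≤ m ∧ c l = α * q ^ d l)
    (hdi : ∀ i < k + 1, ∀ j < k + 1, d i = d j → i = j) :
    (wtRoots α (α * q ^ m) q c k).count (c k) ≤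
      (if d k = b then 1 else 0) + (if d k + (k - b) = m then 1 else 0) := by
  have hdk := hd k (by omega)
  have hu := h.letter_not_mem hk hdi hdk.1
  have hbk := h.le
  have e1 : ∀ l < k, c k = q * c l → d l + 1 = d k := fun l hl h => by
    have hl' := hd l (by omega)
    rw [hdk.2, hl'.2] at h
    exact (hpow _ (by omega) _ (by omega) (h.trans (by ring))).symm
  have e2 : ∀ l < k, c k = q⁻¹ * c l → d k + 1 = d l := fun l hl h => by
    have hl' := hd l (by omega)
    rw [hdk.2, hl'.2, eq_inv_mul_iff_mul_eq₀ hq] at h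
    exact hpow _ (by omega) _ (by omega) (Eq.trans (by ring) h)
  have e3 : c k = α → d k = 0 := fun h =>
    hpow _ (by omega) _ (by omega) (by rw [← hdk.2, h, pow_zero, mul_one])
  have e4 : c k = α * q ^ m → d k = m := fun h =>
    hpow _ (by omega) _ (by omega) (by rw [← hdk.2, h])
  have hmem : ∀ l < k, d l < b ∨ m - (k - b) < d l := fun l hl =>
    (h.exists_iff hk (hd l (by omega)).1).1 ⟨l, hl, rfl⟩
  rw [count_wtRoots]
  have A : (if c k = α then 1 else 0) +
      #{l ∈ range k | c k = q * c l} ≤ if d k = b then 1 else 0 := by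
    have c1 : #{l ∈ range k | c k = q * c l} ≤ 1 :=
      card_filter_le_one_of_inj fun i hi j hj hi' hj' => by
        rw [mem_range] at hi hj
        have := e1 i hi hi'
        have := e1 j hj hj'
        exact hdi i (by omega) j (by omega) (by omega)
    by_cases hb : d k = b ∧ c k ≠ α
    · rw [if_pos hb.1, if_neg hb.2]; omega
    · rw [card_filter_eq_zero_of fun l hl hl' => ?_]
      · split_ifs with g1 g2
        · exact le_rfl
        · have := e3 g1; omega
        · omega
        · omega
      · rw [mem_range] at hl
        have g1 := e1 l hl hl'
        have g2 := hmem l hl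
        refine hb ⟨by omega, fun h => ?_⟩
        have := e3 h; omega
  have B : (if c k = α * q ^ m then 1 else 0) +
      #{l ∈ range k | c k = q⁻¹ * c l} ≤
        if d k + (k - b) = m then 1 else 0 := by
    have c1 : #{l ∈ range k | c k = q⁻¹ * c l} ≤ 1 :=
      card_filter_le_one_of_inj fun i hi j hj hi' hj' => by
        rw [mem_range] at hi hj
        have := e2 i hi hi'
        have := e2 j hj hj'
        exact hdi i (by omega) j (by omega) (by omega)
    by_cases hb : d k + (k - b) = m ∧ c k ≠ α * q ^ m
    · rw [if_pos hb.1, if_neg hb.2]; omega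
    · rw [card_filter_eq_zero_of fun l hl hl' => ?_]
      · split_ifs with g1 g2
        · exact le_rfl
        · have := e4 g1; omega
        · omega
        · omega
      · rw [mem_range] at hl
        have g1 := e2 l hl hl'
        have g2 := hmem l hl
        have g3 := (hd l (by omega)).1
        refine hb ⟨by omega, fun h => ?_⟩
        have := e4 h; omega
  omega

theorem exists_isWord (hq : q ≠ 0)
    (hpow : ∀ i ≤ m + 1, ∀ j ≤ m + 1, α * q ^ i = α * q ^ j → i = j)
    (hd : ∀ l < m + 1, d l ≤ m ∧ c l = α * q ^ d l)
    (hdi : ∀ i < m + 1, ∀ j < m + 1, d i = d j → i = j)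
    (hr : ∀ l < m + 1, c l ∈ wtRoots α (α * q ^ m) q c l) (hk : k ≤ m) : ∃ b, IsWord m d k b := by
  classical
  induction k with
  | zero => exact ⟨0, IsWord.nil⟩
  | succ k ih =>
    obtain ⟨b, hb⟩ := ih (by omega)
    have h1 := hb.count_wtRoots_le (by omega) hq hpow (fun l hl => hd l (by omega))
      fun i hi j hj => hdi i (by omega) j (by omega)
    have h2 := Multiset.count_pos.2 (hr k (by omega))
    by_cases h3 : d k = b
    · exact ⟨_, hb.left h3⟩
    · refine ⟨_, hb.right ?_⟩
      by_contra h4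
      rw [if_neg h3, if_neg h4] at h1
      omega

end Multiplicity

section Block

variable [FiniteDimensional K V]
 

theorem IsHecke.aeval_jm_apply_eq_zero (hT : IsHecke α β q n T) (hq : q ≠ 0) (hk : k < n)
    {U : Submodule K V} (hU : ∀ l < n, ∀ x ∈ U, jm q T l x ∈ U) {c : ℕ → K}
    (hc : ∀ l < k, ∀ x ∈ U, jm q T l x = c l • x) (P : K[X]) [DecidableEq K]
    (hP : ∀ (c' : ℕ → K) (x : V), x ≠ 0 → (∀ l < n, jm q T l x = c' l • x) →
      (∀ l < k, c' l = c l) → (∀ l < n, c' l ∈ wtRoots α β q c' l) →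
      (X - C (c' k)) ^ (wtRoots α β q c' k).count (c' k) ∣ P)
    {x : V} (hx : x ∈ U) : aeval (jm q T k) P x = 0 := by
  set W := U.map (aeval (jm q T k) P)
  by_cases hW : W = ⊥
  · have : aeval (jm q T k) P x ∈ W := Submodule.mem_map_of_mem hx
    rwa [hW, Submodule.mem_bot] at this
  obtain ⟨c', y, hyW, hy0, hy, hr⟩ := hT.exists_eigenvector hq hW fun l hl => by
    rintro _ ⟨z, hz, rfl⟩
    refine ⟨jm q T l z, hU l hl z hz, ?_⟩
    exact (congr_fun
      ((hT.jm_commute hl hk).aeval_right_alg P : Commute (jm q T l) _).eq z).symm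
  obtain ⟨z, hz, hzy⟩ := hyW
  have hcc : ∀ l < k, c' l = c l := fun l hl => by
    have h1 := hc l hl y (hzy ▸ Submodule.aeval_mem (hU k hk) P hz)
    rw [hy l (by omega)] at h1
    exact smul_left_injective K hy0 h1
  obtain ⟨P', hP'⟩ := hP c' y hy0 hy hcc hr
  set μ := (wtRoots α β q c' k).count (c' k)
  set s := (wtRoots α β q c' k).filter fun r => ¬ c' k = r
  have hroot : rootPoly (wtRoots α β q c' k) =
      (X - C (c' k)) ^ μ * rootPoly s := by
    conv_lhs => rw [← Multiset.filter_add_not (fun r => c' k = r) (wtRoots α β q c' k)]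
    rw [Multiset.filter_eq, rootPoly, Multiset.map_add, Multiset.prod_add, Multiset.map_replicate,
      Multiset.prod_replicate]
    rfl
  have hs : (rootPoly s).eval (c' k) ≠ 0 := by
    rw [rootPoly, Polynomial.eval_multiset_prod, Multiset.map_map]
    refine Multiset.prod_ne_zero fun h => ?_
    obtain ⟨r, hr, h⟩ := Multiset.mem_map.1 h
    rw [Function.comp_apply, Polynomial.eval_sub, Polynomial.eval_X, Polynomial.eval_C] at h
    exact (Multiset.mem_filter.1 hr).2 (sub_eq_zero.1 h)
  have h1 : aeval (jm q T k) (rootPoly s) y = 0 := by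
    rw [← hzy, ← mul_apply, ← map_mul, hP',
      show rootPoly s * ((X - C (c' k)) ^ μ * P') =
        P' * rootPoly (wtRoots α β q c' k) by rw [hroot]; ring, map_mul, mul_apply,
      hT.aeval_rootPoly hq hk fun l hl => ?_, map_zero]
    rw [hcc l hl, hc l hl z hz]
  rw [aeval_apply_of_apply_eq_smul (hy k hk)] at h1
  exact absurd ((smul_eq_zero.1 h1).resolve_right hy0) hs

namespace HasStringWeights

variable (hw : HasStringWeights α q m T) (hT : IsHecke α (α * q ^ m) q (m + 1) T) (hq : q ≠ 0)
  (hα : α ≠ 0) (hE : ∀ j, 0 < j → j ≤ m + 1 → q ^ j ≠ 1)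

include hT in
theorem commute_jm_wtIdem (hk : k ≤ m) (hl : l < m + 1) (d : ℕ → ℕ) :
    Commute (jm q T l) (wtIdem α q m T d k) := by
  induction k with
  | zero => exact Commute.one_right _
  | succ k ih =>
    exact (ih (by omega)).mul_right ((hT.jm_commute hl (by omega)).aeval_right_alg _)

include hT in
theorem jm_mem_range (hk : k ≤ m) (hl : l < m + 1) (d : ℕ → ℕ) {x : V}
    (hx : x ∈ LinearMap.range (wtIdem α q m T d k)) :
    jm q T l x ∈ LinearMap.range (wtIdem α q m T d k) := by
  obtain ⟨z, rfl⟩ := hx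
  exact ⟨jm q T l z, (congr_fun (commute_jm_wtIdem hT hk hl d).eq z).symm⟩

include hw hT hq hα hE

theorem isDiag (hs : s ≤ m) : IsDiag α q m s T := by
  classical
  induction s with
  | zero => exact ⟨hs, hq, hα, hE, hT, fun k hk => by omega⟩
  | succ s ih =>
    have hD := ih (by omega)
    refine ⟨hs, hq, hα, hE, hT, fun k hk => ?_⟩
    rcases lt_succ_iff_lt_or_eq.1 hk with h | rfl
    · exact hD.jm_poly k h
    set P : K[X] := ∏ j ∈ range (m + 1), (X - C (α * q ^ j))
    have key : ∀ j ≤ k, ∀ d : ℕ → ℕ, (∀ l < j, d l ≤ m) →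
        aeval (jm q T k) P * wtIdem α q m T d j = 0 := by
      intro j hj
      induction hj using Nat.decreasingInduction with
      | self =>
        intro d hd
        ext x
        refine hT.aeval_jm_apply_eq_zero hq (by omega)
          (fun l hl y hy => jm_mem_range hT (by omega) hl d hy) (c := fun l => α * q ^ d l)
          (fun l hl y hy => ?_) P (fun c' y hy0 hy hcc hr => ?_) ⟨x, rfl⟩
        · obtain ⟨z, rfl⟩ := hy
          exact congr_fun (hD.jm_mul_wtIdem le_rfl hd hl) z
        · obtain ⟨d', hd', hdi⟩ := hw c' y hy0 hy
          have hpow : ∀ i ≤ m + 1, ∀ j ≤ m + 1, α * q ^ i = α * q ^ j → i = j :=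
            fun i hi j hj h => by_contra fun hne => hD.pow_ne hi hj hne h
          obtain ⟨b, hb⟩ := exists_isWord hq hpow hd' hdi hr (k := k) (by omega)
          have h1 := hb.count_wtRoots_le (by omega) hq hpow (fun l hl => hd' l (by omega))
            fun i hi j hj => hdi i (by omega) j (by omega)
          have h2 : (wtRoots α (α * q ^ m) q c' k).count (c' k) ≤ 1 := by
            have := hb.le
            refine h1.trans ?_
            split_ifs <;> omega
          refine (pow_dvd_pow _ h2).trans ?_
          rw [pow_one, (hd' k (by omega)).2]
          exact Finset.dvd_prod_of_mem (fun j => X - C (α * q ^ j))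
            (mem_range.2 (by have := (hd' k (by omega)).1; omega))
      | of_succ j hj ihj =>
        intro d hd
        rw [hD.wtIdem_eq_sum d j, mul_sum]
        refine sum_eq_zero fun r hr => ihj _ fun l hl => ?_
        rw [mem_range] at hr
        rcases lt_succ_iff_lt_or_eq.1 hl with h | rfl
        · rw [update_of_ne (by omega)]; exact hd l h
        · rw [update_self]; omega
    simpa [wtIdem] using key 0 (by omega) 0 fun l hl => by omega

theorem isBlock : IsBlock α q m T := by
  classical
  have hD := isDiag hw hT hq hα hE le_rfl
  have hpow : ∀ i ≤ m + 1, ∀ j ≤ m + 1, α * q ^ i = α * q ^ j → i = j :=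
    fun i hi j hj h => by_contra fun hne => hD.pow_ne hi hj hne h
  have hrange : ∀ {d : ℕ → ℕ}, (∀ l < m, d l ≤ m) → ∀ l < m,
      ∀ y ∈ LinearMap.range (wtIdem α q m T d m), jm q T l y = (α * q ^ d l) • y := by
    rintro d hd l hl _ ⟨z, rfl⟩
    exact congr_fun (hD.jm_mul_wtIdem le_rfl hd hl) z
  have hdd : ∀ {d d' : ℕ → ℕ} {c' : ℕ → K}, (∀ l < m, d l ≤ m) →
      (∀ l < m + 1, d' l ≤ m ∧ c' l = α * q ^ d' l) → (∀ l < m, c' l = α * q ^ d l) →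
      ∀ l < m, d' l = d l := fun hd hd' hcc l hl => by
    have h1 := hd' l (by omega)
    have h2 := hd l hl
    exact hpow _ (by omega) _ (by omega) (h1.2.symm.trans (hcc l hl))
  refine { hD with wt_zero := fun d hd hn => ?_, jm_sq := fun d b hdb => ?_ }
  · by_contra h0
    obtain ⟨c', y, hyW, hy0, hy, hr⟩ := hT.exists_eigenvector hq
      (W := LinearMap.range (wtIdem α q m T d m)) (fun h => h0 (LinearMap.range_eq_bot.1 h))
      fun l hl y hy => jm_mem_range hT le_rfl hl d hy
    obtain ⟨d', hd', hdi⟩ := hw c' y hy0 hy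
    obtain ⟨b, hb⟩ := exists_isWord hq hpow hd' hdi hr le_rfl
    refine hn b (hb.congr (hdd hd hd' fun l hl => ?_))
    have h1 := hrange hd l hl y hyW
    rw [hy l (by omega)] at h1
    exact smul_left_injective K hy0 h1
  · have hd : ∀ l < m, d l ≤ m := fun l hl => hdb.le_of_lt le_rfl hl
    have hP : aeval (jm q T m) ((X - C (α * q ^ b)) ^ 2) =
        (jm q T m - algebraMap K (End K V) (α * q ^ b)) *
          (jm q T m - algebraMap K (End K V) (α * q ^ b)) := by
      simp [pow_two]
    rw [← hP]
    ext x
    refine hT.aeval_jm_apply_eq_zero hq (by omega)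
      (fun l hl y hy => jm_mem_range hT le_rfl hl d hy) (hrange hd) _
      (fun c' y hy0 hy hcc hr => ?_) ⟨x, rfl⟩
    obtain ⟨d', hd', hdi⟩ := hw c' y hy0 hy
    have hb := hdb.congr fun l hl => (hdd hd hd' hcc l hl).symm
    have h1 := hb.count_wtRoots_le le_rfl hq hpow hd' hdi
    have h2 := hb.letter_not_mem le_rfl hdi (hd' m (by omega)).1
    have h3 := hb.le
    rw [(hd' m (by omega)).2, show d' m = b by omega] at h1 ⊢
    refine pow_dvd_pow _ (h1.trans ?_)
    split_ifs <;> omega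

end HasStringWeights

end Block

section Map

variable {S : Type*} [Ring S] [Algebra K S] {T : ℕ → R} (φ : R →ₐ[K] S)

theorem map_jm (k : ℕ) : φ (jm q T k) = jm q (fun i => φ (T i)) k := by
  induction k with
  | zero => rfl
  | succ k ih => rw [jm, jm, map_smul, map_mul, map_mul, ih]

theorem map_wtIdem (d : ℕ → ℕ) (k : ℕ) :
    φ (wtIdem α q m T d k) = wtIdem α q m (fun i => φ (T i)) d k := by
  induction k with
  | zero => exact map_one φ
  | succ k ih =>
    rw [wtIdem, wtIdem, map_mul, ih, jmIdem, jmIdem, ← map_jm, Polynomial.aeval_algHom_apply]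

theorem map_jphi (i : ℕ) : φ (jphi q T i) = jphi q (fun i => φ (T i)) i := by
  simp only [jphi, map_sub, map_mul, map_jm]

theorem map_moveRight (b j : ℕ) :
    φ (moveRight q T b j) = moveRight q (fun i => φ (T i)) b j := by
  induction j with
  | zero => exact map_one φ
  | succ j ih => rw [moveRight, moveRight, map_mul, ih, map_jphi]

theorem map_moveLeft (b j : ℕ) :
    φ (moveLeft α q m T b j) = moveLeft α q m (fun i => φ (T i)) b j := by
  induction j with
  | zero => exact map_one φ
  | succ j ih => rw [moveLeft, moveLeft, map_mul, ih, map_smul, map_jphi]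

theorem map_zvert (b : ℕ) : φ (zvert α q m T b) = zvert α q m (fun i => φ (T i)) b :=
  map_wtIdem φ _ _

theorem map_zloop (b : ℕ) : φ (zloop α q m T b) = zloop α q m (fun i => φ (T i)) b := by
  rw [zloop, zloop, map_mul, map_sub, map_zvert, map_jm, AlgHom.commutes]

theorem map_zup (b : ℕ) : φ (zup α q m T b) = zup α q m (fun i => φ (T i)) b := by
  simp only [zup, map_mul, map_sub, map_zvert, map_jm, map_moveLeft]

theorem map_zdown (b : ℕ) : φ (zdown α q m T b) = zdown α q m (fun i => φ (T i)) b := by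
  simp only [zdown, map_mul, map_sub, map_zvert, map_jm, map_moveRight]

theorem map_zsum : φ (zsum α q m T) = zsum α q m (fun i => φ (T i)) := by
  simp only [zsum, map_sum, map_zvert]

theorem IsBlock.map (hB : IsBlock α q m T) : IsBlock α q m (fun i => φ (T i)) where
  hs := hB.hs
  hq := hB.hq
  hα := hB.hα
  hE := hB.hE
  hT := hB.hT.map φ
  jm_poly k hk := by
    rw [← map_jm, Polynomial.aeval_algHom_apply, hB.jm_poly k hk, map_zero]
  wt_zero d hd hw := by rw [← map_wtIdem, hB.wt_zero d hd hw, map_zero]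
  jm_sq d b hd := by
    rw [← map_wtIdem, ← map_jm, ← AlgHom.commutes φ, ← map_sub, ← map_mul, ← map_mul,
      hB.jm_sq d b hd, map_zero]

theorem IsBlock.prod {T' : ℕ → S} (hB : IsBlock α q m T) (hB' : IsBlock α q m T') :
    IsBlock α q m (fun i => (T i, T' i)) := by
  have hjm : ∀ k, jm q (fun i => (T i, T' i)) k = (jm q T k, jm q T' k) := fun k =>
    Prod.ext (map_jm (AlgHom.fst K R S) k) (map_jm (AlgHom.snd K R S) k)
  have hwt : ∀ d k, wtIdem α q m (fun i => (T i, T' i)) d k =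
      (wtIdem α q m T d k, wtIdem α q m T' d k) := fun d k =>
    Prod.ext (map_wtIdem (AlgHom.fst K R S) d k) (map_wtIdem (AlgHom.snd K R S) d k)
  exact {
    hs := hB.hs
    hq := hB.hq
    hα := hB.hα
    hE := hB.hE
    hT := {
      quad_zero := fun h => Prod.ext (hB.hT.quad_zero h) (hB'.hT.quad_zero h)
      quad := fun i h h' => Prod.ext (hB.hT.quad i h h') (hB'.hT.quad i h h')
      braid_zero := fun h => Prod.ext (hB.hT.braid_zero h) (hB'.hT.braid_zero h)
      braid := fun i h h' => Prod.ext (hB.hT.braid i h h') (hB'.hT.braid i h h')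
      comm := fun i j h h' => Prod.ext (hB.hT.comm i j h h') (hB'.hT.comm i j h h') }
    jm_poly := fun k hk => by
      rw [hjm]
      refine Prod.ext ?_ ?_
      · exact (Polynomial.aeval_algHom_apply (AlgHom.fst K R S) _ _).symm.trans (hB.jm_poly k hk)
      · exact (Polynomial.aeval_algHom_apply (AlgHom.snd K R S) _ _).symm.trans (hB'.jm_poly k hk)
    wt_zero := fun d hd hw => by
      rw [hwt, hB.wt_zero d hd hw, hB'.wt_zero d hd hw]
      rfl
    jm_sq := fun d b hd => by
      rw [hwt, hjm]
      exact Prod.ext (hB.jm_sq d b hd) (hB'.jm_sq d b hd) }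

end Map

/-- Homomorphisms between representations of a zigzag quiver. -/
structure ZIntw (m : ℕ) (e u d y : ℕ → End K V) (e' u' d' y' : ℕ → End K V')
    (g : V →ₗ[K] V') : Prop where
  he : ∀ a ≤ m, ∀ x, g (e a x) = e' a (g x)
  hu : ∀ b < m, ∀ x, g (u b x) = u' b (g x)
  hd : ∀ b < m, ∀ x, g (d b x) = d' b (g x)
  hy : ∀ a ≤ m, ∀ x, g (y a x) = y' a (g x)
  supp : ∀ x, ∑ a ∈ range (m + 1), e' a (g x) = g x

section Lift

variable {T' : ℕ → End K V'}

theorem Intw.map_genAlg {φ : V →ₗ[K] V'} (h : Intw n T T' φ)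
    {P : End K V × End K V'}
    (hP : P ∈ genAlg K (fun i => (T i, T' i)) n) (x : V) : φ (P.1 x) = P.2 (φ x) := by
  refine Algebra.adjoin_induction (p := fun P _ => ∀ x, φ (P.1 x) = P.2 (φ x)) ?_ ?_ ?_ ?_ hP x
  · rintro _ ⟨i, hi, rfl⟩ x
    exact h i hi x
  · intro r x
    simp
  · intro P Q _ _ h1 h2 x
    simp [h1, h2]
  · intro P Q _ _ h1 h2 x
    simp [h1, h2]

theorem Intw.map_zsum {φ : V →ₗ[K] V'} (h : Intw (m + 1) T T' φ) (x : V) :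
    φ (zsum α q m T x) = zsum α q m T' (φ x) := by
  have h1 : zsum α q m (fun i => (T i, T' i)) = (zsum α q m T, zsum α q m T') :=
    Prod.ext (_root_.map_zsum (AlgHom.fst K (End K V) (End K V')))
      (_root_.map_zsum (AlgHom.snd K (End K V) (End K V')))
  have h2 := h.map_genAlg (IsBlock.zsum_mem (α := α) (q := q) (m := m) (Nat.le_succ m)) x
  rwa [h1] at h2

theorem commute_prodMap {g : V →ₗ[K] V'} {P : End K V × End K V'}
    (h : ∀ x, g (P.1 x) = P.2 (g x)) :
    Commute (LinearMap.prodMapAlgHom K V V' P) (LinearMap.inr K V V' ∘ₗ g ∘ₗ LinearMap.fst K V V') := by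
  refine ext fun x => Prod.ext ?_ ?_
  · exact map_zero P.1
  · exact (h x.1).symm

/-- A homomorphism between the truncations of two modules in a block extends to the modules. -/
theorem ZIntw.exists_intw (hB : IsBlock α q m T) (hB' : IsBlock α q m T') {g : V →ₗ[K] V'}
    (hg : ZIntw m (zvert α q m T) (zup α q m T) (zdown α q m T) (zloop α q m T)
      (zvert α q m T') (zup α q m T') (zdown α q m T') (zloop α q m T') g) :
    ∃ w : V →ₗ[K] V', Intw (m + 1) T T' w ∧ ∀ x, zsum α q m T' (w x) = g x := by
  set φ := LinearMap.prodMapAlgHom K V V'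
  set f₁ := AlgHom.fst K (End K V) (End K V')
  set f₂ := AlgHom.snd K (End K V) (End K V')
  set T₂ : ℕ → End K V × End K V' := fun i => (T i, T' i)
  set G : End K (V × V') := LinearMap.inr K V V' ∘ₗ g ∘ₗ LinearMap.fst K V V'
  have hsum : zsum α q m (fun i => φ (T₂ i)) = φ (zsum α q m T, zsum α q m T') := by
    rw [← map_zsum φ]
    exact congr_arg φ (Prod.ext (map_zsum f₁) (map_zsum f₂))
  have hsupp : ∀ x, zsum α q m T' (g x) = g x := fun x => by
    rw [zsum, LinearMap.sum_apply, hg.supp]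
  suffices H : ∃ w, (∀ x ∈ genAlg K (fun i => φ (T₂ i)) (m + 1), Commute x w) ∧
      zsum α q m (fun i => φ (T₂ i)) * w = G by
    obtain ⟨w, hw, hwg⟩ := H
    refine ⟨LinearMap.snd K V V' ∘ₗ w ∘ₗ LinearMap.inl K V V', fun i hi x => ?_, fun x => ?_⟩
    · have h1 := congr_fun (hw _ (mem_genAlg hi)).eq (x, (0 : V'))
      have h2 : φ (T₂ i) (x, 0) = (T i x, (0 : V')) := Prod.ext rfl (map_zero (T' i))
      rw [mul_apply, mul_apply, h2] at h1
      exact (congr_arg Prod.snd h1).symm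
    · have h1 := congr_fun hwg (x, (0 : V'))
      rw [hsum] at h1
      exact congr_arg Prod.snd h1
  refine ((hB.prod hB').map φ).exists_commute_of_commute ?_ ?_
    (fun a ha => ?_) (fun a ha => ?_) (fun b hb => ?_) fun b hb => ?_
  · have hc : Commute (φ (zsum α q m T, zsum α q m T')) G := commute_prodMap fun x => by
      simp only [zsum, LinearMap.sum_apply, map_sum]
      exact sum_congr rfl fun a ha => hg.he a (by have := mem_range.1 ha; omega) x
    rw [hsum, ← hc.eq]
    exact ext fun x => Prod.ext (map_zero (zsum α q m T)) (hsupp x.1)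
  · rw [hsum]
    exact ext fun x => Prod.ext (map_zero (zsum α q m T)) (hsupp x.1)
  · rw [← map_zvert φ, show zvert α q m T₂ a = (zvert α q m T a, zvert α q m T' a) from
      Prod.ext (map_zvert f₁ a) (map_zvert f₂ a)]
    exact commute_prodMap (hg.he a ha)
  · rw [← map_zloop φ, show zloop α q m T₂ a = (zloop α q m T a, zloop α q m T' a) from
      Prod.ext (map_zloop f₁ a) (map_zloop f₂ a)]
    exact commute_prodMap (hg.hy a ha)
  · rw [← map_zup φ, show zup α q m T₂ b = (zup α q m T b, zup α q m T' b) from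
      Prod.ext (map_zup f₁ b) (map_zup f₂ b)]
    exact commute_prodMap (hg.hu b hb)
  · rw [← map_zdown φ, show zdown α q m T₂ b = (zdown α q m T b, zdown α q m T' b) from
      Prod.ext (map_zdown f₁ b) (map_zdown f₂ b)]
    exact commute_prodMap (hg.hd b hb)

/-- Idempotents on the truncation of an indecomposable module are trivial. -/
theorem ZIntw.eq_zero_or [FiniteDimensional K V] (hB : IsBlock α q m T) (hV : Indec (m + 1) T)
    {g : End K V}
    (hg : ZIntw m (zvert α q m T) (zup α q m T) (zdown α q m T) (zloop α q m T)
      (zvert α q m T) (zup α q m T) (zdown α q m T) (zloop α q m T) g) (hgg : g * g = g) :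
    g = 0 ∨ g = zsum α q m T := by
  obtain ⟨w, hw, hwg⟩ := hg.exists_intw hB hB
  set z := zsum α q m T
  have hz : z * w = g := ext hwg
  have hzw : z * w = w * z := ext fun x => (hw.map_zsum x).symm
  have hzz : z * z = z := hB.zsum_mul_zsum
  rcases hV.isUnit_or_isNilpotent hw with h | ⟨j, hj⟩
  · right
    have h1 : z * w * w = z * w := by
      calc z * w * w = (z * z) * w * w := by rw [hzz]
        _ = (z * w) * (z * w) := by
          rw [← mul_assoc (z * w) z w, mul_assoc z w z, ← hzw, ← mul_assoc z z w]
        _ = z * w := by rw [hz, hgg]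
    rw [← hz]
    exact h.mul_right_cancel h1
  · left
    have h1 : g ^ (j + 1) = g := by
      clear hj
      induction j with
      | zero => rw [pow_one]
      | succ j ih => rw [pow_succ, ih, hgg]
    rw [← h1, ← hz, (show Commute z w from hzw).mul_pow, pow_succ w, hj, zero_mul, mul_zero]

theorem ZIntw.isUnit_of_fixed [FiniteDimensional K V] (hB : IsBlock α q m T) (hV : Indec (m + 1) T)
    {w : V →ₗ[K] V'} {w' : V' →ₗ[K] V} (hw : Intw (m + 1) T T' w) (hw' : Intw (m + 1) T' T w')
    {g : V →ₗ[K] V'} {h : V' →ₗ[K] V} (hg : ∀ x, zsum α q m T' (w x) = g x)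
    (hh : ∀ x, zsum α q m T (w' x) = h x) {v : V} (hv0 : v ≠ 0) (hv : h (g v) = v) :
    IsUnit (w' ∘ₗ w : End K V) := by
  refine (hV.isUnit_or_isNilpotent (hw'.comp hw)).resolve_right fun ⟨j, hj⟩ => hv0 ?_
  set z := zsum α q m T
  have hzz : ∀ x, z (z x) = z x := congr_fun hB.zsum_mul_zsum
  have h1 : z (w' (w v)) = v := by
    rw [← hzz, ← hw'.map_zsum, hg, hh, hv]
  have h2 : ∀ x, z ((w' ∘ₗ w : End K V) x) = (w' ∘ₗ w : End K V) (z x) := fun x => by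
    rw [comp_apply, comp_apply, hw.map_zsum, hw'.map_zsum]
  have hzv : z v = v := by rw [← h1, hzz]
  have h3 : (w' ∘ₗ w : End K V) v = v := by
    rw [← hzv, ← h2, comp_apply, h1]
    exact hzv.symm
  have h4 : ∀ j : ℕ, ((w' ∘ₗ w : End K V) ^ j) v = v := fun j => by
    induction j with
    | zero => rfl
    | succ j ih => rw [pow_succ, mul_apply, h3, ih]
  rw [← h4 j, hj, LinearMap.zero_apply]

end Lift

namespace IsZig

section Table

variable {κ κ' : ℕ → K}
  {e u d y : ℕ → R} (hZ : IsZig m κ κ' e u d y) {a b c : ℕ} {x z : R}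

include hZ

theorem left (ha : a ≤ m) (hc : c ≤ m) (h : e a * x = x) : e c * x = if c = a then x else 0 := by
  split_ifs with hac
  · rw [hac, h]
  · rw [← h, ← mul_assoc, hZ.eo c hc a ha hac, zero_mul]

theorem right (ha : a ≤ m) (hc : c ≤ m) (h : x * e a = x) : x * e c = if c = a then x else 0 := by
  split_ifs with hac
  · rw [hac, h]
  · rw [← h, mul_assoc, hZ.eo a ha c hc (Ne.symm hac), mul_zero]

theorem mul_eq_zero_of_ne (ha : a ≤ m) (hc : c ≤ m) (hac : a ≠ c) (hx : x * e a = x)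
    (hz : e c * z = z) : x * z = 0 := by
  rw [← hx, mul_assoc, hZ.left hc ha hz, if_neg hac, mul_zero]

theorem sum_mul (ha : a ≤ m) (h : e a * x = x) : (∑ c ∈ range (m + 1), e c) * x = x := by
  rw [Finset.sum_mul, sum_eq_single a (fun c hc hca => ?_) fun h => ?_, h]
  · rw [hZ.left ha (by have := mem_range.1 hc; omega) h, if_neg hca]
  · exact absurd (mem_range.2 (by omega)) h

theorem y_mul_y (ha : a ≤ m) (hc : c ≤ m) : y a * y c = 0 := by
  by_cases h : a = c
  · rw [h, hZ.yy c hc]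
  · exact hZ.mul_eq_zero_of_ne ha hc h (hZ.ye a ha) (hZ.ey c hc)

theorem y_mul_u (ha : a ≤ m) (hb : b < m) : y a * u b = 0 := by
  by_cases h : a = b + 1
  · rw [h, hZ.yu b hb]
  · exact hZ.mul_eq_zero_of_ne ha hb h (hZ.ye a ha) (hZ.eu b hb)

theorem u_mul_y (ha : a ≤ m) (hb : b < m) : u b * y a = 0 := by
  by_cases h : b = a
  · rw [← h, hZ.uy b hb]
  · exact hZ.mul_eq_zero_of_ne hb.le ha h (hZ.ue b hb) (hZ.ey a ha)

theorem y_mul_d (ha : a ≤ m) (hb : b < m) : y a * d b = 0 := by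
  by_cases h : a = b
  · rw [h, hZ.yd b hb]
  · exact hZ.mul_eq_zero_of_ne ha hb.le h (hZ.ye a ha) (hZ.ed b hb)

theorem d_mul_y (ha : a ≤ m) (hb : b < m) : d b * y a = 0 := by
  by_cases h : b + 1 = a
  · rw [← h, hZ.dy b hb]
  · exact hZ.mul_eq_zero_of_ne hb ha h (hZ.de b hb) (hZ.ey a ha)

theorem u_mul_u (hb : b < m) (hc : c < m) : u b * u c = 0 := by
  by_cases h : b = c + 1
  · rw [h, hZ.uu c (by omega)]
  · exact hZ.mul_eq_zero_of_ne hb.le hc h (hZ.ue b hb) (hZ.eu c hc)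

theorem d_mul_d (hb : b < m) (hc : c < m) : d b * d c = 0 := by
  by_cases h : b + 1 = c
  · rw [← h, hZ.dd b (by omega)]
  · exact hZ.mul_eq_zero_of_ne hb hc.le h (hZ.de b hb) (hZ.ed c hc)

theorem d_mul_u (hb : b < m) (hc : c < m) (h : b ≠ c) : d b * u c = 0 :=
  hZ.mul_eq_zero_of_ne hb hc (by omega) (hZ.de b hb) (hZ.eu c hc)

theorem u_mul_d (hb : b < m) (hc : c < m) (h : b ≠ c) : u b * d c = 0 :=
  hZ.mul_eq_zero_of_ne hb.le hc.le h (hZ.ue b hb) (hZ.ed c hc)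

end Table

variable {κ κ' : ℕ → K} {e' u' d' y' : ℕ → End K V'} {e u d y : ℕ → End K V}

/-- The homomorphism attached to a vector and a linear form, both located at the vertex `a`. -/
noncomputable def projMap (m a : ℕ) (κ κ' : ℕ → K) (u d y : ℕ → End K V)
    (u' d' y' : ℕ → End K V') (ξ : V →ₗ[K] K) (v : V') : V →ₗ[K] V' :=
  (ξ ∘ₗ y a).smulRight v + ξ.smulRight (y' a v) + ∑ b ∈ range m,
    (((κ b)⁻¹ • ξ ∘ₗ d b).smulRight (u' b v) + ((κ' b)⁻¹ • ξ ∘ₗ u b).smulRight (d' b v))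

theorem projMap_apply (a : ℕ) (ξ : V →ₗ[K] K) (v : V') (w : V) :
    projMap m a κ κ' u d y u' d' y' ξ v w = ξ (y a w) • v + ξ w • y' a v +
      ∑ b ∈ range m, (((κ b)⁻¹ * ξ (d b w)) • u' b v + ((κ' b)⁻¹ * ξ (u b w)) • d' b v) := by
  simp [projMap, LinearMap.sum_apply]

variable (hZ : IsZig m κ κ' e u d y) (hZ' : IsZig m κ κ' e' u' d' y')

include hZ hZ'

theorem zIntw_projMap (hκ : ∀ b < m, κ b ≠ 0 ∧ κ' b ≠ 0) {a : ℕ} (ha : a ≤ m) {ξ : V →ₗ[K] K}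
    (hξ : ∀ w, ξ (e a w) = ξ w) {v : V'} (hv : e' a v = v) :
    ZIntw m e u d y e' u' d' y' (projMap m a κ κ' u d y u' d' y' ξ v) := by
  have hξ0 : ∀ {c : ℕ} {x : End K V}, c ≤ m → c ≠ a → e c * x = x → ∀ w, ξ (x w) = 0 :=
    fun {c x} hc hca hx w => by
      rw [← hξ, ← mul_apply, hZ.left hc ha hx, if_neg (Ne.symm hca),
        LinearMap.zero_apply, map_zero]
  have hv0 : ∀ {c : ℕ} {x : End K V'}, c ≤ m → c ≠ a → x * e' c = x → x v = 0 :=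
    fun {c x} hc hca hx => by
      rw [← hv, ← mul_apply, hZ'.right hc ha hx, if_neg (Ne.symm hca),
        LinearMap.zero_apply]
  have Z : ∀ {x z : End K V}, x * z = 0 → ∀ w, x (z w) = 0 := congr_fun
  have Z' : ∀ {x z : End K V'}, x * z = 0 → ∀ w, x (z w) = 0 := congr_fun
  refine ⟨fun c hc w => ?_, fun c hc w => ?_, fun c hc w => ?_, fun c hc w => ?_, fun w => ?_⟩
  · have hec : ∀ {i : ℕ} {x : End K V} {z : End K V'}, i ≤ m → x * e i = x →
        e' i * z = z → ∀ s : K, (s * ξ (x (e c w))) • z v = (s * ξ (x w)) • e' c (z v) :=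
      fun {i x z} hi hx hz s => by
        rw [← mul_apply, ← mul_apply, hZ.right hi hc hx, hZ'.left hi hc hz]
        split_ifs <;> simp
    have h1 := hec (z := e' a) ha (hZ.ye a ha) (hZ'.ee a ha) 1
    have h2 := hec (x := e a) ha (hZ.ee a ha) (hZ'.ey a ha) 1
    rw [hv, one_mul, one_mul] at h1
    rw [hξ, hξ, one_mul, one_mul] at h2
    rw [projMap_apply, projMap_apply, map_add, map_add, map_smul, map_smul, map_sum, h1, h2]
    refine congr_arg₂ _ rfl (sum_congr rfl fun b hb => ?_)
    rw [mem_range] at hb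
    rw [map_add, map_smul, map_smul, hec hb (hZ.de b hb) (hZ'.eu b hb),
      hec hb.le (hZ.ue b hb) (hZ'.ed b hb)]
  · have h1 : ξ (u c w) • y' a v = ξ (u c w) • y' (c + 1) v := by
      by_cases h : c + 1 = a
      · rw [h]
      · rw [hξ0 hc h (hZ.eu c hc), zero_smul, zero_smul]
    have h2 : ξ (y a w) • u' c v = ξ (y c w) • u' c v := by
      by_cases h : c = a
      · rw [h]
      · rw [hv0 hc.le h (hZ'.ue c hc), smul_zero, smul_zero]
    rw [projMap_apply, projMap_apply, map_add, map_add, map_smul, map_smul, map_sum,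
      Z (hZ.y_mul_u ha hc), Z' (hZ'.u_mul_y ha hc), h1, h2,
      sum_eq_single c (fun b hb hbc => ?_) fun h => absurd (mem_range.2 hc) h,
      sum_eq_single c (fun b hb hbc => ?_) fun h => absurd (mem_range.2 hc) h]
    · have e1 : d c (u c w) = κ c • y c w := congr_fun (hZ.du c hc) w
      have e2 : u' c (d' c v) = κ' c • y' (c + 1) v := congr_fun (hZ'.ud c hc) v
      rw [map_add, map_smul, map_smul, Z (hZ.u_mul_u hc hc), Z' (hZ'.u_mul_u hc hc), e1, e2,
        map_smul, smul_eq_mul, inv_mul_cancel_left₀ (hκ c hc).1, smul_smul, mul_right_comm,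
        inv_mul_cancel₀ (hκ c hc).2]
      simp [add_comm]
    · rw [mem_range] at hb
      simp [Z' (hZ'.u_mul_u hc hb), Z' (hZ'.u_mul_d hc hb hbc.symm)]
    · rw [mem_range] at hb
      simp [Z (hZ.u_mul_u hb hc), Z (hZ.d_mul_u hb hc hbc)]
  · have h1 : ξ (d c w) • y' a v = ξ (d c w) • y' c v := by
      by_cases h : c = a
      · rw [h]
      · rw [hξ0 hc.le h (hZ.ed c hc), zero_smul, zero_smul]
    have h2 : ξ (y a w) • d' c v = ξ (y (c + 1) w) • d' c v := by
      by_cases h : c + 1 = a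
      · rw [h]
      · rw [hv0 hc h (hZ'.de c hc), smul_zero, smul_zero]
    rw [projMap_apply, projMap_apply, map_add, map_add, map_smul, map_smul, map_sum,
      Z (hZ.y_mul_d ha hc), Z' (hZ'.d_mul_y ha hc), h1, h2,
      sum_eq_single c (fun b hb hbc => ?_) fun h => absurd (mem_range.2 hc) h,
      sum_eq_single c (fun b hb hbc => ?_) fun h => absurd (mem_range.2 hc) h]
    · have e1 : u c (d c w) = κ' c • y (c + 1) w := congr_fun (hZ.ud c hc) w
      have e2 : d' c (u' c v) = κ c • y' c v := congr_fun (hZ'.du c hc) v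
      rw [map_add, map_smul, map_smul, Z (hZ.d_mul_d hc hc), Z' (hZ'.d_mul_d hc hc), e1, e2,
        map_smul, smul_eq_mul, inv_mul_cancel_left₀ (hκ c hc).2, smul_smul, mul_right_comm,
        inv_mul_cancel₀ (hκ c hc).1]
      simp [add_comm]
    · rw [mem_range] at hb
      simp [Z' (hZ'.d_mul_d hc hb), Z' (hZ'.d_mul_u hc hb hbc.symm)]
    · rw [mem_range] at hb
      simp [Z (hZ.d_mul_d hb hc), Z (hZ.u_mul_d hb hc hbc)]
  · have h1 : ξ (y c w) • y' a v = ξ (y a w) • y' c v := by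
      by_cases h : c = a
      · rw [h]
      · rw [hξ0 hc h (hZ.ey c hc), hv0 hc h (hZ'.ye c hc), zero_smul, smul_zero]
    rw [projMap_apply, projMap_apply, map_add, map_add, map_smul, map_smul, map_sum,
      Z (hZ.y_mul_y ha hc), Z' (hZ'.y_mul_y hc ha), h1, sum_eq_zero fun b hb => ?_,
      sum_eq_zero fun b hb => ?_]
    · simp
    · rw [mem_range] at hb
      simp [Z' (hZ'.y_mul_u hc hb), Z' (hZ'.y_mul_d hc hb)]
    · rw [mem_range] at hb
      simp [Z (hZ.u_mul_y hc hb), Z (hZ.d_mul_y hc hb)]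
  · rw [← LinearMap.sum_apply]
    have hS : ∀ {i : ℕ} {x : End K V'}, i ≤ m → e' i * x = x → ∀ w,
        (∑ a ∈ range (m + 1), e' a) (x w) = x w := fun hi hx =>
      congr_fun (hZ'.sum_mul hi hx)
    have hSv := hS ha (hZ'.ee a ha) v
    rw [hv] at hSv
    simp only [projMap_apply, map_add, map_smul, map_sum, hS ha (hZ'.ey a ha), hSv]
    refine congr_arg₂ _ rfl (sum_congr rfl fun b hb => ?_)
    rw [mem_range] at hb
    rw [hS hb (hZ'.eu b hb), hS hb.le (hZ'.ed b hb)]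

omit hZ' in
theorem projMap_apply_y (ha : a ≤ m) (ξ : V →ₗ[K] K) (v' : V') {v : V}
    (hv : ξ (y a v) = 1) : projMap m a κ κ' u d y u' d' y' ξ v' (y a v) = y' a v' := by
  have Z : ∀ {x z : End K V}, x * z = 0 → ∀ w, x (z w) = 0 := congr_fun
  rw [projMap_apply, Z (hZ.y_mul_y ha ha), hv, sum_eq_zero fun b hb => ?_]
  · simp
  · rw [mem_range] at hb
    simp [Z (hZ.u_mul_y ha hb), Z (hZ.d_mul_y ha hb)]

end IsZig

section Thin

/-- Vectors and linear forms on the vertices `b, …, c` that span a thin direct summand of the chain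
of linear relations `{(s i w, t i w)}`, as far as the relations ending in these vertices go. -/
structure Thin (s t : ℕ → End K V) (b c : ℕ) (x : ℕ → V) (ξ : ℕ → V →ₗ[K] K) : Prop where
  vec : ∀ i, b ≤ i → i < c → ∃ w, s i w = x i ∧ t i w = x (i + 1)
  form : ∀ i, b ≤ i → i < c → ∀ w, ξ i (s i w) = ξ (i + 1) (t i w)
  unit : ∀ i, b ≤ i → i ≤ c → ξ i (x i) = 1
  bot : ∀ i, i + 1 = b → (∃ w, s i w = 0 ∧ t i w = x b) ∨ ∀ w, ξ b (t i w) = 0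

theorem Thin.start {s t : ℕ → End K V} {v : V} {ξ : V →ₗ[K] K} (h : ξ v = 1)
    (hb : ∀ i, i + 1 = b → (∃ w, s i w = 0 ∧ t i w = v) ∨ ∀ w, ξ (t i w) = 0) :
    Thin s t b b (fun _ => v) fun _ => ξ :=
  ⟨fun _ _ _ => by omega, fun _ _ _ => by omega, fun _ _ _ => h, hb⟩

theorem Thin.step {s t : ℕ → End K V} {b c : ℕ} {x : ℕ → V} {ξ : ℕ → V →ₗ[K] K}
    (h : Thin s t b c x ξ) (hbc : b ≤ c) {w : V} {v : V} {η : V →ₗ[K] K} (hs : s c w = x c)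
    (ht : t c w = v) (hη : ∀ w, ξ c (s c w) = η (t c w)) (hv : η v = 1) :
    Thin s t b (c + 1) (update x (c + 1) v) (update ξ (c + 1) η) where
  vec i hi hic := by
    rw [update_of_ne hic.ne]
    obtain rfl | hlt := eq_or_lt_of_le (lt_succ_iff.1 hic)
    · exact ⟨w, hs, by rw [update_self, ht]⟩
    · rw [update_of_ne (by omega)]
      exact h.vec i hi hlt
  form i hi hic := by
    rw [update_of_ne hic.ne]
    obtain rfl | hlt := eq_or_lt_of_le (lt_succ_iff.1 hic)
    · rwa [update_self]
    · rw [update_of_ne (by omega)]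
      exact h.form i hi hlt
  unit i hi hic := by
    obtain rfl | hlt := eq_or_lt_of_le hic
    · rwa [update_self, update_self]
    · rw [update_of_ne hlt.ne, update_of_ne hlt.ne]
      exact h.unit i hi (by omega)
  bot i hi := by
    rw [update_of_ne (by omega), update_of_ne (by omega)]
    exact h.bot i hi

/-- Any vector and linear form in a common step of a suitable filtration extend to thin data. -/
theorem exists_filtration (s t : ℕ → End K V) (c : ℕ) :
    ∃ F : ℕ → Submodule K V, F 0 = ⊥ ∧ (∃ N, F N = ⊤) ∧ ∀ (v : V) (ξ : V →ₗ[K] K) (j : ℕ),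
      ξ v = 1 → v ∈ F (j + 1) → (∀ z ∈ F j, ξ z = 0) →
        ∃ b ≤ c, ∃ X Ξ, X c = v ∧ Ξ c = ξ ∧ Thin s t b c X Ξ := by
  induction c with
  | zero =>
    exact ⟨fun j => if j = 0 then ⊥ else ⊤, if_pos rfl, ⟨1, if_neg one_ne_zero⟩, fun v ξ j h _ _ =>
      ⟨0, le_rfl, _, _, rfl, rfl, Thin.start h fun i hi => absurd hi i.succ_ne_zero⟩⟩
  | succ c ih =>
    obtain ⟨F, hF0, ⟨N, hN⟩, hF⟩ := ih
    refine ⟨fun j => if j = 0 then ⊥ else if j ≤ N + 1 then ((F (j - 1)).comap (s c)).map (t c)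
      else ⊤, if_pos rfl, ⟨N + 2, by simp⟩, fun v ξ j h hv hξ => ?_⟩
    by_cases hbot : ∀ i, i + 1 = c + 1 → (∃ w, s i w = 0 ∧ t i w = v) ∨ ∀ w, ξ (t i w) = 0
    · exact ⟨c + 1, le_rfl, _, _, rfl, rfl, Thin.start h hbot⟩
    push Not at hbot
    obtain ⟨i, hi, h1, w₁, h2⟩ := hbot
    obtain rfl : i = c := by omega
    beta_reduce at hv hξ
    rw [if_neg j.add_one_ne_zero] at hv
    by_cases hj : j + 1 ≤ N + 1
    swap
    · by_cases hj1 : j = N + 1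
      · refine absurd (hξ (t i w₁) ?_) h2
        simp [hj1, hN]
      · rw [if_neg (by omega), if_neg (by omega)] at hξ
        simp [hξ v trivial] at h
    rw [if_pos hj] at hv
    obtain ⟨w, hw, hwv⟩ := hv
    obtain _ | j := j
    · simp only [Nat.add_sub_cancel, zero_add, hF0] at hw
      exact absurd hwv (h1 w ((Submodule.mem_bot K).1 hw))
    rw [if_neg j.add_one_ne_zero, if_pos (by omega)] at hξ
    have hmem : ξ ∘ₗ t i ∈ LinearMap.range ((F j).mkQ ∘ₗ s i).dualMap := by
      rw [LinearMap.range_dualMap_eq_dualAnnihilator_ker, Submodule.mem_dualAnnihilator]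
      intro z hz
      exact hξ _ ⟨z, (show s i z ∈ F j from (Submodule.Quotient.mk_eq_zero (F j)).1 hz), rfl⟩
    obtain ⟨η, hη⟩ := hmem
    have hη' : ∀ w, (η ∘ₗ (F j).mkQ) (s i w) = ξ (t i w) := congr_fun hη
    obtain ⟨b, hb, X, Ξ, hX, hΞ, hT⟩ := hF (s i w) (η ∘ₗ (F j).mkQ) j (by rw [hη', hwv, h]) hw
      fun z hz => by
        rw [comp_apply, Submodule.mkQ_apply, (Submodule.Quotient.mk_eq_zero _).2 hz,
          map_zero]
    refine ⟨b, by omega, _, _, update_self .., update_self ..,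
      hT.step hb hX.symm hwv (fun w => ?_) h⟩
    rw [hΞ, hη']

end Thin

section Codes

variable {κ κ' : ℕ → K} {e' u' d' y' : ℕ → End K V'} {e u d y : ℕ → End K V}

/-- A thin summand, on the vertices `b, …, c`, of a representation of a zigzag quiver all of whose
vertices of the parity `r` are sinks. -/
structure ThinSummand (m r b c : ℕ) (e u d y : ℕ → End K V) (x : ℕ → V)
    (ξ : ℕ → V →ₗ[K] K) : Prop extends Thin (fun i => if i % 2 = r then d i else e i)
      (fun i => if i % 2 = r then e (i + 1) else u i) b c x ξ where
  hb : b ≤ c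
  hy : ∀ a ≤ m, y a = 0
  hu : ∀ i < m, i % 2 = r → u i = 0
  hd : ∀ i < m, i % 2 ≠ r → d i = 0
  fix : e c (x c) = x c
  top : c < m → e (c + 1) = 0

/-- The isomorphism type of the truncation of an indecomposable module in a block. -/
def HasCode (m : ℕ) (e u d y : ℕ → End K V) :
    Fin (m + 1) ⊕ Fin 2 × Fin (m + 1) × Fin (m + 1) → Prop
  | .inl a => ∃ (v : V) (ξ : V →ₗ[K] K), e a v = v ∧ (∀ w, ξ (e a w) = ξ w) ∧ ξ (y a v) = 1
  | .inr (r, b, c) => ∃ x ξ, ThinSummand m r b c e u d y x ξ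

namespace IsZig

variable (hZ : IsZig m κ κ' e u d y) (hZ' : IsZig m κ κ' e' u' d' y')

include hZ

theorem ee_apply : ∀ a ≤ m, ∀ w, e a (e a w) = e a w := fun _ h =>
  congr_fun (hZ.ee _ h)

theorem ue_apply : ∀ b < m, ∀ w, u b (e b w) = u b w := fun _ h =>
  congr_fun (hZ.ue _ h)

theorem eu_apply : ∀ b < m, ∀ w, e (b + 1) (u b w) = u b w := fun _ h =>
  congr_fun (hZ.eu _ h)

theorem de_apply : ∀ b < m, ∀ w, d b (e (b + 1) w) = d b w := fun _ h =>
  congr_fun (hZ.de _ h)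

theorem ed_apply : ∀ b < m, ∀ w, e b (d b w) = d b w := fun _ h =>
  congr_fun (hZ.ed _ h)

theorem exists_parity (hy : ∀ a ≤ m, y a = 0)
    (hI : ∀ g, ZIntw m e u d y e u d y g → g * g = g → g = 0 ∨ g = ∑ a ∈ range (m + 1), e a) :
    ∃ r : Fin 2, ∀ i < m, (i % 2 = r → u i = 0) ∧ (i % 2 ≠ r → d i = 0) := by
  have Z : ∀ {x z : End K V}, x * z = 0 → ∀ w, x (z w) = 0 := congr_fun
  have hee := hZ.ee_apply
  have hue := hZ.ue_apply
  have heu := hZ.eu_apply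
  have hde := hZ.de_apply
  have hed := hZ.ed_apply
  set S : Submodule K V := ⨅ b : Fin m, LinearMap.ker (u b) ⊓ LinearMap.ker (d b) with hSdef
  have hS : ∀ z, z ∈ S ↔ ∀ b < m, u b z = 0 ∧ d b z = 0 := fun z => by
    simp [hSdef, Submodule.mem_iInf, Fin.forall_iff]
  obtain ⟨σ, hσ⟩ := S.mkQ.exists_rightInverse_of_surjective S.range_mkQ
  set π : End K V := σ ∘ₗ S.mkQ with hπdef
  have hπ0 : ∀ z ∈ S, π z = 0 := fun z hz => by
    rw [hπdef, comp_apply, Submodule.mkQ_apply, (Submodule.Quotient.mk_eq_zero _).2 hz,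
      map_zero]
  have hπS : ∀ x, x - π x ∈ S := fun x => by
    rw [← Submodule.Quotient.mk_eq_zero, Submodule.Quotient.mk_sub, sub_eq_zero]
    exact (congr_fun hσ _).symm
  have huπ : ∀ b < m, ∀ x, u b (π x) = u b x := fun b hb x => by
    have := ((hS _).1 (hπS x) b hb).1
    rw [map_sub, sub_eq_zero] at this
    exact this.symm
  have hdπ : ∀ b < m, ∀ x, d b (π x) = d b x := fun b hb x => by
    have := ((hS _).1 (hπS x) b hb).2
    rw [map_sub, sub_eq_zero] at this
    exact this.symm
  have hπu : ∀ b < m, ∀ x, π (u b x) = 0 := fun b hb x => hπ0 _ ((hS _).2 fun c hc =>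
    ⟨Z (hZ.u_mul_u hc hb) x, by
      by_cases h : c = b
      · exact Z (x := d c) (by rw [h, hZ.du b hb, hy b hb.le, smul_zero]) x
      · exact Z (hZ.d_mul_u hc hb h) x⟩)
  have hπd : ∀ b < m, ∀ x, π (d b x) = 0 := fun b hb x => hπ0 _ ((hS _).2 fun c hc =>
    ⟨by
      by_cases h : c = b
      · exact Z (x := u c) (by rw [h, hZ.ud b hb, hy (b + 1) hb, smul_zero]) x
      · exact Z (hZ.u_mul_d hc hb h) x, Z (hZ.d_mul_d hc hb) x⟩)
  have hSe : ∀ a ≤ m, ∀ z ∈ S, e a z ∈ S := fun a ha z hz => (hS _).2 fun c hc => by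
    rw [← mul_apply, ← mul_apply, hZ.right hc.le ha (hZ.ue c hc),
      hZ.right hc ha (hZ.de c hc)]
    split_ifs <;> simp [(hS _).1 hz c hc]
  have hππ : ∀ a ≤ m, ∀ x, π (e a (π (e a x))) = π (e a x) := fun a ha x => by
    have := hπ0 _ (hSe a ha _ (hπS (e a x)))
    rw [map_sub, map_sub, sub_eq_zero, hee a ha] at this
    exact this.symm
  set Q : ℕ → End K V := fun a => if a % 2 = 0 then e a * π * e a else e a - e a * π * e a
    with hQdef
  have hQ0 : ∀ {a : ℕ}, a % 2 = 0 → ∀ x, Q a x = e a (π (e a x)) := fun h x => by simp [hQdef, h]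
  have hQ1 : ∀ {a : ℕ}, a % 2 ≠ 0 → ∀ x, Q a x = e a x - e a (π (e a x)) := fun h x => by
    simp [hQdef, h]
  have hQe : ∀ a ≤ m, Q a * e a = Q a := fun a ha => ext fun x => by
    by_cases h : a % 2 = 0
    · simp [hQ0 h, hee a ha]
    · simp [hQ1 h, hee a ha]
  have heQ : ∀ a ≤ m, e a * Q a = Q a := fun a ha => ext fun x => by
    by_cases h : a % 2 = 0
    · simp [hQ0 h, hee a ha]
    · simp [hQ1 h, hee a ha]
  have hQQ : ∀ a ≤ m, Q a * Q a = Q a := fun a ha => ext fun x => by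
    by_cases h : a % 2 = 0
    · simp [hQ0 h, hee a ha, hππ a ha]
    · simp [hQ1 h, hee a ha, hππ a ha]
  set P : End K V := ∑ a ∈ range (m + 1), Q a with hPdef
  have heP : ∀ a ≤ m, e a * P = Q a := fun a ha => by
    rw [hPdef, mul_sum, sum_eq_single a (fun c hc hca => ?_) fun h => ?_, heQ a ha]
    · have hc' := mem_range_succ_iff.1 hc
      rw [hZ.left hc' ha (heQ c hc'), if_neg (Ne.symm hca)]
    · exact absurd (mem_range_succ_iff.2 ha) h
  have hPe : ∀ a ≤ m, P * e a = Q a := fun a ha => by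
    rw [hPdef, Finset.sum_mul, sum_eq_single a (fun c hc hca => ?_) fun h => ?_, hQe a ha]
    · have hc' := mem_range_succ_iff.1 hc
      rw [hZ.right hc' ha (hQe c hc'), if_neg (Ne.symm hca)]
    · exact absurd (mem_range_succ_iff.2 ha) h
  have hPe' : ∀ a ≤ m, ∀ x, P (e a x) = Q a x := fun a ha => congr_fun (hPe a ha)
  have heP' : ∀ a ≤ m, ∀ x, e a (P x) = Q a x := fun a ha => congr_fun (heP a ha)
  have hP : ZIntw m e u d y e u d y P := by
    refine ⟨fun a ha x => by rw [hPe' a ha, heP' a ha], fun b hb x => ?_, fun b hb x => ?_,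
      fun a ha x => by simp [hy a ha], fun x => ?_⟩
    · rw [← heu b hb, hPe' _ hb, ← hue b hb (P x), heP' b hb.le]
      by_cases h : b % 2 = 0
      · rw [hQ0 h, hQ1 (by omega)]
        simp [heu b hb, hue b hb, huπ b hb, hπu b hb]
      · rw [hQ1 h, hQ0 (by omega)]
        simp [heu b hb, hue b hb, huπ b hb, hπu b hb]
    · rw [← hed b hb, hPe' _ hb.le, ← hde b hb (P x), heP' _ hb]
      by_cases h : b % 2 = 0
      · rw [hQ0 h, hQ1 (by omega)]
        simp [hed b hb, hde b hb, hdπ b hb, hπd b hb]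
      · rw [hQ1 h, hQ0 (by omega)]
        simp [hed b hb, hde b hb, hdπ b hb, hπd b hb]
    · exact (sum_congr rfl fun a ha => heP' a (mem_range_succ_iff.1 ha) x).trans
        (LinearMap.sum_apply ..).symm
  have hPP : P * P = P := (Finset.sum_mul ..).trans <| sum_congr rfl fun a ha => by
    have ha' := mem_range_succ_iff.1 ha
    rw [← hQe a ha', mul_assoc, heP a ha', hQe a ha', hQQ a ha']
  have key : ∀ r, (∀ a ≤ m, a % 2 = r → ∀ x, e a (π (e a x)) = 0) → ∀ i < m,
      (i % 2 = r → u i = 0) ∧ ((i + 1) % 2 = r → d i = 0) := fun r h i hi =>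
    ⟨fun hr => ext fun x => by
      rw [← hue i hi, ← huπ i hi, ← hue i hi, h i hi.le hr, map_zero, LinearMap.zero_apply],
    fun hr => ext fun x => by
      rw [← hde i hi, ← hdπ i hi, ← hde i hi, h _ hi hr, map_zero, LinearMap.zero_apply]⟩
  obtain h0 | h1 := hI P hP hPP
  · refine ⟨0, fun i hi => ?_⟩
    have := key 0 (fun a ha h x => by rw [← hQ0 h, ← heP' a ha, h0]; simp) i hi
    exact ⟨fun h => this.1 h, fun h => this.2 (by simp at h; omega)⟩
  · refine ⟨1, fun i hi => ?_⟩
    have := key 1 (fun a ha h x => by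
      have h2 := hQ1 (a := a) (by omega) x
      have h3 : Q a = e a := by
        rw [← heP a ha, h1, mul_sum, sum_eq_single a (fun c hc hca => ?_) fun h => ?_,
          hZ.ee a ha]
        · exact hZ.eo a ha c (mem_range_succ_iff.1 hc) hca.symm
        · exact absurd (mem_range_succ_iff.2 ha) h
      rwa [h3, eq_comm, sub_eq_self] at h2) i hi
    exact ⟨fun h => this.1 h, fun h => this.2 (by simp at h; omega)⟩

theorem exists_hasCode (hne : ∃ a ≤ m, e a ≠ 0)
    (hI : ∀ g, ZIntw m e u d y e u d y g → g * g = g → g = 0 ∨ g = ∑ a ∈ range (m + 1), e a) :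
    ∃ p, HasCode m e u d y p := by
  classical
  by_cases hy : ∀ a ≤ m, y a = 0
  · obtain ⟨r, hr⟩ := hZ.exists_parity hy hI
    obtain ⟨a, ha, hea⟩ := hne
    set c := Nat.findGreatest (fun a => e a ≠ 0) m
    have hc : e c ≠ 0 := Nat.findGreatest_spec (P := fun a => e a ≠ 0) ha hea
    have hcm : c ≤ m := Nat.findGreatest_le m
    obtain ⟨z, hz⟩ : ∃ z, e c z ≠ 0 := by
      by_contra! h
      exact hc (ext h)
    obtain ⟨F, hF0, ⟨N, hN⟩, hF⟩ := exists_filtration (fun i => if i % 2 = r then d i else e i)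
      (fun i => if i % 2 = r then e (i + 1) else u i) c
    have hex : ∃ j, ∃ v ∈ F j, e c v = v ∧ v ≠ 0 :=
      ⟨N, e c z, hN ▸ trivial, congr_fun (hZ.ee c hcm) z, hz⟩
    obtain ⟨v, hv, hev, hv0⟩ := Nat.find_spec hex
    have hlt := fun j => Nat.find_min hex (m := j)
    generalize Nat.find hex = j at hv hlt
    obtain _ | j := j
    · rw [hF0] at hv
      exact absurd ((Submodule.mem_bot K).1 hv) hv0
    obtain ⟨η, hη, hηF⟩ := Submodule.exists_le_ker_of_notMem
      (fun h => hlt j j.lt_succ_self ⟨v, h, hev, hv0⟩ : v ∉ F j)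
    obtain ⟨b, hb, X, Ξ, hX, -, hT⟩ := hF v ((η v)⁻¹ • η) j (by simp [hη]) hv fun z hz => by
      simp [mem_ker.1 (hηF hz)]
    exact ⟨.inr (r, ⟨b, by omega⟩, ⟨c, by omega⟩), X, Ξ, hT, hb, hy, fun i hi => (hr i hi).1,
      fun i hi => (hr i hi).2, by simp only [hX, hev], fun h => by
        simpa using Nat.findGreatest_is_greatest (P := fun a => e a ≠ 0) c.lt_succ_self h⟩
  · push Not at hy
    obtain ⟨a, ha, hya⟩ := hy
    obtain ⟨z, hz⟩ : ∃ z, y a z ≠ 0 := by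
      by_contra! h
      exact hya (ext h)
    obtain ⟨η, hη, -⟩ := Submodule.exists_le_ker_of_notMem (mt (Submodule.mem_bot K).1 hz)
    have hee : ∀ w, e a (e a w) = e a w := congr_fun (hZ.ee a ha)
    have hey : ∀ w, e a (y a w) = y a w := congr_fun (hZ.ey a ha)
    have hye : ∀ w, y a (e a w) = y a w := congr_fun (hZ.ye a ha)
    exact ⟨.inl ⟨a, by omega⟩, e a z, (η (y a z))⁻¹ • η ∘ₗ e a, hee z, fun w => by simp [hee],
      by simp [hey, hye, hη]⟩

include hZ' in
theorem zIntw_thin {r b c : ℕ} (hc : c ≤ m) {x : ℕ → V} {ξ : ℕ → V →ₗ[K] K} {x' : ℕ → V'}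
    {ξ' : ℕ → V' →ₗ[K] K} (h : ThinSummand m r b c e u d y x ξ)
    (h' : ThinSummand m r b c e' u' d' y' x' ξ') :
    ∃ g : V →ₗ[K] V', ZIntw m e u d y e' u' d' y' g ∧ g (x c) = x' c := by
  have hvec' := h'.vec
  have hform := h.form
  have hbot := h.bot
  have hbot' := h'.bot
  have hee := hZ.ee_apply
  have hee' := hZ'.ee_apply
  have hue := hZ.ue_apply
  have heu := hZ.eu_apply
  have hed := hZ.ed_apply
  have hue' := hZ'.ue_apply
  have hed' := hZ'.ed_apply
  have hde' := hZ'.de_apply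
  have hfix : ∀ i, b ≤ i → i ≤ c → e' i (x' i) = x' i := fun i hi hic => by
    obtain rfl | hlt := eq_or_lt_of_le hic
    · exact h'.fix
    · obtain ⟨w, hw, -⟩ := hvec' i hi hlt
      rw [← hw]
      split_ifs
      · exact hed' i (by omega) w
      · exact hee' i (by omega) w
  set X : ℕ → V' := fun i => if b ≤ i ∧ i ≤ c then x' i else 0 with hX
  have hXin : ∀ {i}, b ≤ i → i ≤ c → X i = x' i := fun h1 h2 => if_pos ⟨h1, h2⟩
  have hXout : ∀ {i}, (b ≤ i → ¬ i ≤ c) → X i = 0 := fun h => if_neg fun h2 => h h2.1 h2.2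
  have heX : ∀ i, e' i (X i) = X i := fun i => by
    simp only [hX]
    split_ifs with hi
    · exact hfix i hi.1 hi.2
    · exact map_zero _
  set g : V →ₗ[K] V' := ∑ i ∈ range (m + 1), (ξ i ∘ₗ e i).smulRight (X i) with hg
  have hgw : ∀ w, g w = ∑ i ∈ range (m + 1), ξ i (e i w) • X i := fun w => by
    simp [hg, LinearMap.sum_apply]
  have h1 : ∀ k ≤ m, ∀ z, g (e k z) = ξ k (e k z) • X k := fun k hk z => by
    rw [hgw, sum_eq_single k (fun i hi hik => ?_) fun h => ?_, hee k hk]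
    · rw [← mul_apply, hZ.eo i (mem_range_succ_iff.1 hi) k hk hik]
      simp
    · exact absurd (mem_range_succ_iff.2 hk) h
  have h2 : ∀ k ≤ m, ∀ z, e' k (g z) = ξ k (e k z) • X k := fun k hk z => by
    rw [hgw, map_sum, sum_eq_single k (fun i hi hik => ?_) fun h => ?_, map_smul, heX]
    · rw [map_smul, ← heX, ← mul_apply,
        hZ'.eo k hk i (mem_range_succ_iff.1 hi) hik.symm]
      simp
    · exact absurd (mem_range_succ_iff.2 hk) h
  refine ⟨g, ⟨fun k hk z => by rw [h1 k hk, h2 k hk], fun k hk z => ?_, fun k hk z => ?_,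
    fun k hk z => by simp [h.hy k hk, h'.hy k hk], fun z => ?_⟩, ?_⟩
  · by_cases hr : k % 2 = r
    · simp [h.hu k hk hr, h'.hu k hk hr]
    rw [← heu k hk, h1 (k + 1) hk, ← hue' k hk (g z), h2 k hk.le, map_smul, heu k hk]
    by_cases hkb : b ≤ k
    · by_cases hkc : k < c
      · obtain ⟨w, hw, hw'⟩ := hvec' k hkb hkc
        have hf := hform k hkb hkc z
        simp only [if_neg hr] at hw hw' hf
        rw [hXin hkb hkc.le, hXin (by omega) hkc, ← hw, hue' k hk, hw', hf]
      · rw [hXout (i := k + 1) (by omega), smul_zero]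
        by_cases hkc' : k = c
        · subst hkc'
          rw [← hZ'.eu k hk, h'.top hk]
          simp
        · rw [hXout (i := k) (by omega)]
          simp
    · rw [hXout (i := k) (by omega), map_zero, smul_zero]
      by_cases hkb' : k + 1 = b
      · obtain ⟨w, hw, hw'⟩ | h3 := hbot k hkb'
        · have hn := h.unit b le_rfl h.hb
          simp only [if_neg hr] at hw hw'
          rw [← hw', ← hue k hk, hw, map_zero, map_zero] at hn
          exact absurd hn zero_ne_one
        · simp only [if_neg hr] at h3
          rw [hkb', h3, zero_smul]
      · rw [hXout (by omega), smul_zero]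
  · by_cases hr : k % 2 = r
    swap
    · simp [h.hd k hk hr, h'.hd k hk hr]
    rw [← hed k hk, h1 _ hk.le, ← hde' k hk (g z), h2 (k + 1) hk, map_smul, hed k hk]
    by_cases hkb : b ≤ k
    · by_cases hkc : k < c
      · obtain ⟨w, hw, hw'⟩ := hvec' k hkb hkc
        have hf := hform k hkb hkc z
        simp only [if_pos hr] at hw hw' hf
        rw [hXin hkb hkc.le, hXin (by omega) hkc, ← hw', hde' k hk, hw, hf]
      · rw [hXout (i := k + 1) (by omega), map_zero, smul_zero]
        by_cases hkc' : k = c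
        · subst hkc'
          rw [← hZ.de k hk, h.top hk]
          simp
        · rw [hXout (by omega), smul_zero]
    · rw [hXout (i := k) (by omega), smul_zero]
      by_cases hkb' : k + 1 = b
      · rw [hXin hkb'.ge (hkb' ▸ h.hb), hkb']
        obtain ⟨w, hw, hw'⟩ | h3 := hbot' k hkb'
        · simp only [if_pos hr] at hw hw'
          rw [← hw', hde' k hk, hw, smul_zero]
        · have hn := h'.unit b le_rfl h.hb
          have h4 := h3 (x' b)
          simp only [if_pos hr, hkb', hfix b le_rfl h.hb, hn] at h4
          exact absurd h4 one_ne_zero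
      · rw [hXout (by omega), map_zero, smul_zero]
  · rw [hgw z]
    exact sum_congr rfl fun k hk => by rw [← hgw, h2 k (mem_range_succ_iff.1 hk)]
  · rw [← h.fix, h1 c hc, h.fix, h.unit c h.hb le_rfl, one_smul, hXin h.hb le_rfl]

include hZ' in
theorem exists_of_hasCode (hκ : ∀ b < m, κ b ≠ 0 ∧ κ' b ≠ 0)
    {p : Fin (m + 1) ⊕ Fin 2 × Fin (m + 1) × Fin (m + 1)} (h : HasCode m e u d y p)
    (h' : HasCode m e' u' d' y' p) :
    ∃ (g : V →ₗ[K] V') (g' : V' →ₗ[K] V), ZIntw m e u d y e' u' d' y' g ∧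
      ZIntw m e' u' d' y' e u d y g' ∧ ∃ v, v ≠ 0 ∧ g' (g v) = v := by
  obtain a | ⟨r, b, c⟩ := p
  · obtain ⟨v, ξ, h1, h2, h3⟩ := h
    obtain ⟨v', ξ', h1', h2', h3'⟩ := h'
    have ha : (a : ℕ) ≤ m := lt_succ_iff.1 a.2
    refine ⟨_, _, hZ.zIntw_projMap hZ' hκ ha h2 h1', hZ'.zIntw_projMap hZ hκ ha h2' h1, y a v,
      fun h => ?_, ?_⟩
    · simp [h] at h3
    · rw [hZ.projMap_apply_y ha ξ v' h3, hZ'.projMap_apply_y ha ξ' v h3']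
  · obtain ⟨x, ξ, h⟩ := h
    obtain ⟨x', ξ', h'⟩ := h'
    have hc : (c : ℕ) ≤ m := lt_succ_iff.1 c.2
    obtain ⟨g, hg, hgx⟩ := hZ.zIntw_thin hZ' hc h h'
    obtain ⟨g', hg', hgx'⟩ := hZ'.zIntw_thin hZ hc h' h
    refine ⟨g, g', hg, hg', x c, fun h0 => ?_, by rw [hgx, hgx']⟩
    have := h.unit c h.hb le_rfl
    simp [h0] at this

end IsZig

end Codes

section FiniteType

variable {K : Type} [Field K] {α β q : K}

theorem IsHecke.symm {A : Type*} [Ring A] [Algebra K A] {T : ℕ → A}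
    (h : IsHecke α β q n T) : IsHecke β α q n T :=
  { h with quad_zero := by rw [add_comm β, mul_comm β]; exact h.quad_zero }

theorem finRep_zero : FinRep K α β q 0 := by
  refine ⟨Unit, inferInstance, fun _ => ⟨K, 0, by constructor <;> intros <;> omega⟩,
    fun M hM => ⟨(), ?_⟩⟩
  obtain ⟨v, hv⟩ := @exists_ne M.V hM.1 0
  obtain ⟨η, hη, -⟩ := Submodule.exists_le_ker_of_notMem (mt (Submodule.mem_bot K).1 hv)
  set i : M.V →ₗ[K] K := (η v)⁻¹ • η with hi
  have hiv : i v = 1 := by simp [hi, hη]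
  refine HSys.summand_of_isUnit (i := i) (p := LinearMap.toSpanSingleton K M.V v)
    (fun _ h => absurd h (by omega)) (fun _ h => absurd h (by omega)) ?_
  obtain h | h := hM.2 (LinearMap.toSpanSingleton K M.V v ∘ₗ i)
    (ext fun x => by simp [hiv]) fun _ h => absurd h (by omega)
  · have := congr_fun h v
    simp [hiv, hv] at this
  · rw [h]
    exact isUnit_one

theorem IsBlock.exists_hasCode {V : Type*} [AddCommGroup V] [Module K V] [FiniteDimensional K V]
    {T : ℕ → End K V} (hB : IsBlock α q m T) (hV : Indec (m + 1) T) :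
    ∃ p, HasCode m (zvert α q m T) (zup α q m T) (zdown α q m T) (zloop α q m T) p := by
  refine hB.isZig.exists_hasCode ?_ fun g hg hgg => hg.eq_zero_or hB hV hgg
  by_contra! h
  have := hV.1
  have h1 := hB.one_mem_of_forall le_rfl ⊥ fun b hb x _ y _ => by
    change x * zvert α q m T b * y ∈ _
    rw [h b hb, mul_zero, zero_mul]
    exact Submodule.zero_mem _
  exact one_ne_zero ((Submodule.mem_bot K).1 h1)

theorem HSys.summand_of_hasCode {M X : HSys K α β q (m + 1)} {γ : K}
    (hM : Indec (m + 1) M.T) (hB : IsBlock γ q m M.T) (hB' : IsBlock γ q m X.T)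
    {p : Fin (m + 1) ⊕ Fin 2 × Fin (m + 1) × Fin (m + 1)}
    (h : HasCode m (zvert γ q m M.T) (zup γ q m M.T) (zdown γ q m M.T) (zloop γ q m M.T) p)
    (h' : HasCode m (zvert γ q m X.T) (zup γ q m X.T) (zdown γ q m X.T) (zloop γ q m X.T) p) :
    M.Summand X := by
  have hκ : ∀ b < m, q * (q ^ 2 - 1) * (γ * q ^ b) ≠ 0 ∧ -((q ^ 2 - 1) * (γ * q ^ b)) ≠ 0 :=
    fun b hb => by
      have h2 := sub_ne_zero.2 (hB.hE 2 (by omega) (by omega))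
      have h3 := mul_ne_zero hB.hα (pow_ne_zero b hB.hq)
      exact ⟨mul_ne_zero (mul_ne_zero hB.hq h2) h3, neg_ne_zero.2 (mul_ne_zero h2 h3)⟩
  obtain ⟨g, g', hg, hg', v, hv0, hv⟩ := hB.isZig.exists_of_hasCode hB'.isZig hκ h h'
  obtain ⟨w, hw, hwg⟩ := hg.exists_intw hB hB'
  obtain ⟨w', hw', hwg'⟩ := hg'.exists_intw hB' hB
  exact summand_of_isUnit hw hw' (ZIntw.isUnit_of_fixed hB hM hw hw' hwg hwg' hv0 hv)

/-- There are only finitely many indecomposable modules in a block. -/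
theorem exists_finite_block (α β γ q : K) (m : ℕ) :
    ∃ (S : Type) (_ : Finite S) (X : S → HSys K α β q (m + 1)), ∀ M : HSys K α β q (m + 1),
      Indec (m + 1) M.T → IsBlock γ q m M.T → ∃ s, M.Summand (X s) := by
  let P : Fin (m + 1) ⊕ Fin 2 × Fin (m + 1) × Fin (m + 1) → HSys K α β q (m + 1) → Prop :=
    fun p M => IsBlock γ q m M.T ∧
      HasCode m (zvert γ q m M.T) (zup γ q m M.T) (zdown γ q m M.T) (zloop γ q m M.T) p
  refine ⟨{p // ∃ M, P p M}, inferInstance, fun p => p.2.choose, fun M hM hB => ?_⟩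
  obtain ⟨p, hp⟩ := hB.exists_hasCode hM
  have hex : ∃ M, P p M := ⟨M, hB, hp⟩
  exact ⟨⟨p, hex⟩, HSys.summand_of_hasCode hM hB hex.choose_spec.1 hp hex.choose_spec.2⟩

theorem FinRep.succ (hq : q ≠ 0) (hE : ∀ j, 0 < j → j ≤ m + 1 → q ^ j ≠ 1)
    (hf : ∀ j, 0 < j → j < 2 * f → q ^ j ≠ 1) (hm : m + 1 < 2 * f + 4)
    (h : FinRep K 1 (q ^ f) q m) : FinRep K 1 (q ^ f) q (m + 1) := by
  classical
  obtain ⟨S, _, X, hX⟩ := h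
  obtain ⟨S₁, _, X₁, hX₁⟩ := exists_finite_block 1 (q ^ f) 1 q m
  obtain ⟨S₂, _, X₂, hX₂⟩ := exists_finite_block 1 (q ^ f) (q ^ f) q m
  refine ⟨S ⊕ S₁ ⊕ S₂, inferInstance, Sum.elim (fun s => (X s).ind) (Sum.elim X₁ X₂),
    fun M hM => ?_⟩
  have hβ : q ^ f ≠ 0 := pow_ne_zero f hq
  have hq1 : q ≠ 1 := fun h => hE 1 one_pos (by omega) (by rw [h, one_pow])
  have := hM.1
  obtain ⟨c, v, -, hv0, hv, hc⟩ := M.hT.exists_eigenvector hq (W := ⊤) top_ne_bot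
    fun _ _ _ _ => trivial
  obtain ⟨τ, hτ, -⟩ := M.hT.exists_trPow_genFun hq one_ne_zero hβ hq1 hv0 hv le_rfl
  by_cases hτ0 : ∃ j, τ j ≠ 0
  · obtain ⟨j, hj⟩ := hτ0
    have hu := (hM.isUnit_or_isNilpotent
      (M.hT.intw_trPow hq one_ne_zero hβ m.lt_succ_self j)).resolve_right fun ⟨k, hk⟩ => by
        have h1 : ∀ k, (trPow (1 * q ^ f) q M.T (m + 1) j ^ k) v = τ j ^ k • v := fun k => by
          induction k with
          | zero => simp
          | succ k ih => rw [pow_succ', mul_apply, ih, map_smul, hτ, smul_smul, pow_succ]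
        have h2 := h1 k
        rw [hk, LinearMap.zero_apply, eq_comm, smul_eq_zero] at h2
        exact h2.elim (pow_ne_zero k hj) hv0
    obtain ⟨s, hs⟩ := HSys.exists_summand_ind hM hq one_ne_zero hβ X hX
      ((M.hT.intw_jm m.lt_succ_self).pow j) hu
    exact ⟨.inl s, hs⟩
  · push Not at hτ0
    obtain ⟨α, hα, -, hc'⟩ := exists_string_of_balanced hq (fun j h0 hj => hE j h0 (by omega)) hf hm
      (weight_ne_zero one_ne_zero hβ hq hc) fun x hx =>
        M.hT.two_mul_card_le hq one_ne_zero hβ hq1 hv0 hv (fun j => by rw [hτ, hτ0, zero_smul]) hx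
    have hα0 : α ≠ 0 := by
      obtain ⟨rfl, -⟩ | ⟨rfl, -⟩ := hα
      exacts [one_ne_zero, hβ]
    have hT : IsHecke α (α * q ^ m) q (m + 1) M.T := by
      obtain ⟨h1, h2⟩ | ⟨h1, h2⟩ := hα
      · rw [h2, h1]
        exact M.hT
      · rw [h2, h1]
        exact M.hT.symm
    have hlt : ∀ i j, i < j → j ≤ m → α * q ^ i ≠ α * q ^ j := fun i j hij hj h => by
      rw [← Nat.add_sub_cancel' hij.le, pow_add, ← mul_assoc] at h
      exact hE (j - i) (by omega) (by omega)
        (mul_left_cancel₀ (mul_ne_zero hα0 (pow_ne_zero i hq)) (h.symm.trans (mul_one _).symm))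
    have hinj : Set.InjOn (fun j => α * q ^ j) (range (m + 1) : Set ℕ) := fun i hi j hj h => by
      simp only [Finset.coe_range, Set.mem_Iio] at hi hj
      by_contra hne
      obtain h' | h' := Nat.lt_or_gt_of_ne hne
      · exact hlt i j h' (by omega) h
      · exact hlt j i h' (by omega) h.symm
    have hB := (hM.hasStringWeights hT hq hinj hv0 hv hc').isBlock hT hq hα0 hE
    obtain ⟨rfl, -⟩ | ⟨rfl, -⟩ := hα
    · obtain ⟨s, hs⟩ := hX₁ M hM hB
      exact ⟨.inr (.inl s), hs⟩
    · obtain ⟨s, hs⟩ := hX₂ M hM hB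
      exact ⟨.inr (.inr s), hs⟩

/-- The finite type half of the classification. -/
theorem finRep_of_lt_min (hq : q ≠ 0) (hf : ((2 * f : ℕ) : ℕ∞) ≤ multOrder q)
    (hn : (n : ℕ∞) < min (multOrder q) ((2 * f + 4 : ℕ) : ℕ∞)) : FinRep K 1 (q ^ f) q n := by
  have hE : ∀ j : ℕ, 0 < j → (j : ℕ∞) < multOrder q → q ^ j ≠ 1 := fun j hj hlt h => by
    have h0 := orderOf_pos_iff.2 (isOfFinOrder_iff_pow_eq_one.2 ⟨j, hj, h⟩)
    rw [multOrder, if_neg h0.ne'] at hlt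
    exact absurd (orderOf_le_of_pow_eq_one hj h) (not_le.2 (by exact_mod_cast hlt))
  obtain ⟨hn1, hn2⟩ := lt_min_iff.1 hn
  have hn2' : n < 2 * f + 4 := by exact_mod_cast hn2
  clear hn hn2
  induction n with
  | zero => exact finRep_zero
  | succ m ih =>
    have hm : (m : ℕ∞) ≤ (m + 1 : ℕ) := by exact_mod_cast m.le_succ
    refine (ih (hm.trans_lt hn1) (by omega)).succ hq (fun j h0 hj => hE j h0 ?_)
      (fun j h0 hj => hE j h0 ?_) hn2'
    · exact lt_of_le_of_lt (by exact_mod_cast hj) hn1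
    · exact lt_of_lt_of_le (by exact_mod_cast hj) hf

end FiniteType

end

theorem heckeB_finite_representation_type_iff
    (K : Type) [Field K] (q : K) (hq : q ≠ 0) (he : 3 ≤ multOrder q)
    (f : ℕ) (hf : ((2 * f : ℕ) : ℕ∞) ≤ multOrder q) (n : ℕ) (hn : 1 ≤ n) :
    HasFiniteRepresentationType K (HeckeB K 1 (q ^ f) q n) ↔
      (n : ℕ∞) < min (multOrder q) ((2 * f + 4 : ℕ) : ℕ∞) := by
  rw [hasFiniteRepresentationType_iff_finRep]
  exact ⟨fun h => not_le.1 fun hle => not_finRep_of_min_le hq he hf hle h, finRep_of_lt_min hq hf⟩
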